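/- Let a = (a₁,a₂,a₃,a₄) ∈ (ℤ\{0})⁴ be such that A = a₁a₂a₃a₄ is not a perfect square and |A| ≤ B^{4/7}. Then N_a(B) = 𝔊_a·σ_∞(ε)·B/|A|^{1/2} + O_ε(B^{41/42+ε}·Δ^{1/3}/|A|^{11/24}), where the implied constant depends only on ε > 0. -/

import Mathlib

open scoped BigOperators
open MeasureTheory Filter

attribute [local instance 0] Classical.propDecidable

noncomputable section

/-- `e(t) = exp(2πit)`. -/
def eC (t : ℝ) : ℂ := Complex.exp (2 * Real.pi * Complex.I * t)

/-- A nonzero integer `z` is squareful if `p² ∣ z` for every prime `p` dividing `z`. -/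
def Squareful (z : ℤ) : Prop := ∀ p : ℕ, p.Prime → (p : ℤ) ∣ z → (p : ℤ) ^ 2 ∣ z

/-- The standard bump function in one variable. -/
def psi1 (t : ℝ) : ℝ := if |t| < 1 then Real.exp (-(1 - t ^ 2)⁻¹) else 0

/-- The smooth weight `w₁`. -/
def w1 (η : ℝ) (x : Fin 4 → ℝ) : ℝ :=
  if ‖x‖ ≤ η then 0
  else if ‖x‖ ≤ 2 * η then Real.exp 1 * psi1 (‖x‖ / η - 2)
  else if ‖x‖ ≤ 1 - η then 1
  else if ‖x‖ ≤ 1 then Real.exp 1 * psi1 (‖x‖ / η - (1 - η) / η)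
  else 0

/-- The smooth weight `w₂`. -/
def w2 (η : ℝ) (x : Fin 4 → ℝ) : ℝ :=
  if ‖x‖ ≤ η then 0
  else if ‖x‖ ≤ 2 * η then Real.exp 1 * psi1 (‖x‖ / η - 2)
  else if ‖x‖ ≤ 1 then 1
  else if ‖x‖ ≤ 1 + η then Real.exp 1 * psi1 (‖x‖ / η - 1 / η)
  else 0

/-- `u(t) = c₀ ψ₁(4t - 3)`, normalised so that `∫ u = 1`. -/
def uFn (t : ℝ) : ℝ := (∫ s : ℝ, psi1 (4 * s - 3))⁻¹ * psi1 (4 * t - 3)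

/-- Heath-Brown's function `h(x, y)`. -/
def hFn (x y : ℝ) : ℝ :=
  ∑' j : ℕ, (x * ((j : ℝ) + 1))⁻¹ *
    (uFn (x * ((j : ℝ) + 1)) - uFn (|y| / (x * ((j : ℝ) + 1))))

/-- The exponential sum `S_{q,a}(c)`. -/
def Sqa (a c : Fin 4 → ℤ) (q : ℕ) : ℂ :=
  ∑ k ∈ (Finset.range q).filter fun k => Nat.gcd k q = 1,
    ∑ b ∈ Fintype.piFinset fun _ : Fin 4 => Finset.range q,
      eC (((((k : ℤ) * (∑ i, a i * (b i : ℤ) ^ 2) + ∑ i, (b i : ℤ) * c i) : ℤ) : ℝ) / (q : ℝ))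

/-- Partial sums of the singular series `𝔊_a`. -/
def singularPartial (a : Fin 4 → ℤ) (T : ℕ) : ℂ :=
  ∑ q ∈ Finset.Icc 1 T, (1 / (q : ℂ) ^ 4) * Sqa a 0 q

/-- The quadratic form `G(x) = Σ εᵢ xᵢ²`. -/
def Gquad (e : Fin 4 → ℤ) (x : Fin 4 → ℝ) : ℝ := ∑ i, (e i : ℝ) * x i ^ 2

/-- The singular integral `σ_∞(ε)`. -/
def sigmaInf (e : Fin 4 → ℤ) : ℂ :=
  ∫ θ : ℝ, ∫ x in Set.univ.pi fun _ : Fin 4 => Set.Icc (-1 : ℝ) 1, eC (-(θ * Gquad e x))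

/-- The weighted singular integral `σ_∞(w)`. -/
def sigmaInfW (w : (Fin 4 → ℝ) → ℝ) (e : Fin 4 → ℤ) : ℂ :=
  ∫ θ : ℝ, ∫ x : Fin 4 → ℝ, (w x : ℂ) * eC (-(θ * Gquad e x))

/-- `Pᵢ = (B / |aᵢ|)^{1/2}`. -/
def Pvec (a : Fin 4 → ℤ) (B : ℝ) (i : Fin 4) : ℝ := Real.sqrt (B / ((a i).natAbs : ℝ))

/-- The oscillatory integral `I_{q,a}(c)`. -/
def Iqa (w : (Fin 4 → ℝ) → ℝ) (a : Fin 4 → ℤ) (B : ℝ) (c : Fin 4 → ℤ) (q : ℝ) : ℂ :=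
  ∫ x : Fin 4 → ℝ,
    (w (fun i => x i / Pvec a B i) : ℂ) *
      (hFn (q / Real.sqrt B) ((∑ i, (a i : ℝ) * x i ^ 2) / B) : ℂ) *
      eC (-(∑ i, (c i : ℝ) * x i) / q)

/-- `Δ(v) = ∏ᵢ gcd(vᵢ, ∏_{j≠i} vⱼ)`. -/
def Delta4 (v : Fin 4 → ℤ) : ℕ :=
  ∏ i, Int.gcd (v i) (∏ j ∈ Finset.univ.erase i, v j)

/-- `Δ_c(a) = ∏ᵢ gcd(gcd(aᵢ,cᵢ), ∏_{j≠i} gcd(aⱼ,cⱼ))`. -/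
def DeltaC (a c : Fin 4 → ℤ) : ℕ :=
  ∏ i, Int.gcd (Int.gcd (a i) (c i) : ℤ) (∏ j ∈ Finset.univ.erase i, (Int.gcd (a j) (c j) : ℤ))

/-- The dual form `F*_a(c)`. -/
def dualForm (a c : Fin 4 → ℤ) : ℤ :=
  ∑ i, (∏ j ∈ Finset.univ.erase i, a j) * c i ^ 2

/-- The counting function `N_a(B)`. -/
def Na (a : Fin 4 → ℤ) (B : ℝ) : ℕ :=
  {x : Fin 4 → ℤ | (∀ i, x i ≠ 0) ∧ (∑ i, a i * x i ^ 2) = 0 ∧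
    ∀ i, (((a i * x i ^ 2).natAbs : ℝ)) ≤ B}.ncard

/-- The smoothly weighted counting function `N_{w,a}(B)`. -/
def Nwa (w : (Fin 4 → ℝ) → ℝ) (a : Fin 4 → ℤ) (B : ℝ) : ℝ :=
  ∑' x : Fin 4 → ℤ,
    if (∀ i, x i ≠ 0) ∧ (∑ i, a i * x i ^ 2) = 0 then
      w fun i => (x i : ℝ) / Pvec a B i
    else 0

/-- The inclusion-exclusion weights `ω(r, s, s₀)`. -/
def omegaFn (r s : Fin 4 → ℕ) (s0 : ℕ) : ℤ :=
  if (∀ i, Squarefree (r i)) ∧ (∀ i, Squarefree (s i)) ∧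
      Finset.univ.gcd s = 1 ∧ (∀ i, Nat.gcd s0 (s i) = 1) ∧
      ∀ p : ℕ, p.Prime → p ∣ (∏ i, r i) * ∏ i, s i → ∀ i, p ∣ r i * s i then
    ArithmeticFunction.moebius s0 *
      ∏ p ∈ ((∏ i, r i) * ∏ i, s i).primeFactors,
        (-1 : ℤ) ^ (((∏ i, r i) * ∏ i, s i).factorization p + 1)
  else 0

/-- The cardinality of the set `𝒩(B; r, s, s₀)`. -/
def calN (B D : ℝ) (r s : Fin 4 → ℕ) (s0 : ℕ) : ℕ :=
  {z : Fin 4 → ℤ | (∀ i, z i ≠ 0) ∧ (∀ i, Squareful (z i)) ∧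
    (∀ i, (((z i).natAbs : ℝ)) ≤ B) ∧ (∑ i, z i) = 0 ∧
    ∃ x y : Fin 4 → ℤ,
      (∀ i, 0 < x i ∧ Squarefree (y i) ∧ z i = x i ^ 2 * y i ^ 3 ∧
        (r i : ℤ) ∣ y i ∧ (s i : ℤ) ∣ x i ∧ (s0 : ℤ) ∣ x i) ∧
      (((∏ i, y i).natAbs : ℝ)) ≤ D ∧ ¬ IsSquare (∏ i, y i)}.ncard

/-- The local counting function `M_n(y, p)`. -/
def Mcount (y : Fin 4 → ℤ) (p n : ℕ) : ℕ :=
  {m : Fin 4 → ℕ | (∀ i, m i < p ^ n) ∧ ((p : ℤ) ^ n ∣ ∑ i, y i ^ 3 * (m i : ℤ) ^ 2) ∧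
    ∃ j, ¬ (p : ℤ) ∣ (m j : ℤ) * y j}.ncard

end

open Real Finset
open Complex (I norm_real norm_natCast re_ofReal_mul)
open Nat (Coprime le_of_dvd coprime_iff_gcd_eq_one totient prime_two mem_divisors prime_of_mem_primeFactors prime_dvd_prime_iff_eq factorization_pow dvd_of_mem_divisors)
open ArithmeticFunction (moebius)

local notation "ℤ⁴" => (Fin 4 → ℤ)
local notation "ℂ⁴" => (Fin 4 → ℂ)
local notation "cexp" => Complex.exp
local notation "absProd" a:max => (Int.natAbs (∏ i, a i) : ℝ)

noncomputable section

/-! ### Periodic sums over residues -/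

lemma eC_add (x y : ℝ) : eC (x + y) = eC x * eC y := by
  unfold eC; rw [← Complex.exp_add]; congr 1; push_cast; ring

lemma eC_int (n : ℤ) : eC (n : ℝ) = 1 := by
  unfold eC
  have := Complex.exp_int_mul_two_pi_mul_I n
  rw [← this]; congr 1; push_cast; ring

lemma eC_zero : eC 0 = 1 := by simpa using eC_int 0

lemma norm_eC (x : ℝ) : ‖eC x‖ = 1 := by
  unfold eC
  rw [show (2 * π * I * x : ℂ) = ((2 * π * x : ℝ) : ℂ) * I by
    push_cast; ring]
  exact Complex.norm_exp_ofReal_mul_I _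

/-- `e(x/q)` for integers `x`. -/
def eQ (q : ℕ) (x : ℤ) : ℂ := eC ((x : ℝ) / (q : ℝ))

lemma eQ_add (q : ℕ) (x y : ℤ) : eQ q (x + y) = eQ q x * eQ q y := by
  unfold eQ; rw [← eC_add]; congr 1; push_cast; ring

lemma eQ_zero (q : ℕ) : eQ q 0 = 1 := by simp [eQ, eC_zero]

lemma norm_eQ (q : ℕ) (x : ℤ) : ‖eQ q x‖ = 1 := norm_eC _

lemma eQ_mul_self {q : ℕ} (hq : q ≠ 0) (x : ℤ) : eQ q (q * x) = 1 := by
  unfold eQ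
  rw [← eC_int x]; congr 1; push_cast; field_simp

lemma eQ_cong {q : ℕ} (hq : q ≠ 0) {x y : ℤ} (h : (q : ℤ) ∣ x - y) : eQ q x = eQ q y := by
  obtain ⟨t, ht⟩ := h
  rw [show x = y + q * t by linarith, eQ_add, eQ_mul_self hq, mul_one]

lemma eQ_mul_left {d q : ℕ} (hd : d ≠ 0) (x : ℤ) : eQ (d * q) (d * x) = eQ q x := by
  unfold eQ; congr 1; push_cast
  have : (d : ℝ) ≠ 0 := by exact_mod_cast hd
  rw [mul_div_mul_left _ _ this]

lemma eQ_eq_one_iff {q : ℕ} (hq : q ≠ 0) (x : ℤ) : eQ q x = 1 ↔ (q : ℤ) ∣ x := by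
  constructor
  · intro h
    unfold eQ eC at h
    rw [Complex.exp_eq_one_iff] at h
    obtain ⟨n, hn⟩ := h
    have hq' : (q : ℂ) ≠ 0 := by exact_mod_cast hq
    have h2 : (2 * (π : ℂ) * I) ≠ 0 := Complex.two_pi_I_ne_zero
    have h3 : ((x : ℂ) / q) = n := by
      apply mul_left_cancel₀ h2
      rw [mul_comm _ (n : ℂ), ← hn]; push_cast; ring
    rw [div_eq_iff hq'] at h3
    refine ⟨n, ?_⟩
    have : (x : ℂ) = ((n * q : ℤ) : ℂ) := by rw [h3]; push_cast; ring
    have := Int.cast_injective this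
    rw [this]; ring
  · rintro ⟨t, rfl⟩; exact eQ_mul_self hq t

/-- Periodic functions depend only on residues. -/
lemma per_cong {α : Type*} {q : ℕ} {f : ℤ → α} (hf : ∀ x, f (x + q) = f x) {x y : ℤ}
    (h : (q : ℤ) ∣ x - y) : f x = f y := by
  obtain ⟨t, ht⟩ := h
  have hp : Function.Periodic f (q : ℤ) := hf
  have := hp.int_mul t y
  rw [show x = y + t * q by linarith]
  simpa using this

lemma per_sum_reindex {q : ℕ} (hq : q ≠ 0) {f : ℤ → ℂ} (hf : ∀ x, f (x + q) = f x) {ι : Type*}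
    (s : Finset ι) (g : ι → ℤ) (hcard : s.card = q)
    (hinj : ∀ i ∈ s, ∀ j ∈ s, (q : ℤ) ∣ g i - g j → i = j) :
    ∑ i ∈ s, f (g i) = ∑ b ∈ range q, f b := by
  have hq0 : (0 : ℤ) < q := by exact_mod_cast Nat.pos_of_ne_zero hq
  have hmap : ∀ i ∈ s, (g i % q).toNat ∈ range q := by
    intro i _
    have h1 := Int.emod_nonneg (g i) hq0.ne'
    have h2 := Int.emod_lt_of_pos (g i) hq0
    rw [mem_range]; omega
  have hinj' : Set.InjOn (fun i => (g i % q).toNat) s := by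
    intro i hi j hj hij
    apply hinj i hi j hj
    have h1 := Int.emod_nonneg (g i) hq0.ne'
    have h2 := Int.emod_nonneg (g j) hq0.ne'
    have : g i % q = g j % q := by
      have : (g i % q).toNat = (g j % q).toNat := hij
      omega
    exact Int.ModEq.dvd (show g j ≡ g i [ZMOD q] from this.symm)
  refine sum_nbij (fun i => (g i % q).toNat) hmap hinj' ?_ ?_
  · exact surjOn_of_injOn_of_card_le _ hmap hinj' (by simp [hcard])
  · intro i _
    apply per_cong hf
    have h1 := Int.emod_nonneg (g i) hq0.ne'
    rw [Int.toNat_of_nonneg h1]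
    exact Int.dvd_self_sub_emod

lemma range_cast_inj {q : ℕ} {b b' : ℕ} (h1 : b < q) (h2 : b' < q)
    (h : (q : ℤ) ∣ (b : ℤ) - b') : b = b' := by
  have := Int.eq_zero_of_abs_lt_dvd h (by rw [abs_lt]; constructor <;> omega)
  omega

lemma per_sum_affine {q : ℕ} (hq : q ≠ 0) {f : ℤ → ℂ} (hf : ∀ x, f (x + q) = f x) {u : ℤ}
    (hu : IsCoprime u (q : ℤ)) (t : ℤ) :
    ∑ b ∈ range q, f (u * b + t) = ∑ b ∈ range q, f b := by
  refine per_sum_reindex hq hf _ (fun b : ℕ => u * b + t) (by simp) ?_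
  intro i hi j hj h
  rw [mem_range] at hi hj
  apply range_cast_inj hi hj
  have : (q : ℤ) ∣ u * ((i : ℤ) - j) := by convert h using 1; ring
  exact hu.symm.dvd_of_dvd_mul_left this

lemma per_sum_shift {q : ℕ} (hq : q ≠ 0) {f : ℤ → ℂ} (hf : ∀ x, f (x + q) = f x) (t : ℤ) : ∑ b ∈ range q, f (b + t) = ∑ b ∈ range q, f b := by
  simpa using per_sum_affine hq hf (u := 1) isCoprime_one_left t

lemma per_sum_mul {q : ℕ} (hq : q ≠ 0) {f : ℤ → ℂ} (hf : ∀ x, f (x + q) = f x) {u : ℤ}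
    (hu : IsCoprime u (q : ℤ)) :
    ∑ b ∈ range q, f (u * b) = ∑ b ∈ range q, f b := by
  simpa using per_sum_affine hq hf hu 0

lemma per_sum_rep {d q : ℕ} {f : ℤ → ℂ} (hf : ∀ x, f (x + q) = f x) : ∑ b ∈ range (d * q), f b = d * ∑ b ∈ range q, f b := by
  induction d with
  | zero => simp
  | succ d ih =>
    rw [Nat.succ_mul, sum_range_add, ih]
    have : ∀ x ∈ range q, f (((d * q + x : ℕ) : ℤ)) = f x := by
      intro x _
      apply per_cong hf
      push_cast; exact ⟨d, by ring⟩
    rw [sum_congr rfl this]; push_cast; ring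

lemma per_sum_crt {q₁ q₂ : ℕ} (h1 : q₁ ≠ 0) (h2 : q₂ ≠ 0) (hc : Coprime q₁ q₂) {f : ℤ → ℂ}
    (hf : ∀ x, f (x + (q₁ * q₂ : ℕ)) = f x) :
    ∑ b ∈ range (q₁ * q₂), f b = ∑ b₁ ∈ range q₁, ∑ b₂ ∈ range q₂, f (b₁ * q₂ + b₂ * q₁) := by
  rw [← sum_product']
  symm
  refine per_sum_reindex (mul_ne_zero h1 h2) hf _
    (fun b : ℕ × ℕ => (b.1 * q₂ + b.2 * q₁ : ℤ)) (by simp) ?_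
  rintro ⟨i1, i2⟩ hi ⟨j1, j2⟩ hj h
  simp only [mem_product, mem_range] at hi hj
  have hcz : IsCoprime (q₁ : ℤ) (q₂ : ℤ) := Nat.isCoprime_iff_coprime.mpr hc
  dsimp only at h; push_cast at h
  have e1 : (q₁ : ℤ) ∣ (i1 : ℤ) - j1 := by
    have := (Dvd.intro _ rfl : (q₁ : ℤ) ∣ q₁ * q₂).trans h
    have h' : (q₁ : ℤ) ∣ q₂ * ((i1 : ℤ) - j1) := by
      have h3 := dvd_sub this (dvd_mul_right (q₁ : ℤ) ((i2 : ℤ) - j2))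
      rw [show (q₂ : ℤ) * ((i1 : ℤ) - j1) = (i1 * q₂ + i2 * q₁ - (j1 * q₂ + j2 * q₁)) - q₁ * (i2 - j2) by ring]
      exact h3
    exact hcz.dvd_of_dvd_mul_left h'
  have e2 : (q₂ : ℤ) ∣ (i2 : ℤ) - j2 := by
    have := (Dvd.intro_left _ rfl : (q₂ : ℤ) ∣ q₁ * q₂).trans h
    have h' : (q₂ : ℤ) ∣ q₁ * ((i2 : ℤ) - j2) := by
      have h3 := dvd_sub this (dvd_mul_right (q₂ : ℤ) ((i1 : ℤ) - j1))
      rw [show (q₁ : ℤ) * ((i2 : ℤ) - j2) = (i1 * q₂ + i2 * q₁ - (j1 * q₂ + j2 * q₁)) - q₂ * (i1 - j1) by ring]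
      exact h3
    exact hcz.symm.dvd_of_dvd_mul_left h'
  rw [Prod.mk.injEq]
  exact ⟨range_cast_inj hi.1 hj.1 e1, range_cast_inj hi.2 hj.2 e2⟩

/-- Orthogonality of additive characters. -/
lemma sum_eQ {q : ℕ} (hq : q ≠ 0) (m : ℤ) : ∑ b ∈ range q, eQ q (m * b) = if (q : ℤ) ∣ m then (q : ℂ) else 0 := by
  split_ifs with h
  · rw [sum_congr rfl (g := fun _ => (1 : ℂ))]
    · simp
    · intro b _
      rw [eQ_eq_one_iff hq]; exact h.mul_right _
  · have hper : ∀ x : ℤ, eQ q (m * (x + q)) = eQ q (m * x) := fun x =>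
      eQ_cong hq ⟨m, by ring⟩
    have := per_sum_shift hq (f := fun x => eQ q (m * x)) hper 1
    simp only [mul_add, mul_one, eQ_add] at this
    rw [← sum_mul] at this
    have hne : eQ q m ≠ 1 := by rwa [Ne, eQ_eq_one_iff hq]
    have h2 : (∑ b ∈ range q, eQ q (m * b)) * (eQ q m - 1) = 0 := by rw [mul_sub, this]; ring
    rcases mul_eq_zero.mp h2 with h3 | h3
    · exact h3
    · exact absurd (sub_eq_zero.mp h3) hne

/-! ### Quadratic Gauss sums and `Sqa` -/

/-- One-dimensional quadratic Gauss sum. -/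
def Gs (q : ℕ) (m c : ℤ) : ℂ := ∑ b ∈ range q, eQ q (m * b ^ 2 + c * b)

lemma Gs_per {q : ℕ} (hq : q ≠ 0) (m c : ℤ) (x : ℤ) : eQ q (m * (x + q) ^ 2 + c * (x + q)) = eQ q (m * x ^ 2 + c * x) :=
  eQ_cong hq ⟨m * (2 * x + q) + c, by ring⟩

lemma Gs_cong {q : ℕ} (hq : q ≠ 0) {m m' c c' : ℤ} (h : (q : ℤ) ∣ m - m') (h' : (q : ℤ) ∣ c - c') : Gs q m c = Gs q m' c' := by
  unfold Gs
  refine sum_congr rfl fun b _ => eQ_cong hq ?_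
  rw [show m * (b : ℤ) ^ 2 + c * b - (m' * (b : ℤ) ^ 2 + c' * b) = (m - m') * (b : ℤ) ^ 2 + (c - c') * b by ring]
  exact dvd_add (h.mul_right _) (h'.mul_right _)

lemma Gs_mul {q₁ q₂ : ℕ} (h1 : q₁ ≠ 0) (h2 : q₂ ≠ 0) (hc : Coprime q₁ q₂) (m c : ℤ) : Gs (q₁ * q₂) m c = Gs q₁ (q₂ * m) c * Gs q₂ (q₁ * m) c := by
  have hq := mul_ne_zero h1 h2
  unfold Gs
  rw [per_sum_crt h1 h2 hc (f := fun x => eQ (q₁ * q₂) (m * x ^ 2 + c * x)) (Gs_per hq m c), sum_mul_sum]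
  refine sum_congr rfl fun b₁ _ => sum_congr rfl fun b₂ _ => ?_
  rw [← eQ_mul_left (d := q₂) (q := q₁) h2, ← eQ_mul_left (d := q₁) (q := q₂) h1, mul_comm q₂ q₁, ← eQ_add]
  exact eQ_cong hq ⟨2 * m * b₁ * b₂, by push_cast; ring⟩

lemma Gs_dvd {d q : ℕ} (hd : d ≠ 0) (hq : q ≠ 0) (m c : ℤ) : Gs (d * q) (d * m) (d * c) = d * Gs q m c := by
  unfold Gs
  rw [← per_sum_rep (f := fun x => eQ q (m * x ^ 2 + c * x)) (Gs_per hq m c)]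
  refine sum_congr rfl fun b _ => ?_
  rw [← eQ_mul_left hd (q := q)]; congr 1; ring

lemma Gs_eq_zero {q : ℕ} (hq : q ≠ 0) {m c : ℤ} (h : ¬ ((Int.gcd m q : ℕ) : ℤ) ∣ c) : Gs q m c = 0 := by
  set g := Int.gcd m q with hg
  have hgq : (g : ℤ) ∣ q := Int.gcd_dvd_right _ _
  have hgm : (g : ℤ) ∣ m := Int.gcd_dvd_left _ _
  obtain ⟨q', hq'⟩ := hgq
  obtain ⟨m', hm'⟩ := hgm
  have hg0 : (g : ℤ) ≠ 0 := by
    intro h0; rw [h0, zero_mul] at hq'; exact hq (by exact_mod_cast hq')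
  have hq0' : q' ≠ 0 := by
    rintro rfl; rw [mul_zero] at hq'; exact hq (by exact_mod_cast hq')
  have key := per_sum_shift hq (f := fun x => eQ q (m * x ^ 2 + c * x)) (Gs_per hq m c) q'
  have h1 : ∀ b ∈ range q, eQ q (m * ((b : ℤ) + q') ^ 2 + c * (b + q')) = eQ q (c * q') * eQ q (m * (b : ℤ) ^ 2 + c * b) := by
    intro b _
    rw [← eQ_add]
    refine eQ_cong hq ⟨m' * (2 * b + q'), ?_⟩
    rw [hq', hm']; ring
  have hne : eQ q (c * q') ≠ 1 := by
    rw [Ne, eQ_eq_one_iff hq, hq']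
    intro h2
    exact h (Int.dvd_of_mul_dvd_mul_right hq0' h2)
  rw [sum_congr rfl h1, ← mul_sum] at key
  have h2 : (eQ q (c * q') - 1) * Gs q m c = 0 := by unfold Gs; rw [sub_mul, key]; ring
  rcases mul_eq_zero.mp h2 with h3 | h3
  · exact absurd (sub_eq_zero.mp h3) hne
  · exact h3

lemma conj_eQ (q : ℕ) (x : ℤ) : (starRingEnd ℂ) (eQ q x) = eQ q (-x) := by
  unfold eQ eC
  rw [← Complex.exp_conj]
  congr 1
  simp only [map_mul, map_ofNat, Complex.conj_ofReal, Complex.conj_I]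
  push_cast; ring

/-- Weyl differencing. -/
lemma Gs_normSq {q : ℕ} (hq : q ≠ 0) (m c : ℤ) : ((‖Gs q m c‖ ^ 2 : ℝ) : ℂ) = ∑ h ∈ range q, eQ q (m * h ^ 2 + c * h) *
        (if (q : ℤ) ∣ 2 * m * h then (q : ℂ) else 0) := by
  have h1 : ((‖Gs q m c‖ ^ 2 : ℝ) : ℂ) = (starRingEnd ℂ) (Gs q m c) * Gs q m c := by rw [Complex.conj_mul']; push_cast; rfl
  rw [h1]
  have h2 : (starRingEnd ℂ) (Gs q m c) * Gs q m c = ∑ b ∈ range q, ∑ h ∈ range q, eQ q (m * h ^ 2 + c * h) * eQ q (2 * m * h * b) := by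
    conv_lhs => rw [Gs, map_sum, sum_mul]
    refine sum_congr rfl fun b _ => ?_
    rw [conj_eQ, ← per_sum_shift hq (f := fun x => eQ q (m * x ^ 2 + c * x)) (Gs_per hq m c) b, mul_sum]
    refine sum_congr rfl fun h _ => ?_
    rw [← eQ_add, ← eQ_add]; congr 1; ring
  rw [h2, sum_comm]
  refine sum_congr rfl fun h _ => ?_
  rw [← mul_sum, sum_eQ hq]

lemma card_dvd_range {q : ℕ} (hq : q ≠ 0) (m : ℤ) : ((range q).filter fun h => (q : ℤ) ∣ m * (h : ℕ)).card = Int.gcd m q := by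
  set g := Int.gcd m q with hg
  have hgq : (g : ℤ) ∣ q := Int.gcd_dvd_right _ _
  obtain ⟨q', hq'⟩ : g ∣ q := by exact_mod_cast hgq
  have hg0 : g ≠ 0 := by rintro h0; rw [h0, zero_mul] at hq'; exact hq hq'
  have hq'0 : q' ≠ 0 := by rintro h0; rw [h0, mul_zero] at hq'; exact hq hq'
  have : ((range q).filter fun h => (q : ℤ) ∣ m * (h : ℕ)) = (range g).image (fun t => q' * t) := by
    ext h
    simp only [mem_filter, mem_range, mem_image]
    have hd : (q : ℤ) ∣ m * h ↔ (q' : ℕ) ∣ h := by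
      obtain ⟨m', hm'⟩ : (g : ℤ) ∣ m := Int.gcd_dvd_left _ _
      have hcop : IsCoprime (q' : ℤ) m' := by
        rw [Int.isCoprime_iff_gcd_eq_one]
        have h4 : Int.gcd ((g : ℤ) * m') ((g : ℤ) * q') = g := by rw [← hm', ← Nat.cast_mul, ← hq']
        rw [Int.gcd_mul_left, Int.natAbs_natCast] at h4
        rw [Int.gcd_comm]
        exact Nat.eq_of_mul_eq_mul_left (Nat.pos_of_ne_zero hg0) (by rw [h4, mul_one])
      rw [hq', hm']
      push_cast
      rw [mul_assoc, mul_dvd_mul_iff_left (by exact_mod_cast hg0)]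
      constructor
      · intro hh; exact_mod_cast hcop.dvd_of_dvd_mul_left hh
      · intro hh; exact Dvd.dvd.mul_left (by exact_mod_cast hh) _
    rw [hd]
    constructor
    · rintro ⟨hlt, t, rfl⟩
      refine ⟨t, ?_, rfl⟩
      rw [hq', mul_comm g] at hlt
      exact lt_of_mul_lt_mul_left hlt (Nat.zero_le _)
    · rintro ⟨t, ht, rfl⟩
      refine ⟨?_, dvd_mul_right _ _⟩
      rw [hq', mul_comm g]
      exact Nat.mul_lt_mul_of_pos_left ht (Nat.pos_of_ne_zero hq'0)
  rw [this, card_image_of_injective, card_range]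
  intro x y hxy
  exact Nat.eq_of_mul_eq_mul_left (Nat.pos_of_ne_zero hq'0) hxy

lemma Gs_norm_sq_le {q : ℕ} (hq : q ≠ 0) (m c : ℤ) : ‖Gs q m c‖ ^ 2 ≤ 2 * q * Int.gcd m q := by
  have h1 : ‖((‖Gs q m c‖ ^ 2 : ℝ) : ℂ)‖ = ‖Gs q m c‖ ^ 2 := by rw [norm_real, norm_of_nonneg (by positivity)]
  rw [← h1, Gs_normSq hq]
  calc _ ≤ ∑ h ∈ range q, (if (q : ℤ) ∣ 2 * m * h then (q : ℝ) else 0) := by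
        refine (norm_sum_le _ _).trans (sum_le_sum fun h _ => ?_)
        rw [norm_mul, norm_eQ, one_mul]
        split_ifs <;> simp
    _ = Int.gcd (2 * m) q * q := by rw [← sum_filter, sum_const, card_dvd_range hq]; simp
    _ ≤ _ := by
        have : Int.gcd (2 * m) q ≤ 2 * Int.gcd m q := by
          apply le_of_dvd
          · have : 0 < Int.gcd m q := Int.gcd_pos_of_ne_zero_right _ (by exact_mod_cast hq)
            omega
          · have h5 := Int.gcd_mul_left 2 m q
            have h6 : Int.gcd (2 * m) q ∣ Int.gcd (2 * m) (2 * q) := Int.gcd_dvd_gcd_mul_left_right _ _ _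
            rw [h5] at h6; simpa using h6
        have : (Int.gcd (2 * m) q : ℝ) ≤ 2 * Int.gcd m q := by exact_mod_cast this
        have hq0 : (0 : ℝ) ≤ q := Nat.cast_nonneg _
        nlinarith

/-- The sum over units as a sum over all residues. -/
def uInd (q : ℕ) (k : ℤ) : ℂ := if Int.gcd k q = 1 then 1 else 0

lemma uInd_per (q : ℕ) (k : ℤ) : uInd q (k + q) = uInd q k := by
  unfold uInd
  rw [show Int.gcd (k + q) q = Int.gcd k q from Int.gcd_add_right_left_of_dvd k (dvd_refl _)]

lemma Sqa_eq (a c : ℤ⁴) (q : ℕ) : Sqa a c q = ∑ k ∈ range q, uInd q k * ∏ i, Gs q (k * a i) (c i) := by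
  unfold Sqa
  rw [sum_filter]
  refine sum_congr rfl fun k _ => ?_
  unfold uInd
  rw [Int.gcd_natCast_natCast]
  split_ifs with h
  · rw [one_mul]
    unfold Gs
    rw [prod_univ_sum]
    refine sum_congr rfl fun b _ => ?_
    rw [show (eC (((((k : ℤ) * (∑ i, a i * (b i : ℤ) ^ 2) + ∑ i, (b i : ℤ) * c i) : ℤ) : ℝ) / (q : ℝ)))
      = eQ q ((k : ℤ) * (∑ i, a i * (b i : ℤ) ^ 2) + ∑ i, (b i : ℤ) * c i) from rfl]
    simp only [Fin.sum_univ_four, Fin.prod_univ_four, ← eQ_add]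
    congr 1; ring
  · simp

lemma Gs_prod_per {q : ℕ} (hq : q ≠ 0) (a c : ℤ⁴) (k : ℤ) : ∏ i, Gs q ((k + q) * a i) (c i) = ∏ i, Gs q (k * a i) (c i) :=
  prod_congr rfl fun i _ => Gs_cong hq ⟨a i, by ring⟩ ⟨0, by ring⟩

lemma Sqa_mul {q₁ q₂ : ℕ} (h1 : q₁ ≠ 0) (h2 : q₂ ≠ 0) (hc : Coprime q₁ q₂)
    (a c : ℤ⁴) : Sqa a c (q₁ * q₂) = Sqa a c q₁ * Sqa a c q₂ := by
  have hq := mul_ne_zero h1 h2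
  have hcz : IsCoprime (q₁ : ℤ) (q₂ : ℤ) := Nat.isCoprime_iff_coprime.mpr hc
  rw [Sqa_eq, Sqa_eq, Sqa_eq]
  rw [per_sum_crt h1 h2 hc (f := fun k => uInd (q₁ * q₂) k * ∏ i, Gs (q₁ * q₂) (k * a i) (c i))
    (fun x => by rw [uInd_per, Gs_prod_per hq])]
  rw [← per_sum_mul h1 (f := fun k => uInd q₁ k * ∏ i, Gs q₁ (k * a i) (c i))
    (fun x => by rw [uInd_per, Gs_prod_per h1]) (u := (q₂ : ℤ) * q₂)
    (hcz.symm.mul_left hcz.symm)]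
  rw [← per_sum_mul h2 (f := fun k => uInd q₂ k * ∏ i, Gs q₂ (k * a i) (c i))
    (fun x => by rw [uInd_per, Gs_prod_per h2]) (u := (q₁ : ℤ) * q₁)
    (hcz.mul_left hcz)]
  rw [sum_mul_sum]
  refine sum_congr rfl fun b₁ _ => sum_congr rfl fun b₂ _ => ?_
  have hu : uInd (q₁ * q₂) (b₁ * q₂ + b₂ * q₁) = uInd q₁ (q₂ * q₂ * b₁) * uInd q₂ (q₁ * q₁ * b₂) := by
    unfold uInd
    simp only [← Int.isCoprime_iff_gcd_eq_one]
    have e1 : IsCoprime ((b₁ : ℤ) * q₂ + b₂ * q₁) ((q₁ * q₂ : ℕ) : ℤ) ↔ IsCoprime ((q₂ : ℤ) * q₂ * b₁) q₁ ∧ IsCoprime ((q₁ : ℤ) * q₁ * b₂) q₂ := by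
      push_cast
      rw [IsCoprime.mul_right_iff, IsCoprime.add_mul_right_left_iff, add_comm, IsCoprime.add_mul_right_left_iff]
      simp only [IsCoprime.mul_left_iff]
      have := hcz; have := hcz.symm; tauto
    by_cases hA : IsCoprime ((q₂ : ℤ) * q₂ * b₁) q₁ <;>
      by_cases hB : IsCoprime ((q₁ : ℤ) * q₁ * b₂) q₂ <;>
        simp only [e1, hA, hB, and_self, and_false, false_and, if_true, if_false, mul_one, mul_zero]
  have hg : ∀ i, Gs (q₁ * q₂) ((b₁ * q₂ + b₂ * q₁) * a i) (c i) = Gs q₁ (q₂ * q₂ * b₁ * a i) (c i) * Gs q₂ (q₁ * q₁ * b₂ * a i) (c i) := by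
    intro i
    rw [Gs_mul h1 h2 hc]
    congr 1
    · exact Gs_cong h1 ⟨q₂ * b₂ * a i, by ring⟩ ⟨0, by ring⟩
    · exact Gs_cong h2 ⟨q₁ * b₁ * a i, by ring⟩ ⟨0, by ring⟩
  rw [hu, prod_congr rfl fun i _ => hg i, prod_mul_distrib]
  ring

/-- The weight `ω_c(q) = ∏ gcd(aᵢ,q)^{1/2} 1[gcd(aᵢ,q) ∣ cᵢ]`. -/
def omg (a c : ℤ⁴) (q : ℕ) : ℝ := ∏ i, if ((Int.gcd (a i) q : ℕ) : ℤ) ∣ c i then sqrt (Int.gcd (a i) q) else 0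

lemma omg_nonneg (a c : ℤ⁴) (q : ℕ) : 0 ≤ omg a c q := prod_nonneg fun i _ => by split_ifs <;> positivity

lemma Sqa_bound {q : ℕ} (hq : q ≠ 0) (a c : ℤ⁴) : ‖Sqa a c q‖ ≤ 4 * (q : ℝ) ^ 3 * omg a c q := by
  rw [Sqa_eq]
  have hk : ∀ k ∈ range q, ‖uInd q k * ∏ i, Gs q (k * a i) (c i)‖ ≤ 4 * (q : ℝ) ^ 2 * omg a c q := by
    intro k _
    unfold uInd
    split_ifs with h
    · rw [one_mul, norm_prod]
      have hgc : ∀ i, Int.gcd ((k : ℤ) * a i) q = Int.gcd (a i) q := by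
        intro i
        rw [← Int.isCoprime_iff_gcd_eq_one] at h
        exact Int.gcd_mul_right_left_of_gcd_eq_one (Int.isCoprime_iff_gcd_eq_one.mp h)
      have hi : ∀ i, ‖Gs q (k * a i) (c i)‖ ≤ sqrt 2 * sqrt q * (if ((Int.gcd (a i) q : ℕ) : ℤ) ∣ c i then sqrt (Int.gcd (a i) q) else 0) := by
        intro i
        split_ifs with hd
        · rw [← sqrt_mul (by norm_num), ← sqrt_mul (by positivity)]
          apply le_sqrt_of_sq_le
          have := Gs_norm_sq_le hq (k * a i) (c i)
          rwa [hgc] at this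
        · rw [Gs_eq_zero hq (by rwa [hgc])]; simp
      calc ∏ i, ‖Gs q (k * a i) (c i)‖ ≤ ∏ i, (sqrt 2 * sqrt q * (if ((Int.gcd (a i) q : ℕ) : ℤ) ∣ c i then sqrt (Int.gcd (a i) q) else 0)) :=
            prod_le_prod (fun i _ => norm_nonneg _) fun i _ => hi i
        _ = 4 * (q : ℝ) ^ 2 * omg a c q := by
            rw [prod_mul_distrib]; unfold omg
            congr 1
            rw [prod_const, card_univ, Fintype.card_fin, mul_pow, show (4 : ℕ) = 2 * 2 by norm_num, pow_mul, pow_mul, sq_sqrt (by norm_num),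
              sq_sqrt (by positivity)]; norm_num
    · rw [zero_mul, norm_zero]
      have := omg_nonneg a c q; positivity
  refine (norm_sum_le_of_le _ hk).trans ?_
  rw [sum_const, card_range, nsmul_eq_mul]
  apply le_of_eq; ring

lemma Sqa_trivial (a c : ℤ⁴) (q : ℕ) : ‖Sqa a c q‖ ≤ (q : ℝ) ^ 5 := by
  rw [Sqa_eq]
  have hg : ∀ m c, ‖Gs q m c‖ ≤ q := by
    intro m c
    refine (norm_sum_le_of_le _ (fun b _ => (norm_eQ _ _).le)).trans ?_
    simp
  have hk : ∀ k ∈ range q, ‖uInd q k * ∏ i, Gs q (k * a i) (c i)‖ ≤ (q : ℝ) ^ 4 := by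
    intro k _
    rw [norm_mul, norm_prod]
    have h1 : ‖uInd q k‖ ≤ 1 := by unfold uInd; split_ifs <;> simp
    have h2 : ∏ i, ‖Gs q (k * a i) (c i)‖ ≤ (q : ℝ) ^ 4 := by
      refine (prod_le_prod (fun i _ => norm_nonneg _) fun i _ => hg _ _).trans ?_
      simp
    calc _ ≤ 1 * (q : ℝ) ^ 4 := mul_le_mul h1 h2 (prod_nonneg fun i _ => norm_nonneg _) zero_le_one
      _ = _ := one_mul _
  refine (norm_sum_le_of_le _ hk).trans ?_
  rw [sum_const, card_range, nsmul_eq_mul]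
  apply le_of_eq; ring

/-! ### Gauss sums at odd prime powers -/

lemma sum_range_mul_eq (d q : ℕ) (f : ℕ → ℂ) : ∑ b ∈ range (d * q), f b = ∑ x ∈ range q, ∑ y ∈ range d, f (x + q * y) := by
  induction d with
  | zero => simp
  | succ d ih =>
    rw [Nat.succ_mul, sum_range_add, ih]
    simp only [sum_range_succ, sum_add_distrib]
    congr 1
    refine sum_congr rfl fun x _ => ?_
    congr 1; ring

lemma Gs_complete_square {q : ℕ} (hq : q ≠ 0) {m v : ℤ} (hv : (q : ℤ) ∣ 4 * m * v - 1) (c : ℤ) : Gs q m c = eQ q (-v * c ^ 2) * Gs q m 0 := by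
  unfold Gs
  rw [← per_sum_shift hq (f := fun x => eQ q (m * x ^ 2 + 0 * x)) (Gs_per hq m 0) (2 * v * c), mul_sum]
  refine sum_congr rfl fun b _ => ?_
  rw [← eQ_add]
  apply eQ_cong hq
  obtain ⟨t, ht⟩ := hv
  refine ⟨-t * (c * b + v * c ^ 2), ?_⟩
  have : 4 * m * v = q * t + 1 := by linarith
  linear_combination (-(c * (b : ℤ) + v * c ^ 2)) * ht

lemma Gs_reduce {p : ℕ} (hp : p.Prime) (h2 : p ≠ 2) (n : ℕ) {u : ℤ} (hu : ¬ (p : ℤ) ∣ u) : Gs (p ^ (n + 2)) u 0 = p * Gs (p ^ n) u 0 := by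
  have hp0 := hp.ne_zero
  have hpz : Prime (p : ℤ) := Nat.prime_iff_prime_int.mp hp
  have h2u : ∀ b : ℤ, (p : ℤ) ∣ 2 * u * b ↔ (p : ℤ) ∣ b := by
    intro b
    constructor
    · intro h
      rcases hpz.dvd_or_dvd h with h | h
      · rcases hpz.dvd_or_dvd h with h | h
        · exfalso
          have h3 : p ∣ 2 := by exact_mod_cast h
          exact h2 ((prime_dvd_prime_iff_eq hp prime_two).mp h3)
        · exact absurd h hu
      · exact h
    · intro h; exact h.mul_left _
  have e1 : Gs (p ^ (n + 2)) u 0 = ∑ x ∈ range (p ^ (n + 1)), eQ (p ^ (n + 2)) (u * x ^ 2) * (if (p : ℤ) ∣ x then (p : ℂ) else 0) := by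
    unfold Gs
    rw [show p ^ (n + 2) = p * p ^ (n + 1) by ring, sum_range_mul_eq]
    refine sum_congr rfl fun x _ => ?_
    have h3 := sum_eQ hp0 (2 * u * x)
    simp only [h2u] at h3
    rw [← h3, mul_sum]
    refine sum_congr rfl fun y _ => ?_
    have h4 := eQ_mul_left (d := p ^ (n + 1)) (q := p) (pow_ne_zero _ hp0) (2 * u * x * y)
    rw [← h4, mul_comm (p ^ (n + 1)) p, ← eQ_add]
    refine eQ_cong (by positivity) ⟨u * y ^ 2 * p ^ n, ?_⟩
    push_cast; ring
  rw [e1, show p ^ (n + 1) = p ^ n * p by ring, sum_range_mul_eq]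
  have hpos : 0 < p := hp.pos
  rw [← sum_erase_add _ _ (mem_range.mpr hpos)]
  rw [sum_eq_zero, zero_add]
  · unfold Gs
    rw [mul_sum]
    refine sum_congr rfl fun y _ => ?_
    have : (p : ℤ) ∣ ((0 + p * y : ℕ) : ℤ) := by push_cast; exact ⟨y, by ring⟩
    rw [if_pos this, mul_comm]
    congr 1
    rw [← eQ_mul_left (d := p ^ 2) (q := p ^ n) (by positivity)]
    rw [show p ^ 2 * p ^ n = p ^ (n + 2) by ring]
    congr 1; push_cast; ring
  · intro x hx
    rw [mem_erase, mem_range] at hx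
    refine sum_eq_zero fun y _ => ?_
    rw [if_neg, mul_zero]
    intro h
    have h3 : p ∣ x + p * y := by exact_mod_cast h
    have h4 : p ∣ x := (Nat.dvd_add_left (dvd_mul_right p y)).mp h3
    exact absurd (le_of_dvd (Nat.pos_of_ne_zero hx.1) h4) (not_le.mpr hx.2)

lemma sum_range_zmod {E : Type*} [AddCommMonoid E] {q : ℕ} [NeZero q] (f : ℕ → E) : ∑ b ∈ range q, f b = ∑ z : ZMod q, f z.val := by
  refine sum_nbij' (fun b : ℕ => (b : ZMod q)) ZMod.val (by simp) ?_ ?_ ?_ ?_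
  · intro z _; exact mem_range.mpr (ZMod.val_lt z)
  · intro b hb; exact ZMod.val_cast_of_lt (mem_range.mp hb)
  · intro z _; simp
  · intro b hb; rw [ZMod.val_cast_of_lt (mem_range.mp hb)]

lemma Gs_prime_eq {p : ℕ} [Fact p.Prime] (h2 : p ≠ 2) (m : ℤ) : Gs p m 0 = ∑ x ∈ range p, (1 + (legendreSym p x : ℂ)) * eQ p (m * x) := by
  have hp0 : p ≠ 0 := (Fact.out : p.Prime).ne_zero
  set f : ZMod p → ℂ := fun z => eQ p (m * z.val) with hf
  have e1 : Gs p m 0 = ∑ b : ZMod p, f (b ^ 2) := by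
    unfold Gs
    rw [sum_range_zmod]
    refine sum_congr rfl fun b _ => ?_
    apply eQ_cong hp0
    rw [show m * (b.val : ℤ) ^ 2 + 0 * (b.val : ℤ) - m * ((b ^ 2).val : ℤ) = m * ((b.val : ℤ) ^ 2 - ((b ^ 2).val : ℤ)) by ring]
    apply Dvd.dvd.mul_left
    rw [← ZMod.intCast_zmod_eq_zero_iff_dvd]
    push_cast; simp
  rw [e1, sum_range_zmod]
  rw [← sum_fiberwise (s := univ) (g := fun b : ZMod p => b ^ 2)]
  refine sum_congr rfl fun x _ => ?_
  have h3 : ∀ b ∈ univ.filter (fun b : ZMod p => b ^ 2 = x), f (b ^ 2) = f x := by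
    intro b hb; rw [(mem_filter.mp hb).2]
  rw [sum_congr rfl h3, sum_const, nsmul_eq_mul]
  congr 1
  have h4 := legendreSym.card_sqrts p h2 (x.val : ℤ)
  have h5 : (univ.filter (fun b : ZMod p => b ^ 2 = x)) = {y : ZMod p | y ^ 2 = ((x.val : ℤ) : ZMod p)}.toFinset := by ext b; simp
  rw [h5]
  have h6 : ((({y : ZMod p | y ^ 2 = ((x.val : ℤ) : ZMod p)}.toFinset.card : ℤ)) : ℂ) = ((legendreSym p (x.val : ℤ) + 1 : ℤ) : ℂ) := by rw [← h4]
  push_cast at h6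
  rw [add_comm]; convert h6 using 1
  norm_cast

lemma legendreSym_per {p : ℕ} [Fact p.Prime] (x : ℤ) : legendreSym p (x + p) = legendreSym p x := by
  rw [legendreSym.mod p (x + p), legendreSym.mod p x]; simp

lemma Gs_prime {p : ℕ} [Fact p.Prime] (h2 : p ≠ 2) {u : ℤ} (hu : ¬ (p : ℤ) ∣ u) : Gs p u 0 = (legendreSym p u : ℂ) * Gs p 1 0 := by
  have hp : p.Prime := Fact.out
  have hp0 : p ≠ 0 := hp.ne_zero
  have hpz : Prime (p : ℤ) := Nat.prime_iff_prime_int.mp hp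
  have hcop : IsCoprime u (p : ℤ) := ((Prime.coprime_iff_not_dvd hpz).mpr hu).symm
  have key : ∀ m : ℤ, ¬ (p : ℤ) ∣ m → Gs p m 0 = ∑ x ∈ range p, (legendreSym p x : ℂ) * eQ p (m * x) := by
    intro m hm
    rw [Gs_prime_eq h2]
    simp only [add_mul, one_mul, sum_add_distrib]
    rw [sum_eQ hp0, if_neg hm, zero_add]
  have h1 : ¬ (p : ℤ) ∣ 1 := hpz.not_dvd_one
  rw [key u hu, key 1 h1]
  rw [← per_sum_mul hp0 (f := fun x => (legendreSym p x : ℂ) * eQ p (1 * x)) (u := u)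
    (fun x => by rw [legendreSym_per]; congr 1; exact eQ_cong hp0 ⟨1, by ring⟩) hcop]
  rw [mul_sum]
  refine sum_congr rfl fun x _ => ?_
  rw [legendreSym.mul]
  have h3 : (legendreSym p u : ℂ) * legendreSym p u = 1 := by
    have := legendreSym.sq_one p (a := u) (by
      rwa [Ne, ZMod.intCast_zmod_eq_zero_iff_dvd])
    rw [← sq]; exact_mod_cast this
  push_cast
  rw [one_mul, ← mul_assoc, ← mul_assoc, h3, one_mul]

lemma Gs_prime_pow {p : ℕ} [Fact p.Prime] (h2 : p ≠ 2) (n : ℕ) {u : ℤ} (hu : ¬ (p : ℤ) ∣ u) :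
    Gs (p ^ n) u 0 = (legendreSym p u : ℂ) ^ n * Gs (p ^ n) 1 0 := by
  have hp : p.Prime := Fact.out
  have hpz : Prime (p : ℤ) := Nat.prime_iff_prime_int.mp hp
  have h3 : (legendreSym p u : ℂ) ^ 2 = 1 := by
    have := legendreSym.sq_one p (a := u) (by
      rwa [Ne, ZMod.intCast_zmod_eq_zero_iff_dvd])
    exact_mod_cast this
  induction n using Nat.twoStepInduction with
  | zero => simp [Gs, eQ_zero]
  | one => simpa using Gs_prime h2 hu
  | more n ih _ =>
    rw [Gs_reduce hp h2 n hu, Gs_reduce hp h2 n hpz.not_dvd_one, ih, pow_add, h3]; ring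

lemma Gs_one_pow_four {p : ℕ} [Fact p.Prime] (h2 : p ≠ 2) (n : ℕ) : Gs (p ^ n) 1 0 ^ 4 = (p : ℂ) ^ (2 * n) := by
  have hp : p.Prime := Fact.out
  have hp0 := hp.ne_zero
  have hpz : Prime (p : ℤ) := Nat.prime_iff_prime_int.mp hp
  induction n using Nat.twoStepInduction with
  | zero => simp [Gs, eQ_zero]
  | one =>
    rw [pow_one]
    have h1 := Gs_normSq hp0 1 0
    have h4 : ((‖Gs p 1 0‖ ^ 2 : ℝ) : ℂ) = p := by
      rw [h1, sum_eq_single 0]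
      · simp [eQ_zero]
      · intro h hh hne
        rw [if_neg, mul_zero]
        intro hd
        rcases hpz.dvd_or_dvd hd with h3 | h3
        · have h3 : p ∣ 2 := by exact_mod_cast h3
          exact h2 ((prime_dvd_prime_iff_eq hp prime_two).mp h3)
        · have h3 : p ∣ h := by exact_mod_cast h3
          exact absurd (le_of_dvd (Nat.pos_of_ne_zero hne) h3)
            (not_le.mpr (mem_range.mp hh))
      · intro h; simp [hp.pos] at h
    have h5 : (starRingEnd ℂ) (Gs p 1 0) = (legendreSym p (-1) : ℂ) * Gs p 1 0 := by
      rw [← Gs_prime h2 (by rw [dvd_neg]; exact hpz.not_dvd_one)]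
      unfold Gs
      rw [map_sum]
      refine sum_congr rfl fun b _ => ?_
      rw [conj_eQ]; congr 1; ring
    have h6 : ((‖Gs p 1 0‖ ^ 2 : ℝ) : ℂ) = (starRingEnd ℂ) (Gs p 1 0) * Gs p 1 0 := by rw [Complex.conj_mul']; push_cast; rfl
    rw [h4, h5] at h6
    have h3 : (legendreSym p (-1) : ℂ) ^ 2 = 1 := by
      have := legendreSym.sq_one p (a := -1) (by
        rw [Ne, ZMod.intCast_zmod_eq_zero_iff_dvd, dvd_neg]; exact hpz.not_dvd_one)
      exact_mod_cast this
    calc Gs p 1 0 ^ 4 = (legendreSym p (-1) : ℂ) ^ 2 * Gs p 1 0 ^ 4 := by rw [h3, one_mul]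
      _ = ((legendreSym p (-1) : ℂ) * Gs p 1 0 * Gs p 1 0) ^ 2 := by ring
      _ = _ := by rw [← h6]
  | more n ih _ =>
    rw [Gs_reduce hp h2 n hpz.not_dvd_one, mul_pow, ih]; ring

/-- Ramanujan sums. -/
def ram (q : ℕ) (n : ℤ) : ℂ := ∑ k ∈ range q, uInd q k * eQ q (n * k)

lemma ram_unit_mul {q : ℕ} (hq : q ≠ 0) {w : ℤ} (hw : IsCoprime w (q : ℤ)) (n : ℤ) : ram q (w * n) = ram q n := by
  unfold ram
  rw [← per_sum_mul hq (f := fun k => uInd q k * eQ q (n * k)) (u := w)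
    (fun x => by rw [uInd_per]; congr 1; exact eQ_cong hq ⟨n, by ring⟩) hw]
  refine sum_congr rfl fun k _ => ?_
  congr 1
  · unfold uInd
    rw [Int.gcd_mul_right_left_of_gcd_eq_one (Int.isCoprime_iff_gcd_eq_one.mp hw)]
  · congr 1; ring

lemma unit_sum {q : ℕ} [NeZero q] (h : ℕ → ℂ) : ∑ k ∈ range q, uInd q k * h k = ∑ u : (ZMod q)ˣ, h (u : ZMod q).val := by
  have e1 : ∑ k ∈ range q, uInd q k * h k = ∑ k ∈ (range q).filter (fun k => Coprime k q), h k := by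
    rw [sum_filter]
    refine sum_congr rfl fun k _ => ?_
    unfold uInd
    rw [Int.gcd_natCast_natCast]
    by_cases hk : Coprime k q
    · rw [if_pos hk, if_pos hk, one_mul]
    · rw [if_neg hk, if_neg hk, zero_mul]
  rw [e1]
  refine sum_bij' (fun k hk => ZMod.unitOfCoprime k (mem_filter.mp hk).2)
    (fun u _ => (u : ZMod q).val) (by simp) ?_ ?_ ?_ ?_
  · intro u _
    exact mem_filter.mpr ⟨mem_range.mpr (ZMod.val_lt _), ZMod.val_coe_unit_coprime u⟩
  · intro k hk
    simp only [ZMod.coe_unitOfCoprime]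
    exact ZMod.val_cast_of_lt (mem_range.mp (mem_filter.mp hk).1)
  · intro u _; ext; simp
  · intro k hk
    simp only [ZMod.coe_unitOfCoprime]
    rw [ZMod.val_cast_of_lt (mem_range.mp (mem_filter.mp hk).1)]

/-- A sum over units where the summand only depends on an inverse of the variable. -/
lemma ram_inv {q : ℕ} (hq : q ≠ 0) (n : ℤ) (K : ℂ) (h : ℕ → ℂ)
    (hh : ∀ k l : ℕ, (q : ℤ) ∣ (k : ℤ) * l - 1 → h k = K * eQ q (n * l)) :
    ∑ k ∈ range q, uInd q k * h k = K * ram q n := by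
  have : NeZero q := ⟨hq⟩
  unfold ram
  rw [unit_sum, unit_sum (h := fun k => eQ q (n * k)), ← Equiv.sum_comp (Equiv.inv (ZMod q)ˣ), mul_sum]
  refine sum_congr rfl fun u _ => ?_
  apply hh
  rw [← ZMod.intCast_zmod_eq_zero_iff_dvd]
  simp

lemma ram_zero (q : ℕ) : ram q 0 = totient q := by
  unfold ram
  simp only [zero_mul, eQ_zero, mul_one]
  unfold uInd
  rw [sum_ite, sum_const_zero, add_zero, sum_const, nsmul_eq_mul, mul_one, totient]
  congr 2
  ext k
  simp only [mem_filter, mem_range, Int.gcd_natCast_natCast, coprime_iff_gcd_eq_one, Nat.gcd_comm k q]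

lemma ram_prime_pow_bound {p : ℕ} (hp : p.Prime) (n : ℕ) (m : ℤ) : ‖ram (p ^ n) m‖ ≤ Int.gcd m ((p ^ n : ℕ) : ℤ) := by
  have hp0 := hp.ne_zero
  rcases n with _ | r
  · simp [ram, uInd, eQ_zero]
  have e1 : ram (p ^ (r + 1)) m = ∑ k ∈ range (p ^ (r + 1)), eQ (p ^ (r + 1)) (m * k) -
      ∑ k ∈ range (p ^ r), eQ (p ^ r) (m * k) := by
    have e2 : ∑ k ∈ range (p ^ (r + 1)), (1 - uInd (p ^ (r + 1)) k) * eQ (p ^ (r + 1)) (m * k) = ∑ k ∈ range (p ^ r), eQ (p ^ r) (m * k) := by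
      rw [show p ^ (r + 1) = p ^ r * p by ring, sum_range_mul_eq, ← sum_erase_add _ _ (mem_range.mpr hp.pos), sum_eq_zero, zero_add]
      · refine sum_congr rfl fun y _ => ?_
        have : uInd (p ^ r * p) ((0 + p * y : ℕ) : ℤ) = 0 := by
          unfold uInd
          rw [if_neg]
          rw [Int.gcd_natCast_natCast]
          intro h
          have h3 : p ∣ Nat.gcd (0 + p * y) (p ^ r * p) := Nat.dvd_gcd (by simp) (dvd_mul_left _ _)
          rw [h] at h3
          exact hp.one_lt.ne' (Nat.dvd_one.mp h3)
        rw [this, sub_zero, one_mul, mul_comm (p ^ r) p, ← eQ_mul_left (d := p) (q := p ^ r) hp0]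
        congr 1; push_cast; ring
      · intro x hx
        rw [mem_erase, mem_range] at hx
        refine sum_eq_zero fun y _ => ?_
        have : uInd (p ^ r * p) ((x + p * y : ℕ) : ℤ) = 1 := by
          unfold uInd
          rw [if_pos]
          rw [Int.gcd_natCast_natCast, ← pow_succ]
          apply Nat.Coprime.pow_right
          rw [Nat.coprime_comm, hp.coprime_iff_not_dvd]
          intro h3
          have h4 : p ∣ x := (Nat.dvd_add_left (dvd_mul_right p y)).mp h3
          exact absurd (le_of_dvd (Nat.pos_of_ne_zero hx.1) h4) (not_le.mpr hx.2)
        rw [this, sub_self, zero_mul]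
    rw [← e2]; unfold ram
    rw [← sum_sub_distrib]
    refine sum_congr rfl fun k _ => by ring
  rw [e1, sum_eQ (by positivity), sum_eQ (by positivity)]
  have hgpos : 0 < Int.gcd m ((p ^ (r + 1) : ℕ) : ℤ) := Int.gcd_pos_of_ne_zero_right _ (by positivity)
  have hle : p ^ r ≤ p ^ (r + 1) := Nat.pow_le_pow_right hp.pos (Nat.le_succ r)
  by_cases h1 : ((p ^ (r + 1) : ℕ) : ℤ) ∣ m
  · have h2 : ((p ^ r : ℕ) : ℤ) ∣ m := by
      refine dvd_trans ?_ h1; push_cast; exact pow_dvd_pow _ (Nat.le_succ r)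
    rw [if_pos h1, if_pos h2, show Int.gcd m ((p ^ (r + 1) : ℕ) : ℤ) = p ^ (r + 1) from by
      rw [Int.gcd_eq_natAbs_right h1, Int.natAbs_natCast]]
    rw [← Nat.cast_sub hle, Complex.norm_natCast]
    exact_mod_cast Nat.sub_le _ _
  · rw [if_neg h1]
    by_cases h2 : ((p ^ r : ℕ) : ℤ) ∣ m
    · rw [if_pos h2, zero_sub, norm_neg, Complex.norm_natCast]
      exact_mod_cast le_of_dvd hgpos (Int.natCast_dvd_natCast.mp (Int.dvd_coe_gcd h2 (by
        push_cast; exact pow_dvd_pow _ (Nat.le_succ r))))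
    · rw [if_neg h2]; simp

/-! ### Evaluation of `Sqa` -/

lemma dualForm_eq (a c : ℤ⁴) : dualForm a c = a 1 * a 2 * a 3 * c 0 ^ 2 + a 0 * a 2 * a 3 * c 1 ^ 2 + a 0 * a 1 * a 3 * c 2 ^ 2 +
      a 0 * a 1 * a 2 * c 3 ^ 2 := by
  unfold dualForm
  rw [Fin.sum_univ_four]
  have e0 : (univ.erase (0 : Fin 4)) = {1, 2, 3} := by decide
  have e1 : (univ.erase (1 : Fin 4)) = {0, 2, 3} := by decide
  have e2 : (univ.erase (2 : Fin 4)) = {0, 1, 3} := by decide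
  have e3 : (univ.erase (3 : Fin 4)) = {0, 1, 2} := by decide
  rw [e0, e1, e2, e3]
  simp [mul_assoc]

lemma exists_inv {q : ℕ} {m : ℤ} (h : IsCoprime m (q : ℤ)) : ∃ v : ℤ, (q : ℤ) ∣ m * v - 1 := by
  obtain ⟨u, v, huv⟩ := h
  exact ⟨u, -v, by linear_combination huv⟩

lemma coprime_ppow {p : ℕ} (hp : p.Prime) {m : ℤ} (h : ¬ (p : ℤ) ∣ m) (n : ℕ) : IsCoprime m ((p ^ n : ℕ) : ℤ) := by
  have hpz : Prime (p : ℤ) := Nat.prime_iff_prime_int.mp hp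
  push_cast
  exact ((Prime.coprime_iff_not_dvd hpz).mpr h).symm.pow_right

lemma Gs_full {p : ℕ} [Fact p.Prime] (h2 : p ≠ 2) (n : ℕ) {m v : ℤ} (hm : ¬ (p : ℤ) ∣ m)
    (hv : ((p ^ n : ℕ) : ℤ) ∣ 4 * m * v - 1) (c : ℤ) :
    Gs (p ^ n) m c = eQ (p ^ n) (-v * c ^ 2) * ((legendreSym p m : ℂ) ^ n * Gs (p ^ n) 1 0) := by
  rw [Gs_complete_square (pow_ne_zero _ (Fact.out : p.Prime).ne_zero) hv, Gs_prime_pow h2 n hm]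

lemma not_dvd_four {p : ℕ} (hp : p.Prime) (h2 : p ≠ 2) : ¬ (p : ℤ) ∣ 4 := by
  intro h
  have h3 : p ∣ 2 ^ 2 := by exact_mod_cast h
  exact h2 ((prime_dvd_prime_iff_eq hp prime_two).mp (hp.dvd_of_dvd_pow h3))

lemma not_dvd_of_inv {p : ℕ} (hp : p.Prime) {n : ℕ} (hn : n ≠ 0) {k l : ℤ}
    (h : ((p ^ n : ℕ) : ℤ) ∣ k * l - 1) : ¬ (p : ℤ) ∣ k := by
  intro h1
  have hpz : Prime (p : ℤ) := Nat.prime_iff_prime_int.mp hp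
  have h3 : (p : ℤ) ∣ k * l - 1 := dvd_trans (by push_cast; exact dvd_pow_self _ hn) h
  exact hpz.not_dvd_one ((dvd_sub_right (h1.mul_right l)).mp h3)

lemma legendre_sq {p : ℕ} [Fact p.Prime] {k : ℤ} (h : ¬ (p : ℤ) ∣ k) : (legendreSym p k : ℂ) ^ 2 = 1 := by
  have := legendreSym.sq_one p (a := k) (by rwa [Ne, ZMod.intCast_zmod_eq_zero_iff_dvd])
  exact_mod_cast this

lemma Sqa_prime_pow {p : ℕ} [Fact p.Prime] (h2 : p ≠ 2) (n : ℕ) (a c : ℤ⁴)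
    (ha : ∀ i, ¬ (p : ℤ) ∣ a i) :
    Sqa a c (p ^ n) = (legendreSym p (∏ i, a i) : ℂ) ^ n * (p : ℂ) ^ (2 * n) * ram (p ^ n) (dualForm a c) := by
  have hp : p.Prime := Fact.out
  have hpz : Prime (p : ℤ) := Nat.prime_iff_prime_int.mp hp
  have hq : p ^ n ≠ 0 := pow_ne_zero _ hp.ne_zero
  rcases Nat.eq_zero_or_pos n with rfl | hn
  · rw [Sqa_eq]; simp [ram, Gs, uInd, eQ_zero]
  have hA : ¬ (p : ℤ) ∣ 4 * ∏ i, a i := by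
    intro h
    rcases hpz.dvd_or_dvd h with h | h
    · exact not_dvd_four hp h2 h
    · obtain ⟨i, _, hi⟩ := (Prime.dvd_finset_prod_iff hpz _).mp h
      exact ha i hi
  obtain ⟨w, hw⟩ := exists_inv (coprime_ppow hp hA n)
  have hwc : IsCoprime (-w) ((p ^ n : ℕ) : ℤ) := by
    obtain ⟨t, ht⟩ := hw
    exact ⟨-(4 * ∏ i, a i), -t, by linear_combination ht⟩
  rw [Sqa_eq, ← ram_unit_mul hq hwc]
  apply ram_inv hq
  intro k l hkl
  have hk : ¬ (p : ℤ) ∣ k := not_dvd_of_inv hp hn.ne' hkl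
  rw [Fin.prod_univ_four] at hw
  obtain ⟨t, ht⟩ := hw
  obtain ⟨s, hs⟩ := hkl
  have hka : ∀ i, ¬ (p : ℤ) ∣ k * a i := fun i h => (hpz.dvd_or_dvd h).elim hk (ha i)
  have hv : ∀ x y : ℤ, x * y = a 0 * a 1 * a 2 * a 3 → ((p ^ n : ℕ) : ℤ) ∣ 4 * (k * x) * (w * l * y) - 1 := fun x y h =>
    ⟨t * (k * l) + s, by linear_combination (k * l : ℤ) * ht + hs + 4 * k * w * l * h⟩
  rw [Fin.prod_univ_four, Fin.prod_univ_four, Gs_full h2 n (hka 0) (hv _ (a 1 * a 2 * a 3) (by ring)), Gs_full h2 n (hka 1) (hv _ (a 0 * a 2 * a 3) (by ring)), Gs_full h2 n (hka 2) (hv _ (a 0 * a 1 * a 3) (by ring)), Gs_full h2 n (hka 3) (hv _ (a 0 * a 1 * a 2) (by ring))]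
  have h4 := Gs_one_pow_four h2 n
  have hL : (legendreSym p k : ℂ) ^ (4 * n) = 1 := by rw [show 4 * n = 2 * (2 * n) by ring, pow_mul, legendre_sq hk, one_pow]
  simp only [legendreSym.mul]
  push_cast
  rw [dualForm_eq]
  rw [show -w * (a 1 * a 2 * a 3 * c 0 ^ 2 + a 0 * a 2 * a 3 * c 1 ^ 2 + a 0 * a 1 * a 3 * c 2 ^ 2 +
      a 0 * a 1 * a 2 * c 3 ^ 2) * l = -(w * l * (a 1 * a 2 * a 3)) * c 0 ^ 2 +
      -(w * l * (a 0 * a 2 * a 3)) * c 1 ^ 2 + -(w * l * (a 0 * a 1 * a 3)) * c 2 ^ 2 +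
      -(w * l * (a 0 * a 1 * a 2)) * c 3 ^ 2 by ring, eQ_add, eQ_add, eQ_add, ← h4]
  rw [mul_comm 4 n, pow_mul] at hL
  generalize eQ (p ^ n) _ = E0
  generalize eQ (p ^ n) _ = E1
  generalize eQ (p ^ n) _ = E2
  generalize eQ (p ^ n) _ = E3
  simp only [mul_pow]
  linear_combination ((legendreSym p (a 0) : ℂ) ^ n * (legendreSym p (a 1) : ℂ) ^ n *
    (legendreSym p (a 2) : ℂ) ^ n * (legendreSym p (a 3) : ℂ) ^ n * (Gs (p ^ n) 1 0) ^ 4 * E0 * E1 * E2 * E3) * hL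

lemma sum_legendre_units {p : ℕ} [Fact p.Prime] (h2 : p ≠ 2) (n : ℕ) :
    ∑ k ∈ range (p ^ (n + 1)), uInd (p ^ (n + 1)) k * (legendreSym p k : ℂ) = 0 := by
  have hp : p.Prime := Fact.out
  have hpz : Prime (p : ℤ) := Nat.prime_iff_prime_int.mp hp
  have hq : p ^ (n + 1) ≠ 0 := pow_ne_zero _ hp.ne_zero
  obtain ⟨z, hz⟩ := FiniteField.exists_nonsquare (F := ZMod p) (by rwa [ZMod.ringChar_zmod_n])
  have hr : legendreSym p (z.val : ℤ) = -1 := by rw [legendreSym.eq_neg_one_iff]; simpa using hz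
  have hnd : ¬ (p : ℤ) ∣ (z.val : ℤ) := by
    intro h
    rw [(legendreSym.eq_zero_iff p _).mpr ((ZMod.intCast_zmod_eq_zero_iff_dvd _ p).mpr h)] at hr
    norm_num at hr
  have hper : ∀ x : ℤ, uInd (p ^ (n + 1)) (x + (p ^ (n + 1) : ℕ)) *
      (legendreSym p (x + (p ^ (n + 1) : ℕ)) : ℂ) = uInd (p ^ (n + 1)) x * (legendreSym p x : ℂ) := by
    intro x
    rw [uInd_per, per_cong (f := fun x => legendreSym p x) (q := p) legendreSym_per
      (y := x) ⟨(p : ℤ) ^ n, by push_cast; ring⟩]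
  have key := per_sum_mul hq (f := fun k => uInd (p ^ (n + 1)) k * (legendreSym p k : ℂ)) hper
    (coprime_ppow hp hnd (n + 1))
  have h3 : ∀ k ∈ range (p ^ (n + 1)), uInd (p ^ (n + 1)) ((z.val : ℤ) * k) *
      (legendreSym p ((z.val : ℤ) * k) : ℂ) = - (uInd (p ^ (n + 1)) k * (legendreSym p k : ℂ)) := by
    intro k _
    unfold uInd
    rw [Int.gcd_mul_right_left_of_gcd_eq_one
      (Int.isCoprime_iff_gcd_eq_one.mp (coprime_ppow hp hnd (n + 1))), legendreSym.mul, hr]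
    push_cast; ring
  rw [sum_congr rfl h3, sum_neg_distrib] at key
  exact self_eq_neg.mp key.symm

lemma Sqa_exact_dvd_aux {p : ℕ} [Fact p.Prime] (h2 : p ≠ 2) (n : ℕ) (a' a₁ a₂ a₃ c₀ c₁ c₂ c₃ : ℤ)
    (h0 : ¬ (p : ℤ) ∣ a') (h1 : ¬ (p : ℤ) ∣ a₁) (h22 : ¬ (p : ℤ) ∣ a₂) (h3 : ¬ (p : ℤ) ∣ a₃)
    (hF : a₁ * a₂ * a₃ * c₀ ^ 2 + p * a' * a₂ * a₃ * c₁ ^ 2 + p * a' * a₁ * a₃ * c₂ ^ 2 + p * a' * a₁ * a₂ * c₃ ^ 2 = 0) :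
    ∑ k ∈ range (p ^ (n + 1)), uInd (p ^ (n + 1)) k * (Gs (p ^ (n + 1)) (k * (p * a')) c₀ * Gs (p ^ (n + 1)) (k * a₁) c₁ *
        Gs (p ^ (n + 1)) (k * a₂) c₂ * Gs (p ^ (n + 1)) (k * a₃) c₃) = 0 := by
  have hp : p.Prime := Fact.out
  have hpz : Prime (p : ℤ) := Nat.prime_iff_prime_int.mp hp
  have hp0 : (p : ℤ) ≠ 0 := hpz.ne_zero
  have hq : p ^ (n + 1) ≠ 0 := pow_ne_zero _ hp.ne_zero
  have hc0 : (p : ℤ) ∣ c₀ := by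
    have : (p : ℤ) ∣ a₁ * a₂ * a₃ * c₀ ^ 2 := ⟨-(a' * a₂ * a₃ * c₁ ^ 2 + a' * a₁ * a₃ * c₂ ^ 2 + a' * a₁ * a₂ * c₃ ^ 2), by
        linear_combination hF⟩
    rcases hpz.dvd_or_dvd this with h | h
    · rcases hpz.dvd_or_dvd h with h | h
      · rcases hpz.dvd_or_dvd h with h | h
        · exact absurd h h1
        · exact absurd h h22
      · exact absurd h h3
    · exact hpz.dvd_of_dvd_pow h
  obtain ⟨c', rfl⟩ := hc0
  have hF' : a₁ * a₂ * a₃ * p * c' ^ 2 + a' * a₂ * a₃ * c₁ ^ 2 + a' * a₁ * a₃ * c₂ ^ 2 + a' * a₁ * a₂ * c₃ ^ 2 = 0 := by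
    apply mul_left_cancel₀ hp0
    linear_combination hF
  have hA : ¬ (p : ℤ) ∣ 4 * (a' * a₁ * a₂ * a₃) := by
    intro h
    rcases hpz.dvd_or_dvd h with h | h
    · exact not_dvd_four hp h2 h
    rcases hpz.dvd_or_dvd h with h | h
    · rcases hpz.dvd_or_dvd h with h | h
      · rcases hpz.dvd_or_dvd h with h | h
        · exact h0 h
        · exact h1 h
      · exact h22 h
    · exact h3 h
  obtain ⟨w, t, ht⟩ := exists_inv (coprime_ppow hp hA (n + 1))
  set K : ℂ := p * ((legendreSym p a' : ℂ) ^ n * Gs (p ^ n) 1 0) * (((legendreSym p a₁ : ℂ) * legendreSym p a₂ * legendreSym p a₃) ^ (n + 1) *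
      Gs (p ^ (n + 1)) 1 0 ^ 3) with hK
  rw [← mul_zero K, ← sum_legendre_units h2 n, mul_sum]
  refine sum_congr rfl fun k _ => ?_
  unfold uInd
  split_ifs with hg
  swap
  · simp
  rw [one_mul, one_mul]
  obtain ⟨l, s, hs⟩ := exists_inv (Int.isCoprime_iff_gcd_eq_one.mpr hg)
  have hk : ¬ (p : ℤ) ∣ k := not_dvd_of_inv hp (Nat.succ_ne_zero n) ⟨s, hs⟩
  have hka : ∀ {b : ℤ}, ¬ (p : ℤ) ∣ b → ¬ (p : ℤ) ∣ k * b := fun hb h => (hpz.dvd_or_dvd h).elim hk hb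
  have hv0 : ((p ^ n : ℕ) : ℤ) ∣ 4 * (k * a') * (w * l * (a₁ * a₂ * a₃)) - 1 := ⟨p * (t * (k * l) + s), by
      push_cast at ht hs ⊢
      linear_combination (k * l : ℤ) * ht + hs⟩
  have hv : ∀ x y : ℤ, x * y = a' * a₁ * a₂ * a₃ → ((p ^ (n + 1) : ℕ) : ℤ) ∣ 4 * (k * x) * (w * l * y) - 1 := fun x y h =>
    ⟨t * (k * l) + s, by linear_combination (k * l : ℤ) * ht + hs + 4 * k * w * l * h⟩
  have e0 : Gs (p ^ (n + 1)) (k * (p * a')) (p * c') = p * (eQ (p ^ (n + 1)) (p * (-(w * l * (a₁ * a₂ * a₃)) * c' ^ 2)) *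
        ((legendreSym p (k * a') : ℂ) ^ n * Gs (p ^ n) 1 0)) := by
    rw [show p ^ (n + 1) = p * p ^ n by ring, eQ_mul_left hp.ne_zero, ← Gs_full h2 n (hka h0) hv0, ← Gs_dvd hp.ne_zero (pow_ne_zero _ hp.ne_zero)]
    congr 1; ring
  rw [e0, Gs_full h2 _ (hka h1) (hv _ (a' * a₂ * a₃) (by ring)), Gs_full h2 _ (hka h22) (hv _ (a' * a₁ * a₃) (by ring)), Gs_full h2 _ (hka h3) (hv _ (a' * a₁ * a₂) (by ring))]
  have hE : eQ (p ^ (n + 1)) (p * (-(w * l * (a₁ * a₂ * a₃)) * c' ^ 2)) * eQ (p ^ (n + 1)) (-(w * l * (a' * a₂ * a₃)) * c₁ ^ 2) *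
      eQ (p ^ (n + 1)) (-(w * l * (a' * a₁ * a₃)) * c₂ ^ 2) *
      eQ (p ^ (n + 1)) (-(w * l * (a' * a₁ * a₂)) * c₃ ^ 2) = 1 := by
    rw [← eQ_add, ← eQ_add, ← eQ_add, ← eQ_zero (p ^ (n + 1))]
    congr 1
    linear_combination (-(w * l)) * hF'
  have hL : (legendreSym p k : ℂ) ^ (4 * n + 2) = 1 := by rw [show 4 * n + 2 = 2 * (2 * n + 1) by ring, pow_mul, legendre_sq hk, one_pow]
  generalize eQ (p ^ (n + 1)) _ = E0 at *
  generalize eQ (p ^ (n + 1)) _ = E1 at *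
  generalize eQ (p ^ (n + 1)) _ = E2 at *
  generalize eQ (p ^ (n + 1)) _ = E3 at *
  simp only [legendreSym.mul]
  push_cast
  simp only [mul_pow]
  rw [hK]
  simp only [mul_pow]
  linear_combination (p * ((legendreSym p a' : ℂ) ^ n * Gs (p ^ n) 1 0) * (((legendreSym p a₁ : ℂ) ^ (n + 1) * (legendreSym p a₂ : ℂ) ^ (n + 1) *
      (legendreSym p a₃ : ℂ) ^ (n + 1)) *
      Gs (p ^ (n + 1)) 1 0 ^ 3)) * ((legendreSym p k : ℂ) ^ (4 * n + 3) * hE + (legendreSym p k : ℂ) * hL)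

lemma Sqa_exact_dvd {p : ℕ} [Fact p.Prime] (h2 : p ≠ 2) (n : ℕ) (a c : ℤ⁴)
    (hd : (p : ℤ) ∣ ∏ i, a i) (hd2 : ¬ (p : ℤ) ^ 2 ∣ ∏ i, a i) (hF : dualForm a c = 0) :
    Sqa a c (p ^ (n + 1)) = 0 := by
  have hp : p.Prime := Fact.out
  have hpz : Prime (p : ℤ) := Nat.prime_iff_prime_int.mp hp
  obtain ⟨i, _, a', hi⟩ := (Prime.dvd_finset_prod_iff hpz _).mp hd
  have hne : ∀ j, j ≠ i → ¬ (p : ℤ) ∣ a j := by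
    intro j hj h
    apply hd2
    rw [← mul_prod_erase _ _ (mem_univ i), ← mul_prod_erase _ _
      (mem_erase.mpr ⟨hj, mem_univ j⟩), sq, ← mul_assoc]
    exact Dvd.dvd.mul_right (mul_dvd_mul ⟨a', hi⟩ h) _
  have ha' : ¬ (p : ℤ) ∣ a' := by
    intro h
    apply hd2
    rw [← mul_prod_erase _ _ (mem_univ i), hi, sq]
    exact Dvd.dvd.mul_right (mul_dvd_mul (dvd_refl _) h) _
  rw [Sqa_eq]
  rw [dualForm_eq] at hF
  simp only [Fin.prod_univ_four]
  fin_cases i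
  · simp only [Fin.zero_eta, Fin.isValue] at hi hne
    rw [hi] at hF ⊢
    exact Sqa_exact_dvd_aux h2 n a' (a 1) (a 2) (a 3) (c 0) (c 1) (c 2) (c 3) ha' (hne 1 (by decide))
      (hne 2 (by decide)) (hne 3 (by decide)) (by linear_combination hF)
  · simp only [Fin.mk_one, Fin.isValue] at hi hne
    rw [hi] at hF ⊢
    rw [← Sqa_exact_dvd_aux h2 n a' (a 0) (a 2) (a 3) (c 1) (c 0) (c 2) (c 3) ha' (hne 0 (by decide))
      (hne 2 (by decide)) (hne 3 (by decide)) (by linear_combination hF)]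
    refine sum_congr rfl fun k _ => by ring
  · simp only [Fin.reduceFinMk, Fin.isValue] at hi hne
    rw [hi] at hF ⊢
    rw [← Sqa_exact_dvd_aux h2 n a' (a 0) (a 1) (a 3) (c 2) (c 0) (c 1) (c 3) ha' (hne 0 (by decide))
      (hne 1 (by decide)) (hne 3 (by decide)) (by linear_combination hF)]
    refine sum_congr rfl fun k _ => by ring
  · simp only [Fin.reduceFinMk, Fin.isValue] at hi hne
    rw [hi] at hF ⊢
    rw [← Sqa_exact_dvd_aux h2 n a' (a 0) (a 1) (a 2) (c 3) (c 0) (c 1) (c 2) ha' (hne 0 (by decide))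
      (hne 1 (by decide)) (hne 2 (by decide)) (by linear_combination hF)]
    refine sum_congr rfl fun k _ => by ring

lemma Sqa_one (a c : ℤ⁴) : Sqa a c 1 = 1 := by
  rw [Sqa_eq]; simp [Gs, uInd, eQ_zero]

/-- For `q` odd such that no prime `p ∣ q` has `p² ∣ A`, and `F*(c) = 0`. -/
lemma Sqa_eval (a c : ℤ⁴) (hF : dualForm a c = 0) (q : ℕ) (hq0 : q ≠ 0)
    (hq : ∀ p : ℕ, p.Prime → p ∣ q → p ≠ 2 ∧ ¬ (p : ℤ) ^ 2 ∣ ∏ i, a i) :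
    Sqa a c q = (jacobiSym (∏ i, a i) q : ℂ) * (q : ℂ) ^ 2 * (totient q : ℂ) := by
  induction q using Nat.recOnPosPrimePosCoprime with
  | zero => exact absurd rfl hq0
  | one => simp [Sqa_one]
  | prime_pow p n hp hn =>
    have : Fact p.Prime := ⟨hp⟩
    obtain ⟨hp2, hpA⟩ := hq p hp (dvd_pow_self _ hn.ne')
    rw [jacobiSym.pow_right, ← jacobiSym.legendreSym.to_jacobiSym]
    by_cases hd : (p : ℤ) ∣ ∏ i, a i
    · obtain ⟨m, rfl⟩ := Nat.exists_eq_succ_of_ne_zero hn.ne'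
      rw [Nat.succ_eq_add_one, Sqa_exact_dvd hp2 m a c hd hpA hF, (legendreSym.eq_zero_iff p _).mpr ((ZMod.intCast_zmod_eq_zero_iff_dvd _ p).mpr hd)]
      simp
    · have ha : ∀ i, ¬ (p : ℤ) ∣ a i := fun i h => hd (h.trans (dvd_prod_of_mem a (mem_univ i)))
      rw [Sqa_prime_pow hp2 n a c ha, hF, ram_zero]
      push_cast; ring
  | coprime x y hx hy hxy ihx ihy =>
    have hx0 : x ≠ 0 := by omega
    have hy0 : y ≠ 0 := by omega
    rw [Sqa_mul hx0 hy0 hxy, ihx hx0 (fun p hp h => hq p hp (h.mul_right y)),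
      ihy hy0 (fun p hp h => hq p hp (h.mul_left x)), jacobiSym.mul_right' _ hx0 hy0,
      Nat.totient_mul hxy]
    push_cast; ring

lemma Sqa_coprime_bound (a c : ℤ⁴) (q : ℕ) (hq0 : q ≠ 0)
    (hq : ∀ p : ℕ, p.Prime → p ∣ q → p ≠ 2 ∧ ∀ i, ¬ (p : ℤ) ∣ a i) :
    ‖Sqa a c q‖ ≤ (q : ℝ) ^ 2 * Int.gcd (dualForm a c) q := by
  induction q using Nat.recOnPosPrimePosCoprime with
  | zero => exact absurd rfl hq0
  | one => simp [Sqa_one]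
  | prime_pow p n hp hn =>
    have : Fact p.Prime := ⟨hp⟩
    obtain ⟨hp2, ha⟩ := hq p hp (dvd_pow_self _ hn.ne')
    rw [Sqa_prime_pow hp2 n a c ha, norm_mul, norm_mul]
    have h1 : ‖(legendreSym p (∏ i, a i) : ℂ) ^ n‖ = 1 := by
      have hA : ¬ (p : ℤ) ∣ ∏ i, a i := by
        intro h
        obtain ⟨i, _, hi⟩ := (Prime.dvd_finset_prod_iff (Nat.prime_iff_prime_int.mp hp) _).mp h
        exact ha i hi
      have := congrArg (‖·‖) (legendre_sq hA)
      simp only [norm_pow, norm_one] at this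
      rw [norm_pow, (pow_eq_one_iff_of_nonneg (norm_nonneg _) two_ne_zero).mp this, one_pow]
    rw [h1, one_mul]
    have h3 := ram_prime_pow_bound hp n (dualForm a c)
    have h4 : ‖(p : ℂ) ^ (2 * n)‖ = ((p ^ n : ℕ) : ℝ) ^ 2 := by rw [norm_pow, Complex.norm_natCast]; push_cast; ring
    rw [h4]
    gcongr
  | coprime x y hx hy hxy ihx ihy =>
    have hx0 : x ≠ 0 := by omega
    have hy0 : y ≠ 0 := by omega
    rw [Sqa_mul hx0 hy0 hxy, norm_mul]
    have h1 := ihx hx0 (fun p hp h => hq p hp (h.mul_right y))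
    have h2 := ihy hy0 (fun p hp h => hq p hp (h.mul_left x))
    have h3 : Int.gcd (dualForm a c) ((x * y : ℕ) : ℤ) = Int.gcd (dualForm a c) x * Int.gcd (dualForm a c) y := by
      simp only [Int.gcd_eq_natAbs_gcd_natAbs, Int.natAbs_natCast]
      exact Nat.Coprime.gcd_mul _ hxy
    rw [h3]
    push_cast
    calc ‖Sqa a c x‖ * ‖Sqa a c y‖ ≤ ((x : ℝ) ^ 2 * Int.gcd (dualForm a c) x) * ((y : ℝ) ^ 2 * Int.gcd (dualForm a c) y) :=
          mul_le_mul h1 h2 (norm_nonneg _) (by positivity)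
      _ = _ := by ring


/-! ### B1: divisor bounds, smooth parts -/

lemma rpow_prod_fact (n : ℕ) (hn : n ≠ 0) (δ : ℝ) : (n : ℝ) ^ δ = ∏ p ∈ n.primeFactors, ((p : ℝ) ^ (n.factorization p)) ^ δ := by
  conv_lhs => rw [← Nat.prod_factorization_pow_eq_self hn]
  rw [Finsupp.prod, Nat.support_factorization]
  push_cast
  exact (finset_prod_rpow _ _ (fun i _ => by positivity) δ).symm

lemma prod_le_const_mul {δ K : ℝ} (P : ℕ) (hK : 1 ≤ K) (n : ℕ) (hn : n ≠ 0)
    (g : ℕ → ℝ) (h0 : ∀ p, 0 ≤ g p)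
    (h1 : ∀ p ∈ n.primeFactors, p < P → g p ≤ K * ((p : ℝ) ^ (n.factorization p)) ^ δ)
    (h2 : ∀ p ∈ n.primeFactors, P ≤ p → g p ≤ ((p : ℝ) ^ (n.factorization p)) ^ δ) :
    ∏ p ∈ n.primeFactors, g p ≤ K ^ P * (n : ℝ) ^ δ := by
  calc ∏ p ∈ n.primeFactors, g p
      ≤ ∏ p ∈ n.primeFactors, ((if p < P then K else 1) * ((p : ℝ) ^ (n.factorization p)) ^ δ) := by
        apply prod_le_prod (fun p _ => h0 p)
        intro p hp
        split_ifs with h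
        · exact h1 p hp h
        · rw [one_mul]; exact h2 p hp (not_lt.mp h)
    _ = (∏ p ∈ n.primeFactors, (if p < P then K else 1)) * (n : ℝ) ^ δ := by rw [prod_mul_distrib, ← rpow_prod_fact n hn]
    _ ≤ K ^ P * (n : ℝ) ^ δ := by
        apply mul_le_mul_of_nonneg_right _ (by positivity)
        rw [prod_ite, prod_const, prod_const_one, mul_one]
        apply pow_le_pow_right₀ hK
        calc (n.primeFactors.filter (· < P)).card ≤ (range P).card := by
              apply card_le_card
              intro x hx
              simp at hx ⊢
              exact hx.2
          _ = P := card_range P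

lemma exists_nat_rpow_ge {δ : ℝ} (hδ : 0 < δ) (K : ℝ) : ∃ P : ℕ, ∀ p : ℕ, P ≤ p → K ≤ (p : ℝ) ^ δ := by
  have h : Tendsto (fun p : ℕ => (p : ℝ) ^ δ) atTop atTop := (tendsto_rpow_atTop hδ).comp tendsto_natCast_atTop_atTop
  exact (h.eventually_ge_atTop K).exists_forall_of_atTop

lemma tau_bound {δ : ℝ} (hδ : 0 < δ) : ∃ C : ℝ, 1 ≤ C ∧ ∀ n : ℕ, n ≠ 0 → (n.divisors.card : ℝ) ≤ C * (n : ℝ) ^ δ := by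
  obtain ⟨P, hP⟩ := exists_nat_rpow_ge hδ 2
  have hl : 0 < log 2 := log_pos (by norm_num)
  set K := max 1 (1 / (δ * log 2)) with hKdef
  have hK : 1 ≤ K := le_max_left _ _
  refine ⟨K ^ P, one_le_pow₀ hK, fun n hn => ?_⟩
  rw [Nat.card_divisors hn]
  push_cast
  refine prod_le_const_mul P hK n hn (fun p => (n.factorization p : ℝ) + 1) (fun p => by positivity) ?_ ?_
  · intro p hp _
    have hp2 : (2 : ℝ) ≤ p := by exact_mod_cast (prime_of_mem_primeFactors hp).two_le
    set v := n.factorization p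
    have h1 : ((2 : ℝ) ^ v) ^ δ ≤ ((p : ℝ) ^ v) ^ δ := by gcongr
    have h2 : 1 + δ * log 2 * v ≤ ((2 : ℝ) ^ v) ^ δ := by
      rw [← rpow_natCast, ← rpow_mul (by norm_num), rpow_def_of_pos (by norm_num)]
      have := add_one_le_exp (log 2 * ((v : ℝ) * δ))
      linarith
    have h3 : 1 ≤ K * (δ * log 2) := by
      have : 1 / (δ * log 2) ≤ K := le_max_right _ _
      rwa [div_le_iff₀ (by positivity)] at this
    have hv : (0 : ℝ) ≤ v := by positivity
    calc (v : ℝ) + 1 ≤ K * (1 + δ * log 2 * v) := by nlinarith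
      _ ≤ _ := by gcongr; linarith
  · intro p hp hPp
    set v := n.factorization p
    have := hP p hPp
    calc (v : ℝ) + 1 ≤ 2 ^ v := by
          have : v + 1 ≤ 2 ^ v := Nat.lt_two_pow_self
          exact_mod_cast this
      _ ≤ ((p : ℝ) ^ δ) ^ v := by gcongr
      _ = ((p : ℝ) ^ v) ^ δ := by rw [← rpow_natCast, ← rpow_natCast, ← rpow_mul (by positivity), ← rpow_mul (by positivity), mul_comm]

lemma const_omega_bound {δ : ℝ} (hδ : 0 < δ) {K : ℝ} (hK : 1 ≤ K) : ∃ C : ℝ, 1 ≤ C ∧ ∀ n : ℕ, n ≠ 0 → K ^ n.primeFactors.card ≤ C * (n : ℝ) ^ δ := by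
  obtain ⟨P, hP⟩ := exists_nat_rpow_ge hδ K
  refine ⟨K ^ P, one_le_pow₀ hK, fun n hn => ?_⟩
  rw [← prod_const]
  have key : ∀ p ∈ n.primeFactors, (p : ℝ) ≤ (p : ℝ) ^ (n.factorization p) := by
    intro p hp
    have hp1 : (1 : ℝ) ≤ p := by exact_mod_cast (prime_of_mem_primeFactors hp).one_le
    apply le_self_pow₀ hp1
    have := Nat.support_factorization n ▸ hp
    exact Finsupp.mem_support_iff.mp this
  refine prod_le_const_mul P hK n hn (fun p => K) (fun p => by positivity) ?_ ?_
  · intro p hp _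
    have hp1 : (1 : ℝ) ≤ p := by exact_mod_cast (prime_of_mem_primeFactors hp).one_le
    have : (1 : ℝ) ≤ ((p : ℝ) ^ (n.factorization p)) ^ δ := one_le_rpow (one_le_pow₀ hp1) hδ.le
    nlinarith
  · intro p hp hPp
    refine (hP p hPp).trans ?_
    exact rpow_le_rpow (by positivity) (key p hp) hδ.le

/-- `q` is composed of primes dividing `M` -/
def smo (M q : ℕ) : Prop := q ≠ 0 ∧ ∀ p : ℕ, p.Prime → p ∣ q → p ∣ M

/-- sum over smooth numbers of q^{-δ} -/
lemma smooth_sum {δ κ : ℝ} (hδ : 0 < δ) (hκ : 0 < κ) : ∃ C : ℝ, 1 ≤ C ∧ ∀ M : ℕ, M ≠ 0 → ∀ S : Finset ℕ, (∀ q ∈ S, smo M q) →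
      ∑ q ∈ S, (q : ℝ) ^ (-δ) ≤ C * (M : ℝ) ^ κ := by
  have h2 : (2 : ℝ) ^ (-δ) < 1 := rpow_lt_one_of_one_lt_of_neg (by norm_num) (by linarith)
  set K : ℝ := (1 - (2 : ℝ) ^ (-δ))⁻¹ with hK
  have hpos : 0 < 1 - (2 : ℝ) ^ (-δ) := by linarith
  have hK1 : 1 ≤ K := by
    rw [hK]; apply one_le_inv₀ hpos |>.mpr
    have : (0 : ℝ) < (2 : ℝ) ^ (-δ) := by positivity
    linarith
  obtain ⟨C, hC1, hC⟩ := const_omega_bound hκ hK1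
  refine ⟨C, hC1, fun M hM S hS => ?_⟩
  refine le_trans ?_ (hC M hM)
  let f : ℕ →* ℝ :=
    { toFun := fun n => (n : ℝ) ^ (-δ)
      map_one' := by simp
      map_mul' := fun x y => by
        push_cast
        exact mul_rpow (by positivity) (by positivity) }
  have hf : ∀ n, f n = (n : ℝ) ^ (-δ) := fun n => rfl
  have hp : ∀ {p : ℕ}, p.Prime → f p ≤ 2 ^ (-δ) := by
    intro p hp
    rw [hf]
    apply rpow_le_rpow_of_nonpos (by norm_num) (by exact_mod_cast hp.two_le) (by linarith)
  obtain ⟨hs, hsum⟩ := EulerProduct.summable_and_hasSum_factoredNumbers_prod_filter_prime_geometric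
    (f := f) (fun {p} h => by rw [norm_of_nonneg (by rw [hf]; positivity)]; exact (hp h).trans_lt h2) M.primeFactors
  have hmem : ∀ q ∈ S, q ∈ Nat.factoredNumbers M.primeFactors := by
    intro q hq
    obtain ⟨h0, h1⟩ := hS q hq
    apply Nat.mem_factoredNumbers_of_primeFactors_subset h0
    intro p hp
    exact Nat.mem_primeFactors.mpr ⟨prime_of_mem_primeFactors hp, h1 p (prime_of_mem_primeFactors hp) (Nat.dvd_of_mem_primeFactors hp), hM⟩
  have e1 : ∑ q ∈ S, (q : ℝ) ^ (-δ) = ∑ q ∈ S.attach.map ⟨fun q => (⟨q.1, hmem q.1 q.2⟩ : Nat.factoredNumbers M.primeFactors), fun x y h => by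
          apply Subtype.ext
          exact congrArg (fun z => z.1) h⟩, f q := by
    rw [sum_map]
    exact (sum_attach S (fun q : ℕ => (q : ℝ) ^ (-δ))).symm
  rw [e1]
  refine (sum_le_hasSum _ (fun i _ => by rw [hf]; positivity) hsum).trans ?_
  calc ∏ p ∈ M.primeFactors.filter Nat.Prime, (1 - f p)⁻¹
      ≤ ∏ p ∈ M.primeFactors.filter Nat.Prime, K := by
        apply Finset.prod_le_prod
        · intro p h
          have := hp (mem_filter.mp h).2
          exact inv_nonneg.mpr (by linarith)
        · intro p h
          have := hp (mem_filter.mp h).2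
          exact inv_anti₀ hpos (by linarith)
    _ = K ^ (M.primeFactors.filter Nat.Prime).card := prod_const _
    _ ≤ K ^ M.primeFactors.card := pow_le_pow_right₀ hK1 (card_filter_le _ _)

/-- the `M`-part of `q` -/
def sPart (M q : ℕ) : ℕ := Nat.gcd q (M ^ q)

lemma sPart_dvd (M q : ℕ) : sPart M q ∣ q := Nat.gcd_dvd_left _ _

lemma sPart_smo {M q : ℕ} (hq : q ≠ 0) : smo M (sPart M q) := by
  refine ⟨Nat.gcd_ne_zero_left hq, fun p hp h => ?_⟩
  exact hp.dvd_of_dvd_pow (h.trans (Nat.gcd_dvd_right _ _))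

lemma sPart_coprime {M q : ℕ} (hM : M ≠ 0) (hq : q ≠ 0) : Coprime (q / sPart M q) M := by
  apply Nat.Coprime.symm
  rw [coprime_iff_gcd_eq_one]
  by_contra h
  obtain ⟨p, hp, hpd⟩ := Nat.exists_prime_and_dvd h
  have hpM := hpd.trans (Nat.gcd_dvd_left _ _)
  have hpq := hpd.trans (Nat.gcd_dvd_right _ _)
  have h1 : p ^ (q.factorization p) ∣ sPart M q := by
    apply Nat.dvd_gcd (Nat.ordProj_dvd q p)
    apply (pow_dvd_pow_of_dvd hpM _).trans
    exact pow_dvd_pow _ (Nat.factorization_lt p hq).le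
  have h2 : p ^ (q.factorization p + 1) ∣ q := by
    rw [pow_succ]
    have := mul_dvd_mul h1 hpq
    rwa [Nat.mul_div_cancel' (sPart_dvd M q)] at this
  exact Nat.pow_succ_factorization_not_dvd hq hp h2

lemma smo_coprime {M q r : ℕ} (h : smo M q) (hr : Coprime r M) : Coprime r q := by
  rw [coprime_iff_gcd_eq_one]
  by_contra h'
  obtain ⟨p, hp, hpd⟩ := Nat.exists_prime_and_dvd h'
  have := h.2 p hp (hpd.trans (Nat.gcd_dvd_right _ _))
  exact Nat.Prime.not_coprime_iff_dvd.mpr ⟨p, hp, hpd.trans (Nat.gcd_dvd_left _ _), this⟩ hr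

lemma sPart_mul {M q r : ℕ} (hM : M ≠ 0) (h : smo M q) (hr : Coprime r M) (hr0 : r ≠ 0) : sPart M (r * q) = q := by
  have h0 : r * q ≠ 0 := mul_ne_zero hr0 h.1
  have c1 := sPart_coprime hM h0
  have s1 := sPart_smo (M := M) h0
  have e := Nat.div_mul_cancel (sPart_dvd M (r * q))
  apply Nat.dvd_antisymm
  · have : sPart M (r * q) ∣ r * q := sPart_dvd M _
    exact (smo_coprime s1 hr).symm.dvd_of_dvd_mul_left this
  · have : q ∣ (r * q / sPart M (r * q)) * sPart M (r * q) := by rw [e]; exact Dvd.intro_left r rfl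
    exact (smo_coprime h c1).symm.dvd_of_dvd_mul_left this

lemma sum_split {E : Type*} [AddCommMonoid E] {M : ℕ} (hM : M ≠ 0) (x : ℕ) (f : ℕ → E) : ∑ q ∈ Icc 1 x, f q =
      ∑ q ∈ (Icc 1 x).filter (fun q => smo M q), ∑ r ∈ (Icc 1 (x / q)).filter (fun r => Coprime r M), f (r * q) := by
  rw [sum_sigma']
  symm
  refine sum_bij' (fun s _ => s.2 * s.1) (fun q _ => ⟨sPart M q, q / sPart M q⟩) ?_ ?_ ?_ ?_ ?_
  · rintro ⟨q, r⟩ h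
    simp only [mem_sigma, mem_filter, mem_Icc] at h ⊢
    obtain ⟨⟨⟨h1, h2⟩, h3⟩, ⟨h4, h5⟩, h6⟩ := h
    exact ⟨Nat.mul_pos h4 h1, (Nat.le_div_iff_mul_le h1).mp h5⟩
  · intro q hq
    simp only [mem_sigma, mem_filter, mem_Icc] at hq ⊢
    have hq0 : q ≠ 0 := by omega
    have hs := sPart_smo (M := M) hq0
    have hsp : 0 < sPart M q := Nat.pos_of_ne_zero hs.1
    have hle := le_of_dvd (by omega) (sPart_dvd M q)
    exact ⟨⟨⟨hsp, by omega⟩, hs⟩, ⟨Nat.div_pos hle hsp, Nat.div_le_div_right hq.2⟩, sPart_coprime hM hq0⟩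
  · rintro ⟨q, r⟩ h
    simp only [mem_sigma, mem_filter, mem_Icc] at h ⊢
    obtain ⟨⟨⟨h1, h2⟩, h3⟩, ⟨h4, h5⟩, h6⟩ := h
    have := sPart_mul hM h3 h6 (by omega)
    rw [this, Nat.mul_div_cancel _ h1]
  · intro q hq
    exact Nat.div_mul_cancel (sPart_dvd M q)
  · rintro ⟨q, r⟩ h
    rfl


/-! ### B2: Pólya–Vinogradov -/

lemma gauss_normSq {f : ℕ} [NeZero f] {χ : DirichletCharacter ℂ f} (hχ : χ.IsPrimitive) : ‖gaussSum χ ZMod.stdAddChar‖ ^ 2 = f := by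
  set τ := gaussSum χ ZMod.stdAddChar with hτ
  have hnorm : ∀ (ψ : DirichletCharacter ℂ f) (a : ZMod f), ((‖ψ a‖ ^ 2 : ℝ) : ℂ) = if IsUnit a then 1 else 0 := by
    intro ψ a
    split_ifs with h
    · have := DirichletCharacter.unit_norm_eq_one ψ h.unit
      rw [IsUnit.unit_spec] at this
      rw [this]; simp
    · rw [MulChar.map_nonunit _ h]; simp
  set U : ℂ := ∑ a : ZMod f, if IsUnit a then 1 else 0 with hU
  have h1 : ∑ a : ZMod f, ((‖gaussSum χ (ZMod.stdAddChar.mulShift a)‖ ^ 2 : ℝ) : ℂ) = U * ((‖τ‖ ^ 2 : ℝ) : ℂ) := by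
    rw [hU, sum_mul]
    apply sum_congr rfl
    intro a _
    rw [gaussSum_mulShift_of_isPrimitive _ hχ, ← hnorm χ⁻¹ a, norm_mul, mul_pow]
    push_cast; ring
  have h2 : ∑ a : ZMod f, ((‖gaussSum χ (ZMod.stdAddChar.mulShift a)‖ ^ 2 : ℝ) : ℂ) = U * f := by
    have : ∀ a : ZMod f, ((‖gaussSum χ (ZMod.stdAddChar.mulShift a)‖ ^ 2 : ℝ) : ℂ) = ∑ b : ZMod f, ∑ b' : ZMod f, (χ b * (starRingEnd ℂ) (χ b')) *
          ZMod.stdAddChar (a * (b - b')) := by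
      intro a
      push_cast
      rw [← Complex.mul_conj', gaussSum, map_sum, sum_mul_sum]
      apply sum_congr rfl; intro b _
      apply sum_congr rfl; intro b' _
      rw [map_mul, AddChar.mulShift_apply, AddChar.mulShift_apply, mul_sub, sub_eq_add_neg, AddChar.map_add_eq_mul]
      have : (starRingEnd ℂ) (ZMod.stdAddChar (a * b')) = ZMod.stdAddChar (-(a * b')) := (AddChar.map_neg_eq_conj _ _).symm
      rw [this]; ring
    simp_rw [this]
    rw [sum_comm]
    rw [hU, sum_mul]
    apply sum_congr rfl; intro b _
    rw [sum_comm]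
    rw [sum_eq_single b]
    · rw [← mul_sum, AddChar.sum_mulShift _ (ZMod.isPrimitive_stdAddChar f)]
      rw [← hnorm χ b]
      simp [Complex.mul_conj']
    · intro b' _ hb
      rw [← mul_sum, AddChar.sum_mulShift _ (ZMod.isPrimitive_stdAddChar f)]
      rw [if_neg (sub_ne_zero.mpr (Ne.symm hb))]; simp
    · simp
  have hU0 : U ≠ 0 := by
    rw [hU, sum_boole]
    have : 0 < (univ.filter (fun a : ZMod f => IsUnit a)).card := card_pos.mpr ⟨1, by simp⟩
    exact_mod_cast this.ne'
  have := mul_left_cancel₀ hU0 (h1.symm.trans h2)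
  exact_mod_cast this

lemma geom_norm_bound {f j : ℕ} (hj : 0 < j) (hjf : j < f) (y : ℕ) : ‖∑ n ∈ range y, (cexp (2 * π * I * j / f)) ^ n‖ ≤
      f / (2 * j : ℝ) + f / (2 * ((f : ℝ) - j)) := by
  set z := cexp (2 * π * I * j / f) with hz
  have hf : (0 : ℝ) < f := by exact_mod_cast hj.trans hjf
  have hj' : (0 : ℝ) < j := by exact_mod_cast hj
  have hjf' : (j : ℝ) < f := by exact_mod_cast hjf
  have hz1 : z = cexp (I * ((2 * π * j / f : ℝ))) := by rw [hz]; congr 1; push_cast; ring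
  have hzn : ‖z‖ = 1 := by rw [hz1, mul_comm]; exact Complex.norm_exp_ofReal_mul_I _
  have hd : ‖z - 1‖ = ‖2 * sin (π * j / f)‖ := by rw [hz1, Complex.norm_exp_I_mul_ofReal_sub_one]; congr 3; ring
  have hpi := pi_pos
  have hA : 0 < 2 * (j : ℝ) / f := by positivity
  have hB : 0 < 2 * ((f : ℝ) - j) / f := by apply div_pos _ hf; linarith
  have hsin : min (2 * (j : ℝ) / f) (2 * ((f : ℝ) - j) / f) ≤ sin (π * j / f) := by
    by_cases h : 2 * (j : ℝ) ≤ f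
    · refine (min_le_left _ _).trans ?_
      have := mul_le_sin (x := π * j / f) (by positivity)
        (by rw [div_le_div_iff₀ hf (by norm_num)]; nlinarith)
      refine le_trans (le_of_eq ?_) this
      field_simp
    · refine (min_le_right _ _).trans ?_
      push Not at h
      have := mul_le_sin (x := π * (f - j) / f)
        (by apply div_nonneg _ hf.le; nlinarith)
        (by rw [div_le_div_iff₀ hf (by norm_num)]; nlinarith)
      rw [show π * ((f : ℝ) - j) / f = π - π * j / f by field_simp, sin_pi_sub] at this
      refine le_trans (le_of_eq ?_) this
      field_simp
  have hmin : 0 < min (2 * (j : ℝ) / f) (2 * ((f : ℝ) - j) / f) := lt_min hA hB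
  have hs0 : 0 < sin (π * j / f) := hmin.trans_le hsin
  have hz0 : z - 1 ≠ 0 := by rw [← norm_pos_iff, hd, norm_of_nonneg (by positivity)]; positivity
  rw [geom_sum_eq (sub_ne_zero.mp hz0), norm_div, hd, norm_of_nonneg (by positivity)]
  have hnum : ‖z ^ y - 1‖ ≤ 2 := by
    calc ‖z ^ y - 1‖ ≤ ‖z ^ y‖ + ‖(1 : ℂ)‖ := norm_sub_le _ _
      _ = 2 := by rw [norm_pow, hzn]; norm_num
  calc ‖z ^ y - 1‖ / (2 * sin (π * j / f))
      ≤ 2 / (2 * min (2 * (j : ℝ) / f) (2 * ((f : ℝ) - j) / f)) := by gcongr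
    _ = 1 / min (2 * (j : ℝ) / f) (2 * ((f : ℝ) - j) / f) := by field_simp
    _ ≤ 1 / (2 * (j : ℝ) / f) + 1 / (2 * ((f : ℝ) - j) / f) := by
        rcases min_cases (2 * (j : ℝ) / f) (2 * ((f : ℝ) - j) / f) with h | h
        · rw [h.1]; have : 0 < 1 / (2 * ((f : ℝ) - j) / f) := by positivity
          linarith
        · rw [h.1]; have : 0 < 1 / (2 * (j : ℝ) / f) := by positivity
          linarith
    _ = _ := by rw [one_div_div, one_div_div]

lemma sum_inv_le_log (f : ℕ) : ∑ j ∈ range f, (1 : ℝ) / ((j : ℝ) + 1) ≤ 1 + log f := by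
  have := harmonic_le_one_add_log f
  rw [harmonic] at this
  push_cast at this
  simpa [one_div] using this

lemma polya_primitive {f : ℕ} [NeZero f] (hf1 : f ≠ 1) {χ : DirichletCharacter ℂ f}
    (hχ : χ.IsPrimitive) (y : ℕ) :
    ‖∑ n ∈ range y, χ (n : ZMod f)‖ ≤ sqrt f * (1 + log f) := by
  have hf0 : 0 < f := Nat.pos_of_ne_zero (NeZero.ne f)
  have hχ' : (χ⁻¹).IsPrimitive := by rw [DirichletCharacter.isPrimitive_def, DirichletCharacter.conductor_inv]; exact hχ
  set τ := gaussSum χ⁻¹ ZMod.stdAddChar with hτ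
  have hτn : ‖τ‖ = sqrt f := by rw [← gauss_normSq hχ', sqrt_sq (norm_nonneg _)]
  have hfpos : (0 : ℝ) < f := by exact_mod_cast hf0
  have hexp : τ * ∑ n ∈ range y, χ (n : ZMod f) = ∑ b : ZMod f, χ⁻¹ b * ∑ n ∈ range y, (ZMod.stdAddChar b) ^ n := by
    rw [mul_sum]
    simp_rw [mul_sum]
    rw [sum_comm]
    apply sum_congr rfl
    intro n _
    have := gaussSum_mulShift_of_isPrimitive ZMod.stdAddChar hχ' (n : ZMod f)
    rw [inv_inv] at this
    rw [mul_comm, ← this, gaussSum]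
    apply sum_congr rfl
    intro b _
    rw [AddChar.mulShift_apply]
    congr 1
    rw [← nsmul_eq_mul, AddChar.map_nsmul_eq_pow]
  have hbound : ‖τ * ∑ n ∈ range y, χ (n : ZMod f)‖ ≤ f * (1 + log f) := by
    rw [hexp]
    refine (norm_sum_le _ _).trans ?_
    have e : ∑ b : ZMod f, ‖χ⁻¹ b * ∑ n ∈ range y, (ZMod.stdAddChar b) ^ n‖ = ∑ j ∈ range f, ‖χ⁻¹ (j : ZMod f) *
          ∑ n ∈ range y, (cexp (2 * π * I * j / f)) ^ n‖ := by
      rw [sum_range_zmod (q := f)]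
      apply sum_congr rfl
      intro b _
      have h1 : ((b.val : ℕ) : ZMod f) = b := ZMod.natCast_zmod_val b
      rw [h1]
      have h2 := ZMod.stdAddChar_coe (N := f) ((b.val : ℕ) : ℤ)
      rw [Int.cast_natCast, h1] at h2
      rw [h2]; push_cast; rfl
    rw [e]
    obtain ⟨g, rfl⟩ : ∃ g, f = g + 1 := ⟨f - 1, by omega⟩
    rw [sum_range_succ']
    have h0 : ((0 : ℕ) : ZMod (g + 1)) = 0 := by simp
    rw [h0, DirichletCharacter.map_zero' _ hf1, zero_mul, norm_zero, add_zero]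
    calc ∑ k ∈ range g, ‖χ⁻¹ ((k + 1 : ℕ) : ZMod (g + 1)) * ∑ n ∈ range y, (cexp (2 * π * I * (k + 1 : ℕ) / (g + 1 : ℕ))) ^ n‖
        ≤ ∑ k ∈ range g, (((g + 1 : ℕ) : ℝ) / 2 * (1 / ((k : ℝ) + 1)) + ((g + 1 : ℕ) : ℝ) / 2 * (1 / (((g - 1 - k : ℕ) : ℝ) + 1))) := by
          apply sum_le_sum
          intro k hk
          have hk' := mem_range.mp hk
          rw [norm_mul]
          have hb := geom_norm_bound (f := g + 1) (j := k + 1) (by omega) (by omega) y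
          have h1 := DirichletCharacter.norm_le_one χ⁻¹ ((k + 1 : ℕ) : ZMod (g + 1))
          refine (mul_le_mul h1 hb (norm_nonneg _) zero_le_one).trans ?_
          have hc : ((g - 1 - k : ℕ) : ℝ) = (g : ℝ) - 1 - k := by rw [Nat.sub_sub, Nat.cast_sub (by omega)]; push_cast; ring
          rw [one_mul, hc]
          apply le_of_eq
          push_cast
          have : (k : ℝ) < g := by exact_mod_cast hk'
          have h3 : (g : ℝ) - k ≠ 0 := by linarith
          have h4 : (g : ℝ) + 1 - (k + 1) ≠ 0 := by linarith
          have h5 : (g : ℝ) - 1 - k + 1 ≠ 0 := by linarith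
          rw [show (g : ℝ) + 1 - (k + 1) = g - k by ring, show (g : ℝ) - 1 - k + 1 = g - k by ring]
          field_simp
      _ = ((g + 1 : ℕ) : ℝ) * ∑ k ∈ range g, (1 / ((k : ℝ) + 1)) := by
          rw [sum_add_distrib, ← mul_sum, ← mul_sum, sum_range_reflect (fun k : ℕ => 1 / ((k : ℝ) + 1)) g]
          ring
      _ ≤ ((g + 1 : ℕ) : ℝ) * (1 + log ((g + 1 : ℕ) : ℝ)) := by
          apply mul_le_mul_of_nonneg_left _ (by positivity)
          refine le_trans ?_ (sum_inv_le_log (g + 1))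
          rw [sum_range_succ]
          have : (0 : ℝ) ≤ 1 / ((g : ℝ) + 1) := by positivity
          linarith
  rw [norm_mul, hτn] at hbound
  have hs : 0 < sqrt f := sqrt_pos.mpr hfpos
  have hss : sqrt f * sqrt f = f := mul_self_sqrt hfpos.le
  have : sqrt f * ‖∑ n ∈ range y, χ (n : ZMod f)‖ ≤ sqrt f * (sqrt f * (1 + log f)) := by rw [← mul_assoc, hss]; exact hbound
  exact le_of_mul_le_mul_left this hs


/-! ### B3: the quadratic character -/

lemma split_pow (p : ℕ) (hp : p.Prime) {n : ℕ} (hn : n ≠ 0) : ∃ k m, n = p ^ k * m ∧ ¬ p ∣ m := by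
  obtain ⟨k, m, h1, h2⟩ := Nat.exists_eq_pow_mul_and_not_dvd hn p hp.ne_one
  exact ⟨k, m, h2, h1⟩

lemma exists_jacobi_neg_one_aux (σ : ℤ) (hσ : σ = 1 ∨ σ = -1) (b a : ℕ) (hb : b ≠ 0) (ha : Squarefree a)
    (hns : σ = 1 → a ≠ 1) :
    ∃ n : ℕ, Odd n ∧ Coprime n (b ^ 2 * a) ∧ jacobiSym (σ * (b ^ 2 * a : ℕ)) n = -1 := by
  have ha0 : a ≠ 0 := ha.ne_zero
  obtain ⟨e, m, ham, hm2⟩ := split_pow 2 prime_two ha0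
  have hmo : Odd m := by rw [← Nat.not_even_iff_odd, even_iff_two_dvd]; exact hm2
  have he : e = 0 ∨ e = 1 := by
    by_contra h
    have h2 : 2 ≤ e := by omega
    have : 2 * 2 ∣ a := by rw [ham]; exact (pow_dvd_pow 2 h2).mul_right m
    have := Nat.isUnit_iff.mp (ha 2 this)
    omega
  have hform : ∀ n : ℕ, Coprime n b → jacobiSym (σ * (b ^ 2 * a : ℕ)) n = jacobiSym σ n * (jacobiSym 2 n ^ e * jacobiSym m n) := by
    intro n hn
    rw [jacobiSym.mul_left, ham]
    push_cast
    rw [jacobiSym.mul_left, jacobiSym.mul_left, jacobiSym.pow_left 2, jacobiSym.sq_one', one_mul]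
    rw [Int.gcd_natCast_natCast]; exact hn.symm
  by_cases hm1 : m = 1
  · obtain ⟨k, b0, hbk, hb2⟩ := split_pow 2 prime_two hb
    set t := if σ = -1 ∧ e = 1 then 7 else 3 with ht
    have hcop : Coprime 8 b0 := by
      rw [show 8 = 2 ^ 3 by norm_num]
      exact Nat.Coprime.pow_left 3 ((Nat.Prime.coprime_iff_not_dvd prime_two).mpr hb2)
    obtain ⟨n, hn8, hnb⟩ := Nat.chineseRemainder hcop t 1
    have hn8' : n % 8 = t := by
      have : n % 8 = t % 8 := hn8
      rw [this, ht]; split_ifs <;> rfl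
    have hodd : Odd n := by
      rw [Nat.odd_iff];
      have : t = 7 ∨ t = 3 := by rw [ht]; split_ifs <;> simp
      omega
    have hc2 : Coprime n 2 := (Nat.coprime_two_right).mpr hodd
    have hcb0 : Coprime n b0 := by
      have := hnb.gcd_eq
      rw [coprime_iff_gcd_eq_one, this]; simp
    have hcb : Coprime n b := by rw [hbk]; exact Nat.Coprime.mul_right (Nat.Coprime.pow_right _ hc2) hcb0
    refine ⟨n, hodd, ?_, ?_⟩
    · refine Nat.Coprime.mul_right (Nat.Coprime.pow_right _ hcb) ?_
      rw [ham, hm1, mul_one]; exact Nat.Coprime.pow_right _ hc2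
    · rw [hform n hcb, hm1]
      have h2 := jacobiSym.at_two hodd
      rw [ZMod.χ₈_nat_eq_if_mod_eight, hn8', Nat.odd_iff.mp hodd] at h2
      have h4 := jacobiSym.at_neg_one hodd
      rw [ZMod.χ₄_nat_three_mod_four (by
        have : t = 7 ∨ t = 3 := by rw [ht]; split_ifs <;> simp
        omega)] at h4
      simp only [Nat.cast_one, jacobiSym.one_left, mul_one]
      rw [h2]
      rcases hσ with rfl | rfl <;> rcases he with rfl | rfl
      · exfalso; apply hns rfl; rw [ham, hm1]; norm_num
      · rw [jacobiSym.one_left, ht]; norm_num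
      · rw [h4]; norm_num
      · rw [h4, ht]; norm_num
  · obtain ⟨p, hp, hpm⟩ := Nat.exists_prime_and_dvd hm1
    have : Fact p.Prime := ⟨hp⟩
    obtain ⟨m', hm'⟩ := hpm
    have hp2 : p ≠ 2 := by
      rintro rfl; exact hm2 ⟨m', hm'⟩
    have hpm' : ¬ p ∣ m' := by
      intro h
      have : p * p ∣ a := by
        rw [ham, hm']
        exact (mul_dvd_mul_left p h).mul_left _
      have := Nat.isUnit_iff.mp (ha p this)
      exact hp.ne_one this
    obtain ⟨k, b0, hbk, hbp⟩ := split_pow p hp hb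
    obtain ⟨r, hr⟩ := FiniteField.exists_nonsquare (F := ZMod p) (by rwa [ZMod.ringChar_zmod_n])
    have hcop : Coprime (8 * (b0 * m')) p := by
      apply Nat.Coprime.symm
      rw [Nat.Prime.coprime_iff_not_dvd hp, hp.dvd_mul, hp.dvd_mul]
      push Not
      refine ⟨?_, hbp, hpm'⟩
      intro h
      rw [show 8 = 2 ^ 3 by norm_num] at h
      exact hp2 ((prime_dvd_prime_iff_eq hp prime_two).mp (hp.dvd_of_dvd_pow h))
    obtain ⟨n, hn1, hnp⟩ := Nat.chineseRemainder hcop 1 r.val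
    have hn8 : n % 8 = 1 := by
      have : n % 8 = 1 % 8 := hn1.of_mul_right (b0 * m')
      exact this
    have hnb0 : n ≡ 1 [MOD b0] := (hn1.of_mul_left 8).of_mul_right m'
    have hnm' : n ≡ 1 [MOD m'] := (hn1.of_mul_left 8).of_mul_left b0
    have hodd : Odd n := by rw [Nat.odd_iff]; omega
    have hc2 : Coprime n 2 := (Nat.coprime_two_right).mpr hodd
    have hcm' : Coprime n m' := by rw [coprime_iff_gcd_eq_one, hnm'.gcd_eq]; simp
    have hcb0 : Coprime n b0 := by rw [coprime_iff_gcd_eq_one, hnb0.gcd_eq]; simp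
    have hJp : jacobiSym n p = -1 := by
      rw [← jacobiSym.legendreSym.to_jacobiSym, legendreSym.eq_neg_one_iff]
      have : ((n : ℤ) : ZMod p) = r := by
        have := (ZMod.natCast_eq_natCast_iff _ _ _).mpr hnp
        push_cast
        rw [this, ZMod.natCast_zmod_val]
      rwa [this]
    have hcp : Coprime n p := by
      apply Nat.Coprime.symm
      rw [Nat.Prime.coprime_iff_not_dvd hp]
      intro h
      have : jacobiSym n p = 0 := by
        rw [jacobiSym.eq_zero_iff]
        refine ⟨hp.ne_zero, ?_⟩
        rw [Int.gcd_natCast_natCast, Nat.gcd_eq_right h]; exact hp.ne_one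
      rw [hJp] at this; norm_num at this
    have hcb : Coprime n b := by rw [hbk]; exact Nat.Coprime.mul_right (Nat.Coprime.pow_right _ hcp) hcb0
    refine ⟨n, hodd, ?_, ?_⟩
    · refine Nat.Coprime.mul_right (Nat.Coprime.pow_right _ hcb) ?_
      rw [ham, hm']
      exact Nat.Coprime.mul_right (Nat.Coprime.pow_right _ hc2) (Nat.Coprime.mul_right hcp hcm')
    · rw [hform n hcb]
      have h2 := jacobiSym.at_two hodd
      rw [ZMod.χ₈_nat_eq_if_mod_eight, hn8, Nat.odd_iff.mp hodd] at h2
      have h4 := jacobiSym.at_neg_one hodd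
      rw [ZMod.χ₄_nat_one_mod_four (by omega)] at h4
      have hs : jacobiSym σ n = 1 := by
        rcases hσ with rfl | rfl
        · exact jacobiSym.one_left _
        · exact h4
      have hm0 : m' ≠ 0 := by rintro rfl; simp at hpm'
      rw [hs, h2, ← jacobiSym.quadratic_reciprocity_one_mod_four (by omega) hmo, hm', jacobiSym.mul_right' _ hp.ne_zero hm0, hJp]
      have : jacobiSym n m' = 1 := by
        have h : ((n : ℕ) : ℤ) % (m' : ℤ) = 1 % (m' : ℤ) := by exact_mod_cast hnm'
        rw [jacobiSym.mod_left' h, jacobiSym.one_left]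
      rw [this]; norm_num

/-- squarefree decomposition of `A` -/
lemma exists_sqfree_decomp (A : ℤ) (hA : A ≠ 0) : ∃ (σ : ℤ) (b s : ℕ), (σ = 1 ∨ σ = -1) ∧ b ≠ 0 ∧
    Squarefree s ∧ A = σ * (b ^ 2 * s : ℕ) ∧ A.natAbs = b ^ 2 * s := by
  obtain ⟨s, b, h1, h2, h3, h4⟩ := Nat.sq_mul_squarefree_of_pos (Int.natAbs_pos.mpr hA)
  refine ⟨A.sign, b, s, ?_, h2.ne', h4, ?_, h3.symm⟩
  · rcases lt_or_gt_of_ne hA with h | h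
    · right; exact Int.sign_eq_neg_one_of_neg h
    · left; exact Int.sign_eq_one_of_pos h
  · rw [h3]; exact (Int.sign_mul_natAbs A).symm

lemma exists_jacobi_neg_one (A : ℤ) (hA : A ≠ 0) (hns : ¬ IsSquare A) : ∃ n : ℕ, Odd n ∧ Coprime n A.natAbs ∧ jacobiSym A n = -1 := by
  obtain ⟨σ, b, s, h1, h2, h3, h4, h5⟩ := exists_sqfree_decomp A hA
  have := exists_jacobi_neg_one_aux σ h1 b s h2 h3 (by
    rintro rfl rfl
    apply hns
    rw [h4]
    exact ⟨b, by push_cast; ring⟩)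
  rwa [← h4, ← h5] at this

/-- The values of the quadratic character. -/
def chv (A : ℤ) (n : ℕ) : ℂ := if Coprime n (4 * A.natAbs) then (jacobiSym A n : ℂ) else 0

lemma coprime_four_odd {A : ℤ} {n : ℕ} (h : Coprime n (4 * A.natAbs)) : Odd n := by
  have : Coprime n 2 := (h.coprime_mul_right_right).coprime_dvd_right (by norm_num)
  exact Nat.coprime_two_right.mp this

lemma chv_mod (A : ℤ) (n : ℕ) : chv A (n % (4 * A.natAbs)) = chv A n := by
  unfold chv
  have : Coprime (n % (4 * A.natAbs)) (4 * A.natAbs) ↔ Coprime n (4 * A.natAbs) := by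
    rw [coprime_iff_gcd_eq_one, coprime_iff_gcd_eq_one, (Nat.mod_modEq n _).gcd_eq]
  rw [if_congr this rfl rfl]
  split_ifs with h
  · rw [← jacobiSym.mod_right A (coprime_four_odd h)]
  · rfl

lemma chv_mul (A : ℤ) (m n : ℕ) : chv A (m * n) = chv A m * chv A n := by
  unfold chv
  by_cases h1 : Coprime m (4 * A.natAbs)
  · by_cases h2 : Coprime n (4 * A.natAbs)
    · have hm := (coprime_four_odd h1).pos.ne'
      have hn := (coprime_four_odd h2).pos.ne'
      rw [if_pos h1, if_pos h2, if_pos (Nat.Coprime.mul_left h1 h2), jacobiSym.mul_right' _ hm hn]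
      push_cast; rfl
    · rw [if_neg h2, mul_zero, if_neg]
      exact fun h => h2 (h.coprime_mul_left)
  · rw [if_neg h1, zero_mul, if_neg]
    exact fun h => h1 (h.coprime_mul_right)

lemma norm_chv_le (A : ℤ) (n : ℕ) : ‖chv A n‖ ≤ 1 := by
  unfold chv
  split_ifs
  · rcases jacobiSym.trichotomy A n with h | h | h <;> rw [h] <;> simp
  · simp

/-- The Dirichlet character. -/
def chA (A : ℤ) (hA : A ≠ 0) : DirichletCharacter ℂ (4 * A.natAbs) where
  toFun z := chv A z.val
  map_one' := by
    have : Fact (1 < 4 * A.natAbs) := ⟨by have := Int.natAbs_pos.mpr hA; omega⟩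
    rw [ZMod.val_one]
    simp [chv]
  map_mul' x y := by rw [ZMod.val_mul, chv_mod, chv_mul]
  map_nonunit' z hz := by
    have : NeZero (4 * A.natAbs) := ⟨by have := Int.natAbs_pos.mpr hA; omega⟩
    rw [chv, if_neg]
    intro h
    apply hz
    have := (ZMod.isUnit_iff_coprime z.val (4 * A.natAbs)).mpr h
    rwa [ZMod.natCast_zmod_val] at this

lemma chA_apply (A : ℤ) (hA : A ≠ 0) (n : ℕ) : chA A hA (n : ZMod (4 * A.natAbs)) = chv A n := by
  change chv A ((n : ZMod (4 * A.natAbs)).val) = _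
  rw [ZMod.val_natCast, chv_mod]

lemma chA_ne_one (A : ℤ) (hA : A ≠ 0) (hns : ¬ IsSquare A) : chA A hA ≠ 1 := by
  obtain ⟨n, h1, h2, h3⟩ := exists_jacobi_neg_one A hA hns
  intro h
  have hc : Coprime n (4 * A.natAbs) := by
    refine Nat.Coprime.mul_right ?_ h2
    rw [show 4 = 2 ^ 2 by norm_num]
    exact Nat.Coprime.pow_right _ (Nat.coprime_two_right.mpr h1)
  have e := chA_apply A hA n
  rw [h, chv, if_pos hc, h3, MulChar.one_apply ((ZMod.isUnit_iff_coprime n _).mpr hc)] at e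
  norm_num at e

lemma chA_conductor (A : ℤ) (hA : A ≠ 0) {σ : ℤ} {b s : ℕ} (hσ : σ = 1 ∨ σ = -1)
    (hAs : A = σ * (b ^ 2 * s : ℕ)) (hn : A.natAbs = b ^ 2 * s) :
    (chA A hA).conductor ∣ 4 * s := by
  have hApos := Int.natAbs_pos.mpr hA
  have : NeZero (4 * A.natAbs) := ⟨by omega⟩
  apply DirichletCharacter.conductor_dvd_of_mem_conductorSet
  have hd : 4 * s ∣ 4 * A.natAbs := by rw [hn]; exact ⟨b ^ 2, by ring⟩
  rw [DirichletCharacter.mem_conductorSet_iff, DirichletCharacter.factorsThrough_iff_ker_unitsMap hd]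
  intro u hu
  rw [MonoidHom.mem_ker] at hu ⊢
  have hcop : Coprime (u : ZMod (4 * A.natAbs)).val (4 * A.natAbs) := ZMod.val_coe_unit_coprime u
  set n := (u : ZMod (4 * A.natAbs)).val with hndef
  have hun : (u : ZMod (4 * A.natAbs)) = (n : ZMod (4 * A.natAbs)) := (ZMod.natCast_zmod_val _).symm
  rw [← Units.val_inj, MulChar.coe_toUnitHom, hun, chA_apply, chv, if_pos hcop]
  have h1 : ((n : ℕ) : ZMod (4 * s)) = ((1 : ℕ) : ZMod (4 * s)) := by
    have := congrArg Units.val hu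
    rw [ZMod.unitsMap_def, Units.coe_map, hun] at this
    simpa using this
  have h2 : n % (4 * s) = 1 % (4 * s) := (ZMod.natCast_eq_natCast_iff _ _ _).mp h1
  have hodd := coprime_four_odd hcop
  have hss : jacobiSym (σ * s) n = 1 := by
    have hns : (σ * (s : ℤ)).natAbs = s := by rcases hσ with rfl | rfl <;> simp
    have h3 := jacobiSym.mod_right (σ * (s : ℤ)) odd_one
    rw [hns, jacobiSym.one_right] at h3
    rw [jacobiSym.mod_right _ hodd, hns, h2]
    exact h3.symm
  have : jacobiSym A n = 1 := by
    rw [hAs]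
    push_cast
    rw [show σ * ((b : ℤ) ^ 2 * s) = (b : ℤ) ^ 2 * (σ * s) by ring, jacobiSym.mul_left, hss, mul_one]
    apply jacobiSym.sq_one'
    rw [Int.gcd_natCast_natCast]
    have : Coprime n (b ^ 2 * s) := hn ▸ hcop.coprime_mul_left_right
    exact (this.coprime_mul_right_right.coprime_dvd_right (dvd_pow_self b two_ne_zero)).symm
  rw [this]; simp


/-! ### B4: character sums -/

lemma sum_divisors_swap {E : Type*} [AddCommMonoid E] (y : ℕ) (F : ℕ → ℕ → E) : ∑ n ∈ Icc 1 y, ∑ d ∈ n.divisors, F d (n / d) =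
      ∑ d ∈ Icc 1 y, ∑ m ∈ Icc 1 (y / d), F d m := by
  rw [sum_sigma', sum_sigma']
  refine sum_bij' (fun s _ => ⟨s.2, s.1 / s.2⟩) (fun s _ => ⟨s.1 * s.2, s.1⟩) ?_ ?_ ?_ ?_ ?_
  · rintro ⟨n, d⟩ h
    simp only [mem_sigma, mem_Icc, mem_divisors] at h ⊢
    obtain ⟨⟨h1, h2⟩, h3, h4⟩ := h
    have hd := Nat.pos_of_dvd_of_pos h3 h1
    have hle := le_of_dvd h1 h3
    exact ⟨⟨hd, by omega⟩, Nat.div_pos hle hd, Nat.div_le_div_right h2⟩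
  · rintro ⟨d, m⟩ h
    simp only [mem_sigma, mem_Icc, mem_divisors] at h ⊢
    obtain ⟨⟨h1, h2⟩, h3, h4⟩ := h
    refine ⟨⟨Nat.mul_pos h1 h3, ?_⟩, Dvd.intro _ rfl, (Nat.mul_pos h1 h3).ne'⟩
    rw [mul_comm]; exact (Nat.le_div_iff_mul_le h1).mp h4
  · rintro ⟨n, d⟩ h
    simp only [mem_sigma, mem_Icc, mem_divisors] at h ⊢
    rw [Nat.mul_div_cancel' h.2.1]
  · rintro ⟨d, m⟩ h
    simp only [mem_sigma, mem_Icc, mem_divisors] at h ⊢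
    rw [Nat.mul_div_cancel_left _ (by omega)]
  · rintro ⟨n, d⟩ h
    rfl

lemma sum_moebius_divisors (n : ℕ) (hn : n ≠ 0) : ∑ d ∈ n.divisors, (moebius d : ℂ) = if n = 1 then 1 else 0 := by
  have h := ArithmeticFunction.coe_mul_zeta_apply (f := ((moebius : ArithmeticFunction ℤ) : ArithmeticFunction ℂ)) (x := n)
  rw [ArithmeticFunction.coe_moebius_mul_coe_zeta, ArithmeticFunction.one_apply] at h
  rw [h]
  rfl

lemma norm_moebius_le (d : ℕ) : ‖(moebius d : ℂ)‖ ≤ 1 := by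
  rcases ArithmeticFunction.moebius_eq_or d with h | h | h <;> rw [h] <;> simp

lemma chv_sum_le {A : ℤ} (hA : A ≠ 0) (hns : ¬ IsSquare A) {σ : ℤ} {b s : ℕ} (hσ : σ = 1 ∨ σ = -1)
    (hAs : A = σ * (b ^ 2 * s : ℕ)) (hn : A.natAbs = b ^ 2 * s) (y : ℕ) :
    ‖∑ n ∈ Icc 1 y, chv A n‖ ≤ (4 * A.natAbs).divisors.card * (sqrt (4 * s) * (1 + log (4 * s))) := by
  have hApos := Int.natAbs_pos.mpr hA
  set N := 4 * A.natAbs with hN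
  have hN0 : N ≠ 0 := by omega
  have : NeZero N := ⟨hN0⟩
  set f := (chA A hA).conductor with hf
  have hf0 : f ≠ 0 := DirichletCharacter.conductor_ne_zero _
  have : NeZero f := ⟨hf0⟩
  have hf1 : f ≠ 1 := fun h => chA_ne_one A hA hns
    (DirichletCharacter.eq_one_iff_conductor_eq_one.mpr h)
  have hfs : f ∣ 4 * s := chA_conductor A hA hσ hAs hn
  have hs0 : s ≠ 0 := by rintro rfl; simp at hn; omega
  have hfle : f ≤ 4 * s := le_of_dvd (by omega) hfs
  set ψ := (chA A hA).primitiveCharacter with hψ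
  have hprim : ψ.IsPrimitive := DirichletCharacter.primitiveCharacter_isPrimitive _
  have hψ0 : ψ ((0 : ℕ) : ZMod f) = 0 := by rw [Nat.cast_zero]; exact DirichletCharacter.map_zero' _ hf1
  have hPV : ∀ z : ℕ, ‖∑ m ∈ Icc 1 z, ψ (m : ZMod f)‖ ≤ sqrt (4 * s) * (1 + log (4 * s)) := by
    intro z
    have e : ∑ m ∈ Icc 1 z, ψ (m : ZMod f) = ∑ m ∈ range (z + 1), ψ (m : ZMod f) := by
      rw [sum_range_succ', hψ0, add_zero, range_eq_Ico, sum_Ico_add' (fun k => ψ ((k : ℕ) : ZMod f)) 0 z 1]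
      rfl
    rw [e]
    refine (polya_primitive hf1 hprim _).trans ?_
    have h1 : (f : ℝ) ≤ 4 * s := by exact_mod_cast hfle
    have h2 : (0 : ℝ) < f := by exact_mod_cast Nat.pos_of_ne_zero hf0
    have h3 : (1 : ℝ) ≤ f := by exact_mod_cast Nat.pos_of_ne_zero hf0
    have := log_nonneg h3
    have h4 : log f ≤ log (4 * s) := log_le_log h2 h1
    apply mul_le_mul (sqrt_le_sqrt h1) (by linarith) (by linarith) (sqrt_nonneg _)
  have hval : ∀ n ∈ Icc 1 y, chv A n = ∑ d ∈ n.divisors,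
      (fun d m : ℕ => if d ∣ N then (moebius d : ℂ) * ψ (d : ZMod f) * ψ (m : ZMod f) else 0)
        d (n / d) := by
    intro n hn1
    have hn0 : n ≠ 0 := by have := (mem_Icc.mp hn1).1; omega
    have h1 : ∑ d ∈ n.divisors, (if d ∣ N then
        (moebius d : ℂ) * ψ (d : ZMod f) * ψ ((n / d : ℕ) : ZMod f) else 0) =
        ψ (n : ZMod f) * ∑ d ∈ (Nat.gcd n N).divisors, (moebius d : ℂ) := by
      rw [← sum_filter, mul_sum]
      refine sum_congr ?_ ?_
      · ext d
        simp only [mem_filter, mem_divisors, Nat.dvd_gcd_iff]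
        have : Nat.gcd n N ≠ 0 := Nat.gcd_ne_zero_left hn0
        tauto
      · intro d hd
        have hdn : d ∣ n := (Nat.dvd_gcd_iff.mp (dvd_of_mem_divisors hd)).1
        rw [mul_assoc, ← map_mul, ← Nat.cast_mul, Nat.mul_div_cancel' hdn, mul_comm]
    change chv A n = ∑ d ∈ n.divisors, (if d ∣ N then
        (moebius d : ℂ) * ψ (d : ZMod f) * ψ ((n / d : ℕ) : ZMod f) else 0)
    rw [h1, sum_moebius_divisors _ (Nat.gcd_ne_zero_left hn0)]
    by_cases hc : Nat.gcd n N = 1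
    · rw [if_pos hc, mul_one, ← chA_apply A hA]
      have := DirichletCharacter.primitiveCharacter_apply_of_isCoprime (chA A hA) (a := (n : ℤ))
        (by rw [Int.isCoprime_iff_gcd_eq_one, Int.gcd_natCast_natCast]; exact hc)
      rw [Int.cast_natCast, Int.cast_natCast] at this
      exact this.symm
    · rw [if_neg hc, mul_zero, chv, if_neg hc]
  rw [sum_congr rfl hval, sum_divisors_swap y (fun d m : ℕ => if d ∣ N then (moebius d : ℂ) * ψ (d : ZMod f) * ψ (m : ZMod f) else 0)]
  refine (norm_sum_le _ _).trans ?_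
  have hpos : 0 ≤ sqrt (4 * s) * (1 + log (4 * s)) := (norm_nonneg _).trans (hPV 0)
  calc ∑ d ∈ Icc 1 y, ‖∑ m ∈ Icc 1 (y / d), (if d ∣ N then
          (moebius d : ℂ) * ψ (d : ZMod f) * ψ (m : ZMod f) else 0)‖
      ≤ ∑ d ∈ Icc 1 y, if d ∣ N then sqrt (4 * s) * (1 + log (4 * s)) else 0 := by
        apply sum_le_sum
        intro d _
        split_ifs with h
        · rw [← mul_sum, norm_mul, norm_mul]
          have h1 := norm_moebius_le d
          have h2 := DirichletCharacter.norm_le_one ψ (d : ZMod f)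
          calc _ ≤ 1 * 1 * (sqrt (4 * s) * (1 + log (4 * s))) := by
                gcongr
                exact hPV _
            _ = _ := by ring
        · simp
    _ = ∑ d ∈ (Icc 1 y).filter (· ∣ N), sqrt (4 * s) * (1 + log (4 * s)) := by rw [sum_filter]
    _ ≤ ∑ d ∈ N.divisors, sqrt (4 * s) * (1 + log (4 * s)) := by
        apply sum_le_sum_of_subset_of_nonneg
        · intro d hd
          exact Nat.mem_divisors.mpr ⟨(mem_filter.mp hd).2, hN0⟩
        · intros; exact hpos
    _ = _ := by rw [sum_const, nsmul_eq_mul]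

lemma totient_div_eq (n : ℕ) (hn : n ≠ 0) : ((totient n : ℕ) : ℂ) / n = ∑ d ∈ n.divisors, (moebius d : ℂ) / d := by
  have h := (ArithmeticFunction.sum_eq_iff_sum_mul_moebius_eq (R := ℂ) (f := fun n => (totient n : ℂ))
    (g := fun n => (n : ℂ))).mp (by
      intro m _
      have := Nat.sum_totient m
      exact_mod_cast this) n (Nat.pos_of_ne_zero hn)
  rw [← h, sum_div, Nat.sum_divisorsAntidiagonal (fun i j => (moebius i : ℂ) * (j : ℂ) / n)]
  apply sum_congr rfl
  intro d hd
  have hdn := dvd_of_mem_divisors hd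
  have hd0 : d ≠ 0 := fun h => by rw [h] at hdn; exact hn (Nat.eq_zero_of_zero_dvd hdn)
  have hd0' : (d : ℂ) ≠ 0 := by exact_mod_cast hd0
  have hn0' : (n : ℂ) ≠ 0 := by exact_mod_cast hn
  rw [Nat.cast_div hdn hd0']
  field_simp

lemma chv_phi_sum_le {A : ℤ} {U : ℝ} (hU : ∀ y : ℕ, ‖∑ n ∈ Icc 1 y, chv A n‖ ≤ U) (y : ℕ) :
    ‖∑ n ∈ Icc 1 y, chv A n * ((totient n : ℕ) : ℂ) / n‖ ≤ (1 + log y) * U := by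
  have e : ∀ n ∈ Icc 1 y, chv A n * ((totient n : ℕ) : ℂ) / n = ∑ d ∈ n.divisors,
      (fun d m : ℕ => (moebius d : ℂ) / d * chv A d * chv A m) d (n / d) := by
    intro n hn
    have hn0 : n ≠ 0 := by have := (mem_Icc.mp hn).1; omega
    rw [mul_div_assoc, totient_div_eq n hn0, mul_sum]
    apply sum_congr rfl
    intro d hd
    change _ = (moebius d : ℂ) / d * chv A d * chv A (n / d)
    rw [mul_assoc, ← chv_mul, Nat.mul_div_cancel' (dvd_of_mem_divisors hd), mul_comm]
  have hU0 : 0 ≤ U := (norm_nonneg _).trans (hU 0)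
  rw [sum_congr rfl e, sum_divisors_swap y (fun d m : ℕ => (moebius d : ℂ) / d * chv A d * chv A m)]
  refine (norm_sum_le _ _).trans ?_
  calc ∑ d ∈ Icc 1 y, ‖∑ m ∈ Icc 1 (y / d), (moebius d : ℂ) / d * chv A d * chv A m‖
      ≤ ∑ d ∈ Finset.Icc 1 y, 1 / (d : ℝ) * U := by
        apply sum_le_sum
        intro d _
        rw [← Finset.mul_sum, norm_mul, norm_mul, norm_div, Complex.norm_natCast]
        have h1 := norm_moebius_le d
        have h2 := norm_chv_le A d
        calc _ ≤ 1 / (d : ℝ) * 1 * U := by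
              gcongr
              exact hU _
          _ = _ := by ring
    _ = (∑ d ∈ range y, 1 / ((d : ℝ) + 1)) * U := by
        rw [sum_mul, range_eq_Ico]
        rw [show Icc 1 y = Ico (0 + 1) (y + 1) from rfl, ← sum_Ico_add' (fun d : ℕ => 1 / (d : ℝ) * U)]
        push_cast; rfl
    _ ≤ (1 + log y) * U := by
        gcongr
        exact sum_inv_le_log y


/-! ### B5: Key proposition -/

lemma one_add_log_le {δ : ℝ} (hδ : 0 < δ) {t : ℝ} (ht : 1 ≤ t) : 1 + log t ≤ (1 + 1 / δ) * t ^ δ := by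
  have h1 := log_le_rpow_div (by linarith : 0 ≤ t) hδ
  have h2 : (1 : ℝ) ≤ t ^ δ := one_le_rpow ht hδ.le
  have : t ^ δ / δ = 1 / δ * t ^ δ := by ring
  nlinarith

lemma chv_eq_jacobi {A : ℤ} {n : ℕ} (hn : Odd n) : chv A n = (jacobiSym A n : ℂ) := by
  unfold chv
  split_ifs with h
  · rfl
  · have : jacobiSym A n = 0 := by
      rw [jacobiSym.eq_zero_iff]
      refine ⟨hn.pos.ne', fun hg => h ?_⟩
      refine Nat.Coprime.mul_right ?_ ?_
      · rw [show 4 = 2 ^ 2 by norm_num]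
        exact Nat.Coprime.pow_right _ (Nat.coprime_two_right.mpr hn)
      · rw [Nat.coprime_comm, coprime_iff_gcd_eq_one]
        rw [Int.gcd_eq_natAbs] at hg
        simpa using hg
    rw [this]; simp

lemma Sqa_part_sum (a c : ℤ⁴) (hF : dualForm a c = 0) {b s : ℕ} (hb : b ≠ 0) (hs : Squarefree s)
    (hn : (∏ i, a i).natAbs = b ^ 2 * s) (y : ℕ) :
    ∑ r ∈ (Icc 1 y).filter (fun r => Coprime r (2 * b)), Sqa a c r / (r : ℂ) ^ 3 =
      ∑ n ∈ Icc 1 y, chv (∏ i, a i) n * ((totient n : ℕ) : ℂ) / n := by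
  rw [sum_filter]
  apply sum_congr rfl
  intro r hr
  have hr0 : r ≠ 0 := by have := (mem_Icc.mp hr).1; omega
  have hr0' : (r : ℂ) ≠ 0 := by exact_mod_cast hr0
  split_ifs with h
  · have hodd : Odd r := Nat.coprime_two_right.mp h.coprime_mul_right_right
    rw [chv_eq_jacobi hodd, Sqa_eval a c hF r hr0]
    · field_simp
    · intro p hp hpr
      have hpc : Coprime p (2 * b) := h.coprime_dvd_left hpr
      refine ⟨?_, ?_⟩
      · rintro rfl
        have := Nat.coprime_two_right.mp hpc.coprime_mul_right_right
        exact absurd this (by decide)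
      · intro hd
        have h1 : p ^ 2 ∣ b ^ 2 * s := by
          rw [← hn];
          have := Int.natAbs_dvd_natAbs.mpr hd
          rwa [Int.natAbs_pow, Int.natAbs_natCast] at this
        have h2 : Coprime (p ^ 2) (b ^ 2) := Nat.Coprime.pow 2 2 hpc.coprime_mul_left_right
        have h3 : p ^ 2 ∣ s := h2.dvd_of_dvd_mul_left h1
        have := Nat.isUnit_iff.mp (hs p (by rwa [← sq]))
        exact hp.ne_one this
  · have : chv (∏ i, a i) r = 0 := by
      rw [chv, if_neg]
      intro h'
      apply h
      rw [hn] at h'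
      refine Nat.Coprime.mul_right ?_ ?_
      · exact h'.coprime_mul_right_right.coprime_dvd_right (by norm_num)
      · exact h'.coprime_mul_left_right.coprime_mul_right_right.coprime_dvd_right (dvd_pow_self b two_ne_zero)
    rw [this]; simp

lemma gcd_prod_dvd (b s P : ℕ) (hb : b ≠ 0) (hs : Squarefree s) (hP : P ∣ b ^ 2 * s)
    (hsm : ∀ p, p.Prime → p ∣ P → p ∣ 2 * b) : (P * s) ^ 3 ∣ 4 * (b ^ 2 * s) ^ 4 := by
  have hs0 := hs.ne_zero
  have hA0 : b ^ 2 * s ≠ 0 := by positivity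
  have hP0 : P ≠ 0 := fun h => hA0 (Nat.eq_zero_of_zero_dvd (h ▸ hP))
  have h4 : (4 : ℕ) = 2 ^ 2 := by norm_num
  rw [← Nat.factorization_prime_le_iff_dvd (by positivity) (by positivity)]
  intro p hp
  rw [factorization_pow, Nat.factorization_mul hP0 hs0, Nat.factorization_mul (by norm_num) (by positivity),
    factorization_pow (b ^ 2 * s), Nat.factorization_mul (by positivity) hs0, factorization_pow b, h4,
    factorization_pow 2]
  simp only [Finsupp.smul_apply, Finsupp.add_apply, smul_eq_mul]
  have hvP : P.factorization p ≤ 2 * b.factorization p + s.factorization p := by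
    have := (Nat.factorization_prime_le_iff_dvd hP0 hA0).mpr hP p hp
    rwa [Nat.factorization_mul (by positivity) hs0, factorization_pow b] at this
  have hvs : s.factorization p ≤ 1 := hs.natFactorization_le_one p
  by_cases hpb : p ∣ b
  · have : 0 < b.factorization p := hp.factorization_pos_of_dvd hb hpb
    omega
  · by_cases hp2 : p = 2
    · subst hp2
      have : (Nat.factorization 2) 2 = 1 := by simp [Nat.prime_two.factorization]
      omega
    · have : P.factorization p = 0 := by
        apply Nat.factorization_eq_zero_of_not_dvd
        intro h
        rcases hp.dvd_mul.mp (hsm p hp h) with h | h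
        · exact hp2 ((prime_dvd_prime_iff_eq hp prime_two).mp h)
        · exact hpb h
      omega

lemma omg_le (a c : ℤ⁴) (q : ℕ) : omg a c q ≤ sqrt ((∏ i, Int.gcd (a i) q : ℕ) : ℝ) := by
  have h : sqrt ((∏ i, Int.gcd (a i) q : ℕ) : ℝ) = ∏ i, sqrt (Int.gcd (a i) q : ℝ) := by
    push_cast
    rw [Fin.prod_univ_four, Fin.prod_univ_four, sqrt_mul (by positivity), sqrt_mul (by positivity), sqrt_mul (by positivity)]
  rw [h]
  unfold omg
  apply Finset.prod_le_prod
  · intro i _; split_ifs <;> positivity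
  · intro i _; split_ifs
    · exact le_rfl
    · positivity

lemma key_aux (b s P : ℕ) (hb : b ≠ 0) (hs : Squarefree s) (hP : P ∣ b ^ 2 * s)
    (hsm : ∀ p, p.Prime → p ∣ P → p ∣ 2 * b) :
    sqrt P * sqrt s ≤ 2 * ((b ^ 2 * s : ℕ) : ℝ) ^ ((2 : ℝ) / 3) := by
  have h := le_of_dvd (by have := hs.ne_zero; positivity) (gcd_prod_dvd b s P hb hs hP hsm)
  have h' : ((P : ℝ) * s) ^ 3 ≤ 4 * ((b ^ 2 * s : ℕ) : ℝ) ^ 4 := by exact_mod_cast h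
  set n : ℝ := ((b ^ 2 * s : ℕ) : ℝ) with hn
  have hn0 : 0 ≤ n := by positivity
  rw [← sqrt_mul (by positivity)]
  apply sqrt_le_iff.mpr
  refine ⟨by positivity, ?_⟩
  have : (n ^ ((2 : ℝ) / 3)) ^ 6 = n ^ 4 := by rw [← rpow_natCast, ← rpow_mul hn0, ← rpow_natCast]; norm_num
  refine le_of_pow_le_pow_left₀ (n := 3) (by norm_num) (by positivity) ?_
  calc ((P : ℝ) * s) ^ 3 ≤ 4 * n ^ 4 := h'
    _ ≤ 64 * n ^ 4 := by nlinarith [pow_nonneg hn0 4]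
    _ = ((2 * n ^ ((2 : ℝ) / 3)) ^ 2) ^ 3 := by rw [← this]; ring

lemma gcd_prod_dvd_prod (a : ℤ⁴) (q : ℕ) : (∏ i, Int.gcd (a i) q) ∣ (∏ i, a i).natAbs := by
  rw [show (∏ i, a i).natAbs = ∏ i, (a i).natAbs from map_prod Int.natAbsHom a univ]
  apply prod_dvd_prod_of_dvd
  intro i _
  exact Int.natAbs_dvd_natAbs.mpr (Int.gcd_dvd_left (a := a i) (b := q))

theorem key_prop {δ : ℝ} (hδ : 0 < δ) : ∃ C : ℝ, 1 ≤ C ∧ ∀ (a : ℤ⁴), (∀ i, a i ≠ 0) → ¬ IsSquare (∏ i, a i) → ∀ c, dualForm a c = 0 → ∀ x : ℕ, 1 ≤ x →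
    ‖∑ q ∈ Icc 1 x, Sqa a c q / (q : ℂ) ^ 3‖ ≤ C * (x : ℝ) ^ δ * absProd a ^ (2 / 3 + δ) := by
  set d := δ / 3 with hd
  have hd0 : 0 < d := by positivity
  obtain ⟨C1, hC1, h1⟩ := smooth_sum hd0 hd0
  obtain ⟨C2, hC2, h2⟩ := tau_bound hd0
  have hL : 1 ≤ 1 + 1 / d := by have : 0 < 1 / d := by positivity
                                linarith
  have h32 : (1 : ℝ) ≤ (2 : ℝ) ^ d * 4 ^ d * 4 ^ d := by
    have h2 : (1 : ℝ) ≤ (2 : ℝ) ^ d := one_le_rpow (by norm_num) hd0.le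
    have h4 : (1 : ℝ) ≤ (4 : ℝ) ^ d := one_le_rpow (by norm_num) hd0.le
    exact one_le_mul_of_one_le_of_one_le (one_le_mul_of_one_le_of_one_le h2 h4) h4
  refine ⟨16 * (C1 * C2 * ((1 + 1 / d) * (1 + 1 / d)) * ((2 : ℝ) ^ d * 4 ^ d * 4 ^ d)), ?_, ?_⟩
  · have := one_le_mul_of_one_le_of_one_le (one_le_mul_of_one_le_of_one_le
      (one_le_mul_of_one_le_of_one_le hC1 hC2) (one_le_mul_of_one_le_of_one_le hL hL)) h32
    linarith
  intro a ha hns c hF x hx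
  have hA : (∏ i, a i) ≠ 0 := prod_ne_zero_iff.mpr fun i _ => ha i
  obtain ⟨σ, b, s, hσ, hb, hs, hAs, hn⟩ := exists_sqfree_decomp _ hA
  have hs0 := hs.ne_zero
  have hM : 2 * b ≠ 0 := by positivity
  set n := (∏ i, a i).natAbs with hndef
  have hn1 : 1 ≤ n := Int.natAbs_pos.mpr hA
  have hx1 : (1 : ℝ) ≤ x := by exact_mod_cast hx
  have hnR : (1 : ℝ) ≤ n := by exact_mod_cast hn1
  set U : ℝ := (4 * n).divisors.card * (sqrt (4 * s) * (1 + log (4 * s))) with hU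
  have hsR : (1 : ℝ) ≤ s := by exact_mod_cast Nat.one_le_iff_ne_zero.mpr hs0
  have hlog4s : 0 ≤ log (4 * s) := log_nonneg (by linarith)
  have hU0 : 0 ≤ U := by positivity
  have hsn : (s : ℝ) ≤ n := by
    have : s ≤ n := by rw [hn]; exact Nat.le_mul_of_pos_left _ (by positivity)
    exact_mod_cast this
  have hbn : (b : ℝ) ≤ n := by
    have : b ≤ n := by rw [hn]; exact (Nat.le_self_pow two_ne_zero b).trans (Nat.le_mul_of_pos_right _ (by positivity))
    exact_mod_cast this
  have hlogx : 0 ≤ log x := log_nonneg hx1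
  rw [sum_split hM]
  have hterm : ∀ q ∈ (Icc 1 x).filter (fun q => smo (2 * b) q),
      ‖∑ r ∈ (Icc 1 (x / q)).filter (fun r => Coprime r (2 * b)), Sqa a c (r * q) / ((r * q : ℕ) : ℂ) ^ 3‖
      ≤ (16 * (n : ℝ) ^ ((2 : ℝ) / 3) * (1 + log x) * (4 * n).divisors.card * (1 + log (4 * s)) * (x : ℝ) ^ d) * (q : ℝ) ^ (-d) := by
    intro q hq
    obtain ⟨hq1, hsm⟩ := mem_filter.mp hq
    obtain ⟨hq1, hqx⟩ := mem_Icc.mp hq1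
    have hq0 : q ≠ 0 := by omega
    have hqR : (0 : ℝ) < q := by positivity
    have e1 : ∑ r ∈ (Icc 1 (x / q)).filter (fun r => Coprime r (2 * b)), Sqa a c (r * q) / ((r * q : ℕ) : ℂ) ^ 3 = Sqa a c q / (q : ℂ) ^ 3 *
        ∑ r ∈ (Icc 1 (x / q)).filter (fun r => Coprime r (2 * b)), Sqa a c r / (r : ℂ) ^ 3 := by
      rw [mul_sum]
      apply sum_congr rfl
      intro r hr
      obtain ⟨hr1, hrc⟩ := mem_filter.mp hr
      have hr0 : r ≠ 0 := by have := (mem_Icc.mp hr1).1; omega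
      rw [Sqa_mul hr0 hq0 (smo_coprime hsm hrc)]
      push_cast
      rw [mul_pow]
      field_simp
    rw [e1, Sqa_part_sum a c hF hb hs hn, norm_mul]
    have b1 := chv_phi_sum_le (A := ∏ i, a i) (U := U) (fun y => chv_sum_le hA hns hσ hAs hn y) (x / q)
    have b2 : ‖Sqa a c q / (q : ℂ) ^ 3‖ ≤ 4 * Real.sqrt ((∏ i, Int.gcd (a i) q : ℕ) : ℝ) := by
      rw [norm_div, norm_pow, Complex.norm_natCast, div_le_iff₀ (by positivity)]
      calc ‖Sqa a c q‖ ≤ 4 * (q : ℝ) ^ 3 * omg a c q := Sqa_bound hq0 a c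
        _ ≤ 4 * (q : ℝ) ^ 3 * Real.sqrt ((∏ i, Int.gcd (a i) q : ℕ) : ℝ) := by gcongr; exact omg_le a c q
        _ = _ := by ring
    have b3 := key_aux b s (∏ i, Int.gcd (a i) q) hb hs (hn ▸ gcd_prod_dvd_prod a q) (by
      intro p hp hpd
      obtain ⟨i, _, hi⟩ := (Nat.Prime.prime hp).exists_mem_finset_dvd hpd
      exact hsm.2 p hp (hi.trans (by exact_mod_cast Int.gcd_dvd_right (a := a i) (b := q))))
    rw [← hn] at b3
    have b4 : log ((x / q : ℕ) : ℝ) ≤ log x := by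
      apply log_le_log
      · have := Nat.div_pos hqx (by omega : 0 < q)
        exact_mod_cast this
      · exact_mod_cast Nat.div_le_self x q
    have b5 : (1 : ℝ) ≤ (x : ℝ) ^ d * (q : ℝ) ^ (-d) := by
      rw [rpow_neg hqR.le, ← div_eq_mul_inv, le_div_iff₀ (by positivity), one_mul]
      exact rpow_le_rpow hqR.le (by exact_mod_cast hqx) hd0.le
    have b6 : sqrt (4 * s) = 2 * sqrt s := by rw [sqrt_mul (by norm_num), show (4 : ℝ) = 2 ^ 2 by norm_num, sqrt_sq (by norm_num)]
    set P := sqrt ((∏ i, Int.gcd (a i) q : ℕ) : ℝ) with hP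
    calc _ ≤ (4 * P) * ((1 + log ((x / q : ℕ) : ℝ)) * U) := by
          apply mul_le_mul b2 b1 (norm_nonneg _) (by positivity)
      _ ≤ (4 * P) * ((1 + log x) * U) := by gcongr
      _ = 8 * (P * sqrt s) * (1 + log x) * (4 * n).divisors.card * (1 + log (4 * s)) := by rw [hU, b6]; ring
      _ ≤ 8 * (2 * (n : ℝ) ^ ((2 : ℝ) / 3)) * (1 + log x) * (4 * n).divisors.card * (1 + log (4 * s)) := by gcongr
      _ = (16 * (n : ℝ) ^ ((2 : ℝ) / 3) * (1 + log x) * (4 * n).divisors.card * (1 + log (4 * s))) * 1 := by ring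
      _ ≤ (16 * (n : ℝ) ^ ((2 : ℝ) / 3) * (1 + log x) * (4 * n).divisors.card * (1 + log (4 * s))) * ((x : ℝ) ^ d * (q : ℝ) ^ (-d)) := by gcongr
      _ = _ := by ring
  have c1 := h1 (2 * b) hM ((Icc 1 x).filter (fun q => smo (2 * b) q)) (fun q hq => (mem_filter.mp hq).2)
  have c2 := h2 (4 * n) (by omega)
  push_cast at c1 c2
  have c3 := one_add_log_le hd0 hx1
  have c4 : 1 + log (4 * s) ≤ (1 + 1 / d) * (4 * n) ^ d := by
    refine (one_add_log_le hd0 (by linarith)).trans ?_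
    gcongr
  have c5 : (2 * (b : ℝ)) ^ d ≤ 2 ^ d * (n : ℝ) ^ d := by
    rw [← mul_rpow (by norm_num) (by positivity)]
    gcongr
  have c6 : (4 * (n : ℝ)) ^ d = 4 ^ d * (n : ℝ) ^ d := mul_rpow (by norm_num) (by positivity)
  rw [c6] at c2 c4
  calc _ ≤ _ := norm_sum_le _ _
    _ ≤ _ := sum_le_sum hterm
    _ = (16 * (n : ℝ) ^ ((2 : ℝ) / 3) * (1 + log x) * (4 * n).divisors.card * (1 + log (4 * s)) *
        (x : ℝ) ^ d) * ∑ q ∈ (Icc 1 x).filter (fun q => smo (2 * b) q), (q : ℝ) ^ (-d) := by rw [mul_sum]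
    _ ≤ (16 * (n : ℝ) ^ ((2 : ℝ) / 3) * ((1 + 1 / d) * (x : ℝ) ^ d) * (C2 * (4 ^ d * (n : ℝ) ^ d)) *
        ((1 + 1 / d) * (4 ^ d * (n : ℝ) ^ d)) * (x : ℝ) ^ d) * (C1 * (2 ^ d * (n : ℝ) ^ d)) := by
        have : ∑ q ∈ (Icc 1 x).filter (fun q => smo (2 * b) q), (q : ℝ) ^ (-d) ≤ (C1 * (2 ^ d * (n : ℝ) ^ d)) := c1.trans (by gcongr)
        gcongr
    _ = (16 * (C1 * C2 * ((1 + 1 / d) * (1 + 1 / d)) * ((2 : ℝ) ^ d * 4 ^ d * 4 ^ d))) * ((x : ℝ) ^ d * (x : ℝ) ^ d) *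
        ((n : ℝ) ^ ((2 : ℝ) / 3) * ((n : ℝ) ^ d * (n : ℝ) ^ d * (n : ℝ) ^ d)) := by ring
    _ ≤ _ := by
        have e1 : (x : ℝ) ^ d * (x : ℝ) ^ d ≤ (x : ℝ) ^ δ := by
          rw [← rpow_add (by linarith)]
          exact rpow_le_rpow_of_exponent_le hx1 (by rw [hd]; linarith)
        have e2 : (n : ℝ) ^ ((2 : ℝ) / 3) * ((n : ℝ) ^ d * (n : ℝ) ^ d * (n : ℝ) ^ d) = (n : ℝ) ^ (2 / 3 + δ) := by
          rw [← rpow_add (by linarith), ← rpow_add (by linarith), ← rpow_add (by linarith)]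
          congr 1; rw [hd]; ring
        rw [e2]
        gcongr


/-! ### B6: bound for the singular series -/

lemma abel_bound (f K : ℕ → ℂ) (X : ℕ) (hX : 1 ≤ X) : ‖∑ q ∈ Icc 1 X, f q * K q‖ ≤ ∑ q ∈ Ico 1 X, ‖∑ j ∈ Icc 1 q, f j‖ * ‖K q - K (q + 1)‖ +
        ‖∑ j ∈ Icc 1 X, f j‖ * ‖K X‖ := by
  have e : ∑ q ∈ Icc 1 X, f q * K q = ∑ q ∈ Ico 1 X, (∑ j ∈ Icc 1 q, f j) * (K q - K (q + 1)) + (∑ j ∈ Icc 1 X, f j) * K X := by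
    induction X, hX using Nat.le_induction with
    | base => simp
    | succ n hn ih =>
      rw [sum_Icc_succ_top (by omega), ih, sum_Ico_succ_top hn, sum_Icc_succ_top (by omega)]
      ring
  rw [e]
  refine (norm_add_le _ _).trans ?_
  rw [norm_mul]
  gcongr
  refine (norm_sum_le _ _).trans (le_of_eq ?_)
  simp only [norm_mul]

lemma gcd_prod_le_Delta (a : ℤ⁴) (ha : ∀ i, a i ≠ 0) (q : ℕ) (hq : q ≠ 0) : (∏ i, Int.gcd (a i) q) ^ 2 ≤ q ^ 4 * Delta4 a := by
  have hpair : ∀ i j, Int.gcd (a i) q * Int.gcd (a j) q ≤ q * Nat.gcd (Int.gcd (a i) q) (Int.gcd (a j) q) := by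
    intro i j
    rw [← Nat.gcd_mul_lcm, mul_comm]
    apply Nat.mul_le_mul_right
    apply le_of_dvd (by omega)
    apply Nat.lcm_dvd
    · exact_mod_cast Int.gcd_dvd_right (a := a i) (b := q)
    · exact_mod_cast Int.gcd_dvd_right (a := a j) (b := q)
  have hD : ∀ i j, i ≠ j → Nat.gcd (Int.gcd (a i) q) (Int.gcd (a j) q) ≤ Int.gcd (a i) (∏ j ∈ univ.erase i, a j) := by
    intro i j hij
    apply le_of_dvd
    · exact Int.gcd_pos_of_ne_zero_left _ (ha i)
    · apply Int.dvd_gcd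
      · exact (Int.natCast_dvd_natCast.mpr (Nat.gcd_dvd_left _ _)).trans (Int.gcd_dvd_left (a i) q)
      · have h1 : a j ∣ ∏ j ∈ univ.erase i, a j := dvd_prod_of_mem a (mem_erase.mpr ⟨hij.symm, mem_univ _⟩)
        exact ((Int.natCast_dvd_natCast.mpr (Nat.gcd_dvd_right _ _)).trans (Int.gcd_dvd_left (a j) q)).trans h1
  unfold Delta4
  rw [Fin.prod_univ_four, Fin.prod_univ_four]
  have p1 := (hpair 0 1).trans (Nat.mul_le_mul_left q (hD 0 1 (by decide)))
  have p2 := (hpair 1 3).trans (Nat.mul_le_mul_left q (hD 1 3 (by decide)))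
  have p3 := (hpair 3 2).trans (Nat.mul_le_mul_left q (hD 3 2 (by decide)))
  have p4 := (hpair 2 0).trans (Nat.mul_le_mul_left q (hD 2 0 (by decide)))
  have := Nat.mul_le_mul (Nat.mul_le_mul p1 p2) (Nat.mul_le_mul p3 p4)
  nlinarith [this]

lemma Delta4_pos (a : ℤ⁴) (ha : ∀ i, a i ≠ 0) : 1 ≤ Delta4 a := prod_pos fun i _ => Int.gcd_pos_of_ne_zero_left _ (ha i)

lemma Delta4_le (a : ℤ⁴) (ha : ∀ i, a i ≠ 0) : Delta4 a ≤ (∏ i, a i).natAbs := by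
  rw [show (∏ i, a i).natAbs = ∏ i, (a i).natAbs from map_prod Int.natAbsHom a univ]
  unfold Delta4
  apply prod_le_prod'
  intro i _
  exact le_of_dvd (Int.natAbs_pos.mpr (ha i)) (Int.gcd_dvd_natAbs_left _ _)

lemma sqrt_gcd_le (a : ℤ⁴) (ha : ∀ i, a i ≠ 0) (q : ℕ) (hq : q ≠ 0) : sqrt ((∏ i, Int.gcd (a i) q : ℕ) : ℝ) ≤ q * (Delta4 a : ℝ) ^ ((1 : ℝ) / 4) := by
  have h : (((∏ i, Int.gcd (a i) q : ℕ) : ℝ)) ^ 2 ≤ (q : ℝ) ^ 4 * (Delta4 a : ℝ) := by exact_mod_cast gcd_prod_le_Delta a ha q hq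
  apply sqrt_le_iff.mpr
  refine ⟨by positivity, ?_⟩
  refine le_of_pow_le_pow_left₀ (n := 2) (by norm_num) (by positivity) (h.trans (le_of_eq ?_))
  have : ((Delta4 a : ℝ) ^ ((1 : ℝ) / 4)) ^ 4 = Delta4 a := by rw [← rpow_natCast, ← rpow_mul (by positivity)]; norm_num
  calc (q : ℝ) ^ 4 * (Delta4 a : ℝ) = (q : ℝ) ^ 4 * ((Delta4 a : ℝ) ^ ((1 : ℝ) / 4)) ^ 4 := by rw [this]
    _ = _ := by ring

lemma sum_rpow_le {p : ℝ} (hp : p < -1) : ∃ C : ℝ, 1 ≤ C ∧ ∀ S : Finset ℕ, ∑ q ∈ S, (q : ℝ) ^ p ≤ C := by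
  have hs : Summable fun n : ℕ => (n : ℝ) ^ p := summable_nat_rpow.mpr hp
  refine ⟨1 + ∑' n : ℕ, (n : ℝ) ^ p, ?_, ?_⟩
  · have : 0 ≤ ∑' n : ℕ, (n : ℝ) ^ p := tsum_nonneg fun n => by positivity
    linarith
  · intro S
    have := hs.sum_le_tsum S (fun n _ => by positivity)
    linarith

lemma sum_abs_S (δ : ℝ) (hδ : 0 < δ) : ∃ C : ℝ, 1 ≤ C ∧ ∀ (a : ℤ⁴), (∀ i, a i ≠ 0) → ∀ x : ℕ, 1 ≤ x → ∑ q ∈ Icc 1 x, ‖Sqa a 0 q / (q : ℂ) ^ 3‖ / q ≤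
      C * (x : ℝ) ^ (2 * δ) * absProd a ^ δ * (Delta4 a : ℝ) ^ ((1 : ℝ) / 4) := by
  obtain ⟨C1, hC1, h1⟩ := smooth_sum hδ hδ
  refine ⟨4 * (1 + 1 / δ) * C1, ?_, ?_⟩
  · have : 0 < 1 / δ := by positivity
    nlinarith
  intro a ha x hx
  have hA : (∏ i, a i) ≠ 0 := prod_ne_zero_iff.mpr fun i _ => ha i
  set n := (∏ i, a i).natAbs with hndef
  have hn0 : n ≠ 0 := Int.natAbs_ne_zero.mpr hA
  have hx1 : (1 : ℝ) ≤ x := by exact_mod_cast hx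
  have hlogx : 0 ≤ log x := log_nonneg hx1
  set D := (Delta4 a : ℝ) ^ ((1 : ℝ) / 4) with hD
  have hD0 : 0 ≤ D := by positivity
  rw [sum_split hn0]
  have hterm : ∀ q ∈ (Icc 1 x).filter (fun q => smo n q),
      ∑ r ∈ (Icc 1 (x / q)).filter (fun r => Coprime r n), ‖Sqa a 0 (r * q) / ((r * q : ℕ) : ℂ) ^ 3‖ / ((r * q : ℕ) : ℝ)
      ≤ (4 * D * (1 + log x) * (x : ℝ) ^ δ) * (q : ℝ) ^ (-δ) := by
    intro q hq
    obtain ⟨hq1, hsm⟩ := mem_filter.mp hq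
    obtain ⟨hq1, hqx⟩ := mem_Icc.mp hq1
    have hq0 : q ≠ 0 := by omega
    have hqR : (0 : ℝ) < q := by positivity
    have b5 : (1 : ℝ) ≤ (x : ℝ) ^ δ * (q : ℝ) ^ (-δ) := by
      rw [rpow_neg hqR.le, ← div_eq_mul_inv, le_div_iff₀ (by positivity), one_mul]
      exact rpow_le_rpow hqR.le (by exact_mod_cast hqx) hδ.le
    have hr : ∀ r ∈ (Icc 1 (x / q)).filter (fun r => Coprime r n),
        ‖Sqa a 0 (r * q) / ((r * q : ℕ) : ℂ) ^ 3‖ / ((r * q : ℕ) : ℝ) ≤ 4 * D * (1 / (r : ℝ)) := by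
      intro r hr
      obtain ⟨hr1, hrc⟩ := mem_filter.mp hr
      have hr0 : r ≠ 0 := by have := (mem_Icc.mp hr1).1; omega
      have hrR : (0 : ℝ) < r := by positivity
      have hrq : r * q ≠ 0 := mul_ne_zero hr0 hq0
      have e : ∀ i, Int.gcd (a i) ((r * q : ℕ) : ℤ) = Int.gcd (a i) q := by
        intro i
        rw [Int.gcd_eq_natAbs, Int.gcd_eq_natAbs, Int.natAbs_natCast, Int.natAbs_natCast]
        apply Nat.Coprime.gcd_mul_left_cancel_right
        refine hrc.coprime_dvd_right ?_
        exact Int.natAbs_dvd_natAbs.mpr (dvd_prod_of_mem a (mem_univ i))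
      have b1 : ‖Sqa a 0 (r * q) / ((r * q : ℕ) : ℂ) ^ 3‖ ≤ 4 * (q * D) := by
        rw [norm_div, norm_pow, Complex.norm_natCast, div_le_iff₀ (by positivity)]
        calc ‖Sqa a 0 (r * q)‖ ≤ 4 * ((r * q : ℕ) : ℝ) ^ 3 * omg a 0 (r * q) := Sqa_bound hrq a 0
          _ ≤ 4 * ((r * q : ℕ) : ℝ) ^ 3 * (q * D) := by
            gcongr
            refine (omg_le a 0 (r * q)).trans ?_
            simp only [e]
            exact sqrt_gcd_le a ha q hq0
          _ = _ := by ring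
      calc _ ≤ 4 * (q * D) / ((r * q : ℕ) : ℝ) := by gcongr
        _ = _ := by push_cast; field_simp
    have hlogs : ∑ r ∈ (Icc 1 (x / q)).filter (fun r => Coprime r n), (1 / (r : ℝ)) ≤ 1 + log x := by
      calc _ ≤ ∑ r ∈ Icc 1 x, (1 / (r : ℝ)) := by
            apply sum_le_sum_of_subset_of_nonneg
            · intro r hr
              have := mem_Icc.mp (mem_filter.mp hr).1
              exact mem_Icc.mpr ⟨this.1, this.2.trans (Nat.div_le_self _ _)⟩
            · intros; positivity
        _ = ∑ j ∈ range x, 1 / ((j : ℝ) + 1) := by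
            rw [← Ico_add_one_right_eq_Icc, sum_Ico_eq_sum_range]
            apply sum_congr (by simp)
            intro j _; push_cast; rw [add_comm]
        _ ≤ _ := sum_inv_le_log x
    calc _ ≤ _ := sum_le_sum hr
      _ = (4 * D) * ∑ r ∈ (Icc 1 (x / q)).filter (fun r => Coprime r n), (1 / (r : ℝ)) := by rw [mul_sum]
      _ ≤ (4 * D) * (1 + log x) * 1 := by rw [mul_one]; gcongr
      _ ≤ (4 * D) * (1 + log x) * ((x : ℝ) ^ δ * (q : ℝ) ^ (-δ)) := by gcongr
      _ = _ := by ring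
  have c1 := h1 n hn0 ((Icc 1 x).filter (fun q => smo n q)) (fun q hq => (mem_filter.mp hq).2)
  have c3 := one_add_log_le hδ hx1
  calc _ ≤ _ := sum_le_sum hterm
    _ = (4 * D * (1 + log x) * (x : ℝ) ^ δ) * ∑ q ∈ (Icc 1 x).filter (fun q => smo n q), (q : ℝ) ^ (-δ) := by rw [mul_sum]
    _ ≤ (4 * D * ((1 + 1 / δ) * (x : ℝ) ^ δ) * (x : ℝ) ^ δ) * (C1 * (n : ℝ) ^ δ) := by gcongr
    _ = 4 * (1 + 1 / δ) * C1 * ((x : ℝ) ^ δ * (x : ℝ) ^ δ) * (n : ℝ) ^ δ * D := by ring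
    _ = _ := by rw [← rpow_add (by linarith)]; congr 4; ring

lemma singularPartial_eq (a : ℤ⁴) (T : ℕ) : singularPartial a T = ∑ q ∈ Icc 1 T, Sqa a 0 q / (q : ℂ) ^ 3 * (1 / (q : ℂ)) := by
  unfold singularPartial
  apply sum_congr rfl
  intro q hq
  have : (q : ℂ) ≠ 0 := by
    have := (mem_Icc.mp hq).1
    exact_mod_cast (by omega : q ≠ 0)
  field_simp

lemma dualForm_zero (a : ℤ⁴) : dualForm a 0 = 0 := by simp [dualForm]

theorem singular_bound {δ : ℝ} (hδ : 0 < δ) : ∃ C : ℝ, 1 ≤ C ∧ ∀ (a : ℤ⁴) (G : ℂ), (∀ i, a i ≠ 0) →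
    ¬ IsSquare (∏ i, a i) → Tendsto (singularPartial a) atTop (nhds G) →
    ‖G‖ ≤ C * absProd a ^ δ * (Delta4 a : ℝ) ^ ((1 : ℝ) / 4) := by
  set d := min (δ / 3) (1 / 6) with hd
  have hd0 : 0 < d := by positivity
  have hd3 : 3 * d ≤ δ := by have := min_le_left (δ / 3) (1 / 6); linarith
  have hd6 : d ≤ 1 / 6 := min_le_right _ _
  obtain ⟨C1, hC1, h1⟩ := key_prop hd0
  obtain ⟨C2, hC2, h2⟩ := sum_abs_S d hd0
  obtain ⟨C3, hC3, h3⟩ := sum_rpow_le (p := -(7 / 6)) (by norm_num)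
  refine ⟨C2 + C1 * (C3 + 1), by nlinarith, ?_⟩
  intro a G ha hns hG
  have hA : (∏ i, a i) ≠ 0 := prod_ne_zero_iff.mpr fun i _ => ha i
  set n := (∏ i, a i).natAbs with hndef
  have hn1 : 1 ≤ n := Int.natAbs_pos.mpr hA
  have hnR : (1 : ℝ) ≤ n := by exact_mod_cast hn1
  set D := (Delta4 a : ℝ) ^ ((1 : ℝ) / 4) with hD
  have hD1 : 1 ≤ D := one_le_rpow (by exact_mod_cast Delta4_pos a ha) (by norm_num)
  refine le_of_tendsto hG.norm ?_
  filter_upwards [eventually_ge_atTop n] with Y hY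
  have hY1 : 1 ≤ Y := hn1.trans hY
  set f : ℕ → ℂ := fun q => Sqa a 0 q / (q : ℂ) ^ 3 with hf
  set K : ℕ → ℂ := fun q => if q ≤ n then 1 / (n : ℂ) else 1 / (q : ℂ) with hK
  have hn0C : (n : ℂ) ≠ 0 := by exact_mod_cast (by omega : n ≠ 0)
  have e : singularPartial a Y = ∑ q ∈ Icc 1 n, f q * (1 / (q : ℂ) - 1 / (n : ℂ)) + ∑ q ∈ Icc 1 Y, f q * K q := by
    rw [singularPartial_eq]
    have : ∀ q ∈ Icc 1 Y, f q * K q = f q * (1 / (q : ℂ)) - if q ∈ Icc 1 n then f q * (1 / (q : ℂ) - 1 / (n : ℂ)) else 0 := by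
      intro q hq
      have := (mem_Icc.mp hq).1
      simp only [hK, mem_Icc, this, true_and]
      split_ifs <;> ring
    rw [sum_congr rfl this, sum_sub_distrib, ← sum_filter]
    have : (Icc 1 Y).filter (fun q => q ∈ Icc 1 n) = Icc 1 n := by ext q; simp only [mem_filter, mem_Icc]; omega
    rw [this]; ring
  have b1 : ‖∑ q ∈ Icc 1 n, f q * (1 / (q : ℂ) - 1 / (n : ℂ))‖ ≤ C2 * (n : ℝ) ^ (2 * d) * (n : ℝ) ^ d * D := by
    refine (norm_sum_le _ _).trans (le_trans ?_ (h2 a ha n hn1))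
    apply sum_le_sum
    intro q hq
    obtain ⟨hq1, hqn⟩ := mem_Icc.mp hq
    have hqR : (0 : ℝ) < q := by exact_mod_cast hq1
    rw [norm_mul, div_eq_mul_inv (‖Sqa a 0 q / (q : ℂ) ^ 3‖)]
    refine mul_le_mul_of_nonneg_left ?_ (norm_nonneg _)
    have : (1 / (q : ℂ) - 1 / (n : ℂ)) = ((1 / (q : ℝ) - 1 / (n : ℝ) : ℝ) : ℂ) := by push_cast; ring
    rw [this, norm_real, norm_eq_abs, abs_of_nonneg]
    · have : 0 < 1 / (n : ℝ) := by positivity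
      rw [one_div] at this; rw [one_div, one_div]; linarith
    · rw [sub_nonneg]
      apply one_div_le_one_div_of_le hqR
      exact_mod_cast hqn
  have hP : ∀ q : ℕ, 1 ≤ q → ‖∑ j ∈ Icc 1 q, f j‖ ≤ C1 * (q : ℝ) ^ d * (n : ℝ) ^ (2 / 3 + d) := fun q hq => h1 a ha hns 0 (dualForm_zero a) q hq
  have key : ∀ q : ℕ, n ≤ q → (q : ℝ) ^ d * (1 / ((q : ℝ) * q)) ≤ (n : ℝ) ^ (-(2 : ℝ) / 3) * (q : ℝ) ^ (-(7 : ℝ) / 6) := by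
    intro q hq
    have hqn : (n : ℝ) ≤ q := by exact_mod_cast hq
    have hqR : (0 : ℝ) < q := by linarith
    have : (1 / ((q : ℝ) * q)) = (q : ℝ) ^ (-2 : ℝ) := by rw [rpow_neg hqR.le, one_div, rpow_two, sq]
    rw [this, ← rpow_add hqR]
    calc (q : ℝ) ^ (d + -2) ≤ (q : ℝ) ^ (-(2 : ℝ) / 3 + -(7 : ℝ) / 6) := rpow_le_rpow_of_exponent_le (by linarith) (by linarith)
      _ = (q : ℝ) ^ (-(2 : ℝ) / 3) * (q : ℝ) ^ (-(7 : ℝ) / 6) := rpow_add hqR _ _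
      _ ≤ _ := by exact mul_le_mul_of_nonneg_right (rpow_le_rpow_of_nonpos (by linarith) hqn (by norm_num)) (by positivity)
  have b2 : ‖∑ q ∈ Icc 1 Y, f q * K q‖ ≤ C1 * (C3 + 1) * (n : ℝ) ^ d := by
    refine (abel_bound f K Y hY1).trans ?_
    have t1 : ∀ q ∈ Ico 1 Y, ‖∑ j ∈ Icc 1 q, f j‖ * ‖K q - K (q + 1)‖ ≤ (C1 * (n : ℝ) ^ d) * (q : ℝ) ^ (-(7 / 6) : ℝ) := by
      intro q hq
      obtain ⟨hq1, _⟩ := mem_Ico.mp hq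
      by_cases hqn : q < n
      · have : K q - K (q + 1) = 0 := by
          simp only [hK]; rw [if_pos (by omega), if_pos (by omega), sub_self]
        rw [this, norm_zero, mul_zero]; positivity
      · push Not at hqn
        have hqR : (0 : ℝ) < q := by exact_mod_cast hq1
        have hKq : K q = 1 / (q : ℂ) := by
          simp only [hK]; split_ifs with h
          · rw [le_antisymm h hqn]
          · rfl
        have hKq1 : K (q + 1) = 1 / ((q + 1 : ℕ) : ℂ) := by simp only [hK]; rw [if_neg (by omega)]
        have hdiff : ‖K q - K (q + 1)‖ ≤ 1 / ((q : ℝ) * q) := by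
          have : K q - K (q + 1) = ((1 / ((q : ℝ) * (q + 1)) : ℝ) : ℂ) := by
            rw [hKq, hKq1]; push_cast
            have h1 : (q : ℂ) ≠ 0 := by exact_mod_cast (by omega : q ≠ 0)
            have h2 : (q : ℂ) + 1 ≠ 0 := by exact_mod_cast (by omega : q + 1 ≠ 0)
            field_simp; ring
          rw [this, norm_real, norm_eq_abs, abs_of_nonneg (by positivity)]
          gcongr; linarith
        calc _ ≤ (C1 * (q : ℝ) ^ d * (n : ℝ) ^ (2 / 3 + d)) * (1 / ((q : ℝ) * q)) := by
              apply mul_le_mul (hP q hq1) hdiff (norm_nonneg _) (by positivity)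
          _ = C1 * (n : ℝ) ^ (2 / 3 + d) * ((q : ℝ) ^ d * (1 / ((q : ℝ) * q))) := by ring
          _ ≤ C1 * (n : ℝ) ^ (2 / 3 + d) * ((n : ℝ) ^ (-(2 : ℝ) / 3) * (q : ℝ) ^ (-(7 : ℝ) / 6)) := by
              exact mul_le_mul_of_nonneg_left (key q hqn) (by positivity)
          _ = C1 * ((n : ℝ) ^ (2 / 3 + d) * (n : ℝ) ^ (-(2 : ℝ) / 3)) * (q : ℝ) ^ (-(7 : ℝ) / 6) := by ring
          _ = _ := by rw [← rpow_add (by linarith)]; congr 3 <;> ring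
    have t2 : ‖∑ j ∈ Icc 1 Y, f j‖ * ‖K Y‖ ≤ C1 * (n : ℝ) ^ d := by
      have hYR : (n : ℝ) ≤ Y := by exact_mod_cast hY
      have hKY : ‖K Y‖ = 1 / (Y : ℝ) := by
        have : K Y = 1 / (Y : ℂ) := by
          simp only [hK]; split_ifs with h
          · rw [le_antisymm h hY]
          · rfl
        rw [this]; simp
      rw [hKY]
      have hY0 : (0 : ℝ) < Y := by linarith
      have : (Y : ℝ) ^ d * (1 / Y) ≤ (n : ℝ) ^ (-(2 : ℝ) / 3) := by
        rw [one_div, ← rpow_neg_one, ← rpow_add hY0]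
        calc (Y : ℝ) ^ (d + -1) ≤ (Y : ℝ) ^ (-(2 : ℝ) / 3) := rpow_le_rpow_of_exponent_le (by linarith) (by linarith)
          _ ≤ _ := rpow_le_rpow_of_nonpos (by linarith) hYR (by norm_num)
      calc _ ≤ (C1 * (Y : ℝ) ^ d * (n : ℝ) ^ (2 / 3 + d)) * (1 / (Y : ℝ)) := by
            gcongr; exact hP Y hY1
        _ = C1 * (n : ℝ) ^ (2 / 3 + d) * ((Y : ℝ) ^ d * (1 / Y)) := by ring
        _ ≤ C1 * (n : ℝ) ^ (2 / 3 + d) * (n : ℝ) ^ (-(2 : ℝ) / 3) := by gcongr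
        _ = C1 * ((n : ℝ) ^ (2 / 3 + d) * (n : ℝ) ^ (-(2 : ℝ) / 3)) := by ring
        _ = _ := by rw [← rpow_add (by linarith)]; congr 2; ring
    have := sum_le_sum t1
    rw [← mul_sum] at this
    have h3' := h3 (Ico 1 Y)
    calc _ ≤ (C1 * (n : ℝ) ^ d) * C3 + C1 * (n : ℝ) ^ d := by
          refine add_le_add (this.trans ?_) t2
          gcongr
      _ = _ := by ring
  have m1 : (n : ℝ) ^ (2 * d) * (n : ℝ) ^ d ≤ (n : ℝ) ^ δ := by
    rw [← rpow_add (by linarith)]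
    exact rpow_le_rpow_of_exponent_le hnR (by linarith)
  have m2 : (n : ℝ) ^ d ≤ (n : ℝ) ^ δ := rpow_le_rpow_of_exponent_le hnR (by linarith)
  have hnd : 0 ≤ (n : ℝ) ^ δ := by positivity
  rw [e]
  calc _ ≤ _ := norm_add_le _ _
    _ ≤ C2 * (n : ℝ) ^ (2 * d) * (n : ℝ) ^ d * D + C1 * (C3 + 1) * (n : ℝ) ^ d := add_le_add b1 b2
    _ = C2 * ((n : ℝ) ^ (2 * d) * (n : ℝ) ^ d) * D + C1 * (C3 + 1) * (n : ℝ) ^ d * 1 := by ring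
    _ ≤ C2 * (n : ℝ) ^ δ * D + C1 * (C3 + 1) * (n : ℝ) ^ δ * D := by gcongr
    _ = _ := by ring


/-! ### C1: the function H -/

def gT (k n : ℕ) (β : ℝ) : ℝ := ((n : ℝ) + 1) ^ k * exp (-π * ((n : ℝ) + 1) ^ 2 * β)

def TT (k : ℕ) (β : ℝ) : ℝ := ∑' n : ℕ, gT k n β

lemma gT_nonneg (k n : ℕ) (β : ℝ) : 0 ≤ gT k n β := by unfold gT; positivity

lemma gT_le (k n : ℕ) {β r : ℝ} (hr : 0 ≤ r) (h : r ≤ β) : gT k n β ≤ ((n + 1 : ℕ) : ℝ) ^ k * exp (-(π * r) * ((n + 1 : ℕ) : ℝ)) := by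
  unfold gT
  push_cast
  refine mul_le_mul_of_nonneg_left (exp_le_exp.mpr ?_) (by positivity)
  have h1 : (1 : ℝ) ≤ (n : ℝ) + 1 := by have : (0 : ℝ) ≤ n := by positivity
                                        linarith
  have : r * ((n : ℝ) + 1) ≤ β * ((n : ℝ) + 1) ^ 2 := by
    apply mul_le_mul h _ (by positivity) (by linarith)
    nlinarith
  nlinarith [pi_pos]

lemma summable_gT_bound (k : ℕ) {r : ℝ} (hr : 0 < r) : Summable fun n : ℕ => ((n + 1 : ℕ) : ℝ) ^ k * exp (-(π * r) * ((n + 1 : ℕ) : ℝ)) :=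
  (summable_nat_add_iff (f := fun n : ℕ => (n : ℝ) ^ k * exp (-(π * r) * n)) 1).mpr
    (summable_pow_mul_exp_neg_nat_mul k (by positivity))

lemma summable_gT (k : ℕ) {β : ℝ} (hβ : 0 < β) : Summable fun n => gT k n β :=
  Summable.of_nonneg_of_le (fun n => gT_nonneg k n β) (fun n => gT_le k n hβ.le le_rfl) (summable_gT_bound k hβ)

lemma hasDerivAt_gT (k n : ℕ) (β : ℝ) : HasDerivAt (gT k n) (-π * gT (k + 2) n β) β := by
  unfold gT
  have h1 : HasDerivAt (fun β : ℝ => -π * ((n : ℝ) + 1) ^ 2 * β) (-π * ((n : ℝ) + 1) ^ 2) β := by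
    have := (hasDerivAt_id β).const_mul (-π * ((n : ℝ) + 1) ^ 2)
    rw [mul_one] at this
    exact this
  have := (h1.exp).const_mul (((n : ℝ) + 1) ^ k)
  refine this.congr_deriv ?_
  ring

lemma hasDerivAt_TT (k : ℕ) {β : ℝ} (hβ : 0 < β) : HasDerivAt (TT k) (-π * TT (k + 2) β) β := by
  have := hasDerivAt_tsum_of_isPreconnected (𝕜 := ℝ) (F := ℝ) (g := gT k) (g' := fun n β => -π * gT (k + 2) n β)
    (t := Set.Ioi (β / 2)) (y₀ := β) (y := β)
    ((summable_gT_bound (k + 2) (half_pos hβ)).mul_left π) isOpen_Ioi isPreconnected_Ioi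
    (fun n y _ => hasDerivAt_gT k n y) (fun n y hy => by
      rw [norm_mul, norm_neg, norm_of_nonneg pi_pos.le, norm_of_nonneg (gT_nonneg _ _ _)]
      exact mul_le_mul_of_nonneg_left (gT_le _ _ (half_pos hβ).le (le_of_lt hy)) pi_pos.le)
    (half_lt_self hβ) (summable_gT k hβ) (half_lt_self hβ)
  rw [tsum_mul_left] at this
  exact this

lemma TT_nonneg (k : ℕ) (β : ℝ) : 0 ≤ TT k β := tsum_nonneg fun n => gT_nonneg k n β

/-- T_k(β) ≤ C e^{-πβ} for β ≥ 1 -/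
lemma TT_le (k : ℕ) : ∃ C : ℝ, 0 < C ∧ ∀ β, 1 ≤ β → TT k β ≤ C * exp (-π * β) := by
  have hs : Summable fun n : ℕ => ((n : ℝ) + 1) ^ k * exp (-π * n) := by
    have := (summable_gT_bound k one_pos).mul_right (exp π)
    refine this.congr fun n => ?_
    rw [mul_assoc, ← exp_add]
    push_cast
    congr 2; ring
  refine ⟨1 + ∑' n : ℕ, ((n : ℝ) + 1) ^ k * exp (-π * n), ?_, fun β hβ => ?_⟩
  · have : 0 ≤ ∑' n : ℕ, ((n : ℝ) + 1) ^ k * exp (-π * n) := tsum_nonneg fun n => by positivity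
    linarith
  have h1 : ∀ n : ℕ, gT k n β ≤ ((n : ℝ) + 1) ^ k * exp (-π * n) * exp (-π * β) := by
    intro n
    unfold gT
    rw [mul_assoc (((n : ℝ) + 1) ^ k), ← exp_add]
    refine mul_le_mul_of_nonneg_left (exp_le_exp.mpr ?_) (by positivity)
    have hn : (0 : ℝ) ≤ n := by positivity
    have : (n : ℝ) + β ≤ ((n : ℝ) + 1) ^ 2 * β := by nlinarith [mul_nonneg hn (by linarith : 0 ≤ β - 1), mul_nonneg (mul_nonneg hn hn) (by linarith : 0 ≤ β)]
    nlinarith [pi_pos]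
  calc TT k β ≤ ∑' n : ℕ, ((n : ℝ) + 1) ^ k * exp (-π * n) * exp (-π * β) := (summable_gT k (by linarith)).tsum_le_tsum h1 (hs.mul_right _)
    _ = (∑' n : ℕ, ((n : ℝ) + 1) ^ k * exp (-π * n)) * exp (-π * β) := tsum_mul_right
    _ ≤ _ := by gcongr; linarith

lemma theta_eq {α : ℝ} (hα : 0 < α) : ∑' n : ℤ, exp (-π * α * (n : ℝ) ^ 2) = 1 + 2 * TT 0 α := by
  set f : ℤ → ℝ := fun n => exp (-π * α * (n : ℝ) ^ 2) with hf
  have e : ∀ n : ℕ, f (-((n : ℤ) + 1)) = gT 0 n α := by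
    intro n; simp only [hf, gT]; push_cast; rw [pow_zero, one_mul]; congr 1; ring
  have e' : ∀ n : ℕ, f ((n + 1 : ℕ) : ℤ) = gT 0 n α := by
    intro n; simp only [hf, gT]; push_cast; rw [pow_zero, one_mul]; congr 1; ring
  have s1 : Summable fun n : ℕ => f (n : ℤ) := by
    rw [← summable_nat_add_iff 1]
    exact (summable_gT 0 hα).congr fun n => (e' n).symm
  have s2 : Summable fun n : ℕ => f (-((n : ℤ) + 1)) := (summable_gT 0 hα).congr fun n => (e n).symm
  rw [tsum_of_nat_of_neg_add_one s1 s2, s1.tsum_eq_zero_add]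
  simp only [e, e']
  have : f ((0 : ℕ) : ℤ) = 1 := by simp [hf]
  rw [this, TT]; ring

lemma theta_modular {α : ℝ} (hα : 0 < α) : α ^ ((1 : ℝ) / 2) * (1 + 2 * TT 0 α) = 1 + 2 * TT 0 (1 / α) := by
  rw [← theta_eq hα, ← theta_eq (by positivity : 0 < 1 / α), tsum_exp_neg_mul_int_sq hα, ← mul_assoc]
  rw [mul_one_div_cancel (by positivity), one_mul]
  congr 1; ext n; congr 1; ring

def HH (α : ℝ) : ℝ := 4 * π * α * TT 2 α - 2 * TT 0 α

lemma HH_modular {α : ℝ} (hα : 0 < α) : HH α = 1 - 4 * π * (α ^ (-(3 : ℝ) / 2)) * TT 2 (1 / α) := by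
  have d1 : HasDerivAt (fun α : ℝ => α ^ ((1 : ℝ) / 2) * (1 + 2 * TT 0 α))
      ((1 / 2) * α ^ ((1 : ℝ) / 2 - 1) * (1 + 2 * TT 0 α) + α ^ ((1 : ℝ) / 2) * (2 * (-π * TT 2 α))) α := by
    apply HasDerivAt.mul
    · exact hasDerivAt_rpow_const (Or.inl hα.ne')
    · exact ((hasDerivAt_TT 0 hα).const_mul 2).const_add 1
  have d2 : HasDerivAt (fun α : ℝ => 1 + 2 * TT 0 (1 / α)) (2 * ((-π * TT 2 (1 / α)) * (-(α ^ 2)⁻¹))) α := by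
    have hinv : HasDerivAt (fun α : ℝ => 1 / α) (-(α ^ 2)⁻¹) α := by simpa using hasDerivAt_inv hα.ne'
    exact (((hasDerivAt_TT 0 (by positivity : 0 < 1 / α)).comp α hinv).const_mul 2).const_add 1
  have e : (fun α : ℝ => α ^ ((1 : ℝ) / 2) * (1 + 2 * TT 0 α)) =ᶠ[nhds α] (fun α : ℝ => 1 + 2 * TT 0 (1 / α)) := by
    filter_upwards [lt_mem_nhds hα] with x hx
    exact theta_modular hx
  have h := d1.unique (d2.congr_of_eventuallyEq e)
  set s := α ^ ((1 : ℝ) / 2) with hs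
  have hs0 : 0 < s := by positivity
  have e1 : α ^ ((1 : ℝ) / 2 - 1) = s / α := by rw [rpow_sub hα, rpow_one]
  have ess : s * s = α := by rw [hs, ← rpow_add hα]; norm_num
  have e2 : α ^ (-(3 : ℝ) / 2) = s / α ^ 2 := by rw [show (-(3 : ℝ) / 2) = 1 / 2 - 2 by norm_num, rpow_sub hα, rpow_two]
  rw [e1] at h
  rw [e2, HH]
  have h2 := congrArg (fun t => 2 * s * t) h
  have : 2 * s * (1 / 2 * (s / α) * (1 + 2 * TT 0 α) + s * (2 * (-π * TT 2 α))) = (1 + 2 * TT 0 α) - 4 * π * α * TT 2 α := by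
    have : 2 * s * (1 / 2 * (s / α) * (1 + 2 * TT 0 α) + s * (2 * (-π * TT 2 α))) =
      (s * s) / α * (1 + 2 * TT 0 α) - 4 * π * (s * s) * TT 2 α := by ring
    rw [this, ess, div_self hα.ne', one_mul]
  rw [this] at h2
  have h3 : 4 * π * α * TT 2 α - 2 * TT 0 α = 1 - 2 * s * (2 * (-π * TT 2 (1 / α) * -(α ^ 2)⁻¹)) := by linarith
  rw [h3]; ring

def HD (α : ℝ) : ℝ := 6 * π * TT 2 α - 4 * π ^ 2 * α * TT 4 α

lemma hasDerivAt_HH {α : ℝ} (hα : 0 < α) : HasDerivAt HH (HD α) α := by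
  have h1 : HasDerivAt (fun α : ℝ => 4 * π * α) (4 * π) α := by simpa using (hasDerivAt_id α).const_mul (4 * π)
  have := (h1.mul (hasDerivAt_TT 2 hα)).sub ((hasDerivAt_TT 0 hα).const_mul 2)
  refine this.congr_deriv ?_
  unfold HD; ring

lemma HD_modular {α : ℝ} (hα : 0 < α) : α * HD α = 4 * π * ((3 / 2) * (α ^ (-(3 : ℝ) / 2)) * TT 2 (1 / α) -
    π * (α ^ (-(5 : ℝ) / 2)) * TT 4 (1 / α)) := by
  have hinv : HasDerivAt (fun α : ℝ => 1 / α) (-(α ^ 2)⁻¹) α := by simpa using hasDerivAt_inv hα.ne'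
  have d1 : HasDerivAt (fun α : ℝ => 1 - 4 * π * (α ^ (-(3 : ℝ) / 2)) * TT 2 (1 / α))
      (-(4 * π * (-(3 : ℝ) / 2 * α ^ (-(3 : ℝ) / 2 - 1)) * TT 2 (1 / α) +
        4 * π * (α ^ (-(3 : ℝ) / 2)) * ((-π * TT 4 (1 / α)) * (-(α ^ 2)⁻¹)))) α := by
    apply HasDerivAt.const_sub
    apply HasDerivAt.mul
    · exact (hasDerivAt_rpow_const (Or.inl hα.ne')).const_mul _
    · exact (hasDerivAt_TT 2 (by positivity : 0 < 1 / α)).comp α hinv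
  have e : HH =ᶠ[nhds α] (fun α : ℝ => 1 - 4 * π * (α ^ (-(3 : ℝ) / 2)) * TT 2 (1 / α)) := by
    filter_upwards [lt_mem_nhds hα] with x hx
    exact HH_modular hx
  rw [(hasDerivAt_HH hα).unique (d1.congr_of_eventuallyEq e)]
  rw [rpow_sub hα, rpow_one, show (-(5 : ℝ) / 2) = -(3 : ℝ) / 2 - 1 by norm_num, rpow_sub hα, rpow_one]
  field_simp
  ring

lemma pow_mul_exp_le (k : ℕ) {x : ℝ} (hx : 0 ≤ x) : x ^ k * exp (-x) ≤ k.factorial := by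
  have := pow_div_factorial_le_exp x hx k
  rw [div_le_iff₀ (by positivity)] at this
  rw [exp_neg, ← div_eq_mul_inv, div_le_iff₀ (exp_pos x)]
  linarith

lemma exp_pi_le (x : ℝ) (hx : 0 ≤ x) (k : ℕ) : x ^ k * exp (-π * x) ≤ k.factorial * exp (-x) := by
  have h1 : exp (-π * x) ≤ exp (-x) * exp (-x) := by
    rw [← exp_add]
    apply exp_le_exp.mpr
    nlinarith [pi_gt_three]
  calc _ ≤ x ^ k * (exp (-x) * exp (-x)) := by gcongr
    _ = (x ^ k * exp (-x)) * exp (-x) := by ring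
    _ ≤ _ := by gcongr; exact pow_mul_exp_le k hx

set_option maxHeartbeats 1000000 in
theorem HH_bounds : ∃ C : ℝ, 1 ≤ C ∧ ∀ α : ℝ, 0 < α →
    |HH α| ≤ C * exp (-α) ∧ |HH α - 1| ≤ C * α ∧ |α * HD α| ≤ C * exp (-α) ∧ |α * HD α| ≤ C * α := by
  obtain ⟨C0, hC0, h0⟩ := TT_le 0
  obtain ⟨C2, hC2, h2⟩ := TT_le 2
  obtain ⟨C4, hC4, h4⟩ := TT_le 4
  have hpi := pi_pos
  have hpi4 := pi_le_four
  set K := C0 + C2 + C4 with hK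
  have t0 : ∀ x, 1 ≤ x → TT 0 x ≤ K * exp (-π * x) := fun x hx => (h0 x hx).trans (by gcongr; linarith)
  have t2 : ∀ x, 1 ≤ x → TT 2 x ≤ K * exp (-π * x) := fun x hx => (h2 x hx).trans (by gcongr; linarith)
  have t4 : ∀ x, 1 ≤ x → TT 4 x ≤ K * exp (-π * x) := fun x hx => (h4 x hx).trans (by gcongr; linarith)
  have hK0 : 0 < K := by positivity
  -- generic: for x ≥ 1, k ≤ 4 : x^j T_i(x) ≤ 24 K e^{-x}
  have gen : ∀ x, 1 ≤ x → ∀ j : ℕ, j ≤ 3 → ∀ t, t ≤ K * exp (-π * x) → 0 ≤ t → x ^ j * t ≤ 6 * K * exp (-x) := by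
    intro x hx j hj t ht ht0
    calc x ^ j * t ≤ x ^ j * (K * exp (-π * x)) := by gcongr
      _ = K * (x ^ j * exp (-π * x)) := by ring
      _ ≤ K * (j.factorial * exp (-x)) := mul_le_mul_of_nonneg_left (exp_pi_le x (by linarith) j) hK0.le
      _ ≤ K * (6 * exp (-x)) := by
        gcongr
        have : j.factorial ≤ 6 := by interval_cases j <;> decide
        exact_mod_cast this
      _ = _ := by ring
  have hx1 : ∀ x : ℝ, 1 ≤ x → |HH x| ≤ 200 * K * exp (-x) ∧ |x * HD x| ≤ 1000 * K * exp (-x) := by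
    intro x hx
    have a0 := gen x hx 0 (by norm_num) _ (t0 x hx) (TT_nonneg _ _)
    have a1 := gen x hx 1 (by norm_num) _ (t2 x hx) (TT_nonneg _ _)
    have a2 := gen x hx 2 (by norm_num) _ (t4 x hx) (TT_nonneg _ _)
    have n0 := TT_nonneg 0 x
    have n2 := TT_nonneg 2 x
    have n4 := TT_nonneg 4 x
    set E := K * exp (-x) with hE
    have hE0 : 0 < E := by positivity
    simp only [pow_zero, one_mul, pow_one] at a0 a1 a2
    have m1 : 0 ≤ x * TT 2 x := by positivity
    have m2 : 0 ≤ x ^ 2 * TT 4 x := by positivity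
    have p1 : π * (x * TT 2 x) ≤ 4 * (6 * E) := mul_le_mul hpi4 (by rw [hE]; linarith) m1 (by norm_num)
    have hpi2 : π ^ 2 ≤ 16 := by nlinarith
    have p2 : π ^ 2 * (x ^ 2 * TT 4 x) ≤ 16 * (6 * E) := mul_le_mul hpi2 (by rw [hE]; linarith) m2 (by norm_num)
    have p1' : 0 ≤ π * (x * TT 2 x) := by positivity
    have p2' : 0 ≤ π ^ 2 * (x ^ 2 * TT 4 x) := by positivity
    constructor
    · rw [HH, show 200 * K * exp (-x) = 200 * E by rw [hE]; ring, abs_le]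
      constructor <;> nlinarith
    · rw [HD, show 1000 * K * exp (-x) = 1000 * E by rw [hE]; ring, abs_le]
      constructor <;> nlinarith
  have hx2 : ∀ x : ℝ, 0 < x → x ≤ 1 → |HH x - 1| ≤ 1000 * K * x ∧ |x * HD x| ≤ 1000 * K * x := by
    intro x hx0 hx
    have hy : 1 ≤ 1 / x := by rw [le_div_iff₀ hx0]; linarith
    set y := 1 / x with hydef
    have hxy : x = 1 / y := by rw [hydef]; field_simp
    have a2 := gen y hy 2 (by norm_num) _ (t2 y hy) (TT_nonneg _ _)
    have a3 := gen y hy 3 (by norm_num) _ (t4 y hy) (TT_nonneg _ _)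
    have hexp : exp (-y) ≤ x := by
      have := pow_mul_exp_le 1 (by linarith : 0 ≤ y)
      rw [hxy, le_div_iff₀ (by linarith)]
      simpa [mul_comm] using this
    have a2' : y ^ 2 * TT 2 y ≤ 6 * K * x := a2.trans (by gcongr)
    have a3' : y ^ 3 * TT 4 y ≤ 6 * K * x := a3.trans (by gcongr)
    have r1 : x ^ (-(3 : ℝ) / 2) ≤ y ^ 2 := by
      rw [hydef, one_div, ← rpow_natCast, inv_rpow hx0.le, ← rpow_neg hx0.le]
      exact rpow_le_rpow_of_exponent_ge hx0 hx (by norm_num)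
    have r2 : x ^ (-(5 : ℝ) / 2) ≤ y ^ 3 := by
      rw [hydef, one_div, ← rpow_natCast, inv_rpow hx0.le, ← rpow_neg hx0.le]
      exact rpow_le_rpow_of_exponent_ge hx0 hx (by norm_num)
    have n2 := TT_nonneg 2 y
    have n4 := TT_nonneg 4 y
    have b2 : x ^ (-(3 : ℝ) / 2) * TT 2 y ≤ 6 * K * x := (mul_le_mul_of_nonneg_right r1 n2).trans a2'
    have b3 : x ^ (-(5 : ℝ) / 2) * TT 4 y ≤ 6 * K * x := (mul_le_mul_of_nonneg_right r2 n4).trans a3'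
    have b2' : 0 ≤ x ^ (-(3 : ℝ) / 2) * TT 2 y := by positivity
    have b3' : 0 ≤ x ^ (-(5 : ℝ) / 2) * TT 4 y := by positivity
    rw [HH_modular hx0, HD_modular hx0, ← hydef]
    set E := K * x with hE
    have hE0 : 0 < E := by positivity
    have p1 : π * (x ^ (-(3 : ℝ) / 2) * TT 2 y) ≤ 4 * (6 * E) := mul_le_mul hpi4 (by rw [hE]; linarith) b2' (by norm_num)
    have hpi2 : π ^ 2 ≤ 16 := by nlinarith
    have p2 : π ^ 2 * (x ^ (-(5 : ℝ) / 2) * TT 4 y) ≤ 16 * (6 * E) := mul_le_mul hpi2 (by rw [hE]; linarith) b3' (by norm_num)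
    have p1' : 0 ≤ π * (x ^ (-(3 : ℝ) / 2) * TT 2 y) := by positivity
    have p2' : 0 ≤ π ^ 2 * (x ^ (-(5 : ℝ) / 2) * TT 4 y) := by positivity
    rw [show 1000 * K * x = 1000 * E by rw [hE]; ring]
    constructor
    · rw [abs_le]; constructor <;> nlinarith
    · rw [abs_le]; constructor <;> nlinarith
  have he1 : exp 1 ≤ 3 := by have := exp_one_lt_d9; linarith
  refine ⟨3000 * K + 3, by nlinarith, fun α hα => ?_⟩
  rcases le_total 1 α with h | h
  · obtain ⟨g1, g2⟩ := hx1 α h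
    have hE := exp_pos (-α)
    have hE1 : exp (-α) ≤ 1 := exp_le_one_iff.mpr (by linarith)
    have hKE : K * exp (-α) ≤ K * α := by gcongr; linarith
    have hKE0 : 0 < K * exp (-α) := by positivity
    refine ⟨g1.trans (by nlinarith), ?_, g2.trans (by nlinarith), g2.trans (by nlinarith)⟩
    have := abs_sub (HH α) 1
    rw [abs_one] at this
    nlinarith
  · obtain ⟨g1, g2⟩ := hx2 α hα h
    have hE : 1 ≤ 3 * exp (-α) := by
      have h1 : exp (-1) ≤ exp (-α) := exp_le_exp.mpr (by linarith)
      have h2 : exp (-1) * exp 1 = 1 := by rw [← exp_add]; simp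
      nlinarith [exp_pos (-1)]
    have hKa : K * α ≤ K := by nlinarith
    refine ⟨?_, g1.trans (by nlinarith), ?_, g2.trans (by nlinarith)⟩
    · have : |HH α| ≤ |HH α - 1| + 1 := by
        have := abs_add_le (HH α - 1) 1
        simpa using this
      nlinarith
    · nlinarith

lemma HH_eq_tsum {α : ℝ} (hα : 0 < α) : HasSum (fun j : ℕ => (4 * π * ((j : ℝ) + 1) ^ 2 * α - 2) * exp (-π * ((j : ℝ) + 1) ^ 2 * α)) (HH α) := by
  have := ((summable_gT 2 hα).hasSum.mul_left (4 * π * α)).sub ((summable_gT 0 hα).hasSum.mul_left 2)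
  refine (this.congr_fun ?_)
  intro j; simp only [gT]; ring


/-! ### D1: the delta identity -/

def phit (y : ℝ) : ℝ := (4 * π * y - 2) * exp (-π * y)

lemma phit_bound {y : ℝ} (hy : 0 < y) : |phit y| ≤ 500 / y ^ 3 := by
  have hpi := pi_pos
  have hpi4 := pi_le_four
  rw [phit, abs_mul, abs_exp, le_div_iff₀ (by positivity)]
  have h1 : |4 * π * y - 2| ≤ 16 * y + 2 := by rw [abs_le]; constructor <;> nlinarith [mul_pos hpi hy]
  have h2 : exp (-π * y) ≤ exp (-y) := exp_le_exp.mpr (by nlinarith [pi_gt_three])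
  have h3 := pow_mul_exp_le 4 hy.le
  have h4 := pow_mul_exp_le 3 hy.le
  norm_num [Nat.factorial] at h3 h4
  calc |4 * π * y - 2| * exp (-π * y) * y ^ 3 ≤ (16 * y + 2) * exp (-y) * y ^ 3 := by gcongr
    _ = 16 * (y ^ 4 * exp (-y)) + 2 * (y ^ 3 * exp (-y)) := by ring
    _ ≤ 500 := by linarith

def IdR (R : ℝ) (n : ℤ) (d : ℕ) : ℂ := ∫ τ : ℝ, (phit ((d : ℝ) ^ 2 / R * (1 + τ ^ 2)) : ℂ) * eC (n * τ / R)

lemma continuous_eC : Continuous eC := by unfold eC; fun_prop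

lemma continuous_phit : Continuous phit := by unfold phit; fun_prop

lemma phit_norm_bound {R : ℝ} (hR : 0 < R) (n : ℤ) {d : ℕ} (hd : d ≠ 0) (τ : ℝ) :
    ‖(phit ((d : ℝ) ^ 2 / R * (1 + τ ^ 2)) : ℂ) * eC (n * τ / R)‖ ≤ 500 * R ^ 3 / (d : ℝ) ^ 6 * (1 + τ ^ 2)⁻¹ := by
  have hd0 : (0 : ℝ) < d := by positivity
  rw [norm_mul, norm_eC, mul_one, norm_real, norm_eq_abs]
  refine (phit_bound (by positivity)).trans ?_
  have h1 : 1 ≤ 1 + τ ^ 2 := by nlinarith [sq_nonneg τ]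
  have h2 : 1 + τ ^ 2 ≤ (1 + τ ^ 2) ^ 3 := le_self_pow₀ h1 (by norm_num)
  calc 500 / ((d : ℝ) ^ 2 / R * (1 + τ ^ 2)) ^ 3 = 500 * R ^ 3 / (d : ℝ) ^ 6 * ((1 + τ ^ 2) ^ 3)⁻¹ := by
        field_simp
    _ ≤ _ := by gcongr

lemma phit_integrable {R : ℝ} (hR : 0 < R) (n : ℤ) {d : ℕ} (hd : d ≠ 0) :
    Integrable fun τ : ℝ => (phit ((d : ℝ) ^ 2 / R * (1 + τ ^ 2)) : ℂ) * eC (n * τ / R) := by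
  refine Integrable.mono' (integrable_inv_one_add_sq.const_mul (500 * R ^ 3 / (d : ℝ) ^ 6)) ?_ ?_
  · apply Continuous.aestronglyMeasurable
    have := continuous_phit
    have := continuous_eC
    fun_prop
  · exact Eventually.of_forall fun τ => phit_norm_bound hR n hd τ

lemma Id_norm_le {R : ℝ} (hR : 0 < R) (n : ℤ) {d : ℕ} (hd : d ≠ 0) :
    ∫ τ : ℝ, ‖(phit ((d : ℝ) ^ 2 / R * (1 + τ ^ 2)) : ℂ) * eC (n * τ / R)‖ ≤ 500 * R ^ 3 * π * (1 / (d : ℝ) ^ 6) := by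
  calc _ ≤ ∫ τ : ℝ, 500 * R ^ 3 / (d : ℝ) ^ 6 * (1 + τ ^ 2)⁻¹ := integral_mono (phit_integrable hR n hd).norm (integrable_inv_one_add_sq.const_mul _)
          (fun τ => phit_norm_bound hR n hd τ)
    _ = _ := by rw [integral_const_mul, integral_univ_inv_one_add_sq]; ring

/-- sum over j of φ̃(j² α) is H -/
lemma HH_hasSum {α : ℝ} (hα : 0 < α) : HasSum (fun j : ℕ => phit (((j : ℝ) + 1) ^ 2 * α)) (HH α) := by
  refine (HH_eq_tsum hα).congr_fun fun j => ?_
  simp only [phit]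
  congr 2 <;> ring

def Hint (R : ℝ) (n : ℤ) (q : ℕ) : ℂ := ∫ τ : ℝ, (HH ((q : ℝ) ^ 2 / R * (1 + τ ^ 2)) : ℂ) * eC (n * τ / R)

lemma Hint_hasSum {R : ℝ} (hR : 0 < R) (n : ℤ) {q : ℕ} (hq : q ≠ 0) : HasSum (fun j : ℕ => IdR R n (q * (j + 1))) (Hint R n q) := by
  have h := hasSum_integral_of_summable_integral_norm (μ := volume)
    (F := fun (j : ℕ) (τ : ℝ) => (phit (((q * (j + 1) : ℕ) : ℝ) ^ 2 / R * (1 + τ ^ 2)) : ℂ) * eC (n * τ / R))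
    (fun j => phit_integrable hR n (by positivity)) (by
      have s : Summable fun j : ℕ => 500 * R ^ 3 * π * (1 / (((j + 1 : ℕ)) : ℝ) ^ 6) := by
        apply Summable.mul_left
        exact (summable_nat_add_iff (f := fun j : ℕ => 1 / (j : ℝ) ^ 6) 1).mpr
          (summable_one_div_nat_pow.mpr (by norm_num))
      refine Summable.of_nonneg_of_le (fun j => integral_nonneg fun τ => norm_nonneg _) (fun j => ?_) s
      refine (Id_norm_le hR n (by positivity)).trans ?_
      have : (((j + 1 : ℕ)) : ℝ) ≤ ((q * (j + 1) : ℕ) : ℝ) := by exact_mod_cast Nat.le_mul_of_pos_left _ (by omega)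
      gcongr)
  have e : ∀ τ : ℝ, ∑' j : ℕ, (phit (((q * (j + 1) : ℕ) : ℝ) ^ 2 / R * (1 + τ ^ 2)) : ℂ) * eC (n * τ / R) =
      (HH ((q : ℝ) ^ 2 / R * (1 + τ ^ 2)) : ℂ) * eC (n * τ / R) := by
    intro τ
    have hq0 : (0 : ℝ) < q := by positivity
    have h1 := (Complex.hasSum_ofReal.mpr (HH_hasSum (α := (q : ℝ) ^ 2 / R * (1 + τ ^ 2)) (by positivity))).mul_right (eC (n * τ / R))
    rw [← h1.tsum_eq]
    congr 1; ext j
    congr 3; push_cast; ring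
  simp only [e] at h
  exact h

/-- the Ramanujan sum identity -/
lemma sum_ram {d : ℕ} (hd : d ≠ 0) (n : ℤ) : ∑ q ∈ d.divisors, ram q n = if (d : ℤ) ∣ n then (d : ℂ) else 0 := by
  rw [← sum_eQ hd n]
  have h1 : ∑ b ∈ range d, eQ d (n * b) = ∑ g ∈ d.divisors, ∑ b ∈ (range d).filter (fun b => Nat.gcd b d = g), eQ d (n * b) := by
    rw [sum_fiberwise_of_maps_to]
    intro b _
    exact Nat.mem_divisors.mpr ⟨Nat.gcd_dvd_right _ _, hd⟩
  rw [h1, ← Nat.sum_div_divisors]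
  apply sum_congr rfl
  intro g hg
  have hgd := dvd_of_mem_divisors hg
  obtain ⟨q, rfl⟩ := hgd
  have hg0 : g ≠ 0 := by rintro rfl; simp at hd
  have hq0 : q ≠ 0 := by rintro rfl; simp at hd
  rw [Nat.mul_div_cancel_left q (by omega)]
  unfold ram
  have : ∀ k ∈ range q, uInd q k * eQ q (n * k) = if Nat.gcd k q = 1 then eQ q (n * k) else 0 := by
    intro k _
    unfold uInd
    rw [show Int.gcd (k : ℤ) (q : ℤ) = Nat.gcd k q from rfl]
    split_ifs <;> simp
  rw [sum_congr rfl this, ← sum_filter]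
  apply sum_nbij' (fun k => g * k) (fun b => b / g)
  · intro k hk
    simp only [mem_filter, mem_range] at hk ⊢
    refine ⟨Nat.mul_lt_mul_of_pos_left hk.1 (by omega), ?_⟩
    rw [Nat.gcd_mul_left, hk.2, mul_one]
  · intro b hb
    simp only [mem_filter, mem_range] at hb ⊢
    obtain ⟨hb1, hb2⟩ := hb
    have hgb : g ∣ b := by have := Nat.gcd_dvd_left b (g * q); rwa [hb2] at this
    obtain ⟨k, rfl⟩ := hgb
    rw [Nat.mul_div_cancel_left k (by omega)]
    rw [Nat.gcd_mul_left] at hb2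
    exact ⟨Nat.lt_of_mul_lt_mul_left hb1, Nat.eq_of_mul_eq_mul_left (Nat.pos_of_ne_zero hg0) (by rw [hb2, mul_one])⟩
  · intro k _
    exact Nat.mul_div_cancel_left k (by omega)
  · intro b hb
    simp only [mem_filter, mem_range] at hb
    have hgb : g ∣ b := by have := Nat.gcd_dvd_left b (g * q); rwa [hb.2] at this
    exact Nat.mul_div_cancel' hgb
  · intro k _
    rw [show n * ((g * k : ℕ) : ℤ) = (g : ℤ) * (n * k) by push_cast; ring, eQ_mul_left hg0]

lemma norm_ram_le (q : ℕ) (n : ℤ) : ‖ram q n‖ ≤ q := by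
  unfold ram
  refine (norm_sum_le _ _).trans ?_
  calc _ ≤ ∑ k ∈ range q, (1 : ℝ) := by
        apply sum_le_sum
        intro k _
        unfold uInd
        rw [norm_mul, norm_eQ]
        split_ifs <;> simp
    _ = q := by simp

lemma Id_eval {R : ℝ} (hR : 0 < R) (n : ℤ) {d : ℕ} (hd : d ≠ 0) :
    (d : ℂ) * IdR R n d = ((4 * π * sqrt R * ((d : ℝ) ^ 2 / R - (n : ℝ) ^ 2 / (R * (d : ℝ) ^ 2)) *
      exp (-π * ((d : ℝ) ^ 2 / R + (n : ℝ) ^ 2 / (R * (d : ℝ) ^ 2))) : ℝ) : ℂ) := by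
  have hd0 : (0 : ℝ) < d := by positivity
  set α : ℝ := (d : ℝ) ^ 2 / R with hα
  have hα0 : 0 < α := by positivity
  set ν : ℝ := n / R with hν
  have hpi := pi_pos
  have hαC : (α : ℂ) ≠ 0 := by exact_mod_cast hα0.ne'
  set G : ℝ → ℂ := fun τ => cexp (-(π * α : ℝ) * (τ : ℂ) ^ 2 + 2 * π * I * ν * τ) with hG
  have hGn : ∀ τ, ‖G τ‖ = exp (-(π * α) * τ ^ 2) := by
    intro τ
    simp only [hG]
    rw [Complex.norm_exp]
    congr 1
    have e : (-((π * α : ℝ) : ℂ) * (τ : ℂ) ^ 2 + 2 * π * I * ν * τ) =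
      ((-(π * α) * τ ^ 2 : ℝ) : ℂ) + ((2 * π * ν * τ : ℝ) : ℂ) * I := by push_cast; ring
    rw [e, Complex.add_re, Complex.ofReal_re, re_ofReal_mul, Complex.I_re, mul_zero, add_zero]
  have hGd : ∀ τ : ℝ, HasDerivAt G ((-2 * π * α * τ + 2 * π * I * ν) * G τ) τ := by
    intro τ
    have h1 : HasDerivAt (fun τ : ℝ => (-(π * α : ℝ) * (τ : ℂ) ^ 2 + 2 * π * I * ν * τ))
        (-2 * π * α * τ + 2 * π * I * ν) τ := by
      have hid : HasDerivAt (fun τ : ℝ => (τ : ℂ)) 1 τ := Complex.ofRealCLM.hasDerivAt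
      have := ((hid.pow 2).const_mul (-((π * α : ℝ) : ℂ))).add (hid.const_mul (2 * π * I * ν))
      refine this.congr_deriv ?_
      push_cast; ring
    refine h1.cexp.congr_deriv ?_
    simp only [hG]; ring
  set P : ℝ → ℂ := fun τ => (2 * (τ : ℂ) + 2 * I * ν / α) * G τ with hP
  have hPd : ∀ τ : ℝ, HasDerivAt P ((2 - 4 * π * α * (τ : ℂ) ^ 2 - 4 * π * ν ^ 2 / α) * G τ) τ := by
    intro τ
    have hid : HasDerivAt (fun τ : ℝ => (τ : ℂ)) 1 τ := Complex.ofRealCLM.hasDerivAt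
    have := ((hid.const_mul 2).add_const (2 * I * ν / α)).mul (hGd τ)
    refine this.congr_deriv ?_
    field_simp
    ring_nf
    rw [Complex.I_sq]; ring
  have hGc : Continuous G := by simp only [hG]; fun_prop
  have hGi : Integrable G := by
    refine Integrable.mono' (integrable_exp_neg_mul_sq (b := π * α) (by positivity)) hGc.aestronglyMeasurable ?_
    exact Eventually.of_forall fun τ => (hGn τ).le
  have hG2i : Integrable fun τ : ℝ => (τ : ℂ) ^ 2 * G τ := by
    have := integrable_rpow_mul_exp_neg_mul_sq (b := π * α) (by positivity) (s := 2) (by norm_num)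
    refine Integrable.mono' this (by fun_prop) ?_
    refine Eventually.of_forall fun τ => le_of_eq ?_
    rw [norm_mul, hGn, norm_pow, norm_real, norm_eq_abs, sq_abs, rpow_two]
  have hPi : Integrable fun τ : ℝ => ((2 - 4 * π * α * (τ : ℂ) ^ 2 - 4 * π * ν ^ 2 / α) * G τ) := by
    have := (hGi.const_mul (2 - 4 * π * ν ^ 2 / α : ℂ)).sub (hG2i.const_mul (4 * π * α : ℂ))
    refine this.congr (Eventually.of_forall fun τ => ?_)
    simp only [Pi.sub_apply]; ring
  have hPt : Tendsto P (Filter.cocompact ℝ) (nhds 0) := by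
    have t1 := (tendsto_rpow_abs_mul_exp_neg_mul_sq_cocompact (a := π * α) (by positivity) 1).const_mul 2
    have t0 := (tendsto_rpow_abs_mul_exp_neg_mul_sq_cocompact (a := π * α) (by positivity) 0).const_mul ‖2 * I * ν / α‖
    have t := t1.add t0
    simp only [mul_zero, add_zero] at t
    refine squeeze_zero_norm (fun τ => ?_) t
    simp only [hP]
    rw [norm_mul, hGn, rpow_one, rpow_zero, one_mul, ← mul_assoc, ← add_mul]
    gcongr
    refine (norm_add_le _ _).trans ?_
    rw [norm_mul, norm_real]; simp
  have hPint := integral_of_hasDerivAt_of_tendsto hPd hPi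
    (hPt.mono_left atBot_le_cocompact) (hPt.mono_left atTop_le_cocompact)
  rw [sub_zero] at hPint
  have hGint : ∫ τ, G τ = ((1 / sqrt α * exp (-π * (ν ^ 2 / α)) : ℝ) : ℂ) := by
    have := fourierIntegral_gaussian (b := ((π * α : ℝ) : ℂ)) (by rw [Complex.ofReal_re]; positivity) (2 * π * ν)
    rw [show (fun τ => G τ) = fun x : ℝ => cexp (I * (2 * π * ν) * x) * cexp (-((π * α : ℝ) : ℂ) * (x : ℂ) ^ 2) from ?_, this]
    · push_cast
      congr 1
      · rw [show (π : ℂ) / (π * α) = ((1 / α : ℝ) : ℂ) by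
          push_cast; field_simp]
        rw [show ((1 : ℂ) / 2) = ((1 / 2 : ℝ) : ℂ) by push_cast; ring, ← Complex.ofReal_cpow (by positivity), ← sqrt_eq_rpow,
          sqrt_div zero_le_one, sqrt_one]
        push_cast; rfl
      · congr 1
        field_simp
        ring
    · ext x
      simp only [hG]
      rw [← Complex.exp_add]; congr 1; ring
  have hmain : IdR R n d = (exp (-π * α) : ℂ) * ((4 * π * (α - ν ^ 2 / α) : ℝ) : ℂ) * ∫ τ, G τ := by
    have : ∀ τ : ℝ, (phit ((d : ℝ) ^ 2 / R * (1 + τ ^ 2)) : ℂ) * eC (n * τ / R) = (exp (-π * α) : ℂ) * (((4 * π * (α - ν ^ 2 / α) : ℝ) : ℂ) * G τ -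
          (2 - 4 * π * α * (τ : ℂ) ^ 2 - 4 * π * ν ^ 2 / α) * G τ) := by
      intro τ
      have eG : (exp (-π * (α * (1 + τ ^ 2))) : ℂ) * eC (n * τ / R) = (exp (-π * α) : ℂ) * G τ := by
        simp only [hG, eC, hν]
        push_cast
        rw [← Complex.exp_add, ← Complex.exp_add]
        congr 1
        ring
      rw [← hα, phit]
      push_cast at eG ⊢
      rw [mul_assoc, eG]
      field_simp
      ring
    unfold IdR
    simp_rw [this]
    rw [integral_const_mul, integral_sub (hGi.const_mul _) hPi, hPint, sub_zero, integral_const_mul]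
    ring
  rw [hmain, hGint]
  have hsq : sqrt α = d / sqrt R := by rw [hα, sqrt_div (by positivity), sqrt_sq hd0.le]
  have e2 : ν ^ 2 / α = (n : ℝ) ^ 2 / (R * (d : ℝ) ^ 2) := by rw [hν, hα]; field_simp
  rw [hsq, e2, show -π * (α + (n : ℝ) ^ 2 / (R * (d : ℝ) ^ 2)) = -π * α + -π * ((n : ℝ) ^ 2 / (R * (d : ℝ) ^ 2)) by ring, exp_add]
  have hsR : 0 < sqrt R := sqrt_pos.mpr hR
  rw [← Complex.ofReal_natCast, ← Complex.ofReal_mul, ← Complex.ofReal_mul, ← Complex.ofReal_mul]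
  congr 1
  field_simp

/-! ### D2: the delta identity, conclusion -/

def vId (R : ℝ) (n : ℤ) (d : ℕ) : ℝ := 4 * π * sqrt R * ((d : ℝ) ^ 2 / R - (n : ℝ) ^ 2 / (R * (d : ℝ) ^ 2)) *
      exp (-π * ((d : ℝ) ^ 2 / R + (n : ℝ) ^ 2 / (R * (d : ℝ) ^ 2)))

lemma vId_sum_zero {R : ℝ} (hR : 0 < R) {n : ℤ} (hn : n ≠ 0) : ∑ d ∈ n.natAbs.divisors, vId R n d = 0 := by
  have h := Nat.sum_div_divisors n.natAbs (fun d => vId R n d)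
  have h2 : ∀ d ∈ n.natAbs.divisors, vId R n (n.natAbs / d) = - vId R n d := by
    intro d hd
    obtain ⟨e, he⟩ := dvd_of_mem_divisors hd
    have hN : n.natAbs ≠ 0 := by simpa using hn
    have hd0 : d ≠ 0 := by rintro rfl; simp at he; exact hN (by simpa using he)
    have he0 : e ≠ 0 := by rintro rfl; simp at he; exact hN (by simpa using he)
    have hnsq : (n : ℝ) ^ 2 = ((d : ℝ) * e) ^ 2 := by
      have : ((n.natAbs : ℝ)) ^ 2 = (n : ℝ) ^ 2 := by rw [Nat.cast_natAbs, Int.cast_abs, sq_abs]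
      rw [← this, he]; push_cast; ring
    rw [he, Nat.mul_div_cancel_left e (by omega)]
    unfold vId
    rw [hnsq]
    have hd1 : (d : ℝ) ≠ 0 := by exact_mod_cast hd0
    have he1 : (e : ℝ) ≠ 0 := by exact_mod_cast he0
    have e1 : ((d : ℝ) * e) ^ 2 / (R * (e : ℝ) ^ 2) = (d : ℝ) ^ 2 / R := by field_simp
    have e2 : ((d : ℝ) * e) ^ 2 / (R * (d : ℝ) ^ 2) = (e : ℝ) ^ 2 / R := by field_simp
    rw [e1, e2, add_comm ((e : ℝ) ^ 2 / R)]
    ring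
  rw [sum_congr rfl h2, sum_neg_distrib] at h
  linarith

lemma ram_Id_summable {R : ℝ} (hR : 0 < R) (n : ℤ) : Summable fun p : ℕ+ × ℕ+ => ram p.1 n * IdR R n ((p.1 : ℕ) * (p.2 : ℕ)) := by
  have s5 : Summable fun q : ℕ+ => 1 / ((q : ℕ) : ℝ) ^ 5 := (summable_pnat_iff_summable_nat (f := fun q : ℕ => 1 / (q : ℝ) ^ 5)).mpr
      (summable_one_div_nat_pow.mpr (by norm_num))
  have s6 : Summable fun q : ℕ+ => 500 * R ^ 3 * π * (1 / ((q : ℕ) : ℝ) ^ 6) :=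
    Summable.mul_left _ ((summable_pnat_iff_summable_nat (f := fun q : ℕ => 1 / (q : ℝ) ^ 6)).mpr
      (summable_one_div_nat_pow.mpr (by norm_num)))
  have s := Summable.mul_of_nonneg s5 s6 (fun q => by positivity)
    (fun q => by have := pi_pos; positivity)
  refine Summable.of_norm_bounded s fun p => ?_
  have hp1 : (0 : ℝ) < ((p.1 : ℕ) : ℝ) := by exact_mod_cast p.1.pos
  have hp2 : (0 : ℝ) < ((p.2 : ℕ) : ℝ) := by exact_mod_cast p.2.pos
  have hI : ‖IdR R n ((p.1 : ℕ) * (p.2 : ℕ))‖ ≤ 500 * R ^ 3 * π * (1 / (((p.1 : ℕ) * (p.2 : ℕ) : ℕ) : ℝ) ^ 6) :=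
    (norm_integral_le_integral_norm _).trans (Id_norm_le hR n (mul_ne_zero p.1.ne_zero p.2.ne_zero))
  rw [norm_mul]
  calc _ ≤ ((p.1 : ℕ) : ℝ) * (500 * R ^ 3 * π * (1 / (((p.1 : ℕ) * (p.2 : ℕ) : ℕ) : ℝ) ^ 6)) := by
        apply mul_le_mul (norm_ram_le _ _) hI (norm_nonneg _) hp1.le
    _ = _ := by push_cast; field_simp

theorem delta_id {R : ℝ} (hR : 0 < R) (n : ℤ) : HasSum (fun q : ℕ => ram q n * Hint R n q) (if n = 0 then ((R * (1 - HH R) : ℝ) : ℂ) else 0) := by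
  obtain ⟨T, hT⟩ := ram_Id_summable hR n
  have h1 : HasSum (fun q : ℕ+ => ram q n * Hint R n q) T := by
    refine HasSum.prod_fiberwise (g := fun q : ℕ+ => ram q n * Hint R n q) hT fun q => ?_
    have hq : HasSum (fun j : ℕ+ => IdR R n ((q : ℕ) * (j : ℕ))) (Hint R n q) :=
      (hasSum_pnat_iff_hasSum_succ (f := fun j : ℕ => IdR R n ((q : ℕ) * j))).mpr (Hint_hasSum hR n q.ne_zero)
    exact HasSum.mul_left (ram q n) hq
  have h1' : HasSum (fun q : ℕ => ram q n * Hint R n q) T := by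
    have := (hasSum_pnat_iff (f := fun q : ℕ => ram q n * Hint R n q)).mp h1
    simpa [ram] using this
  have h2 : HasSum (fun d : ℕ+ => if ((d : ℕ) : ℤ) ∣ n then (vId R n d : ℂ) else 0) T := by
    have h3 := sigmaAntidiagonalEquivProd.hasSum_iff.mpr hT
    refine h3.sigma fun d => ?_
    have e : ∀ c : ↥((d : ℕ).divisorsAntidiagonal),
        ((fun p : ℕ+ × ℕ+ => ram p.1 n * IdR R n ((p.1 : ℕ) * (p.2 : ℕ))) ∘ sigmaAntidiagonalEquivProd) ⟨d, c⟩ =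
        ram c.1.1 n * IdR R n d := by
      intro c
      simp only [Function.comp, sigmaAntidiagonalEquivProd, divisorsAntidiagonalFactors, Equiv.coe_fn_mk, PNat.mk_coe]
      rw [(Nat.mem_divisorsAntidiagonal.mp c.2).1]
    have hsum : (∑ c : ↥((d : ℕ).divisorsAntidiagonal), ram c.1.1 n * IdR R n d) = if ((d : ℕ) : ℤ) ∣ n then (vId R n d : ℂ) else 0 := by
      rw [sum_coe_sort (d : ℕ).divisorsAntidiagonal (fun c => ram c.1 n * IdR R n d),
        Nat.sum_divisorsAntidiagonal (fun x _ => ram x n * IdR R n d), ← sum_mul, sum_ram d.ne_zero]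
      have := Id_eval hR n d.ne_zero
      split_ifs with h
      · rw [this]; rfl
      · simp
    rw [← hsum]
    exact (hasSum_fintype _).congr_fun e
  convert h1' using 1
  have h2' : HasSum (fun d : ℕ => if d = 0 then 0 else if ((d : ℕ) : ℤ) ∣ n then (vId R n d : ℂ) else 0) T := by
    have := (hasSum_pnat_iff (f := fun d : ℕ => if d = 0 then 0 else if ((d : ℕ) : ℤ) ∣ n then (vId R n d : ℂ) else 0) (a := T)).mp
      (h2.congr_fun fun d => by simp)
    simpa using this
  split_ifs with hn
  · subst hn
    have h3 := (hasSum_pnat_iff_hasSum_succ (f := fun d : ℕ => if ((d : ℕ) : ℤ) ∣ 0 then (vId R 0 d : ℂ) else 0)).mp h2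
    rw [HH_modular hR, TT, ← h3.tsum_eq, sub_sub_cancel, ← tsum_mul_left, ← tsum_mul_left, Complex.ofReal_tsum]
    congr 1; ext d
    simp only [dvd_zero, if_true]
    congr 1
    unfold vId gT
    have : R * R ^ (-(3 : ℝ) / 2) = sqrt R / R := by
      rw [sqrt_eq_rpow, eq_div_iff hR.ne', mul_comm R, mul_assoc, ← pow_two, ← rpow_natCast R 2, ← rpow_add hR]
      norm_num
    rw [show R * (4 * π * R ^ (-(3 : ℝ) / 2) * (((d : ℝ) + 1) ^ 2 * exp (-π * ((d : ℝ) + 1) ^ 2 * (1 / R)))) =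
      4 * π * (R * R ^ (-(3 : ℝ) / 2)) * (((d : ℝ) + 1) ^ 2 * exp (-π * ((d : ℝ) + 1) ^ 2 * (1 / R))) by ring, this]
    push_cast
    rw [show -π * (((d : ℝ) + 1) ^ 2 / R + 0 ^ 2 / (R * ((d : ℝ) + 1) ^ 2)) = -π * ((d : ℝ) + 1) ^ 2 * (1 / R) by ring]
    ring
  · have hf : HasSum (fun d : ℕ => if d = 0 then 0 else if ((d : ℕ) : ℤ) ∣ n then (vId R n d : ℂ) else 0)
        (∑ d ∈ n.natAbs.divisors, if d = 0 then 0 else if ((d : ℕ) : ℤ) ∣ n then (vId R n d : ℂ) else 0) := by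
      apply hasSum_sum_of_ne_finset_zero
      intro d hd
      by_cases h0 : d = 0
      · simp [h0]
      · have : ¬ (d : ℤ) ∣ n := by
          intro h
          exact hd (Nat.mem_divisors.mpr ⟨Int.natCast_dvd.mp h, by simpa using hn⟩)
        simp [this]
    have := hf.unique h2'
    rw [← this]
    have e : ∀ d ∈ n.natAbs.divisors, (if d = 0 then 0 else if ((d : ℕ) : ℤ) ∣ n then (vId R n d : ℂ) else 0) = (vId R n d : ℂ) := by
      intro d hd
      have hd' := Nat.mem_divisors.mp hd
      have h0 : d ≠ 0 := by rintro rfl; simp at hd'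
      simp [h0, Int.natCast_dvd.mpr hd'.1]
    rw [sum_congr rfl e, ← Complex.ofReal_sum, vId_sum_zero hR hn]
    simp

/-! ### E1: one-dimensional Poisson summation and product sums -/

lemma summable_inv_one_add_mul_sq {t : ℝ} (ht : 0 < t) : Summable fun n : ℤ => 1 / (1 + t * (n : ℝ) ^ 2) := by
  have s1 : Summable fun n : ℤ => (if n = 0 then (1 : ℝ) else 0) := (hasSum_ite_eq (0 : ℤ) (1 : ℝ)).summable
  have s2 : Summable fun n : ℤ => (1 / t) * (1 / (n : ℝ) ^ 2) := Summable.mul_left _ (summable_one_div_int_pow.mpr (by norm_num))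
  refine Summable.of_nonneg_of_le (fun n => by positivity) (fun n => ?_) (s1.add s2)
  by_cases hn : n = 0
  · subst hn; simp
  · have : (0 : ℝ) < (n : ℝ) ^ 2 := by positivity
    simp only [hn, if_false, zero_add]
    rw [div_mul_div_comm, one_mul]
    gcongr
    linarith

lemma exp_neg_le_inv {u : ℝ} (hu : 0 ≤ u) : exp (-u) ≤ 1 / (1 + u) := by
  rw [exp_neg, ← one_div]
  gcongr
  linarith [add_one_le_exp u]

lemma summable_gauss_int {t : ℝ} (ht : 0 < t) : Summable fun n : ℤ => exp (-(t * (n : ℝ) ^ 2)) :=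
  Summable.of_nonneg_of_le (fun n => (exp_pos _).le) (fun n => exp_neg_le_inv (by positivity))
    (summable_inv_one_add_mul_sq ht)

lemma tsum_pi_prod : ∀ (n : ℕ) (f : Fin n → ℤ → ℂ), (∀ i, Summable fun x => ‖f i x‖) → (Summable fun x : Fin n → ℤ => ‖∏ i, f i (x i)‖) ∧
      HasSum (fun x : Fin n → ℤ => ∏ i, f i (x i)) (∏ i, ∑' x, f i x) := by
  intro n
  induction n with
  | zero =>
    intro f _
    have : Finite (Fin 0 → ℤ) := inferInstance
    refine ⟨Summable.of_finite, ?_⟩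
    simpa using hasSum_unique (fun x : Fin 0 → ℤ => (1 : ℂ))
  | succ n ih =>
    intro f hf
    obtain ⟨h1, h2⟩ := ih (fun i => f i.succ) (fun i => hf i.succ)
    have e : ∀ p : ℤ × (Fin n → ℤ), (∏ i, f i ((Fin.consEquiv (fun _ => ℤ)) p i)) = f 0 p.1 * ∏ i : Fin n, f i.succ (p.2 i) := by
      intro p
      rw [Fin.prod_univ_succ]
      simp
    constructor
    · rw [← (Fin.consEquiv (fun _ : Fin (n + 1) => ℤ)).summable_iff]
      refine (summable_mul_of_summable_norm (f := fun x => ‖f 0 x‖) (g := fun y : Fin n → ℤ => ‖∏ i : Fin n, f i.succ (y i)‖)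
        (by simpa using hf 0) (by simpa using h1)).congr fun p => ?_
      simp only [Function.comp]
      rw [e, norm_mul]
    · rw [← (Fin.consEquiv (fun _ : Fin (n + 1) => ℤ)).hasSum_iff]
      rw [Fin.prod_univ_succ, ← h2.tsum_eq, tsum_mul_tsum_of_summable_norm (hf 0) h1]
      refine (summable_mul_of_summable_norm (hf 0) h1).hasSum.congr_fun fun p => ?_
      simp only [Function.comp]
      rw [e]

def csq (w : ℂ) : ℂ := 1 / w ^ (1 / 2 : ℂ)

lemma csq_norm {w : ℂ} (hw : w ≠ 0) : ‖csq w‖ = ‖w‖ ^ (-(1 / 2) : ℝ) := by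
  unfold csq
  rw [norm_div, norm_one, Complex.norm_cpow_of_ne_zero hw, rpow_neg (norm_nonneg _)]
  norm_num

lemma csq_real_mul {r : ℝ} (hr : 0 < r) {w : ℂ} (hw : w ≠ 0) : csq (r * w) = ((1 / sqrt r : ℝ) : ℂ) * csq w := by
  unfold csq
  have hr' : (r : ℂ) ≠ 0 := by exact_mod_cast hr.ne'
  have : ((r : ℂ) * w) ^ (1 / 2 : ℂ) = ((sqrt r : ℝ) : ℂ) * w ^ (1 / 2 : ℂ) := by
    rw [Complex.cpow_def_of_ne_zero (mul_ne_zero hr' hw), Complex.log_ofReal_mul hr hw, add_mul, Complex.exp_add,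
      ← Complex.cpow_def_of_ne_zero hw, sqrt_eq_rpow, Complex.ofReal_cpow hr.le, Complex.cpow_def_of_ne_zero hr',
      Complex.ofReal_log hr.le]
    norm_num
  rw [this]
  push_cast
  field_simp

lemma norm_gauss {z : ℂ} (t : ℝ) : ‖cexp (-π * z * (t : ℂ) ^ 2)‖ = exp (-(π * z.re * t ^ 2)) := by
  rw [Complex.norm_exp]
  congr 1
  have : (-π * z * (t : ℂ) ^ 2) = ((-π * t ^ 2 : ℝ) : ℂ) * z := by push_cast; ring
  rw [this, re_ofReal_mul]; ring

lemma summable_norm_gauss {z : ℂ} (hz : 0 < z.re) : Summable fun n : ℤ => ‖cexp (-π * z * (n : ℂ) ^ 2)‖ := by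
  have := summable_gauss_int (t := π * z.re) (by have := pi_pos; positivity)
  refine this.congr fun n => ?_
  have := norm_gauss (z := z) (n : ℝ)
  push_cast at this
  rw [this]

lemma theta_residue {q : ℕ} (hq : q ≠ 0) {z : ℂ} (hz : 0 < z.re) (b : ℤ) : ∑' y : ℤ, cexp (-π * z * ((y * q + b : ℤ) : ℂ) ^ 2) =
      ((1 / q : ℝ) : ℂ) * csq z * ∑' c : ℤ, eQ q (c * b) * cexp (-π * (1 / ((q : ℂ) ^ 2 * z)) * (c : ℂ) ^ 2) := by
  have hq0 : (0 : ℝ) < q := by positivity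
  have hqC : (q : ℂ) ≠ 0 := by exact_mod_cast hq
  have hz0 : z ≠ 0 := by rintro rfl; simp at hz
  have ha : 0 < (((q : ℝ) ^ 2 : ℝ) * z : ℂ).re := by rw [re_ofReal_mul]; positivity
  have h := Complex.tsum_exp_neg_quadratic ha (-(q * b * z))
  have h1 : ∀ y : ℤ, cexp (-π * z * ((y * q + b : ℤ) : ℂ) ^ 2) = cexp (-π * z * (b : ℂ) ^ 2) *
       cexp (-π * (((q : ℝ) ^ 2 : ℝ) * z : ℂ) * (y : ℂ) ^ 2 + 2 * π * (-(q * b * z)) * y) := by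
    intro y
    rw [← Complex.exp_add]; congr 1; push_cast; ring
  have h2 : ∀ c : ℤ, eQ q (c * b) * cexp (-π * (1 / ((q : ℂ) ^ 2 * z)) * (c : ℂ) ^ 2) = cexp (-π * z * (b : ℂ) ^ 2) *
      cexp (-π / (((q : ℝ) ^ 2 : ℝ) * z : ℂ) * ((c : ℂ) + I * (-(q * b * z))) ^ 2) := by
    intro c
    unfold eQ eC
    rw [← Complex.exp_add, ← Complex.exp_add]
    congr 1
    push_cast
    field_simp
    ring_nf
    simp only [Complex.I_sq]
    ring
  simp_rw [h1, h2]
  rw [tsum_mul_left, tsum_mul_left, h]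
  have h3 := csq_real_mul (r := (q : ℝ) ^ 2) (by positivity) hz0
  rw [sqrt_sq hq0.le] at h3
  rw [← h3]
  unfold csq
  ring

lemma theta_poisson {q : ℕ} (hq : q ≠ 0) (m : ℤ) {z : ℂ} (hz : 0 < z.re) : ∑' x : ℤ, eQ q (m * x ^ 2) * cexp (-π * z * (x : ℂ) ^ 2) =
      ((1 / q : ℝ) : ℂ) * csq z * ∑' c : ℤ, Gs q m c * cexp (-π * (1 / ((q : ℂ) ^ 2 * z)) * (c : ℂ) ^ 2) := by
  haveI : NeZero q := ⟨hq⟩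
  have hq0 : (0 : ℝ) < q := by positivity
  have hsum : Summable fun x : ℤ => eQ q (m * x ^ 2) * cexp (-π * z * (x : ℂ) ^ 2) := by
    refine Summable.of_norm ((summable_norm_gauss hz).congr fun x => ?_)
    rw [norm_mul, norm_eQ, one_mul]
  have hz0 : z ≠ 0 := by rintro rfl; simp at hz
  have hzi : 0 < (1 / ((q : ℂ) ^ 2 * z)).re := by
    have e : (1 / ((q : ℂ) ^ 2 * z)) = ((1 / (q : ℝ) ^ 2 : ℝ) : ℂ) * z⁻¹ := by push_cast; field_simp
    rw [e, re_ofReal_mul, Complex.inv_re]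
    have := Complex.normSq_pos.mpr hz0
    positivity
  rw [← (Int.divModEquiv q).symm.tsum_eq, ← (Equiv.prodComm _ _).tsum_eq]
  have hs2 := (Equiv.prodComm _ _).summable_iff.mpr ((Int.divModEquiv q).symm.summable_iff.mpr hsum)
  refine (Summable.tsum_prod hs2).trans ?_
  · rw [tsum_fintype]
    simp only [Function.comp, Equiv.prodComm_apply, Prod.swap, Int.divModEquiv_symm_apply]
    have h1 : ∀ b : Fin q, ∑' y : ℤ, eQ q (m * (y * q + (b : ℕ) : ℤ) ^ 2) * cexp (-π * z * ((y * q + (b : ℕ) : ℤ) : ℂ) ^ 2) =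
        ((1 / q : ℝ) : ℂ) * csq z * ∑' c : ℤ, eQ q (m * (b : ℕ) ^ 2 + c * (b : ℕ)) * cexp (-π * (1 / ((q : ℂ) ^ 2 * z)) * (c : ℂ) ^ 2) := by
      intro b
      have h2 : ∀ y : ℤ, eQ q (m * (y * q + (b : ℕ) : ℤ) ^ 2) = eQ q (m * (b : ℕ) ^ 2) := by
        intro y
        apply eQ_cong hq
        exact ⟨m * (y ^ 2 * q + 2 * y * (b : ℕ)), by ring⟩
      simp_rw [h2]
      rw [tsum_mul_left, theta_residue hq hz]
      simp_rw [eQ_add, mul_assoc]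
      rw [tsum_mul_left]
      ring
    rw [sum_congr rfl fun b _ => h1 b, ← mul_sum]
    congr 1
    rw [← Summable.tsum_finsetSum]
    · congr 1; ext c
      rw [← sum_mul, Gs, sum_range]
    · intro b _
      refine Summable.of_norm ((summable_norm_gauss hzi).congr fun x => ?_)
      rw [norm_mul, norm_eQ, one_mul]

/-! ### E2: pointwise bounds for the oscillatory integrand -/

def wv (e : ℤ⁴) (ζ : ℂ⁴) (τ : ℝ) (i : Fin 4) : ℂ := ζ i - I * (((e i : ℝ) * τ : ℝ) : ℂ)

def Jint (e : ℤ⁴) (ζ : ℂ⁴) (b : Fin 4 → ℝ) (α τ : ℝ) : ℂ := ∏ i, (csq (wv e ζ τ i) * cexp (-((π / (2 * α) * b i : ℝ) : ℂ) * (wv e ζ τ i)⁻¹))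

def JJ (e : ℤ⁴) (ζ : ℂ⁴) (b : Fin 4 → ℝ) (α : ℝ) : ℂ := ∫ τ : ℝ, (HH (α * (1 + τ ^ 2)) : ℂ) * Jint e ζ b α τ

lemma wv_re (e : ℤ⁴) (ζ : ℂ⁴) (τ : ℝ) (i : Fin 4) : (wv e ζ τ i).re = (ζ i).re := by
  unfold wv; simp

lemma one_le_norm_of_re {z : ℂ} (h : 1 ≤ z.re) : 1 ≤ ‖z‖ := h.trans (Complex.re_le_norm z)

lemma wv_ne {e : ℤ⁴} {ζ : ℂ⁴} (hζ : ∀ i, 1 ≤ (ζ i).re) (τ : ℝ) (i : Fin 4) : wv e ζ τ i ≠ 0 := by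
  intro h
  have := wv_re e ζ τ i
  rw [h] at this
  have := hζ i
  simp at *
  linarith

lemma wv_upper {e : ℤ⁴} (he : ∀ i, |e i| = 1) {ζ : ℂ⁴} (hζ : ∀ i, 1 ≤ (ζ i).re) (τ : ℝ) (i : Fin 4) :
    ‖wv e ζ τ i‖ ^ 2 ≤ 2 * ‖ζ i‖ ^ 2 * (1 + τ ^ 2) := by
  have h1 : ‖wv e ζ τ i‖ ≤ ‖ζ i‖ + |τ| := by
    refine (norm_sub_le _ _).trans ?_
    have : |(e i : ℝ)| = 1 := by exact_mod_cast he i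
    rw [norm_mul, Complex.norm_I, one_mul, norm_real, norm_eq_abs, abs_mul, this, one_mul]
  have h2 := one_le_norm_of_re (hζ i)
  have h3 : ‖wv e ζ τ i‖ ^ 2 ≤ (‖ζ i‖ + |τ|) ^ 2 := by gcongr
  have h4 := sq_abs τ
  nlinarith [sq_nonneg (‖ζ i‖ - |τ|), mul_nonneg (by nlinarith : 0 ≤ ‖ζ i‖ ^ 2 - 1) (sq_nonneg τ)]

lemma wv_lower {e : ℤ⁴} (he : ∀ i, |e i| = 1) {ζ : ℂ⁴} (hζ : ∀ i, 1 ≤ (ζ i).re) (τ : ℝ) (i : Fin 4) :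
    1 + τ ^ 2 ≤ 5 * ‖ζ i‖ ^ 2 * ‖wv e ζ τ i‖ ^ 2 := by
  have h1 : |τ| ≤ ‖ζ i‖ + ‖wv e ζ τ i‖ := by
    have : |(e i : ℝ)| = 1 := by exact_mod_cast he i
    have h : I * (((e i : ℝ) * τ : ℝ) : ℂ) = ζ i - wv e ζ τ i := by unfold wv; ring
    have h2 : ‖I * (((e i : ℝ) * τ : ℝ) : ℂ)‖ = |τ| := by
      rw [norm_mul, Complex.norm_I, one_mul, norm_real, norm_eq_abs, abs_mul, this, one_mul]
    rw [← h2, h]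
    exact norm_sub_le _ _
  have h2 := one_le_norm_of_re (hζ i)
  have h3 : 1 ≤ ‖wv e ζ τ i‖ := one_le_norm_of_re (by rw [wv_re]; exact hζ i)
  have h4 : |τ| ≤ 2 * (‖ζ i‖ * ‖wv e ζ τ i‖) := by nlinarith [mul_nonneg (sub_nonneg.mpr h2) (sub_nonneg.mpr h3)]
  have h5 : 1 ≤ ‖ζ i‖ * ‖wv e ζ τ i‖ := by nlinarith
  have h6 : |τ| ^ 2 ≤ (2 * (‖ζ i‖ * ‖wv e ζ τ i‖)) ^ 2 := by gcongr
  rw [sq_abs] at h6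
  nlinarith

lemma prod_csq_bound {e : ℤ⁴} (he : ∀ i, |e i| = 1) {ζ : ℂ⁴} (hζ : ∀ i, 1 ≤ (ζ i).re) (τ : ℝ) :
    ∏ i, ‖csq (wv e ζ τ i)‖ ≤ 5 * (∏ i, ‖ζ i‖ ^ (1 / 2 : ℝ)) * (1 + τ ^ 2)⁻¹ := by
  have hT : 0 < 1 + τ ^ 2 := by positivity
  have h1 : ∀ i, ‖csq (wv e ζ τ i)‖ ≤ 5 ^ (1 / 4 : ℝ) * ‖ζ i‖ ^ (1 / 2 : ℝ) * (1 + τ ^ 2) ^ (-(1 / 4) : ℝ) := by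
    intro i
    have hw : 0 < ‖wv e ζ τ i‖ := norm_pos_iff.mpr (wv_ne hζ τ i)
    have hz : 0 < ‖ζ i‖ := lt_of_lt_of_le one_pos (one_le_norm_of_re (hζ i))
    rw [csq_norm (wv_ne hζ τ i), rpow_neg hT.le, ← div_eq_mul_inv, le_div_iff₀ (by positivity)]
    rw [rpow_neg hw.le, inv_mul_le_iff₀ (by positivity)]
    have h := rpow_le_rpow hT.le (wv_lower he hζ τ i) (by norm_num : (0 : ℝ) ≤ 1 / 4)
    refine h.trans (le_of_eq ?_)
    rw [mul_rpow (by positivity) (by positivity), mul_rpow (by positivity) (by positivity),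
      ← rpow_natCast, ← rpow_natCast, ← rpow_mul hz.le, ← rpow_mul hw.le]
    norm_num
    ring
  calc _ ≤ ∏ i, (5 ^ (1 / 4 : ℝ) * ‖ζ i‖ ^ (1 / 2 : ℝ) * (1 + τ ^ 2) ^ (-(1 / 4) : ℝ)) := prod_le_prod (fun i _ => norm_nonneg _) (fun i _ => h1 i)
    _ = _ := by
      rw [prod_mul_distrib, prod_mul_distrib, prod_const, prod_const, ← rpow_natCast, ← rpow_natCast, ← rpow_mul (by norm_num), ← rpow_mul hT.le]
      norm_num [rpow_neg_one]

lemma wv_inv_re {e : ℤ⁴} (he : ∀ i, |e i| = 1) {ζ : ℂ⁴} (hζ : ∀ i, 1 ≤ (ζ i).re) (τ : ℝ) (i : Fin 4) :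
    1 / (2 * ‖ζ i‖ ^ 2 * (1 + τ ^ 2)) ≤ ((wv e ζ τ i)⁻¹).re := by
  rw [Complex.inv_re, Complex.normSq_eq_norm_sq, wv_re]
  have hw : 0 < ‖wv e ζ τ i‖ := norm_pos_iff.mpr (wv_ne hζ τ i)
  exact div_le_div₀ (by linarith [hζ i]) (hζ i) (by positivity) (wv_upper he hζ τ i)

lemma exp_factor_bound {e : ℤ⁴} (he : ∀ i, |e i| = 1) {ζ : ℂ⁴} (hζ : ∀ i, 1 ≤ (ζ i).re) (τ : ℝ) (i : Fin 4)
    {α b : ℝ} (hα : 0 < α) (hb : 0 ≤ b) :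
    ‖cexp (-((π / (2 * α) * b : ℝ) : ℂ) * (wv e ζ τ i)⁻¹)‖ ≤ exp (-(b / (2 * ‖ζ i‖ ^ 2) / (α * (1 + τ ^ 2)))) := by
  rw [Complex.norm_exp, ← Complex.ofReal_neg, re_ofReal_mul]
  apply exp_le_exp.mpr
  have h1 := wv_inv_re he hζ τ i
  have hz : 0 < ‖ζ i‖ := lt_of_lt_of_le one_pos (one_le_norm_of_re (hζ i))
  have hp := pi_gt_three
  rw [neg_mul, neg_le_neg_iff]
  calc b / (2 * ‖ζ i‖ ^ 2) / (α * (1 + τ ^ 2)) = 2 / (2 * α) * b * (1 / (2 * ‖ζ i‖ ^ 2 * (1 + τ ^ 2))) := by field_simp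
    _ ≤ π / (2 * α) * b * ((wv e ζ τ i)⁻¹).re := by
      gcongr
      linarith

lemma continuous_csq {f : ℝ → ℂ} (hf : Continuous f) (h : ∀ t, 0 < (f t).re) : Continuous fun t => csq (f t) := by
  unfold csq
  refine Continuous.div continuous_const ?_ fun t => ?_
  · exact hf.cpow continuous_const fun t => Or.inl (h t)
  · rw [Complex.cpow_ne_zero_iff]
    left
    intro h0; have := h t; rw [h0] at this; simp at this

lemma continuous_wv (e : ℤ⁴) (ζ : ℂ⁴) (i : Fin 4) : Continuous fun τ => wv e ζ τ i := by
  unfold wv; fun_prop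

lemma continuous_Jint (e : ℤ⁴) {ζ : ℂ⁴} (hζ : ∀ i, 1 ≤ (ζ i).re) (b : Fin 4 → ℝ) (α : ℝ) : Continuous fun τ => Jint e ζ b α τ := by
  unfold Jint
  refine continuous_finset_prod _ fun i _ => ?_
  refine (continuous_csq (continuous_wv e ζ i) fun t => by rw [wv_re]; linarith [hζ i]).mul ?_
  refine Complex.continuous_exp.comp (continuous_const.mul ?_)
  exact (continuous_wv e ζ i).inv₀ fun t => wv_ne hζ t i

lemma continuous_HH_comp {α : ℝ} (hα : 0 < α) : Continuous fun τ : ℝ => HH (α * (1 + τ ^ 2)) := by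
  rw [continuous_iff_continuousAt]
  intro τ
  have h : 0 < α * (1 + τ ^ 2) := by positivity
  exact ContinuousAt.comp (f := fun τ : ℝ => α * (1 + τ ^ 2)) (g := HH) (hasDerivAt_HH h).continuousAt (by fun_prop)

/-- the exponential decay part -/
def Lam (ζ : ℂ⁴) (b : Fin 4 → ℝ) (Y : ℝ) : ℝ := ∏ i, exp (-(b i / (2 * ‖ζ i‖ ^ 2) / Y))

lemma Jint_bound {e : ℤ⁴} (he : ∀ i, |e i| = 1) {ζ : ℂ⁴} (hζ : ∀ i, 1 ≤ (ζ i).re) (τ : ℝ)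
    {α : ℝ} (hα : 0 < α) {b : Fin 4 → ℝ} (hb : ∀ i, 0 ≤ b i) :
    ‖Jint e ζ b α τ‖ ≤ 5 * (∏ i, ‖ζ i‖ ^ (1 / 2 : ℝ)) * (1 + τ ^ 2)⁻¹ * Lam ζ b (α * (1 + τ ^ 2)) := by
  unfold Jint Lam
  rw [norm_prod]
  simp_rw [norm_mul]
  rw [prod_mul_distrib]
  refine mul_le_mul (prod_csq_bound he hζ τ) ?_ (prod_nonneg fun i _ => norm_nonneg _) (by positivity)
  exact prod_le_prod (fun i _ => norm_nonneg _) fun i _ => exp_factor_bound he hζ τ i hα (hb i)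

lemma Lam_le_inv {ζ : ℂ⁴} {b : Fin 4 → ℝ} (hb : ∀ i, 0 ≤ b i) {Y : ℝ} (hY : 0 < Y) :
    Lam ζ b Y ≤ (1 + Y) ^ 4 * ∏ i, (1 / (1 + b i / (2 * ‖ζ i‖ ^ 2))) := by
  have h : ∀ i, exp (-(b i / (2 * ‖ζ i‖ ^ 2) / Y)) ≤ (1 + Y) * (1 / (1 + b i / (2 * ‖ζ i‖ ^ 2))) := by
    intro i
    have := hb i
    set u := b i / (2 * ‖ζ i‖ ^ 2) with hu
    have hu0 : 0 ≤ u := by positivity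
    refine (exp_neg_le_inv (by positivity)).trans ?_
    rw [mul_one_div, div_le_div_iff₀ (by positivity) (by positivity)]
    have e1 : (1 + Y) * (1 + u / Y) = 1 + u + Y + u / Y := by field_simp; ring
    have : 0 ≤ u / Y := by positivity
    linarith
  calc Lam ζ b Y ≤ ∏ i, ((1 + Y) * (1 / (1 + b i / (2 * ‖ζ i‖ ^ 2)))) := prod_le_prod (fun i _ => (exp_pos _).le) (fun i _ => h i)
    _ = _ := by rw [prod_mul_distrib, prod_const]; rfl

lemma HH_poly_bound : ∃ C : ℝ, 1 ≤ C ∧ ∀ Y : ℝ, 0 < Y → |HH Y| * (1 + Y) ^ 4 ≤ C / Y ^ 3 := by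
  obtain ⟨C, hC, h⟩ := HH_bounds
  refine ⟨C * 6000000, by linarith, fun Y hY => ?_⟩
  rw [le_div_iff₀ (by positivity)]
  have h1 := pow_mul_exp_le 3 hY.le
  have h2 := pow_mul_exp_le 7 hY.le
  norm_num [Nat.factorial] at h1 h2
  have h4 : (1 + Y) ^ 4 ≤ 8 + 8 * Y ^ 4 := by nlinarith [sq_nonneg (Y - 1), sq_nonneg (Y ^ 2 - 1), sq_nonneg (Y ^ 2 - Y), sq_nonneg (Y+1), mul_pos hY hY]
  calc |HH Y| * (1 + Y) ^ 4 * Y ^ 3 ≤ (C * exp (-Y)) * (8 + 8 * Y ^ 4) * Y ^ 3 := by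
        have := (h Y hY).1
        gcongr
    _ = C * (8 * (Y ^ 3 * exp (-Y)) + 8 * (Y ^ 7 * exp (-Y))) := by ring
    _ ≤ C * 6000000 := by
      gcongr
      linarith

lemma J_abs : ∃ C : ℝ, 1 ≤ C ∧ ∀ (e : ℤ⁴), (∀ i, |e i| = 1) → ∀ (ζ : ℂ⁴), (∀ i, 1 ≤ (ζ i).re) → ∀ (b : Fin 4 → ℝ), (∀ i, 0 ≤ b i) → ∀ α : ℝ, 0 < α →
    Integrable (fun τ : ℝ => (HH (α * (1 + τ ^ 2)) : ℂ) * Jint e ζ b α τ) ∧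
    ∫ τ : ℝ, ‖(HH (α * (1 + τ ^ 2)) : ℂ) * Jint e ζ b α τ‖ ≤ C * (∏ i, ‖ζ i‖ ^ (1 / 2 : ℝ)) / α ^ 3 * ∏ i, (1 / (1 + b i / (2 * ‖ζ i‖ ^ 2))) := by
  obtain ⟨C, hC, h⟩ := HH_poly_bound
  refine ⟨C * 5 * π, by nlinarith [pi_gt_three], ?_⟩
  intro e he ζ hζ b hb α hα
  set P := ∏ i, (1 / (1 + b i / (2 * ‖ζ i‖ ^ 2))) with hP
  have hP0 : 0 ≤ P := prod_nonneg fun i _ => by have := hb i; positivity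
  set Z := ∏ i, ‖ζ i‖ ^ (1 / 2 : ℝ) with hZ
  have hZ0 : 0 ≤ Z := prod_nonneg fun i _ => by positivity
  have hpt : ∀ τ : ℝ, ‖(HH (α * (1 + τ ^ 2)) : ℂ) * Jint e ζ b α τ‖ ≤ (C * 5 * Z / α ^ 3 * P) * (1 + τ ^ 2)⁻¹ := by
    intro τ
    have hT : 1 ≤ 1 + τ ^ 2 := by nlinarith [sq_nonneg τ]
    have hY : 0 < α * (1 + τ ^ 2) := by positivity
    rw [norm_mul, norm_real, norm_eq_abs]
    calc |HH (α * (1 + τ ^ 2))| * ‖Jint e ζ b α τ‖ ≤ |HH (α * (1 + τ ^ 2))| * (5 * Z * (1 + τ ^ 2)⁻¹ * ((1 + α * (1 + τ ^ 2)) ^ 4 * P)) := by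
            refine mul_le_mul_of_nonneg_left ?_ (abs_nonneg _)
            refine (Jint_bound he hζ τ hα hb).trans ?_
            exact mul_le_mul_of_nonneg_left (Lam_le_inv hb hY) (by positivity)
      _ = (|HH (α * (1 + τ ^ 2))| * (1 + α * (1 + τ ^ 2)) ^ 4) * (5 * Z * (1 + τ ^ 2)⁻¹ * P) := by ring
      _ ≤ (C / α ^ 3) * (5 * Z * (1 + τ ^ 2)⁻¹ * P) := by
        refine mul_le_mul_of_nonneg_right ?_ (by positivity)
        refine (h _ hY).trans ?_
        gcongr
        nlinarith
      _ = _ := by ring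
  have hm : AEStronglyMeasurable (fun τ : ℝ => (HH (α * (1 + τ ^ 2)) : ℂ) * Jint e ζ b α τ) volume := by
    apply Continuous.aestronglyMeasurable
    exact (Complex.continuous_ofReal.comp (continuous_HH_comp hα)).mul (continuous_Jint e hζ b α)
  have hi := integrable_inv_one_add_sq.const_mul (C * 5 * Z / α ^ 3 * P)
  have hInt : Integrable (fun τ : ℝ => (HH (α * (1 + τ ^ 2)) : ℂ) * Jint e ζ b α τ) := hi.mono' hm (Eventually.of_forall hpt)
  refine ⟨hInt, ?_⟩
  calc _ ≤ ∫ τ : ℝ, (C * 5 * Z / α ^ 3 * P) * (1 + τ ^ 2)⁻¹ := integral_mono hInt.norm hi hpt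
    _ = _ := by rw [integral_const_mul, integral_univ_inv_one_add_sq]; ring

/-! ### E3: Poisson assembly -/

def sgv (a : ℤ⁴) (i : Fin 4) : ℤ := Int.sign (a i)
def nab (a : ℤ⁴) (i : Fin 4) : ℝ := ((a i).natAbs : ℝ)
def bv (a c : ℤ⁴) (i : Fin 4) : ℝ := (c i : ℝ) ^ 2 / nab a i
def Fq (a x : ℤ⁴) : ℤ := ∑ i, a i * x i ^ 2

lemma sgv_abs {a : ℤ⁴} (ha : ∀ i, a i ≠ 0) (i : Fin 4) : |sgv a i| = 1 := by
  unfold sgv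
  rcases lt_or_gt_of_ne (ha i) with h | h
  · rw [Int.sign_eq_neg_one_of_neg h]; rfl
  · rw [Int.sign_eq_one_of_pos h]; rfl

lemma nab_pos {a : ℤ⁴} (ha : ∀ i, a i ≠ 0) (i : Fin 4) : 1 ≤ nab a i := by
  unfold nab
  exact_mod_cast Int.natAbs_pos.mpr (ha i)

lemma nab_sgv (a : ℤ⁴) (i : Fin 4) : (sgv a i : ℝ) * nab a i = a i := by
  unfold nab sgv
  rw [← Int.cast_natCast, ← Int.cast_mul, Int.sign_mul_natAbs]

lemma bv_nonneg (a c : ℤ⁴) (i : Fin 4) : 0 ≤ bv a c i := by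
  unfold bv nab; positivity

def Wx (a : ℤ⁴) (B : ℝ) (ζ : ℂ⁴) (x : ℤ⁴) : ℂ := ∏ i, cexp (-π * (((nab a i / B : ℝ) : ℂ) * ζ i) * (x i : ℂ) ^ 2)

def Nz (a : ℤ⁴) (B : ℝ) (ζ : ℂ⁴) : ℂ := ∑' x : ℤ⁴, if Fq a x = 0 then Wx a B ζ x else 0

lemma Wx_mul_eC {a : ℤ⁴} {B : ℝ} (hB : 0 < B) (ζ : ℂ⁴) (x : ℤ⁴) (τ : ℝ) : Wx a B ζ x * eC (Fq a x * τ / (2 * B)) =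
      ∏ i, cexp (-π * (((nab a i / B : ℝ) : ℂ) * wv (sgv a) ζ τ i) * (x i : ℂ) ^ 2) := by
  unfold Wx eC
  rw [← Complex.exp_sum, ← Complex.exp_sum, ← Complex.exp_add]
  congr 1
  have h : (2 * π * I * ((Fq a x * τ / (2 * B) : ℝ) : ℂ)) = ∑ i, π * I * ((((sgv a i : ℝ) * nab a i : ℝ) : ℂ) * (x i : ℂ) ^ 2) * τ / B := by
    simp_rw [nab_sgv]
    unfold Fq
    rw [Fin.sum_univ_four, Fin.sum_univ_four]
    have : (B : ℂ) ≠ 0 := by exact_mod_cast hB.ne'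
    push_cast
    field_simp
  rw [h, ← sum_add_distrib]
  refine sum_congr rfl fun i _ => ?_
  unfold wv
  push_cast
  ring

lemma zre_lower {a : ℤ⁴} (ha : ∀ i, a i ≠ 0) {B : ℝ} (hB : 0 < B) {ζ : ℂ⁴} (hζ : ∀ i, 1 ≤ (ζ i).re)
    (e : ℤ⁴) (τ : ℝ) (i : Fin 4) : 1 / B ≤ (((nab a i / B : ℝ) : ℂ) * wv e ζ τ i).re := by
  rw [re_ofReal_mul, wv_re]
  have := nab_pos ha i
  have := hζ i
  calc 1 / B = 1 / B * 1 := by ring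
    _ ≤ _ := by gcongr

def gB (B : ℝ) (x : ℤ) : ℝ := exp (-(1 / B * (x : ℝ) ^ 2))

lemma gB_pos (B : ℝ) (x : ℤ) : 0 < gB B x := exp_pos _

lemma gauss_le_gB {a : ℤ⁴} (ha : ∀ i, a i ≠ 0) {B : ℝ} (hB : 0 < B) {ζ : ℂ⁴} (hζ : ∀ i, 1 ≤ (ζ i).re)
    (e : ℤ⁴) (τ : ℝ) (i : Fin 4) (x : ℤ) :
    ‖cexp (-π * (((nab a i / B : ℝ) : ℂ) * wv e ζ τ i) * (x : ℂ) ^ 2)‖ ≤ gB B x := by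
  have h := norm_gauss (z := ((nab a i / B : ℝ) : ℂ) * wv e ζ τ i) (x : ℝ)
  rw [Complex.ofReal_intCast] at h
  rw [h]
  unfold gB
  apply exp_le_exp.mpr
  rw [neg_le_neg_iff]
  have h1 := zre_lower ha hB hζ e τ i
  have hB' : 0 < 1 / B := by positivity
  have : 1 / B ≤ π * (((nab a i / B : ℝ) : ℂ) * wv e ζ τ i).re := by nlinarith [pi_gt_three]
  gcongr

lemma summable_gB {B : ℝ} (hB : 0 < B) : Summable fun x : ℤ⁴ => ∏ i, gB B (x i) := by
  have h := (tsum_pi_prod 4 (fun _ x => (gB B x : ℂ)) (fun i => by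
    have := summable_gauss_int (t := 1 / B) (by positivity)
    refine this.congr fun x => ?_
    rw [norm_real, norm_eq_abs, abs_of_pos (gB_pos _ _)]
    rfl)).1
  refine h.congr fun x => ?_
  rw [norm_prod]
  refine prod_congr rfl fun i _ => ?_
  rw [norm_real, norm_eq_abs, abs_of_pos (gB_pos _ _)]

lemma Wx_norm_le {a : ℤ⁴} (ha : ∀ i, a i ≠ 0) {B : ℝ} (hB : 0 < B) {ζ : ℂ⁴} (hζ : ∀ i, 1 ≤ (ζ i).re)
    (x : ℤ⁴) : ‖Wx a B ζ x‖ ≤ ∏ i, gB B (x i) := by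
  unfold Wx
  rw [norm_prod]
  refine prod_le_prod (fun i _ => norm_nonneg _) fun i _ => ?_
  have := gauss_le_gB ha hB hζ (sgv a) 0 i (x i)
  unfold wv at this
  simpa using this

/-- the one-dimensional theta series -/
def Th (q : ℕ) (k : ℤ) (a : ℤ⁴) (B : ℝ) (ζ : ℂ⁴) (τ : ℝ) (i : Fin 4) : ℂ :=
  ∑' x : ℤ, eQ q (k * a i * x ^ 2) * cexp (-π * (((nab a i / B : ℝ) : ℂ) * wv (sgv a) ζ τ i) * (x : ℂ) ^ 2)

lemma Hint_norm : ∃ C : ℝ, 1 ≤ C ∧ ∀ (R : ℝ), 0 < R → ∀ q : ℕ, q ≠ 0 → Integrable (fun τ : ℝ => HH ((q : ℝ) ^ 2 / R * (1 + τ ^ 2))) ∧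
    ∫ τ : ℝ, |HH ((q : ℝ) ^ 2 / R * (1 + τ ^ 2))| ≤ C * R ^ 3 / (q : ℝ) ^ 6 := by
  obtain ⟨C, hC, h⟩ := HH_poly_bound
  refine ⟨C * π, by nlinarith [pi_gt_three], fun R hR q hq => ?_⟩
  have hq0 : (0 : ℝ) < q := by positivity
  have hpt : ∀ τ : ℝ, |HH ((q : ℝ) ^ 2 / R * (1 + τ ^ 2))| ≤ (C * R ^ 3 / (q : ℝ) ^ 6) * (1 + τ ^ 2)⁻¹ := by
    intro τ
    have hT : 1 ≤ 1 + τ ^ 2 := by nlinarith [sq_nonneg τ]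
    have hY : 0 < (q : ℝ) ^ 2 / R * (1 + τ ^ 2) := by positivity
    calc _ ≤ |HH ((q : ℝ) ^ 2 / R * (1 + τ ^ 2))| * (1 + (q : ℝ) ^ 2 / R * (1 + τ ^ 2)) ^ 4 :=
          le_mul_of_one_le_right (abs_nonneg _) (one_le_pow₀ (by linarith))
      _ ≤ C / ((q : ℝ) ^ 2 / R * (1 + τ ^ 2)) ^ 3 := h _ hY
      _ = (C * R ^ 3 / (q : ℝ) ^ 6) * ((1 + τ ^ 2) ^ 3)⁻¹ := by field_simp
      _ ≤ _ := by
        gcongr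
        exact le_self_pow₀ hT (by norm_num)
  have hi := integrable_inv_one_add_sq.const_mul (C * R ^ 3 / (q : ℝ) ^ 6)
  have hInt : Integrable (fun τ : ℝ => HH ((q : ℝ) ^ 2 / R * (1 + τ ^ 2))) :=
    hi.mono' (continuous_HH_comp (by positivity)).aestronglyMeasurable (Eventually.of_forall hpt)
  refine ⟨hInt, ?_⟩
  calc _ ≤ ∫ τ : ℝ, (C * R ^ 3 / (q : ℝ) ^ 6) * (1 + τ ^ 2)⁻¹ := integral_mono hInt.abs hi hpt
    _ = _ := by rw [integral_const_mul, integral_univ_inv_one_add_sq]; ring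

lemma swap1 {a : ℤ⁴} (ha : ∀ i, a i ≠ 0) {B : ℝ} (hB : 0 < B) {ζ : ℂ⁴} (hζ : ∀ i, 1 ≤ (ζ i).re)
    {q : ℕ} (hq : q ≠ 0) :
    HasSum (fun x : ℤ⁴ => Wx a B ζ x * (ram q (Fq a x) * Hint (2 * B) (Fq a x) q))
      (∫ τ : ℝ, (HH ((q : ℝ) ^ 2 / (2 * B) * (1 + τ ^ 2)) : ℂ) * ∑ k ∈ range q, uInd q k * ∏ i, Th q k a B ζ τ i) := by
  obtain ⟨C, hC, hH⟩ := Hint_norm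
  obtain ⟨hH1, hH2⟩ := hH (2 * B) (by positivity) q hq
  have e : ∀ (x : ℤ⁴) (τ : ℝ), Wx a B ζ x * ram q (Fq a x) * ((HH ((q : ℝ) ^ 2 / (2 * B) * (1 + τ ^ 2)) : ℂ) * eC (Fq a x * τ / (2 * B))) =
      (HH ((q : ℝ) ^ 2 / (2 * B) * (1 + τ ^ 2)) : ℂ) * ∑ k ∈ range q, uInd q k *
        ∏ i, (eQ q (k * a i * x i ^ 2) * cexp (-π * (((nab a i / B : ℝ) : ℂ) * wv (sgv a) ζ τ i) * (x i : ℂ) ^ 2)) := by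
    intro x τ
    simp_rw [prod_mul_distrib, ← Wx_mul_eC hB ζ x τ]
    have h2 : ∀ k : ℕ, ∏ i, eQ q (k * a i * x i ^ 2) = eQ q (Fq a x * k) := by
      intro k
      unfold Fq
      rw [Fin.prod_univ_four, Fin.sum_univ_four, ← eQ_add, ← eQ_add, ← eQ_add]
      congr 1; ring
    simp_rw [h2]
    unfold ram
    rw [mul_sum, sum_mul, mul_sum]
    refine sum_congr rfl fun k _ => ?_
    ring
  have key := hasSum_integral_of_summable_integral_norm (μ := volume)
    (F := fun (x : ℤ⁴) (τ : ℝ) => Wx a B ζ x * ram q (Fq a x) * ((HH ((q : ℝ) ^ 2 / (2 * B) * (1 + τ ^ 2)) : ℂ) * eC (Fq a x * τ / (2 * B))))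
    (fun x => by
      refine Integrable.const_mul ?_ _
      refine Integrable.mono' hH1.abs ?_ ?_
      · apply Continuous.aestronglyMeasurable
        have := continuous_HH_comp (α := (q : ℝ) ^ 2 / (2 * B)) (by positivity)
        have := continuous_eC
        fun_prop
      · refine Eventually.of_forall fun τ => ?_
        rw [norm_mul, norm_eC, mul_one, norm_real, norm_eq_abs]) (by
      refine Summable.of_nonneg_of_le (fun x => integral_nonneg fun τ => norm_nonneg _) (fun x => ?_)
        ((summable_gB hB).mul_right ((q : ℝ) * (C * (2 * B) ^ 3 / (q : ℝ) ^ 6)))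
      have : ∀ τ : ℝ, ‖Wx a B ζ x * ram q (Fq a x) * ((HH ((q : ℝ) ^ 2 / (2 * B) * (1 + τ ^ 2)) : ℂ) * eC (Fq a x * τ / (2 * B)))‖ =
          ‖Wx a B ζ x‖ * ‖ram q (Fq a x)‖ * |HH ((q : ℝ) ^ 2 / (2 * B) * (1 + τ ^ 2))| := by
        intro τ
        rw [norm_mul, norm_mul, norm_mul, norm_eC, mul_one, norm_real, norm_eq_abs]
      simp_rw [this]
      rw [integral_const_mul, mul_assoc]
      have h1 := Wx_norm_le ha hB hζ x
      have h2 := norm_ram_le q (Fq a x)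
      have h3 : 0 ≤ ∫ τ : ℝ, |HH ((q : ℝ) ^ 2 / (2 * B) * (1 + τ ^ 2))| := integral_nonneg fun τ => abs_nonneg _
      have h4 : 0 ≤ ∏ i, gB B (x i) := prod_nonneg fun i _ => (exp_pos _).le
      gcongr)
  have e1 : ∀ x : ℤ⁴, ∫ τ : ℝ, Wx a B ζ x * ram q (Fq a x) * ((HH ((q : ℝ) ^ 2 / (2 * B) * (1 + τ ^ 2)) : ℂ) * eC (Fq a x * τ / (2 * B))) =
      Wx a B ζ x * (ram q (Fq a x) * Hint (2 * B) (Fq a x) q) := by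
    intro x
    rw [integral_const_mul, mul_assoc]; rfl
  have e2 : ∀ τ : ℝ, ∑' x : ℤ⁴, Wx a B ζ x * ram q (Fq a x) * ((HH ((q : ℝ) ^ 2 / (2 * B) * (1 + τ ^ 2)) : ℂ) * eC (Fq a x * τ / (2 * B))) =
      (HH ((q : ℝ) ^ 2 / (2 * B) * (1 + τ ^ 2)) : ℂ) * ∑ k ∈ range q, uInd q k * ∏ i, Th q k a B ζ τ i := by
    intro τ
    simp_rw [e]
    refine HasSum.tsum_eq ?_
    refine HasSum.mul_left _ (hasSum_sum fun k _ => HasSum.mul_left _ ?_)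
    refine (tsum_pi_prod 4 (fun i x => eQ q (k * a i * x ^ 2) * cexp (-π * (((nab a i / B : ℝ) : ℂ) * wv (sgv a) ζ τ i) * (x : ℂ) ^ 2)) ?_).2
    intro i
    refine Summable.of_nonneg_of_le (fun x => norm_nonneg _) (fun x => ?_) (summable_gauss_int (t := 1 / B) (by positivity))
    rw [norm_mul, norm_eQ, one_mul]
    exact gauss_le_gB ha hB hζ (sgv a) τ i x
  simp_rw [e1, e2] at key
  exact key

lemma theta_hasSum {a : ℤ⁴} (ha : ∀ i, a i ≠ 0) {B : ℝ} (hB : 0 < B) {ζ : ℂ⁴} (hζ : ∀ i, 1 ≤ (ζ i).re)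
    {q : ℕ} (hq : q ≠ 0) (τ : ℝ) :
    HasSum (fun c : ℤ⁴ => ((B ^ 2 / sqrt (∏ i, nab a i) : ℝ) : ℂ) * (Sqa a c q / (q : ℂ) ^ 4) * Jint (sgv a) ζ (bv a c) ((q : ℝ) ^ 2 / (2 * B)) τ)
      (∑ k ∈ range q, uInd q k * ∏ i, Th q k a B ζ τ i) := by
  have hq0 : (0 : ℝ) < q := by positivity
  have hqC : (q : ℂ) ≠ 0 := by exact_mod_cast hq
  set z : ℂ⁴ := fun i => ((nab a i / B : ℝ) : ℂ) * wv (sgv a) ζ τ i with hz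
  have hzre : ∀ i, 0 < (z i).re := fun i => lt_of_lt_of_le (by positivity) (zre_lower ha hB hζ (sgv a) τ i)
  have hz0 : ∀ i, z i ≠ 0 := fun i h => by have := hzre i; rw [h] at this; simp at this
  have hzi : ∀ i, 0 < (1 / ((q : ℂ) ^ 2 * z i)).re := by
    intro i
    have e : (1 / ((q : ℂ) ^ 2 * z i)) = ((1 / (q : ℝ) ^ 2 : ℝ) : ℂ) * (z i)⁻¹ := by push_cast; have := hz0 i; field_simp
    rw [e, re_ofReal_mul, Complex.inv_re]
    have := Complex.normSq_pos.mpr (hz0 i)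
    have := hzre i
    positivity
  have hTh : ∀ (k : ℕ) i, Th q k a B ζ τ i = ((1 / q : ℝ) : ℂ) * csq (z i) *
      ∑' c : ℤ, Gs q (k * a i) c * cexp (-π * (1 / ((q : ℂ) ^ 2 * z i)) * (c : ℂ) ^ 2) := by
    intro k i
    exact theta_poisson hq (k * a i) (hzre i)
  have hk : ∀ k : ℕ, HasSum (fun c : ℤ⁴ => (∏ i, (((1 / q : ℝ) : ℂ) * csq (z i))) *
      ∏ i, (Gs q (k * a i) (c i) * cexp (-π * (1 / ((q : ℂ) ^ 2 * z i)) * (c i : ℂ) ^ 2))) (∏ i, Th q k a B ζ τ i) := by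
    intro k
    simp_rw [hTh]
    rw [prod_mul_distrib (f := fun i => ((1 / q : ℝ) : ℂ) * csq (z i))]
    refine HasSum.mul_left _ ?_
    refine (tsum_pi_prod 4 (fun i c => Gs q (k * a i) c * cexp (-π * (1 / ((q : ℂ) ^ 2 * z i)) * (c : ℂ) ^ 2)) ?_).2
    intro i
    refine Summable.of_nonneg_of_le (fun x => norm_nonneg _) (fun x => ?_) ((summable_norm_gauss (hzi i)).mul_left (q : ℝ))
    rw [norm_mul]
    gcongr
    unfold Gs
    refine (norm_sum_le _ _).trans ?_
    simp [norm_eQ]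
  have hsum := hasSum_sum (s := range q) fun k _ => (hk k).mul_left (uInd q k)
  refine hsum.congr_fun fun c => ?_
  rw [Sqa_eq]
  have hcsq : ∏ i, (((1 / q : ℝ) : ℂ) * csq (z i)) = ((B ^ 2 / sqrt (∏ i, nab a i) : ℝ) : ℂ) / (q : ℂ) ^ 4 * ∏ i, csq (wv (sgv a) ζ τ i) := by
    have h1 : ∀ i, csq (z i) = ((1 / sqrt (nab a i / B) : ℝ) : ℂ) * csq (wv (sgv a) ζ τ i) := by
      intro i
      have := nab_pos ha i
      exact csq_real_mul (by positivity) (wv_ne hζ τ i)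
    simp_rw [h1]
    have h2 : ∏ i, (1 / sqrt (nab a i / B)) = B ^ 2 / sqrt (∏ i, nab a i) := by
      have hp : ∀ i, 0 < nab a i := fun i => by have := nab_pos ha i; linarith
      rw [Fin.prod_univ_four, Fin.prod_univ_four]
      have := hp 0; have := hp 1; have := hp 2; have := hp 3
      rw [sqrt_div (by positivity), sqrt_div (by positivity), sqrt_div (by positivity), sqrt_div (by positivity),
        sqrt_mul (by positivity), sqrt_mul (by positivity), sqrt_mul (by positivity)]
      have hBs : B ^ 2 = sqrt B ^ 4 := by rw [show sqrt B ^ 4 = (sqrt B ^ 2) ^ 2 by ring, sq_sqrt hB.le]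
      rw [hBs]
      field_simp
    rw [prod_mul_distrib, prod_mul_distrib, ← Complex.ofReal_prod, ← Complex.ofReal_prod, h2, prod_const]
    push_cast
    simp only [card_univ, Fintype.card_fin]
    ring
  have hexp : ∀ i, cexp (-π * (1 / ((q : ℂ) ^ 2 * z i)) * (c i : ℂ) ^ 2) =
      cexp (-((π / (2 * ((q : ℝ) ^ 2 / (2 * B))) * bv a c i : ℝ) : ℂ) * (wv (sgv a) ζ τ i)⁻¹) := by
    intro i
    congr 1
    simp only [hz, bv]
    have h1 := wv_ne (e := sgv a) hζ τ i
    have h2 : (nab a i : ℂ) ≠ 0 := by have := nab_pos ha i; exact_mod_cast (by linarith : nab a i ≠ 0)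
    have h3 : (B : ℂ) ≠ 0 := by exact_mod_cast hB.ne'
    push_cast
    field_simp
  unfold Jint
  rw [prod_mul_distrib, hcsq, sum_div, mul_sum, sum_mul]
  refine sum_congr rfl fun k _ => ?_
  rw [prod_mul_distrib, prod_congr rfl fun i _ => hexp i]
  field_simp

/-! ### E4: the main identity -/

lemma summable_Lprod {a : ℤ⁴} (ha : ∀ i, a i ≠ 0) {ζ : ℂ⁴} (hζ : ∀ i, 1 ≤ (ζ i).re) :
    Summable fun c : ℤ⁴ => ∏ i, (1 / (1 + bv a c i / (2 * ‖ζ i‖ ^ 2))) := by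
  have hp : ∀ i, 0 < nab a i := fun i => by have := nab_pos ha i; linarith
  have hz : ∀ i, 0 < ‖ζ i‖ := fun i => lt_of_lt_of_le one_pos (one_le_norm_of_re (hζ i))
  have h := (tsum_pi_prod 4 (fun i c => ((1 / (1 + (1 / (nab a i * (2 * ‖ζ i‖ ^ 2))) * (c : ℝ) ^ 2) : ℝ) : ℂ)) (fun i => by
    have h1 := hp i
    have h2 := hz i
    have := summable_inv_one_add_mul_sq (t := 1 / (nab a i * (2 * ‖ζ i‖ ^ 2))) (by positivity)
    refine this.congr fun x => ?_
    rw [norm_real, norm_eq_abs, abs_of_nonneg (by positivity)])).1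
  refine h.congr fun c => ?_
  rw [norm_prod]
  refine prod_congr rfl fun i _ => ?_
  have h1 := hp i
  have h2 := hz i
  rw [norm_real, norm_eq_abs, abs_of_nonneg (by positivity)]
  unfold bv
  congr 2
  field_simp

/-- The terms in the final double sum. -/
def trm (a : ℤ⁴) (B : ℝ) (ζ : ℂ⁴) (q : ℕ) (c : ℤ⁴) : ℂ := Sqa a c q / (q : ℂ) ^ 4 * JJ (sgv a) ζ (bv a c) ((q : ℝ) ^ 2 / (2 * B))

lemma trm_zero (a : ℤ⁴) (B : ℝ) (ζ : ℂ⁴) (c : ℤ⁴) : trm a B ζ 0 c = 0 := by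
  unfold trm; simp

lemma trm_bound : ∃ C : ℝ, 1 ≤ C ∧ ∀ (a : ℤ⁴), (∀ i, a i ≠ 0) → ∀ B : ℝ, 0 < B → ∀ ζ : ℂ⁴, (∀ i, 1 ≤ (ζ i).re) → ∀ (q : ℕ) (c : ℤ⁴), ‖trm a B ζ q c‖ ≤
      (C * (∏ i, ‖ζ i‖ ^ (1 / 2 : ℝ)) * (2 * B) ^ 3 * (1 / (q : ℝ) ^ 5)) * ∏ i, (1 / (1 + bv a c i / (2 * ‖ζ i‖ ^ 2))) := by
  obtain ⟨C, hC, h⟩ := J_abs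
  refine ⟨C, hC, fun a ha B hB ζ hζ q c => ?_⟩
  rcases Nat.eq_zero_or_pos q with rfl | hq
  · rw [trm_zero]; simp
  have hq0 : (0 : ℝ) < q := by exact_mod_cast hq
  have h1 := (h (sgv a) (sgv_abs ha) ζ hζ (bv a c) (bv_nonneg a c) ((q : ℝ) ^ 2 / (2 * B)) (by positivity)).2
  have h2 : ‖JJ (sgv a) ζ (bv a c) ((q : ℝ) ^ 2 / (2 * B))‖ ≤ _ := (norm_integral_le_integral_norm _).trans h1
  unfold trm
  rw [norm_mul, norm_div, norm_pow, Complex.norm_natCast]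
  have h3 := Sqa_trivial a c q
  calc _ ≤ (q : ℝ) ^ 5 / (q : ℝ) ^ 4 * _ := mul_le_mul (by gcongr) h2 (norm_nonneg _) (by positivity)
    _ = _ := by field_simp

lemma trm_summable {a : ℤ⁴} (ha : ∀ i, a i ≠ 0) {B : ℝ} (hB : 0 < B) {ζ : ℂ⁴} (hζ : ∀ i, 1 ≤ (ζ i).re) :
    Summable fun p : ℕ × (ℤ⁴) => ‖trm a B ζ p.1 p.2‖ := by
  obtain ⟨C, hC, h⟩ := trm_bound
  have s1 : Summable fun q : ℕ => C * (∏ i, ‖ζ i‖ ^ (1 / 2 : ℝ)) * (2 * B) ^ 3 * (1 / (q : ℝ) ^ 5) :=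
    Summable.mul_left _ (summable_one_div_nat_pow.mpr (by norm_num))
  have s := Summable.mul_of_nonneg s1 (summable_Lprod ha hζ) (fun q => by
    have : 0 ≤ ∏ i, ‖ζ i‖ ^ (1 / 2 : ℝ) := prod_nonneg fun i _ => by positivity
    simp only [Pi.zero_apply]; positivity) (fun c => by
    simp only [Pi.zero_apply]
    exact prod_nonneg fun i _ => by have := bv_nonneg a c i; positivity)
  exact Summable.of_nonneg_of_le (fun p => norm_nonneg _) (fun p => h a ha B hB ζ hζ p.1 p.2) s

lemma swap2 {a : ℤ⁴} (ha : ∀ i, a i ≠ 0) {B : ℝ} (hB : 0 < B) {ζ : ℂ⁴} (hζ : ∀ i, 1 ≤ (ζ i).re)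
    {q : ℕ} (hq : q ≠ 0) :
    HasSum (fun c : ℤ⁴ => ((B ^ 2 / sqrt (∏ i, nab a i) : ℝ) : ℂ) * trm a B ζ q c)
      (∫ τ : ℝ, (HH ((q : ℝ) ^ 2 / (2 * B) * (1 + τ ^ 2)) : ℂ) * ∑ k ∈ range q, uInd q k * ∏ i, Th q k a B ζ τ i) := by
  obtain ⟨C, hC, h⟩ := J_abs
  have hq0 : (0 : ℝ) < q := by positivity
  set K : ℂ := ((B ^ 2 / sqrt (∏ i, nab a i) : ℝ) : ℂ) with hK
  have hJ := fun c => h (sgv a) (sgv_abs ha) ζ hζ (bv a c) (bv_nonneg a c) ((q : ℝ) ^ 2 / (2 * B)) (by positivity)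
  have key := hasSum_integral_of_summable_integral_norm (μ := volume)
    (F := fun (c : ℤ⁴) (τ : ℝ) => (K * (Sqa a c q / (q : ℂ) ^ 4)) *
      ((HH ((q : ℝ) ^ 2 / (2 * B) * (1 + τ ^ 2)) : ℂ) * Jint (sgv a) ζ (bv a c) ((q : ℝ) ^ 2 / (2 * B)) τ))
    (fun c => (hJ c).1.const_mul _) (by
      refine Summable.of_nonneg_of_le (fun x => integral_nonneg fun τ => norm_nonneg _) (fun c => ?_)
        ((summable_Lprod ha hζ).mul_left (‖K‖ * ((q : ℝ) ^ 5 / (q : ℝ) ^ 4) * (C * (∏ i, ‖ζ i‖ ^ (1 / 2 : ℝ)) / ((q : ℝ) ^ 2 / (2 * B)) ^ 3)))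
      simp_rw [norm_mul (K * (Sqa a c q / (q : ℂ) ^ 4))]
      rw [integral_const_mul]
      calc _ ≤ (‖K‖ * ((q : ℝ) ^ 5 / (q : ℝ) ^ 4)) * _ := by
            refine mul_le_mul ?_ (hJ c).2 (integral_nonneg fun τ => norm_nonneg _) (by positivity)
            rw [norm_mul, norm_div, norm_pow, Complex.norm_natCast]
            have := Sqa_trivial a c q
            gcongr
        _ = _ := by ring)
  have e1 : ∀ c, ∫ τ : ℝ, (K * (Sqa a c q / (q : ℂ) ^ 4)) *
      ((HH ((q : ℝ) ^ 2 / (2 * B) * (1 + τ ^ 2)) : ℂ) * Jint (sgv a) ζ (bv a c) ((q : ℝ) ^ 2 / (2 * B)) τ) = K * trm a B ζ q c := by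
    intro c
    rw [integral_const_mul]
    unfold trm JJ
    ring
  have e2 : ∀ τ : ℝ, ∑' c : ℤ⁴, (K * (Sqa a c q / (q : ℂ) ^ 4)) *
      ((HH ((q : ℝ) ^ 2 / (2 * B) * (1 + τ ^ 2)) : ℂ) * Jint (sgv a) ζ (bv a c) ((q : ℝ) ^ 2 / (2 * B)) τ) =
      (HH ((q : ℝ) ^ 2 / (2 * B) * (1 + τ ^ 2)) : ℂ) * ∑ k ∈ range q, uInd q k * ∏ i, Th q k a B ζ τ i := by
    intro τ
    refine HasSum.tsum_eq ?_
    refine ((theta_hasSum ha hB hζ hq τ).mul_left _).congr_fun fun c => ?_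
    ring
  simp_rw [e1, e2] at key
  exact key

theorem E_main {a : ℤ⁴} (ha : ∀ i, a i ≠ 0) {B : ℝ} (hB : 0 < B) {ζ : ℂ⁴} (hζ : ∀ i, 1 ≤ (ζ i).re) : ((1 - HH (2 * B) : ℝ) : ℂ) * Nz a B ζ =
      ((B / (2 * sqrt (∏ i, nab a i)) : ℝ) : ℂ) * ∑' p : ℕ × (ℤ⁴), trm a B ζ p.1 p.2 := by
  obtain ⟨C, hC, hH⟩ := Hint_norm
  set K : ℂ := ((B ^ 2 / sqrt (∏ i, nab a i) : ℝ) : ℂ) with hK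
  have hT : Summable fun p : ℕ × (ℤ⁴) => Wx a B ζ p.2 * (ram p.1 (Fq a p.2) * Hint (2 * B) (Fq a p.2) p.1) := by
    have s1 : Summable fun q : ℕ => C * (2 * B) ^ 3 * (1 / (q : ℝ) ^ 5) := Summable.mul_left _ (summable_one_div_nat_pow.mpr (by norm_num))
    have s := Summable.mul_of_nonneg s1 (summable_gB hB) (fun q => by
      simp only [Pi.zero_apply]; positivity) (fun c => by
      simp only [Pi.zero_apply]
      exact prod_nonneg fun i _ => (gB_pos _ _).le)
    refine Summable.of_norm_bounded s fun p => ?_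
    rcases Nat.eq_zero_or_pos p.1 with h0 | hq
    · rw [h0]; simp [ram]
    have hq0 : (0 : ℝ) < p.1 := by exact_mod_cast hq
    have h1 := Wx_norm_le ha hB hζ p.2
    have h2 := norm_ram_le p.1 (Fq a p.2)
    have h3 : ‖Hint (2 * B) (Fq a p.2) p.1‖ ≤ C * (2 * B) ^ 3 / (p.1 : ℝ) ^ 6 := by
      refine (norm_integral_le_integral_norm _).trans ?_
      refine le_trans (le_of_eq ?_) (hH (2 * B) (by positivity) p.1 (by omega)).2
      congr 1; ext τ
      rw [norm_mul, norm_eC, mul_one, norm_real, norm_eq_abs]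
    rw [norm_mul, norm_mul]
    have h4 : 0 ≤ ∏ i, gB B (p.2 i) := prod_nonneg fun i _ => (gB_pos _ _).le
    calc _ ≤ (∏ i, gB B (p.2 i)) * ((p.1 : ℝ) * (C * (2 * B) ^ 3 / (p.1 : ℝ) ^ 6)) := by gcongr
      _ = _ := by field_simp
  obtain ⟨S, hS⟩ := hT
  -- sum over q first
  have hx : HasSum (fun x : ℤ⁴ => ((2 * B * (1 - HH (2 * B)) : ℝ) : ℂ) * (if Fq a x = 0 then Wx a B ζ x else 0)) S := by
    refine HasSum.prod_fiberwise ((Equiv.prodComm _ _).hasSum_iff.mpr hS) fun x => ?_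
    have := (delta_id (R := 2 * B) (by positivity) (Fq a x)).mul_left (Wx a B ζ x)
    have hv : (Wx a B ζ x * if Fq a x = 0 then ((2 * B * (1 - HH (2 * B)) : ℝ) : ℂ) else 0) =
        ((2 * B * (1 - HH (2 * B)) : ℝ) : ℂ) * (if Fq a x = 0 then Wx a B ζ x else 0) := by
      split_ifs
      · ring
      · simp
    rw [hv] at this
    exact this
  -- sum over x first
  have hq : HasSum (fun q : ℕ => K * ∑' c, trm a B ζ q c) S := by
    refine HasSum.prod_fiberwise hS fun q => ?_
    by_cases hq : q = 0
    · subst hq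
      simp [ram, trm_zero, hasSum_zero]
    · rw [← tsum_mul_left, (swap2 ha hB hζ hq).tsum_eq]
      exact swap1 ha hB hζ hq
  have hsum := (trm_summable ha hB hζ).of_norm
  have e1 : S = K * ∑' p : ℕ × (ℤ⁴), trm a B ζ p.1 p.2 := by rw [hsum.tsum_prod, ← tsum_mul_left, hq.tsum_eq]
  have e2 : S = ((2 * B * (1 - HH (2 * B)) : ℝ) : ℂ) * Nz a B ζ := by
    unfold Nz
    rw [← tsum_mul_left, hx.tsum_eq]
  have hB' : (B : ℂ) ≠ 0 := by exact_mod_cast hB.ne'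
  have e3 : ((2 * B : ℝ) : ℂ) * (((1 - HH (2 * B) : ℝ) : ℂ) * Nz a B ζ) =
      ((2 * B : ℝ) : ℂ) * (((B / (2 * sqrt (∏ i, nab a i)) : ℝ) : ℂ) * ∑' p : ℕ × (ℤ⁴), trm a B ζ p.1 p.2) := by
    calc _ = S := by rw [e2]; push_cast; ring
      _ = _ := by
        rw [e1, hK, ← mul_assoc]
        congr 1
        rw [← Complex.ofReal_mul]
        congr 1
        have : 0 < sqrt (∏ i, nab a i) := sqrt_pos.mpr (prod_pos fun i _ => by have := nab_pos ha i; linarith)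
        field_simp
  exact mul_left_cancel₀ (by push_cast; exact mul_ne_zero two_ne_zero hB') e3


def L1 (δ κ : ℝ) (c : ℤ) : ℝ := if c = 0 then 1 else (κ / |(c : ℝ)|) ^ (1 + δ)

lemma L1_nonneg (δ : ℝ) {κ : ℝ} (hκ : 0 ≤ κ) (c : ℤ) : 0 ≤ L1 δ κ c := by
  unfold L1; split_ifs <;> positivity

lemma L1_sum {δ : ℝ} (hδ : 0 < δ) : ∃ C : ℝ, 1 ≤ C ∧ ∀ κ : ℝ, 0 ≤ κ → ∀ s : ℕ, s ≠ 0 → ∀ S : Finset ℤ,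
    (∀ c ∈ S, (s : ℤ) ∣ c) → ∑ c ∈ S, L1 δ κ c ≤ 1 + C * (κ / s) ^ (1 + δ) := by
  have hs : Summable fun n : ℤ => |(n : ℝ)| ^ (-(1 + δ)) := summable_abs_int_rpow (by linarith)
  refine ⟨1 + ∑' n : ℤ, |(n : ℝ)| ^ (-(1 + δ)), by
    have : 0 ≤ ∑' n : ℤ, |(n : ℝ)| ^ (-(1 + δ)) := tsum_nonneg fun n => by positivity
    linarith, fun κ hκ s hs0 S hS => ?_⟩
  have hs1 : (0 : ℝ) < s := by positivity
  have hsZ : (s : ℤ) ≠ 0 := by exact_mod_cast hs0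
  have h1 : ∀ c ∈ S, L1 δ κ c ≤ (if c = 0 then 1 else 0) + (κ / s) ^ (1 + δ) * |((c / (s : ℤ) : ℤ) : ℝ)| ^ (-(1 + δ)) := by
    intro c hc
    obtain ⟨m, rfl⟩ := hS c hc
    rw [Int.mul_ediv_cancel_left m hsZ]
    unfold L1
    split_ifs with h
    · have : 0 ≤ (κ / s) ^ (1 + δ) * |(m : ℝ)| ^ (-(1 + δ)) := by positivity
      linarith
    · have hm : m ≠ 0 := by rintro rfl; simp at h
      have hm' : 0 < |(m : ℝ)| := by positivity
      push_cast
      rw [abs_mul, abs_of_pos hs1, zero_add, ← div_div, div_rpow (by positivity) (by positivity), rpow_neg (by positivity)]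
      exact le_of_eq (div_eq_mul_inv _ _)
  refine (sum_le_sum h1).trans ?_
  rw [sum_add_distrib, ← mul_sum]
  have h2 : ∑ c ∈ S, (if c = 0 then (1 : ℝ) else 0) ≤ 1 := by
    rw [sum_ite_eq']
    split_ifs <;> norm_num
  have h3 : ∑ c ∈ S, |((c / (s : ℤ) : ℤ) : ℝ)| ^ (-(1 + δ)) ≤ ∑' n : ℤ, |(n : ℝ)| ^ (-(1 + δ)) := by
    have hinj : Set.InjOn (fun c : ℤ => c / (s : ℤ)) S := by
      intro x hx y hy hxy
      obtain ⟨m, rfl⟩ := hS x hx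
      obtain ⟨n, rfl⟩ := hS y hy
      simp only [Int.mul_ediv_cancel_left _ hsZ] at hxy
      rw [hxy]
    rw [← sum_image (f := fun n : ℤ => |(n : ℝ)| ^ (-(1 + δ))) hinj]
    exact hs.sum_le_tsum _ fun n _ => by positivity
  have h4 : 0 ≤ (κ / s) ^ (1 + δ) := by positivity
  nlinarith

def kap (a : ℤ⁴) (ζ : ℂ⁴) (i : Fin 4) : ℝ := sqrt (2 * nab a i) * ‖ζ i‖

lemma kap_sq (a : ℤ⁴) (ζ : ℂ⁴) (i : Fin 4) : kap a ζ i ^ 2 = 2 * nab a i * ‖ζ i‖ ^ 2 := by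
  unfold kap
  rw [mul_pow, sq_sqrt (by unfold nab; positivity)]

lemma kap_pos {a : ℤ⁴} (ha : ∀ i, a i ≠ 0) {ζ : ℂ⁴} (hζ : ∀ i, 1 ≤ (ζ i).re) (i : Fin 4) : 1 ≤ kap a ζ i := by
  unfold kap
  have h1 := nab_pos ha i
  have h2 := one_le_norm_of_re (hζ i)
  have h3 : 1 ≤ sqrt (2 * nab a i) := one_le_sqrt.mpr (by linarith)
  nlinarith

def Lc (δ : ℝ) (a : ℤ⁴) (ζ : ℂ⁴) (c : ℤ⁴) : ℝ := ∏ i, L1 δ (kap a ζ i) (c i)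

lemma Lc_nonneg (δ : ℝ) {a : ℤ⁴} {ζ : ℂ⁴} (c : ℤ⁴) : 0 ≤ Lc δ a ζ c := prod_nonneg fun i _ => L1_nonneg _ (by unfold kap; positivity) _

lemma rpow_le_one_add {u s : ℝ} (hu : 0 ≤ u) (hs0 : 0 ≤ s) (hs1 : s ≤ 1) : u ^ s ≤ 1 + u := by
  rcases le_total u 1 with h | h
  · have := rpow_le_one hu h hs0
    linarith
  · have := rpow_le_rpow_of_exponent_le h hs1
    rw [rpow_one] at this
    linarith

lemma exp_half_le {u s : ℝ} (hu : 0 < u) (hs0 : 0 ≤ s) (hs1 : s ≤ 1) : exp (-(u / 2)) ≤ 2 * u ^ (-s) := by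
  have h1 := rpow_le_one_add hu.le hs0 hs1
  have h2 := add_one_le_exp (u / 2)
  have h3 : 0 < u ^ s := by positivity
  rw [rpow_neg hu.le, exp_neg, ← div_eq_mul_inv, inv_le_comm₀ (exp_pos _) (by positivity), inv_div, div_le_iff₀ (by norm_num)]
  linarith

lemma coord_bound {δ : ℝ} (hδ : 0 < δ) (hδ1 : δ ≤ 1) {κ : ℝ} (hκ : 0 < κ) {c : ℤ} (hc : c ≠ 0) {Y : ℝ} (hY : 0 < Y) :
    exp (-((c : ℝ) ^ 2 / κ ^ 2 / Y / 2)) ≤ 2 * Y ^ ((1 + δ) / 2) * L1 δ κ c := by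
  have hc' : 0 < |(c : ℝ)| := by positivity
  have hu : 0 < (c : ℝ) ^ 2 / κ ^ 2 / Y := by positivity
  refine (exp_half_le (s := (1 + δ) / 2) hu (by linarith) (by linarith)).trans (le_of_eq ?_)
  unfold L1
  rw [if_neg hc, rpow_neg hu.le, ← inv_rpow hu.le, ← sq_abs (c : ℝ), ← div_pow, inv_div, mul_assoc]
  congr 1
  rw [div_eq_mul_inv, mul_rpow hY.le (by positivity)]
  congr 1
  rw [← inv_pow, inv_div, ← rpow_natCast, ← rpow_mul (by positivity)]
  congr 1
  push_cast; ring

/-! ### F2: weighted bounds for the oscillatory integral -/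

def mu (a : ℤ⁴) (ζ : ℂ⁴) (c : ℤ⁴) (i : Fin 4) : ℝ := bv a c i / (2 * ‖ζ i‖ ^ 2)

lemma mu_nonneg (a : ℤ⁴) (ζ : ℂ⁴) (c : ℤ⁴) (i : Fin 4) : 0 ≤ mu a ζ c i := by
  unfold mu
  have := bv_nonneg a c i
  positivity

lemma mu_eq (a : ℤ⁴) (ζ : ℂ⁴) (c : ℤ⁴) (i : Fin 4) : mu a ζ c i = (c i : ℝ) ^ 2 / kap a ζ i ^ 2 := by
  unfold mu bv
  rw [kap_sq, div_div]
  congr 1; ring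

def hLam (a : ℤ⁴) (ζ : ℂ⁴) (c : ℤ⁴) (Y : ℝ) : ℝ := ∏ i, exp (-(mu a ζ c i / Y / 2))

lemma hLam_nonneg (a : ℤ⁴) (ζ : ℂ⁴) (c : ℤ⁴) (Y : ℝ) : 0 ≤ hLam a ζ c Y := prod_nonneg fun _ _ => (exp_pos _).le

lemma Lam_le_hLam (a : ℤ⁴) (ζ : ℂ⁴) (c : ℤ⁴) {Y : ℝ} (hY : 0 < Y) : Lam ζ (bv a c) Y ≤ hLam a ζ c Y := by
  unfold Lam hLam
  refine prod_le_prod (fun i _ => (exp_pos _).le) fun i _ => ?_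
  have := mu_nonneg a ζ c i
  have h : 0 ≤ mu a ζ c i / Y := by positivity
  apply exp_le_exp.mpr
  change -(mu a ζ c i / Y) ≤ _
  linarith

lemma wt_bound {δ : ℝ} (hδ : 0 < δ) (hδ1 : δ ≤ 1 / 4) {a : ℤ⁴} (ha : ∀ i, a i ≠ 0) {ζ : ℂ⁴} (hζ : ∀ i, 1 ≤ (ζ i).re)
    {c : ℤ⁴} (hc : c ≠ 0) {Y : ℝ} (hY : 0 < Y) :
    exp (-Y) * hLam a ζ c Y ≤ 1200 * Y ^ (1 / 2 - δ) * Lc δ a ζ c := by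
  obtain ⟨i0, hi0⟩ : ∃ i, c i ≠ 0 := by by_contra h; push Not at h; exact hc (funext h)
  have hk : ∀ i, 0 < kap a ζ i := fun i => lt_of_lt_of_le one_pos (kap_pos ha hζ i)
  have hL : ∀ i, 0 ≤ L1 δ (kap a ζ i) (c i) := fun i => L1_nonneg _ (hk i).le _
  have h0 : exp (-(mu a ζ c i0 / Y / 2)) ≤ 2 * Y ^ ((1 + δ) / 2) * L1 δ (kap a ζ i0) (c i0) := by
    rw [mu_eq]; exact coord_bound hδ (by linarith) (hk i0) hi0 hY
  have h1 : ∀ i, exp (-(mu a ζ c i / Y / 2)) ≤ 2 * (1 + Y) * L1 δ (kap a ζ i) (c i) := by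
    intro i
    by_cases hi : c i = 0
    · rw [mu_eq, hi]
      simp [L1]
      linarith
    · rw [mu_eq]
      refine (coord_bound hδ (by linarith) (hk i) hi hY).trans ?_
      refine mul_le_mul_of_nonneg_right ?_ (hL i)
      have := rpow_le_one_add hY.le (s := (1 + δ) / 2) (by linarith) (by linarith)
      linarith
  have h2 : hLam a ζ c Y ≤ (2 * Y ^ ((1 + δ) / 2)) * (2 * (1 + Y)) ^ 3 * Lc δ a ζ c := by
    unfold hLam Lc
    rw [← mul_prod_erase _ _ (mem_univ i0), ← mul_prod_erase _ (fun i => L1 δ (kap a ζ i) (c i)) (mem_univ i0)]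
    have h3 : ∏ i ∈ univ.erase i0, exp (-(mu a ζ c i / Y / 2)) ≤ ∏ i ∈ univ.erase i0, (2 * (1 + Y) * L1 δ (kap a ζ i) (c i)) :=
      prod_le_prod (fun i _ => (exp_pos _).le) fun i _ => h1 i
    rw [prod_mul_distrib, prod_const, card_erase_of_mem (mem_univ _)] at h3
    simp only [card_univ, Fintype.card_fin, Nat.add_one_sub_one] at h3
    refine (mul_le_mul h0 h3 (prod_nonneg fun _ _ => (exp_pos _).le) (by have := hL i0; positivity)).trans (le_of_eq ?_)
    norm_num
    ring
  have h4 : Y ^ ((1 + δ) / 2) ≤ Y ^ (1 / 2 - δ) * (1 + Y) := by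
    have : (1 + δ) / 2 = (1 / 2 - δ) + 3 * δ / 2 := by ring
    rw [this, rpow_add hY]
    refine mul_le_mul_of_nonneg_left ?_ (by positivity)
    exact rpow_le_one_add hY.le (by linarith) (by linarith)
  have h5 : (1 + Y) ^ 4 * exp (-Y) ≤ 72 := by
    have := pow_mul_exp_le 4 (by linarith : 0 ≤ 1 + Y)
    have e1 : exp (-Y) = exp (-(1 + Y)) * exp 1 := by rw [← exp_add]; congr 1; ring
    have e2 := exp_one_lt_d9
    norm_num [Nat.factorial] at this
    rw [e1, ← mul_assoc]
    have h6 : 0 ≤ (1 + Y) ^ 4 * exp (-Y + -1) := by positivity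
    have e3 : -(1 + Y) = -Y + -1 := by ring
    rw [e3]
    nlinarith [exp_pos 1]
  have hLc := Lc_nonneg δ (a := a) (ζ := ζ) c
  calc exp (-Y) * hLam a ζ c Y ≤ exp (-Y) * ((2 * (Y ^ (1 / 2 - δ) * (1 + Y))) * (2 * (1 + Y)) ^ 3 * Lc δ a ζ c) := by
        refine mul_le_mul_of_nonneg_left (h2.trans ?_) (exp_pos _).le
        gcongr
    _ = 16 * ((1 + Y) ^ 4 * exp (-Y)) * (Y ^ (1 / 2 - δ) * Lc δ a ζ c) := by ring
    _ ≤ 16 * 72 * (Y ^ (1 / 2 - δ) * Lc δ a ζ c) := by gcongr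
    _ ≤ _ := by
      have : 0 ≤ Y ^ (1 / 2 - δ) * Lc δ a ζ c := by positivity
      linarith

lemma integrable_T {δ : ℝ} (hδ : 0 < δ) : Integrable fun τ : ℝ => (1 + τ ^ 2)⁻¹ * (1 + τ ^ 2) ^ (1 / 2 - δ) := by
  have := integrable_rpow_neg_one_add_norm_sq (E := ℝ) (μ := volume) (r := 1 + 2 * δ) (by simp; linarith)
  refine this.congr (Eventually.of_forall fun τ => ?_)
  have hT : 0 < 1 + τ ^ 2 := by positivity
  simp only [norm_eq_abs, sq_abs]
  rw [← rpow_neg_one, ← rpow_add hT]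
  congr 1; ring

def tInt (δ : ℝ) : ℝ := 1 + ∫ τ : ℝ, (1 + τ ^ 2)⁻¹ * (1 + τ ^ 2) ^ (1 / 2 - δ)

lemma tInt_pos (δ : ℝ) : 1 ≤ tInt δ := by
  unfold tInt
  have : 0 ≤ ∫ τ : ℝ, (1 + τ ^ 2)⁻¹ * (1 + τ ^ 2) ^ (1 / 2 - δ) := integral_nonneg fun τ => by positivity
  linarith

/-- generic integral bound -/
lemma int_csq_bound {δ : ℝ} (hδ : 0 < δ) {e : ℤ⁴} (he : ∀ i, |e i| = 1) {ζ : ℂ⁴} (hζ : ∀ i, 1 ≤ (ζ i).re)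
    {α D : ℝ} (hα : 0 ≤ α) (hD : 0 ≤ D) (f : ℝ → ℂ) (hf : ∀ τ, ‖f τ‖ ≤ D * (α * (1 + τ ^ 2)) ^ (1 / 2 - δ)) (hm : Continuous f) :
    Integrable (fun τ => (∏ i, csq (wv e ζ τ i)) * f τ) ∧
    ‖∫ τ, (∏ i, csq (wv e ζ τ i)) * f τ‖ ≤ 5 * (∏ i, ‖ζ i‖ ^ (1 / 2 : ℝ)) * D * α ^ (1 / 2 - δ) * tInt δ := by
  have hZ0 : 0 ≤ ∏ i, ‖ζ i‖ ^ (1 / 2 : ℝ) := prod_nonneg fun i _ => by positivity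
  have hpt : ∀ τ, ‖(∏ i, csq (wv e ζ τ i)) * f τ‖ ≤ (5 * (∏ i, ‖ζ i‖ ^ (1 / 2 : ℝ)) * D * α ^ (1 / 2 - δ)) *
      ((1 + τ ^ 2)⁻¹ * (1 + τ ^ 2) ^ (1 / 2 - δ)) := by
    intro τ
    rw [norm_mul, norm_prod]
    refine (mul_le_mul (prod_csq_bound he hζ τ) (hf τ) (norm_nonneg _) (by positivity)).trans (le_of_eq ?_)
    rw [mul_rpow hα (by positivity)]
    ring
  have hi := (integrable_T hδ).const_mul (5 * (∏ i, ‖ζ i‖ ^ (1 / 2 : ℝ)) * D * α ^ (1 / 2 - δ))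
  have hc : Continuous fun τ => (∏ i, csq (wv e ζ τ i)) * f τ := by
    refine Continuous.mul (continuous_finsetProd _ fun i _ => ?_) hm
    exact continuous_csq (continuous_wv e ζ i) fun t => by rw [wv_re]; linarith [hζ i]
  refine ⟨hi.mono' hc.aestronglyMeasurable (Eventually.of_forall hpt), ?_⟩
  refine (norm_integral_le_of_norm_le hi (Eventually.of_forall hpt)).trans ?_
  rw [integral_const_mul]
  refine mul_le_mul_of_nonneg_left ?_ (by positivity)
  unfold tInt; linarith

/-- the exponential part -/
def Ex (e : ℤ⁴) (ζ : ℂ⁴) (b : Fin 4 → ℝ) (α τ : ℝ) : ℂ := ∏ i, cexp (-((π / (2 * α) * b i : ℝ) : ℂ) * (wv e ζ τ i)⁻¹)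

lemma Jint_eq (e : ℤ⁴) (ζ : ℂ⁴) (b : Fin 4 → ℝ) (α τ : ℝ) : Jint e ζ b α τ = (∏ i, csq (wv e ζ τ i)) * Ex e ζ b α τ := by
  unfold Jint Ex
  rw [prod_mul_distrib]

lemma JJ_eq (e : ℤ⁴) (ζ : ℂ⁴) (b : Fin 4 → ℝ) (α : ℝ) : JJ e ζ b α = ∫ τ, (∏ i, csq (wv e ζ τ i)) * ((HH (α * (1 + τ ^ 2)) : ℂ) * Ex e ζ b α τ) := by
  unfold JJ
  congr 1; ext τ; rw [Jint_eq]; ring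

lemma Ex_norm {e : ℤ⁴} (he : ∀ i, |e i| = 1) {ζ : ℂ⁴} (hζ : ∀ i, 1 ≤ (ζ i).re) (a c : ℤ⁴) (τ : ℝ)
    {α : ℝ} (hα : 0 < α) : ‖Ex e ζ (bv a c) α τ‖ ≤ Lam ζ (bv a c) (α * (1 + τ ^ 2)) := by
  unfold Ex Lam
  rw [norm_prod]
  exact prod_le_prod (fun i _ => norm_nonneg _) fun i _ => exp_factor_bound he hζ τ i hα (bv_nonneg a c i)

lemma continuous_Ex (e : ℤ⁴) {ζ : ℂ⁴} (hζ : ∀ i, 1 ≤ (ζ i).re) (b : Fin 4 → ℝ) (α : ℝ) : Continuous fun τ => Ex e ζ b α τ := by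
  unfold Ex
  refine continuous_finsetProd _ fun i _ => ?_
  refine Complex.continuous_exp.comp (continuous_const.mul ?_)
  exact (continuous_wv e ζ i).inv₀ fun t => wv_ne hζ t i

lemma JJ_bound {δ : ℝ} (hδ : 0 < δ) (hδ1 : δ ≤ 1 / 4) : ∃ C : ℝ, 1 ≤ C ∧ ∀ (a : ℤ⁴), (∀ i, a i ≠ 0) →
    ∀ (ζ : ℂ⁴), (∀ i, 1 ≤ (ζ i).re) → ∀ c : ℤ⁴, c ≠ 0 → ∀ α : ℝ, 0 < α →
    ‖JJ (sgv a) ζ (bv a c) α‖ ≤ C * (∏ i, ‖ζ i‖ ^ (1 / 2 : ℝ)) * α ^ (1 / 2 - δ) * Lc δ a ζ c := by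
  obtain ⟨C, hC, h⟩ := HH_bounds
  have ht := tInt_pos δ
  refine ⟨5 * (C * 1200) * tInt δ, by nlinarith, fun a ha ζ hζ c hc α hα => ?_⟩
  have hL := Lc_nonneg δ (a := a) (ζ := ζ) c
  rw [JJ_eq]
  refine (int_csq_bound hδ (sgv_abs ha) hζ hα.le (D := C * 1200 * Lc δ a ζ c) (by positivity) _ (fun τ => ?_) ?_).2.trans (le_of_eq (by ring))
  · have hY : 0 < α * (1 + τ ^ 2) := by positivity
    rw [norm_mul, norm_real, norm_eq_abs]
    have h1 := (Ex_norm (sgv_abs ha) hζ a c τ hα).trans (Lam_le_hLam a ζ c hY)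
    have h2 := wt_bound hδ hδ1 ha hζ hc hY
    calc _ ≤ (C * exp (-(α * (1 + τ ^ 2)))) * hLam a ζ c (α * (1 + τ ^ 2)) := mul_le_mul (h _ hY).1 h1 (norm_nonneg _) (by positivity)
      _ = C * (exp (-(α * (1 + τ ^ 2))) * hLam a ζ c (α * (1 + τ ^ 2))) := by ring
      _ ≤ C * (1200 * (α * (1 + τ ^ 2)) ^ (1 / 2 - δ) * Lc δ a ζ c) := by gcongr
      _ = _ := by ring
  · exact (Complex.continuous_ofReal.comp (continuous_HH_comp hα)).mul (continuous_Ex _ hζ _ _)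

/-! ### F3: partial summation in the modulus -/

lemma k_diff {R D p : ℝ} (hR : 0 < R) (hD : 0 ≤ D) (hp0 : 0 ≤ p) (hp1 : p ≤ 1 / 2) {T : ℝ} (hT : 0 < T) (f f' : ℝ → ℂ)
    (hd : ∀ α, 0 < α → HasDerivAt f (f' α) α) (h1 : ∀ α, 0 < α → ‖f α‖ ≤ D * (α * T) ^ p)
    (h2 : ∀ α : ℝ, 0 < α → ‖(α : ℂ) * f' α‖ ≤ D * (α * T) ^ p) (q : ℕ) (hq : 1 ≤ q) :
    ‖f ((q : ℝ) ^ 2 / R) / (q : ℂ) - f (((q + 1 : ℕ) : ℝ) ^ 2 / R) / ((q + 1 : ℕ) : ℂ)‖ ≤ 6 * D / (q : ℝ) ^ 2 * ((q : ℝ) ^ 2 / R * T) ^ p := by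
  have hq1 : (1 : ℝ) ≤ q := by exact_mod_cast hq
  have hq0 : (0 : ℝ) < q := by linarith
  have key : ∀ t : ℝ, 0 < t → HasDerivAt (fun t : ℝ => f (t ^ 2 / R) / (t : ℂ))
      ((2 * (((t ^ 2 / R : ℝ) : ℂ) * f' (t ^ 2 / R)) - f (t ^ 2 / R)) / (t : ℂ) ^ 2) t := by
    intro t ht
    have hh : HasDerivAt (fun t : ℝ => t ^ 2 / R) (2 * t / R) t := by
      have := ((hasDerivAt_id t).pow 2).div_const R
      refine this.congr_deriv ?_
      simp
    have h3 := (hd (t ^ 2 / R) (by positivity)).scomp t hh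
    have h4 : HasDerivAt (fun t : ℝ => (t : ℂ)) 1 t := (hasDerivAt_id t).ofReal_comp
    have ht' : (t : ℂ) ≠ 0 := by exact_mod_cast ht.ne'
    have hR' : (R : ℂ) ≠ 0 := by exact_mod_cast hR.ne'
    refine (h3.div h4 ht').congr_deriv ?_
    simp only [Function.comp, Complex.real_smul]
    push_cast
    field_simp
  have hmv := (convex_Icc (q : ℝ) (q + 1)).norm_image_sub_le_of_norm_hasDerivWithin_le
    (f := fun t : ℝ => f (t ^ 2 / R) / (t : ℂ)) (C := 6 * D / (q : ℝ) ^ 2 * ((q : ℝ) ^ 2 / R * T) ^ p)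
    (x := (q + 1 : ℝ)) (y := (q : ℝ))
    (fun t ht => (key t (by linarith [ht.1])).hasDerivWithinAt) ?_ (by constructor <;> linarith) (by constructor <;> linarith)
  · simpa using hmv
  · intro t ht
    have ht0 : 0 < t := by linarith [ht.1]
    have hα : 0 < t ^ 2 / R := by positivity
    rw [norm_div, norm_pow, norm_real, norm_eq_abs, abs_of_pos ht0]
    have h3 : ‖2 * (((t ^ 2 / R : ℝ) : ℂ) * f' (t ^ 2 / R)) - f (t ^ 2 / R)‖ ≤ 3 * (D * (t ^ 2 / R * T) ^ p) := by
      refine (norm_sub_le _ _).trans ?_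
      rw [norm_mul, Complex.norm_ofNat]
      linarith [h1 _ hα, h2 _ hα]
    have h4 : (t ^ 2 / R * T) ^ p ≤ 2 * ((q : ℝ) ^ 2 / R * T) ^ p := by
      have h5 : t ^ 2 / R * T ≤ 4 * ((q : ℝ) ^ 2 / R * T) := by
        have : t ^ 2 ≤ 4 * (q : ℝ) ^ 2 := by nlinarith [ht.2]
        calc _ ≤ 4 * (q : ℝ) ^ 2 / R * T := by gcongr
          _ = _ := by ring
      refine (rpow_le_rpow (by positivity) h5 hp0).trans ?_
      rw [mul_rpow (by norm_num) (by positivity)]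
      refine mul_le_mul_of_nonneg_right ?_ (by positivity)
      calc (4 : ℝ) ^ p ≤ 4 ^ (1 / 2 : ℝ) := rpow_le_rpow_of_exponent_le (by norm_num) hp1
        _ = 2 := by rw [show (4 : ℝ) = 2 ^ (2 : ℝ) by norm_num, ← rpow_mul (by norm_num)]; norm_num
    calc _ ≤ 3 * (D * (2 * ((q : ℝ) ^ 2 / R * T) ^ p)) / (q : ℝ) ^ 2 := by
          refine div_le_div₀ (by positivity) (h3.trans ?_) (by positivity) (by gcongr; exact ht.1)
          gcongr
      _ = _ := by ring

lemma F3_abel {δ : ℝ} (hδ : 0 < δ) (hδ1 : δ ≤ 1 / 4) : ∃ C : ℝ, 1 ≤ C ∧ ∀ (a : ℤ⁴), (∀ i, a i ≠ 0) →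
    ¬ IsSquare (∏ i, a i) → ∀ c, dualForm a c = 0 → ∀ (ζ : ℂ⁴), (∀ i, 1 ≤ (ζ i).re) → ∀ R : ℝ, 0 < R →
    ∀ D : ℝ, 0 ≤ D → ∀ ψ ψ' : ℝ → ℝ → ℂ, (∀ α, 0 < α → ∀ τ, HasDerivAt (fun α => ψ α τ) (ψ' α τ) α) →
    (∀ α : ℝ, 0 < α → ∀ τ : ℝ, ‖ψ α τ‖ ≤ D * (α * (1 + τ ^ 2)) ^ (1 / 2 - δ)) →
    (∀ α : ℝ, 0 < α → ∀ τ : ℝ, ‖(α : ℂ) * ψ' α τ‖ ≤ D * (α * (1 + τ ^ 2)) ^ (1 / 2 - δ)) →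
    (∀ α, 0 < α → Continuous (ψ α)) → ∀ X : ℕ, 1 ≤ X →
    ‖∑ q ∈ Icc 1 X, Sqa a c q / (q : ℂ) ^ 3 * ((∫ τ, (∏ i, csq (wv (sgv a) ζ τ i)) * ψ ((q : ℝ) ^ 2 / R) τ) / (q : ℂ))‖ ≤
      C * absProd a ^ (2 / 3 + δ) * R ^ (-(1 / 2) + δ) * (∏ i, ‖ζ i‖ ^ (1 / 2 : ℝ)) * D := by
  obtain ⟨C1, hC1, h1⟩ := key_prop hδ
  obtain ⟨C2, hC2, h2⟩ := sum_rpow_le (p := -1 - δ) (by linarith)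
  have ht := tInt_pos δ
  have hC12 : 1 ≤ C1 * C2 := one_le_mul_of_one_le_of_one_le hC1 hC2
  refine ⟨C1 * C2 * tInt δ * 35, by nlinarith [mul_le_mul hC12 ht (by norm_num) (by linarith)], ?_⟩
  intro a ha hsq c hc ζ hζ R hR D hD ψ ψ' hd hb1 hb2 hcont X hX
  set P := fun τ : ℝ => ∏ i, csq (wv (sgv a) ζ τ i) with hP
  set K : ℕ → ℂ := fun q => (∫ τ, P τ * ψ ((q : ℝ) ^ 2 / R) τ) / (q : ℂ) with hK
  set Z := ∏ i, ‖ζ i‖ ^ (1 / 2 : ℝ) with hZ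
  have hZ0 : 0 ≤ Z := prod_nonneg fun i _ => by positivity
  set N := absProd a ^ (2 / 3 + δ) with hN
  have hN0 : 0 ≤ N := by positivity
  have hqR : ∀ q : ℕ, 1 ≤ q → (0 : ℝ) < (q : ℝ) ^ 2 / R := fun q hq => by
    have : (0 : ℝ) < q := by exact_mod_cast hq
    positivity
  have hpow : ∀ q : ℕ, 1 ≤ q → ((q : ℝ) ^ 2 / R) ^ (1 / 2 - δ) = (q : ℝ) ^ (1 - 2 * δ) * R ^ (-(1 / 2) + δ) := by
    intro q hq
    rw [div_rpow (by positivity) hR.le, div_eq_mul_inv, ← rpow_neg hR.le, ← rpow_natCast, ← rpow_mul (by positivity)]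
    congr 2 <;> (push_cast; ring)
  have hKX : ∀ q : ℕ, 1 ≤ q → ‖K q‖ ≤ (5 * Z * D * tInt δ * R ^ (-(1 / 2) + δ)) * (q : ℝ) ^ (-2 * δ) := by
    intro q hq
    have hq0 : (0 : ℝ) < q := by exact_mod_cast hq
    have := (int_csq_bound hδ (sgv_abs ha) hζ (hqR q hq).le hD (ψ ((q : ℝ) ^ 2 / R)) (hb1 _ (hqR q hq)) (hcont _ (hqR q hq))).2
    rw [hK]
    simp only
    rw [norm_div, Complex.norm_natCast, div_le_iff₀ hq0]
    refine this.trans (le_of_eq ?_)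
    rw [hpow q hq, show (1 - 2 * δ) = -2 * δ + 1 by ring, rpow_add hq0, rpow_one]
    ring
  have hKd : ∀ q : ℕ, 1 ≤ q → ‖K q - K (q + 1)‖ ≤ (30 * Z * D * tInt δ * R ^ (-(1 / 2) + δ)) * (q : ℝ) ^ (-1 - 2 * δ) := by
    intro q hq
    have hq0 : (0 : ℝ) < q := by exact_mod_cast hq
    have hi1 := (int_csq_bound hδ (sgv_abs ha) hζ (hqR q hq).le hD (ψ ((q : ℝ) ^ 2 / R)) (hb1 _ (hqR q hq)) (hcont _ (hqR q hq))).1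
    have hi2 := (int_csq_bound hδ (sgv_abs ha) hζ (hqR (q + 1) (by omega)).le hD (ψ (((q + 1 : ℕ) : ℝ) ^ 2 / R))
      (hb1 _ (hqR (q + 1) (by omega))) (hcont _ (hqR (q + 1) (by omega)))).1
    have e : K q - K (q + 1) = ∫ τ, P τ * (ψ ((q : ℝ) ^ 2 / R) τ / (q : ℂ) - ψ (((q + 1 : ℕ) : ℝ) ^ 2 / R) τ / ((q + 1 : ℕ) : ℂ)) := by
      rw [hK]
      simp only
      rw [← integral_div, ← integral_div, ← integral_sub (hi1.div_const _) (hi2.div_const _)]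
      congr 1; ext τ; ring
    rw [e]
    refine (int_csq_bound hδ (sgv_abs ha) hζ (hqR q hq).le (D := 6 * D / (q : ℝ) ^ 2) (by positivity) _ (fun τ => ?_) ?_).2.trans (le_of_eq ?_)
    · exact k_diff hR hD (by linarith) (by linarith) (by positivity) (fun α => ψ α τ) (fun α => ψ' α τ)
        (fun α hα => hd α hα τ) (fun α hα => hb1 α hα τ) (fun α hα => hb2 α hα τ) q hq
    · exact ((hcont _ (hqR q hq)).div_const _).sub ((hcont _ (hqR (q + 1) (by omega))).div_const _)
    · rw [hpow q hq, show (1 - 2 * δ) = (-1 - 2 * δ) + 2 by ring, rpow_add hq0]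
      rw [show (2 : ℝ) = ((2 : ℕ) : ℝ) by norm_num, rpow_natCast]
      push_cast
      field_simp
      try ring
  refine (abel_bound (fun q => Sqa a c q / (q : ℂ) ^ 3) K X hX).trans ?_
  have hb : ∀ q : ℕ, 1 ≤ q → ‖∑ j ∈ Icc 1 q, Sqa a c j / (j : ℂ) ^ 3‖ ≤ C1 * (q : ℝ) ^ δ * N := fun q hq => h1 a ha hsq c hc q hq
  set M := Z * D * tInt δ * R ^ (-(1 / 2) + δ) with hM
  have hM0 : 0 ≤ M := by have : 0 ≤ tInt δ := by linarith
                         positivity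
  have s1 : ∑ q ∈ Ico 1 X, ‖∑ j ∈ Icc 1 q, Sqa a c j / (j : ℂ) ^ 3‖ * ‖K q - K (q + 1)‖ ≤ C1 * N * (30 * M) * C2 := by
    calc _ ≤ ∑ q ∈ Ico 1 X, (C1 * N * (30 * M)) * (q : ℝ) ^ (-1 - δ) := by
          refine sum_le_sum fun q hq => ?_
          have hq1 := (mem_Ico.mp hq).1
          have hq0 : (0 : ℝ) < q := by exact_mod_cast hq1
          refine (mul_le_mul (hb q hq1) (hKd q hq1) (norm_nonneg _) (by positivity)).trans (le_of_eq ?_)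
          rw [show -1 - δ = δ + (-1 - 2 * δ) by ring, rpow_add hq0]
          rw [hM]; ring
      _ ≤ _ := by
        rw [← mul_sum]
        exact mul_le_mul_of_nonneg_left (h2 _) (by positivity)
  have s2 : ‖∑ j ∈ Icc 1 X, Sqa a c j / (j : ℂ) ^ 3‖ * ‖K X‖ ≤ C1 * N * (5 * M) * C2 := by
    have hX0 : (1 : ℝ) ≤ X := by exact_mod_cast hX
    calc _ ≤ (C1 * (X : ℝ) ^ δ * N) * (5 * M * (X : ℝ) ^ (-2 * δ)) := by
          refine (mul_le_mul (hb X hX) (hKX X hX) (norm_nonneg _) (by positivity)).trans (le_of_eq ?_)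
          rw [hM]; ring
      _ = C1 * N * (5 * M) * (X : ℝ) ^ (-δ) := by rw [show -δ = δ + (-2 * δ) by ring, rpow_add (by linarith)]; ring
      _ ≤ C1 * N * (5 * M) * C2 := by
        refine mul_le_mul_of_nonneg_left ?_ (by positivity)
        exact (rpow_le_one_of_one_le_of_nonpos hX0 (by linarith)).trans hC2
  refine (add_le_add s1 s2).trans (le_of_eq ?_)
  rw [hM]; ring

/-! ### F4: frequencies on the dual quadric -/

lemma dual_sum {a c : ℤ⁴} (ha : ∀ i, a i ≠ 0) (h : dualForm a c = 0) : ∑ i, (sgv a i : ℝ) * bv a c i = 0 := by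
  have h1 : (dualForm a c : ℝ) = ((∏ i, a i : ℤ) : ℝ) * ∑ i, (sgv a i : ℝ) * bv a c i := by
    unfold dualForm
    push_cast
    rw [mul_sum]
    refine sum_congr rfl fun i _ => ?_
    rw [← mul_prod_erase _ _ (mem_univ i)]
    have hn := nab_pos ha i
    have hs : (sgv a i : ℝ) * sgv a i = 1 := by
      have := sgv_abs ha i
      have h2 : sgv a i * sgv a i = 1 := by rw [← abs_mul_self, abs_mul, this]; rfl
      exact_mod_cast h2
    unfold bv
    have hn0 : nab a i ≠ 0 := by linarith
    field_simp
    rw [← nab_sgv a i]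
    linear_combination (-(∏ x ∈ univ.erase i, (a x : ℝ)) * (c i : ℝ) ^ 2 * nab a i) * hs
  rw [h] at h1
  have hA : ((∏ i, a i : ℤ) : ℝ) ≠ 0 := by exact_mod_cast prod_ne_zero_iff.mpr fun i _ => ha i
  exact (mul_eq_zero.mp (h1.symm.trans (by simp))).resolve_left hA

def e0 (e : ℤ⁴) (ζ : ℂ⁴) (b : Fin 4 → ℝ) (τ : ℝ) : ℂ := ∑ i, ((π / 2 * b i : ℝ) : ℂ) * (wv e ζ τ i)⁻¹

lemma Ex_eq (e : ℤ⁴) (ζ : ℂ⁴) (b : Fin 4 → ℝ) {α : ℝ} (hα : 0 < α) (τ : ℝ) : Ex e ζ b α τ = cexp (-(e0 e ζ b τ) * (α : ℂ)⁻¹) := by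
  unfold Ex e0
  rw [← Complex.exp_sum, ← sum_neg_distrib, sum_mul]
  congr 1
  refine sum_congr rfl fun i _ => ?_
  have : (α : ℂ) ≠ 0 := by exact_mod_cast hα.ne'
  push_cast
  field_simp

lemma e0_bound {a c : ℤ⁴} (ha : ∀ i, a i ≠ 0) (h : dualForm a c = 0) {ζ : ℂ⁴} (hζ : ∀ i, 1 ≤ (ζ i).re) (τ : ℝ) :
    ‖e0 (sgv a) ζ (bv a c) τ‖ ≤ 14 * ∑ i, ‖ζ i‖ ^ 4 * mu a ζ c i / (1 + τ ^ 2) := by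
  have hT : 0 < 1 + τ ^ 2 := by positivity
  have hpi := pi_lt_d2
  have hz : ∀ i, 1 ≤ ‖ζ i‖ := fun i => one_le_norm_of_re (hζ i)
  have hw : ∀ i, 1 ≤ ‖wv (sgv a) ζ τ i‖ := fun i => one_le_norm_of_re (by rw [wv_re]; exact hζ i)
  have hb : ∀ i, bv a c i = 2 * ‖ζ i‖ ^ 2 * mu a ζ c i := fun i => by
    have := hz i
    unfold mu; field_simp
  rcases le_total |τ| 1 with hτ | hτ
  · have hT2 : 1 + τ ^ 2 ≤ 2 := by have := sq_abs τ; nlinarith [abs_nonneg τ]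
    unfold e0
    refine (norm_sum_le _ _).trans ?_
    rw [mul_sum]
    refine sum_le_sum fun i _ => ?_
    have hm := mu_nonneg a ζ c i
    rw [norm_mul, norm_inv, norm_real, norm_eq_abs, abs_of_nonneg (by have := bv_nonneg a c i; positivity), hb]
    have h1 : ‖wv (sgv a) ζ τ i‖⁻¹ ≤ 1 := inv_le_one_of_one_le₀ (hw i)
    calc π / 2 * (2 * ‖ζ i‖ ^ 2 * mu a ζ c i) * ‖wv (sgv a) ζ τ i‖⁻¹ ≤ π / 2 * (2 * ‖ζ i‖ ^ 2 * mu a ζ c i) * 1 := by gcongr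
      _ ≤ 7 * (‖ζ i‖ ^ 4 * mu a ζ c i) := by
        have : ‖ζ i‖ ^ 2 ≤ ‖ζ i‖ ^ 4 := pow_le_pow_right₀ (hz i) (by norm_num)
        have h3 : ‖ζ i‖ ^ 2 * mu a ζ c i ≤ ‖ζ i‖ ^ 4 * mu a ζ c i := by gcongr
        have h4 : 0 ≤ ‖ζ i‖ ^ 2 * mu a ζ c i := by positivity
        nlinarith [pi_pos]
      _ ≤ 14 * (‖ζ i‖ ^ 4 * mu a ζ c i / (1 + τ ^ 2)) := by
        rw [← mul_div_assoc, le_div_iff₀ hT]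
        have h4 : 0 ≤ ‖ζ i‖ ^ 4 * mu a ζ c i := by positivity
        nlinarith
  · have hτ0 : τ ≠ 0 := by rintro rfl; norm_num at hτ
    have hs : ∀ i, (sgv a i : ℂ) * sgv a i = 1 := fun i => by
      have := sgv_abs ha i
      have h2 : sgv a i * sgv a i = 1 := by rw [← abs_mul_self, abs_mul, this]; rfl
      exact_mod_cast h2
    have e1 : e0 (sgv a) ζ (bv a c) τ = ∑ i, ((π / 2 * bv a c i : ℝ) : ℂ) * (ζ i * (sgv a i : ℂ) / (I * τ * wv (sgv a) ζ τ i)) := by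
      have h0 : ∑ i, ((π / 2 * bv a c i : ℝ) : ℂ) * ((sgv a i : ℂ) / (I * τ)) = 0 := by
        have : ∑ i, ((π / 2 * bv a c i : ℝ) : ℂ) * ((sgv a i : ℂ) / (I * τ)) = (π / 2 / (I * τ)) * ((∑ i, (sgv a i : ℝ) * bv a c i : ℝ) : ℂ) := by
          push_cast
          rw [mul_sum]
          exact sum_congr rfl fun i _ => by ring
        rw [this, dual_sum ha h]; simp
      rw [← add_zero (e0 _ _ _ _), ← h0]
      unfold e0
      rw [← sum_add_distrib]
      refine sum_congr rfl fun i _ => ?_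
      rw [← mul_add]
      congr 1
      have hw0 := wv_ne (e := sgv a) hζ τ i
      have hτc : (τ : ℂ) ≠ 0 := by exact_mod_cast hτ0
      have hI := Complex.I_ne_zero
      field_simp
      have : ζ i = wv (sgv a) ζ τ i + I * ((sgv a i : ℂ) * τ) := by unfold wv; push_cast; ring
      rw [this]
      linear_combination (-I * τ) * hs i
    rw [e1]
    refine (norm_sum_le _ _).trans ?_
    rw [mul_sum]
    refine sum_le_sum fun i _ => ?_
    have hm := mu_nonneg a ζ c i
    have hsn : ‖(sgv a i : ℂ)‖ = 1 := by rw [Complex.norm_intCast]; exact_mod_cast sgv_abs ha i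
    rw [norm_mul, norm_div, norm_mul, norm_mul, norm_mul, hsn, Complex.norm_I, norm_real, norm_real, norm_eq_abs, norm_eq_abs,
      abs_of_nonneg (by have := bv_nonneg a c i; positivity), hb, one_mul, mul_one]
    have hlow : (1 + τ ^ 2) ≤ 4 * (|τ| * ‖wv (sgv a) ζ τ i‖ * ‖ζ i‖) := by
      have h1 := wv_lower (sgv_abs ha) hζ τ i
      have h2 : 1 + τ ^ 2 ≤ 2 * |τ| ^ 2 := by have := sq_abs τ; nlinarith
      refine le_of_sq_le_sq ?_ (by positivity)
      calc (1 + τ ^ 2) ^ 2 = (1 + τ ^ 2) * (1 + τ ^ 2) := by ring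
        _ ≤ (2 * |τ| ^ 2) * (5 * ‖ζ i‖ ^ 2 * ‖wv (sgv a) ζ τ i‖ ^ 2) := mul_le_mul h2 h1 hT.le (by positivity)
        _ = 10 * (|τ| * ‖wv (sgv a) ζ τ i‖ * ‖ζ i‖) ^ 2 := by ring
        _ ≤ _ := by nlinarith [sq_nonneg (|τ| * ‖wv (sgv a) ζ τ i‖ * ‖ζ i‖)]
    have hwp := hw i
    have hzp := hz i
    have h3 : ‖ζ i‖ / (|τ| * ‖wv (sgv a) ζ τ i‖) ≤ 4 * ‖ζ i‖ ^ 2 / (1 + τ ^ 2) := by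
      rw [div_le_div_iff₀ (by positivity) hT]
      nlinarith
    calc _ ≤ π / 2 * (2 * ‖ζ i‖ ^ 2 * mu a ζ c i) * (4 * ‖ζ i‖ ^ 2 / (1 + τ ^ 2)) := by gcongr
      _ = 4 * π * (‖ζ i‖ ^ 4 * mu a ζ c i / (1 + τ ^ 2)) := by ring
      _ ≤ _ := by
        refine mul_le_mul_of_nonneg_right (by linarith) (by positivity)

def Qz (ζ : ℂ⁴) : ℝ := ∑ i, ‖ζ i‖ ^ 4

lemma Lam_mu (a : ℤ⁴) (ζ : ℂ⁴) (c : ℤ⁴) {Y : ℝ} (hY : 0 < Y) : Lam ζ (bv a c) Y * ∑ i, ‖ζ i‖ ^ 4 * mu a ζ c i / Y ≤ 2 * Qz ζ * hLam a ζ c Y := by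
  have e1 : Lam ζ (bv a c) Y = hLam a ζ c Y * hLam a ζ c Y := by
    unfold hLam Lam
    rw [← prod_mul_distrib]
    refine prod_congr rfl fun i _ => ?_
    rw [← exp_add]
    congr 1
    change -(mu a ζ c i / Y) = _
    ring
  have h0 := hLam_nonneg a ζ c Y
  have hm : ∀ i, 0 ≤ mu a ζ c i / Y := fun i => by have := mu_nonneg a ζ c i; positivity
  rw [e1, mul_sum]
  unfold Qz
  rw [mul_sum, sum_mul]
  refine sum_le_sum fun i _ => ?_
  have h1 : hLam a ζ c Y ≤ exp (-(mu a ζ c i / Y / 2)) := by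
    unfold hLam
    rw [← mul_prod_erase _ _ (mem_univ i)]
    refine mul_le_of_le_one_right (exp_pos _).le (prod_le_one (fun _ _ => (exp_pos _).le) fun j _ => ?_)
    rw [exp_le_one_iff]
    have := hm j
    linarith
  have h2 : exp (-(mu a ζ c i / Y / 2)) * (mu a ζ c i / Y) ≤ 2 := by
    have := add_one_le_exp (mu a ζ c i / Y / 2)
    rw [exp_neg, inv_mul_le_iff₀ (exp_pos _)]
    linarith
  calc hLam a ζ c Y * hLam a ζ c Y * (‖ζ i‖ ^ 4 * mu a ζ c i / Y) = hLam a ζ c Y * ‖ζ i‖ ^ 4 * (hLam a ζ c Y * (mu a ζ c i / Y)) := by ring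
    _ ≤ hLam a ζ c Y * ‖ζ i‖ ^ 4 * 2 := by
      refine mul_le_mul_of_nonneg_left (le_trans ?_ h2) (by positivity)
      exact mul_le_mul_of_nonneg_right h1 (hm i)
    _ = _ := by ring

lemma Qz_ge {ζ : ℂ⁴} (hζ : ∀ i, 1 ≤ (ζ i).re) : 1 ≤ Qz ζ := by
  unfold Qz
  refine le_trans ?_ (single_le_sum (f := fun i => ‖ζ i‖ ^ 4) (fun i _ => by positivity) (mem_univ 0))
  exact one_le_pow₀ (one_le_norm_of_re (hζ 0))

lemma B_pow_le {B δ : ℝ} (hB : 0 < B) (hδ1 : δ ≤ 1 / 4) : (2 * B) ^ (-(1 / 2) + δ) ≤ B ^ (-(1 / 2) + δ) :=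
  rpow_le_rpow_of_nonpos hB (by linarith) (by linarith)

lemma trm_dual {δ : ℝ} (hδ : 0 < δ) (hδ1 : δ ≤ 1 / 4) : ∃ C : ℝ, 1 ≤ C ∧ ∀ (a : ℤ⁴), (∀ i, a i ≠ 0) →
    ¬ IsSquare (∏ i, a i) → ∀ c, c ≠ 0 → dualForm a c = 0 → ∀ (ζ : ℂ⁴), (∀ i, 1 ≤ (ζ i).re) → ∀ B : ℝ, 0 < B →
    ∀ X : ℕ, 1 ≤ X → ‖∑ q ∈ Icc 1 X, trm a B ζ q c‖ ≤
      C * absProd a ^ (2 / 3 + δ) * B ^ (-(1 / 2) + δ) * (∏ i, ‖ζ i‖ ^ (1 / 2 : ℝ)) * Qz ζ * Lc δ a ζ c := by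
  obtain ⟨C1, hC1, h1⟩ := F3_abel hδ hδ1
  obtain ⟨C2, hC2, h2⟩ := HH_bounds
  refine ⟨C1 * (C2 * 36000), by nlinarith, fun a ha hsq c hc0 hc ζ hζ B hB X hX => ?_⟩
  have hQ := Qz_ge hζ
  have hL := Lc_nonneg δ (a := a) (ζ := ζ) c
  have hZ0 : 0 ≤ ∏ i, ‖ζ i‖ ^ (1 / 2 : ℝ) := prod_nonneg fun i _ => by positivity
  have hw : ∀ α : ℝ, 0 < α → ∀ τ : ℝ, (C2 * exp (-(α * (1 + τ ^ 2)))) * (Lam ζ (bv a c) (α * (1 + τ ^ 2)) * (1 + ‖e0 (sgv a) ζ (bv a c) τ * (α : ℂ)⁻¹‖))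
      ≤ (C2 * 36000 * Qz ζ * Lc δ a ζ c) * (α * (1 + τ ^ 2)) ^ (1 / 2 - δ) := by
    intro α hα τ
    have hY : 0 < α * (1 + τ ^ 2) := by positivity
    have hLam0 : 0 ≤ Lam ζ (bv a c) (α * (1 + τ ^ 2)) := prod_nonneg fun _ _ => (exp_pos _).le
    have h3 : ‖e0 (sgv a) ζ (bv a c) τ * (α : ℂ)⁻¹‖ ≤ 14 * ∑ i, ‖ζ i‖ ^ 4 * mu a ζ c i / (α * (1 + τ ^ 2)) := by
      rw [norm_mul, norm_inv, norm_real, norm_eq_abs, abs_of_pos hα]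
      refine (mul_le_mul_of_nonneg_right (e0_bound ha hc hζ τ) (by positivity)).trans (le_of_eq ?_)
      rw [mul_assoc, sum_mul]
      congr 1
      refine sum_congr rfl fun i _ => ?_
      field_simp
    have h4 := Lam_mu a ζ c hY
    have h5 := Lam_le_hLam a ζ c hY
    have h6 := wt_bound hδ hδ1 ha hζ hc0 hY
    have h7 := hLam_nonneg a ζ c (α * (1 + τ ^ 2))
    have h8 : Lam ζ (bv a c) (α * (1 + τ ^ 2)) * (1 + ‖e0 (sgv a) ζ (bv a c) τ * (α : ℂ)⁻¹‖) ≤ 30 * Qz ζ * hLam a ζ c (α * (1 + τ ^ 2)) := by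
      have h9 := mul_le_mul_of_nonneg_left h3 hLam0
      nlinarith [mul_le_mul_of_nonneg_right hQ h7]
    calc _ ≤ (C2 * exp (-(α * (1 + τ ^ 2)))) * (30 * Qz ζ * hLam a ζ c (α * (1 + τ ^ 2))) := mul_le_mul_of_nonneg_left h8 (by positivity)
      _ = C2 * 30 * Qz ζ * (exp (-(α * (1 + τ ^ 2))) * hLam a ζ c (α * (1 + τ ^ 2))) := by ring
      _ ≤ C2 * 30 * Qz ζ * (1200 * (α * (1 + τ ^ 2)) ^ (1 / 2 - δ) * Lc δ a ζ c) := mul_le_mul_of_nonneg_left h6 (by positivity)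
      _ = _ := by ring
  have key := h1 a ha hsq c hc ζ hζ (2 * B) (by linarith) (C2 * 36000 * Qz ζ * Lc δ a ζ c) (by positivity)
    (fun α τ => (HH (α * (1 + τ ^ 2)) : ℂ) * Ex (sgv a) ζ (bv a c) α τ)
    (fun α τ => ((HD (α * (1 + τ ^ 2)) * (1 + τ ^ 2) : ℝ) : ℂ) * Ex (sgv a) ζ (bv a c) α τ +
      (HH (α * (1 + τ ^ 2)) : ℂ) * (Ex (sgv a) ζ (bv a c) α τ * (e0 (sgv a) ζ (bv a c) τ / (α : ℂ) ^ 2))) ?_ ?_ ?_ ?_ X hX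
  · refine (le_of_eq ?_).trans (key.trans ?_)
    · congr 1
      refine sum_congr rfl fun q hq => ?_
      have hq0 : (q : ℂ) ≠ 0 := by
        have := (mem_Icc.mp hq).1
        exact_mod_cast (by omega : q ≠ 0)
      unfold trm
      rw [JJ_eq]
      field_simp
    · have := B_pow_le hB hδ1
      calc _ ≤ C1 * absProd a ^ (2 / 3 + δ) * B ^ (-(1 / 2) + δ) * (∏ i, ‖ζ i‖ ^ (1 / 2 : ℝ)) * (C2 * 36000 * Qz ζ * Lc δ a ζ c) := by gcongr
        _ = _ := by ring
  · intro α hα τ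
    have hY : 0 < α * (1 + τ ^ 2) := by positivity
    have d1 : HasDerivAt (fun α : ℝ => HH (α * (1 + τ ^ 2))) (HD (α * (1 + τ ^ 2)) * (1 + τ ^ 2)) α := by
      have := (hasDerivAt_HH hY).comp α ((hasDerivAt_id α).mul_const (1 + τ ^ 2))
      exact this.congr_deriv (by simp)
    have hαc : (α : ℂ) ≠ 0 := by exact_mod_cast hα.ne'
    have d2 : HasDerivAt (fun α : ℝ => cexp (-(e0 (sgv a) ζ (bv a c) τ) * (α : ℂ)⁻¹))
        (Ex (sgv a) ζ (bv a c) α τ * (e0 (sgv a) ζ (bv a c) τ / (α : ℂ) ^ 2)) α := by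
      have h4 : HasDerivAt (fun t : ℝ => (t : ℂ)) 1 α := (hasDerivAt_id α).ofReal_comp
      have := ((h4.inv hαc).const_mul (-(e0 (sgv a) ζ (bv a c) τ))).cexp
      refine this.congr_deriv ?_
      rw [Ex_eq _ _ _ hα]
      simp only [Pi.inv_apply]
      ring
    have d3 : HasDerivAt (fun α : ℝ => Ex (sgv a) ζ (bv a c) α τ) (Ex (sgv a) ζ (bv a c) α τ * (e0 (sgv a) ζ (bv a c) τ / (α : ℂ) ^ 2)) α := by
      refine d2.congr_of_eventuallyEq ?_
      filter_upwards [lt_mem_nhds hα] with x hx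
      exact Ex_eq _ _ _ hx _
    exact d1.ofReal_comp.mul d3
  · intro α hα τ
    have hY : 0 < α * (1 + τ ^ 2) := by positivity
    refine le_trans ?_ (hw α hα τ)
    rw [norm_mul, norm_real, norm_eq_abs]
    have hE := Ex_norm (sgv_abs ha) hζ a c τ hα
    refine mul_le_mul (h2 _ hY).1 (hE.trans ?_) (norm_nonneg _) (by positivity)
    refine le_mul_of_one_le_right ((norm_nonneg _).trans hE) ?_
    linarith [norm_nonneg (e0 (sgv a) ζ (bv a c) τ * (α : ℂ)⁻¹)]
  · intro α hα τ
    have hY : 0 < α * (1 + τ ^ 2) := by positivity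
    have hαc : (α : ℂ) ≠ 0 := by exact_mod_cast hα.ne'
    refine le_trans ?_ (hw α hα τ)
    have hE := Ex_norm (sgv_abs ha) hζ a c τ hα
    have e1 : (α : ℂ) * (((HD (α * (1 + τ ^ 2)) * (1 + τ ^ 2) : ℝ) : ℂ) * Ex (sgv a) ζ (bv a c) α τ +
      (HH (α * (1 + τ ^ 2)) : ℂ) * (Ex (sgv a) ζ (bv a c) α τ * (e0 (sgv a) ζ (bv a c) τ / (α : ℂ) ^ 2))) =
      ((α * (1 + τ ^ 2) * HD (α * (1 + τ ^ 2)) : ℝ) : ℂ) * Ex (sgv a) ζ (bv a c) α τ +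
      (HH (α * (1 + τ ^ 2)) : ℂ) * (Ex (sgv a) ζ (bv a c) α τ * (e0 (sgv a) ζ (bv a c) τ * (α : ℂ)⁻¹)) := by
      push_cast
      field_simp
    rw [e1]
    refine (norm_add_le _ _).trans ?_
    rw [norm_mul, norm_mul, norm_mul, norm_real, norm_real, norm_eq_abs, norm_eq_abs]
    have g1 := mul_le_mul (h2 _ hY).2.2.1 hE (norm_nonneg _) (by positivity)
    have g2 := mul_le_mul (h2 _ hY).1 (mul_le_mul_of_nonneg_right hE (norm_nonneg (e0 (sgv a) ζ (bv a c) τ * (α : ℂ)⁻¹))) (by positivity) (by positivity)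
    linarith
  · intro α hα
    exact (Complex.continuous_ofReal.comp (continuous_HH_comp hα)).mul (continuous_Ex _ hζ _ _)

def Jinf (a : ℤ⁴) (ζ : ℂ⁴) : ℂ := ∫ τ : ℝ, ∏ i, csq (wv (sgv a) ζ τ i)

lemma integrable_P {a : ℤ⁴} (ha : ∀ i, a i ≠ 0) {ζ : ℂ⁴} (hζ : ∀ i, 1 ≤ (ζ i).re) :
    Integrable (fun τ : ℝ => ∏ i, csq (wv (sgv a) ζ τ i)) ∧ ‖Jinf a ζ‖ ≤ 20 * ∏ i, ‖ζ i‖ ^ (1 / 2 : ℝ) := by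
  have hi := integrable_inv_one_add_sq.const_mul (5 * (∏ i, ‖ζ i‖ ^ (1 / 2 : ℝ)))
  have hb : ∀ τ : ℝ, ‖∏ i, csq (wv (sgv a) ζ τ i)‖ ≤ 5 * (∏ i, ‖ζ i‖ ^ (1 / 2 : ℝ)) * (1 + τ ^ 2)⁻¹ := fun τ => by
    rw [norm_prod]; exact prod_csq_bound (sgv_abs ha) hζ τ
  refine ⟨hi.mono' ?_ (Eventually.of_forall hb), ?_⟩
  · refine (continuous_finsetProd _ fun i _ => ?_).aestronglyMeasurable
    exact continuous_csq (continuous_wv _ ζ i) fun t => by rw [wv_re]; linarith [hζ i]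
  · unfold Jinf
    refine (norm_integral_le_of_norm_le hi (Eventually.of_forall hb)).trans ?_
    rw [integral_const_mul, integral_univ_inv_one_add_sq]
    have hZ0 : 0 ≤ ∏ i, ‖ζ i‖ ^ (1 / 2 : ℝ) := prod_nonneg fun i _ => by positivity
    nlinarith [pi_le_four]

lemma trm_zero_freq {δ : ℝ} (hδ : 0 < δ) (hδ1 : δ ≤ 1 / 4) : ∃ C : ℝ, 1 ≤ C ∧ ∀ (a : ℤ⁴), (∀ i, a i ≠ 0) →
    ¬ IsSquare (∏ i, a i) → ∀ (ζ : ℂ⁴), (∀ i, 1 ≤ (ζ i).re) → ∀ B : ℝ, 0 < B →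
    ∀ X : ℕ, 1 ≤ X → ‖∑ q ∈ Icc 1 X, trm a B ζ q 0 - Jinf a ζ * singularPartial a X‖ ≤
      C * absProd a ^ (2 / 3 + δ) * B ^ (-(1 / 2) + δ) * (∏ i, ‖ζ i‖ ^ (1 / 2 : ℝ)) := by
  obtain ⟨C1, hC1, h1⟩ := F3_abel hδ hδ1
  obtain ⟨C2, hC2, h2⟩ := HH_bounds
  refine ⟨C1 * (2 * C2), by nlinarith, fun a ha hsq ζ hζ B hB X hX => ?_⟩
  have hZ0 : 0 ≤ ∏ i, ‖ζ i‖ ^ (1 / 2 : ℝ) := prod_nonneg fun i _ => by positivity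
  have hgen : ∀ (v Y : ℝ), 0 < Y → v ≤ C2 * exp (-Y) + 1 → v ≤ C2 * Y → v ≤ 2 * C2 * Y ^ (1 / 2 - δ) := by
    intro v Y hY g1 g2
    have hY0 : 0 ≤ Y ^ (1 / 2 - δ) := by positivity
    rcases le_total Y 1 with hy | hy
    · have : Y ≤ Y ^ (1 / 2 - δ) := by
        calc Y = Y ^ (1 : ℝ) := (rpow_one Y).symm
          _ ≤ _ := rpow_le_rpow_of_exponent_ge hY hy (by linarith)
      nlinarith
    · have : 1 ≤ Y ^ (1 / 2 - δ) := one_le_rpow hy (by linarith)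
      have : exp (-Y) ≤ 1 := by rw [exp_le_one_iff]; linarith
      nlinarith
  have hcont : ∀ α : ℝ, 0 < α → Continuous fun τ : ℝ => (HH (α * (1 + τ ^ 2)) : ℂ) - 1 := fun α hα =>
    (Complex.continuous_ofReal.comp (continuous_HH_comp hα)).sub continuous_const
  have hb1 : ∀ α : ℝ, 0 < α → ∀ τ : ℝ, ‖(HH (α * (1 + τ ^ 2)) : ℂ) - 1‖ ≤ (2 * C2) * (α * (1 + τ ^ 2)) ^ (1 / 2 - δ) := by
    intro α hα τ
    have hY : 0 < α * (1 + τ ^ 2) := by positivity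
    have e1 : (HH (α * (1 + τ ^ 2)) : ℂ) - 1 = ((HH (α * (1 + τ ^ 2)) - 1 : ℝ) : ℂ) := by push_cast; ring
    rw [e1, norm_real, norm_eq_abs]
    refine hgen _ _ hY ?_ (h2 _ hY).2.1
    refine (abs_sub _ _).trans ?_
    rw [abs_one]
    linarith [(h2 _ hY).1]
  have key := h1 a ha hsq 0 (dualForm_zero a) ζ hζ (2 * B) (by linarith) (2 * C2) (by positivity)
    (fun α τ => (HH (α * (1 + τ ^ 2)) : ℂ) - 1)
    (fun α τ => ((HD (α * (1 + τ ^ 2)) * (1 + τ ^ 2) : ℝ) : ℂ)) ?_ hb1 ?_ hcont X hX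
  · refine (le_of_eq ?_).trans (key.trans ?_)
    · congr 1
      rw [singularPartial_eq, mul_sum, ← sum_sub_distrib]
      refine sum_congr rfl fun q hq => ?_
      have hq1 := (mem_Icc.mp hq).1
      have hq0 : (q : ℂ) ≠ 0 := by exact_mod_cast (by omega : q ≠ 0)
      have hα : 0 < (q : ℝ) ^ 2 / (2 * B) := by
        have : (0 : ℝ) < q := by exact_mod_cast hq1
        positivity
      have hi := (int_csq_bound hδ (sgv_abs ha) hζ hα.le (by positivity) _ (hb1 _ hα) (hcont _ hα)).1
      have e1 : JJ (sgv a) ζ (bv a 0) ((q : ℝ) ^ 2 / (2 * B)) =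
          (∫ τ, (∏ i, csq (wv (sgv a) ζ τ i)) * ((HH ((q : ℝ) ^ 2 / (2 * B) * (1 + τ ^ 2)) : ℂ) - 1)) + Jinf a ζ := by
        unfold Jinf
        rw [JJ_eq, ← integral_add hi (integrable_P ha hζ).1]
        congr 1; ext τ
        have : Ex (sgv a) ζ (bv a 0) ((q : ℝ) ^ 2 / (2 * B)) τ = 1 := by unfold Ex bv; simp
        rw [this]; ring
      unfold trm
      rw [e1]
      field_simp
      ring
    · have := B_pow_le hB hδ1
      calc _ ≤ C1 * absProd a ^ (2 / 3 + δ) * B ^ (-(1 / 2) + δ) * (∏ i, ‖ζ i‖ ^ (1 / 2 : ℝ)) * (2 * C2) := by gcongr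
        _ = _ := by ring
  · intro α hα τ
    have hY : 0 < α * (1 + τ ^ 2) := by positivity
    have d1 : HasDerivAt (fun α : ℝ => HH (α * (1 + τ ^ 2))) (HD (α * (1 + τ ^ 2)) * (1 + τ ^ 2)) α := by
      have := (hasDerivAt_HH hY).comp α ((hasDerivAt_id α).mul_const (1 + τ ^ 2))
      exact this.congr_deriv (by simp)
    exact d1.ofReal_comp.sub_const 1
  · intro α hα τ
    have hY : 0 < α * (1 + τ ^ 2) := by positivity
    have e1 : (α : ℂ) * ((HD (α * (1 + τ ^ 2)) * (1 + τ ^ 2) : ℝ) : ℂ) = ((α * (1 + τ ^ 2) * HD (α * (1 + τ ^ 2)) : ℝ) : ℂ) := by push_cast; ring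
    rw [e1, norm_real, norm_eq_abs]
    exact hgen _ _ hY (by linarith [(h2 _ hY).2.2.1]) (h2 _ hY).2.2.2

/-! ### F5: summation over the dual variable -/

lemma sum_prod_le (S : Finset (ℤ⁴)) (f : Fin 4 → ℤ → ℝ) (hf : ∀ i t, 0 ≤ f i t) :
    ∑ c ∈ S, ∏ i, f i (c i) ≤ ∏ i, ∑ t ∈ S.image (fun c => c i), f i t := by
  rw [prod_univ_sum]
  refine sum_le_sum_of_subset_of_nonneg (fun c hc => ?_) fun c _ _ => prod_nonneg fun i _ => hf i _
  rw [Fintype.mem_piFinset]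
  exact fun i => mem_image_of_mem _ hc

lemma prod_nab (a : ℤ⁴) : ∏ i, nab a i = absProd a := by
  unfold nab
  have := map_prod Int.natAbsHom a univ
  simp only [Int.natAbsHom_apply] at this
  rw [this]; push_cast; rfl

lemma exists_sq_div {n : ℕ} (hn : n ≠ 0) : ∃ s : ℕ, s ≠ 0 ∧ n ∣ s ^ 2 ∧ ∀ t : ℤ, (n : ℤ) ∣ t ^ 2 → (s : ℤ) ∣ t := by
  have hex : ∃ s : ℕ, s ≠ 0 ∧ n ∣ s ^ 2 := ⟨n, hn, Dvd.intro_left n (by ring)⟩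
  obtain ⟨h0, h1⟩ := Nat.find_spec hex
  refine ⟨Nat.find hex, h0, h1, fun t ht => ?_⟩
  have ht' : n ∣ t.natAbs ^ 2 := by rw [← Int.natAbs_pow]; exact Int.natCast_dvd.mp ht
  set s := Nat.find hex
  have hg : n ∣ (Nat.gcd s t.natAbs) ^ 2 := by rw [← Nat.pow_gcd_pow]; exact Nat.dvd_gcd h1 ht'
  have hg0 : Nat.gcd s t.natAbs ≠ 0 := fun h => h0 (Nat.eq_zero_of_gcd_eq_zero_left h)
  have := Nat.find_min' hex ⟨hg0, hg⟩
  have hle := Nat.gcd_le_left t.natAbs (Nat.pos_of_ne_zero h0)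
  have he : Nat.gcd s t.natAbs = s := le_antisymm hle this
  rw [Int.natCast_dvd, ← he]
  exact Nat.gcd_dvd_right _ _

lemma dual_dvd {a c : ℤ⁴} (ha : ∀ i, a i ≠ 0) (h : dualForm a c = 0) (i : Fin 4) :
    (((a i).natAbs / Int.gcd (a i) (∏ j ∈ univ.erase i, a j) : ℕ) : ℤ) ∣ c i ^ 2 := by
  set P := ∏ j ∈ univ.erase i, a j with hP
  have h1 : a i ∣ P * c i ^ 2 := by
    have h2 : a i ∣ ∑ k ∈ univ.erase i, (∏ j ∈ univ.erase k, a j) * c k ^ 2 := by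
      refine dvd_sum fun k hk => Dvd.dvd.mul_right (dvd_prod_of_mem _ ?_) _
      simp [(ne_of_mem_erase hk).symm]
    unfold dualForm at h
    rw [← add_sum_erase _ _ (mem_univ i)] at h
    rw [eq_neg_of_add_eq_zero_left h]
    exact (dvd_neg).mpr h2
  rw [Int.natCast_dvd, Int.natAbs_pow]
  have h3 : (a i).natAbs ∣ P.natAbs * (c i).natAbs ^ 2 := by
    have := Int.natAbs_dvd_natAbs.mpr h1
    rwa [Int.natAbs_mul, Int.natAbs_pow] at this
  have hg : 0 < Nat.gcd (a i).natAbs P.natAbs := Nat.gcd_pos_of_pos_left _ (Int.natAbs_pos.mpr (ha i))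
  have hco := Nat.coprime_div_gcd_div_gcd hg
  change (a i).natAbs / Nat.gcd (a i).natAbs P.natAbs ∣ _
  refine hco.dvd_of_dvd_mul_left ?_
  rw [← Nat.mul_dvd_mul_iff_right hg, Nat.div_mul_cancel (Nat.gcd_dvd_left _ _), mul_right_comm, Nat.div_mul_cancel (Nat.gcd_dvd_right _ _)]
  exact h3

lemma sum_Lc_dual {δ : ℝ} (hδ : 0 < δ) (hδ1 : δ ≤ 1 / 4) : ∃ C : ℝ, 1 ≤ C ∧ ∀ (a : ℤ⁴), (∀ i, a i ≠ 0) →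
    ∀ (ζ : ℂ⁴), (∀ i, 1 ≤ (ζ i).re) → ∀ S : Finset (ℤ⁴), (∀ c ∈ S, dualForm a c = 0) →
    ∑ c ∈ S, Lc δ a ζ c ≤ C * (Delta4 a : ℝ) ^ ((1 + δ) / 2) * ∏ i, ‖ζ i‖ ^ (1 + δ) := by
  obtain ⟨C, hC, h⟩ := L1_sum hδ
  refine ⟨(5 * C) ^ 4, one_le_pow₀ (by linarith), fun a ha ζ hζ S hS => ?_⟩
  have hk : ∀ i, 0 ≤ kap a ζ i := fun i => by unfold kap; positivity
  refine (sum_prod_le S (fun i => L1 δ (kap a ζ i)) fun i t => L1_nonneg _ (hk i) _).trans ?_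
  have key : ∀ i, ∑ t ∈ S.image (fun c => c i), L1 δ (kap a ζ i) t ≤
      5 * C * (Int.gcd (a i) (∏ j ∈ univ.erase i, a j) : ℝ) ^ ((1 + δ) / 2) * ‖ζ i‖ ^ (1 + δ) := by
    intro i
    set g := Int.gcd (a i) (∏ j ∈ univ.erase i, a j) with hg
    have hgd : g ∣ (a i).natAbs := Nat.gcd_dvd_left _ _
    have hap : 0 < (a i).natAbs := Int.natAbs_pos.mpr (ha i)
    have hg0 : 0 < g := Nat.pos_of_dvd_of_pos hgd hap
    have hn0 : (a i).natAbs / g ≠ 0 := (Nat.div_pos (le_of_dvd hap hgd) hg0).ne'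
    obtain ⟨s, hs0, hs1, hs2⟩ := exists_sq_div hn0
    have hsum := h (kap a ζ i) (hk i) s hs0 (S.image fun c => c i) (by
      intro t ht
      obtain ⟨c, hc, rfl⟩ := mem_image.mp ht
      exact hs2 _ (dual_dvd ha (hS c hc) i))
    have hsp : (0 : ℝ) < s := by positivity
    have hgR : (1 : ℝ) ≤ g := by exact_mod_cast hg0
    have hz := one_le_norm_of_re (hζ i)
    have h1 : (a i).natAbs ≤ g * s ^ 2 := by
      have := le_of_dvd (by positivity) hs1
      calc (a i).natAbs = g * ((a i).natAbs / g) := (Nat.mul_div_cancel' hgd).symm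
        _ ≤ _ := Nat.mul_le_mul_left _ this
    have h2 : kap a ζ i / s ≤ 2 * ((g : ℝ) ^ (1 / 2 : ℝ) * ‖ζ i‖) := by
      rw [div_le_iff₀ hsp]
      refine le_of_sq_le_sq ?_ (by positivity)
      rw [kap_sq, mul_pow, mul_pow, mul_pow, ← sqrt_eq_rpow, sq_sqrt (by positivity)]
      have h3 : nab a i ≤ g * (s : ℝ) ^ 2 := by unfold nab; exact_mod_cast h1
      have h4 : 0 ≤ ‖ζ i‖ ^ 2 := by positivity
      have h5 := mul_le_mul_of_nonneg_right h3 h4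
      have h6 : 0 ≤ g * (s : ℝ) ^ 2 * ‖ζ i‖ ^ 2 := by positivity
      nlinarith
    have h3 : (kap a ζ i / s) ^ (1 + δ) ≤ 4 * ((g : ℝ) ^ ((1 + δ) / 2) * ‖ζ i‖ ^ (1 + δ)) := by
      refine (rpow_le_rpow (by have := hk i; positivity) h2 (by linarith)).trans ?_
      rw [mul_rpow (by norm_num) (by positivity), mul_rpow (by positivity) (by positivity), ← rpow_mul (by positivity)]
      rw [show 1 / 2 * (1 + δ) = (1 + δ) / 2 by ring]
      refine mul_le_mul_of_nonneg_right ?_ (by positivity)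
      calc (2 : ℝ) ^ (1 + δ) ≤ 2 ^ (2 : ℝ) := rpow_le_rpow_of_exponent_le (by norm_num) (by linarith)
        _ = 4 := by norm_num
    have h4 : 1 ≤ (g : ℝ) ^ ((1 + δ) / 2) * ‖ζ i‖ ^ (1 + δ) :=
      one_le_mul_of_one_le_of_one_le (one_le_rpow hgR (by linarith)) (one_le_rpow hz (by linarith))
    refine hsum.trans ?_
    nlinarith
  refine (prod_le_prod (fun i _ => sum_nonneg fun t _ => L1_nonneg _ (hk i) _) fun i _ => key i).trans (le_of_eq ?_)
  rw [prod_mul_distrib, prod_mul_distrib, prod_const, finsetProd_rpow _ _ (fun i _ => by positivity)]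
  unfold Delta4
  push_cast
  rfl

lemma gcd_sum {δ : ℝ} (hδ : 0 < δ) : ∃ C : ℝ, 1 ≤ C ∧ ∀ n : ℕ, n ≠ 0 → ∀ S : Finset ℕ, (∀ r ∈ S, r ≠ 0) →
    ∑ r ∈ S, (r : ℝ) ^ (-1 - δ) * Nat.gcd n r ≤ C * n.divisors.card := by
  obtain ⟨C, hC, h⟩ := sum_rpow_le (p := -1 - δ) (by linarith)
  refine ⟨C, hC, fun n hn S hS => ?_⟩
  have h1 : ∀ r ∈ S, (r : ℝ) ^ (-1 - δ) * Nat.gcd n r ≤ ∑ d ∈ n.divisors, if d ∣ r then (r : ℝ) ^ (-1 - δ) * d else 0 := by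
    intro r hr
    have := single_le_sum (f := fun d : ℕ => if d ∣ r then (r : ℝ) ^ (-1 - δ) * d else 0) (s := n.divisors)
      (fun d _ => by split_ifs <;> positivity) (Nat.mem_divisors.mpr ⟨Nat.gcd_dvd_left n r, hn⟩)
    rwa [if_pos (Nat.gcd_dvd_right n r)] at this
  refine (sum_le_sum h1).trans ?_
  rw [sum_comm]
  have h2 : ∀ d ∈ n.divisors, ∑ r ∈ S, (if d ∣ r then (r : ℝ) ^ (-1 - δ) * d else 0) ≤ C := by
    intro d hd
    have hd0 : 0 < d := Nat.pos_of_mem_divisors hd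
    have hdR : (1 : ℝ) ≤ d := by exact_mod_cast hd0
    rw [← sum_filter]
    have hinj : Set.InjOn (fun r : ℕ => r / d) (S.filter fun r => d ∣ r) := by
      intro x hx y hy hxy
      obtain ⟨_, u, rfl⟩ := mem_filter.mp hx
      obtain ⟨_, v, rfl⟩ := mem_filter.mp hy
      simp only [Nat.mul_div_cancel_left _ hd0] at hxy
      rw [hxy]
    refine le_trans ?_ (h ((S.filter fun r => d ∣ r).image fun r => r / d))
    rw [sum_image hinj]
    refine sum_le_sum fun r hr => ?_
    obtain ⟨_, u, rfl⟩ := mem_filter.mp hr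
    rw [Nat.mul_div_cancel_left _ hd0]
    push_cast
    rw [mul_rpow (by positivity) (by positivity), show -1 - δ = -1 + -δ by ring, rpow_add (by linarith : (0 : ℝ) < d), rpow_neg_one]
    have : (d : ℝ) ^ (-δ) ≤ 1 := rpow_le_one_of_one_le_of_nonpos hdR (by linarith)
    calc _ = (d : ℝ) ^ (-δ) * (u : ℝ) ^ (-1 + -δ) := by field_simp
      _ ≤ 1 * (u : ℝ) ^ (-1 + -δ) := by gcongr
      _ = _ := one_mul _
  refine (sum_le_sum h2).trans (le_of_eq ?_)
  rw [sum_const, nsmul_eq_mul]; ring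

lemma dualForm_le {a : ℤ⁴} (ha : ∀ i, a i ≠ 0) (c : ℤ⁴) : ((dualForm a c).natAbs : ℝ) ≤ absProd a * ∏ i, (1 + (c i : ℝ) ^ 2) := by
  have hn : ∀ i, 1 ≤ nab a i := nab_pos ha
  rw [← prod_nab, Nat.cast_natAbs, dualForm_eq]
  push_cast
  have habs : ∀ i, |(a i : ℝ)| = nab a i := fun i => by unfold nab; rw [Nat.cast_natAbs]; push_cast; rfl
  have h1 : ∀ x y z w u : ℝ, |x * y * z * u ^ 2| = |x| * |y| * |z| * u ^ 2 := fun x y z w u => by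
    rw [abs_mul, abs_mul, abs_mul, abs_of_nonneg (sq_nonneg u)]
  refine (abs_add_le _ _).trans ((add_le_add_left ((abs_add_le _ _).trans (add_le_add_left (abs_add_le _ _) _)) _).trans ?_)
  rw [h1 _ _ _ 0, h1 _ _ _ 0, h1 _ _ _ 0, h1 _ _ _ 0, habs, habs, habs, habs, Fin.prod_univ_four, Fin.prod_univ_four]
  have p0 := hn 0
  have p1 := hn 1
  have p2 := hn 2
  have p3 := hn 3
  generalize nab a 0 = x0 at *
  generalize nab a 1 = x1 at *
  generalize nab a 2 = x2 at *
  generalize nab a 3 = x3 at *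
  have hc : ∀ i, 0 ≤ (c i : ℝ) ^ 2 := fun i => sq_nonneg _
  have c0 := hc 0
  have c1 := hc 1
  have c2 := hc 2
  have c3 := hc 3
  generalize (c 0 : ℝ) ^ 2 = y0 at *
  generalize (c 1 : ℝ) ^ 2 = y1 at *
  generalize (c 2 : ℝ) ^ 2 = y2 at *
  generalize (c 3 : ℝ) ^ 2 = y3 at *
  have k0 : x1 * x2 * x3 * y0 ≤ x0 * x1 * x2 * x3 * y0 := by
    have : 0 ≤ x1 * x2 * x3 * y0 := by positivity
    nlinarith
  have k1 : x0 * x2 * x3 * y1 ≤ x0 * x1 * x2 * x3 * y1 := by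
    have : 0 ≤ x0 * x2 * x3 * y1 := by positivity
    nlinarith
  have k2 : x0 * x1 * x3 * y2 ≤ x0 * x1 * x2 * x3 * y2 := by
    have : 0 ≤ x0 * x1 * x3 * y2 := by positivity
    nlinarith
  have k3 : x0 * x1 * x2 * y3 ≤ x0 * x1 * x2 * x3 * y3 := by
    have : 0 ≤ x0 * x1 * x2 * y3 := by positivity
    nlinarith
  have k4 : y0 + y1 + y2 + y3 ≤ (1 + y0) * (1 + y1) * (1 + y2) * (1 + y3) := by
    have e : (1 + y0) * (1 + y1) * (1 + y2) * (1 + y3) = 1 + (y0 + y1 + y2 + y3) + (y0*y1+y0*y2+y0*y3+y1*y2+y1*y3+y2*y3+y0*y1*y2+y0*y1*y3+y0*y2*y3+y1*y2*y3+y0*y1*y2*y3) := by ring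
    have : 0 ≤ y0*y1+y0*y2+y0*y3+y1*y2+y1*y3+y2*y3+y0*y1*y2+y0*y1*y3+y0*y2*y3+y1*y2*y3+y0*y1*y2*y3 := by positivity
    linarith
  have k5 := mul_le_mul_of_nonneg_left k4 (by positivity : 0 ≤ x0 * x1 * x2 * x3)
  linarith

lemma L1_absorb {δ κ : ℝ} (hδ : 0 < δ) (hδ1 : δ ≤ 1) (hκ : 1 ≤ κ) (c : ℤ) :
    L1 δ κ c * (1 + (c : ℝ) ^ 2) ^ (δ / 4) ≤ 2 * κ ^ (δ / 2) * L1 (δ / 2) κ c := by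
  have hk : 1 ≤ κ ^ (δ / 2) := one_le_rpow hκ (by linarith)
  unfold L1
  split_ifs with h
  · rw [h]; simp; linarith
  · have hc : 1 ≤ |(c : ℝ)| := by exact_mod_cast Int.one_le_abs h
    have h1 : (1 + (c : ℝ) ^ 2) ^ (δ / 4) ≤ 2 * |(c : ℝ)| ^ (δ / 2) := by
      have h2 : 1 + (c : ℝ) ^ 2 ≤ 2 * |(c : ℝ)| ^ 2 := by rw [sq_abs]; nlinarith [sq_abs (c : ℝ)]
      refine (rpow_le_rpow (by positivity) h2 (by linarith)).trans ?_
      rw [mul_rpow (by norm_num) (by positivity), ← rpow_natCast, ← rpow_mul (by positivity)]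
      rw [show ((2 : ℕ) : ℝ) * (δ / 4) = δ / 2 by push_cast; ring]
      refine mul_le_mul_of_nonneg_right ?_ (by positivity)
      calc (2 : ℝ) ^ (δ / 4) ≤ 2 ^ (1 : ℝ) := rpow_le_rpow_of_exponent_le (by norm_num) (by linarith)
        _ = 2 := by norm_num
    calc _ ≤ (κ / |(c : ℝ)|) ^ (1 + δ) * (2 * |(c : ℝ)| ^ (δ / 2)) := mul_le_mul_of_nonneg_left h1 (by positivity)
      _ = _ := by
        rw [show 1 + δ = (1 + δ / 2) + δ / 2 by ring, rpow_add (by positivity), div_rpow (by positivity) (by positivity) (δ / 2)]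
        field_simp

/-! F6: frequencies with nonzero dual form. -/

lemma sum_omg_Lc {δ : ℝ} (hδ : 0 < δ) : ∃ C : ℝ, 1 ≤ C ∧ ∀ (a : ℤ⁴), (∀ i, a i ≠ 0) → ∀ (ζ : ℂ⁴), (∀ i, 1 ≤ (ζ i).re) → ∀ (q : ℕ) (S : Finset (ℤ⁴)),
    ∑ c ∈ S, omg a c q * Lc δ a ζ c ≤ C * ∏ i, kap a ζ i ^ (1 + δ) := by
  obtain ⟨C, hC, h⟩ := L1_sum hδ
  refine ⟨(1 + C) ^ 4, one_le_pow₀ (by linarith), fun a ha ζ hζ q S => ?_⟩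
  have hk := kap_pos ha hζ
  have e1 : ∀ c, omg a c q * Lc δ a ζ c = ∏ i, (if ((Int.gcd (a i) q : ℕ) : ℤ) ∣ c i then sqrt (Int.gcd (a i) q) * L1 δ (kap a ζ i) (c i) else 0) := by
    intro c
    unfold omg Lc
    rw [← prod_mul_distrib]
    refine prod_congr rfl fun i _ => ?_
    split_ifs <;> simp
  simp_rw [e1]
  have hL : ∀ i t, 0 ≤ L1 δ (kap a ζ i) t := fun i t => L1_nonneg _ (by linarith [hk i]) _
  refine (sum_prod_le S (fun i t => if ((Int.gcd (a i) q : ℕ) : ℤ) ∣ t then sqrt (Int.gcd (a i) q) * L1 δ (kap a ζ i) t else 0) (fun i t => by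
    have := hL i t
    split_ifs <;> positivity)).trans ?_
  have e2 : (1 + C) ^ 4 * ∏ i, kap a ζ i ^ (1 + δ) = ∏ i : Fin 4, ((1 + C) * kap a ζ i ^ (1 + δ)) := by rw [prod_mul_distrib]; simp
  rw [e2]
  refine prod_le_prod (fun i _ => sum_nonneg fun t _ => by
    have := hL i t
    split_ifs <;> positivity) fun i _ => ?_
  rw [← sum_filter, ← mul_sum]
  set g := Int.gcd (a i) q with hg
  have hg0 : g ≠ 0 := by rw [hg]; intro h0; exact ha i (Int.gcd_eq_zero_iff.1 h0).1
  have hg1 : (1 : ℝ) ≤ g := by exact_mod_cast Nat.one_le_iff_ne_zero.2 hg0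
  have hgn : (g : ℝ) ≤ nab a i := by
    unfold nab
    exact_mod_cast le_of_dvd (Int.natAbs_pos.2 (ha i)) (Int.natCast_dvd.1 (Int.gcd_dvd_left (a i) q))
  have hz := one_le_norm_of_re (hζ i)
  have hgk : sqrt g ≤ kap a ζ i := by
    unfold kap
    calc sqrt g ≤ sqrt (2 * nab a i) := sqrt_le_sqrt (by linarith)
      _ ≤ _ := le_mul_of_one_le_right (by positivity) hz
  have h1 := h (kap a ζ i) (by linarith [hk i]) g hg0 (filter (fun t => (g : ℤ) ∣ t) (S.image fun c => c i)) (fun c hc => (mem_filter.1 hc).2)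
  have hsg : sqrt g ≤ g := by rw [sqrt_le_left (by positivity)]; nlinarith
  have h2 : sqrt g * (kap a ζ i / g) ^ (1 + δ) ≤ kap a ζ i ^ (1 + δ) := by
    have hkp := hk i
    rw [div_rpow (by linarith) (by positivity), mul_div_assoc', div_le_iff₀ (by positivity), mul_comm]
    refine mul_le_mul_of_nonneg_left (hsg.trans ?_) (by positivity)
    calc (g : ℝ) = (g : ℝ) ^ (1 : ℝ) := by simp
      _ ≤ _ := rpow_le_rpow_of_exponent_le hg1 (by linarith)
  have h3 : sqrt g ≤ kap a ζ i ^ (1 + δ) := hgk.trans (by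
    calc kap a ζ i = kap a ζ i ^ (1 : ℝ) := by simp
      _ ≤ _ := rpow_le_rpow_of_exponent_le (hk i) (by linarith))
  calc _ ≤ sqrt g * (1 + C * (kap a ζ i / g) ^ (1 + δ)) := mul_le_mul_of_nonneg_left h1 (by positivity)
    _ ≤ _ := by nlinarith

lemma Sqa_sum_bound {δ : ℝ} (hδ : 0 < δ) : ∃ C : ℝ, 1 ≤ C ∧ ∀ (a : ℤ⁴), (∀ i, a i ≠ 0) → ∀ (c : ℤ⁴), dualForm a c ≠ 0 → ∀ X : ℕ,
    ∑ q ∈ Icc 1 X, ‖Sqa a c q‖ * (q : ℝ) ^ (-3 - 2 * δ) ≤ C * absProd a ^ (δ / 4) * (∏ i, (1 + (c i : ℝ) ^ 2) ^ (δ / 4)) *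
        ∑ q ∈ (Icc 1 X).filter (smo (2 * (∏ i, a i).natAbs)), (q : ℝ) ^ (-(2 * δ)) * omg a c q := by
  obtain ⟨C1, hC1, h1⟩ := gcd_sum (δ := 2 * δ) (by linarith)
  obtain ⟨C2, hC2, h2⟩ := tau_bound (δ := δ / 4) (by linarith)
  refine ⟨4 * (C1 * C2), by nlinarith, fun a ha c hc X => ?_⟩
  have hA : (∏ i, a i) ≠ 0 := prod_ne_zero_iff.2 fun i _ => ha i
  have hM : 2 * (∏ i, a i).natAbs ≠ 0 := by simp [hA, ha, prod_eq_zero_iff]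
  rw [sum_split hM X (fun q => ‖Sqa a c q‖ * (q : ℝ) ^ (-3 - 2 * δ)), mul_sum]
  refine sum_le_sum fun q hq => ?_
  obtain ⟨hqI, hqs⟩ := mem_filter.1 hq
  have hq1 : 1 ≤ q := (mem_Icc.1 hqI).1
  have hq0 : (0 : ℝ) < q := by exact_mod_cast hq1
  have hn : (dualForm a c).natAbs ≠ 0 := Int.natAbs_ne_zero.2 hc
  have hP0 : 0 ≤ ∏ i, (1 + (c i : ℝ) ^ 2) := prod_nonneg fun i _ => by positivity
  have hgs := h1 _ hn ((Icc 1 (X / q)).filter (fun r => Coprime r (2 * (∏ i, a i).natAbs))) (fun r hr => by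
    have := (mem_Icc.1 (mem_filter.1 hr).1).1; omega)
  have ht : ((dualForm a c).natAbs.divisors.card : ℝ) ≤ C2 * (absProd a ^ (δ / 4) * (∏ i, (1 + (c i : ℝ) ^ 2) ^ (δ / 4))) := by
    refine (h2 _ hn).trans (mul_le_mul_of_nonneg_left ?_ (by linarith))
    rw [finsetProd_rpow _ _ (fun i _ => by positivity), ← mul_rpow (by positivity) hP0]
    exact rpow_le_rpow (by positivity) (dualForm_le ha c) (by linarith)
  have hom := omg_nonneg a c q
  have hterm : ∀ r ∈ (Icc 1 (X / q)).filter (fun r => Coprime r (2 * (∏ i, a i).natAbs)),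
      ‖Sqa a c (r * q)‖ * ((r * q : ℕ) : ℝ) ^ (-3 - 2 * δ) ≤ 4 * ((q : ℝ) ^ (-(2 * δ)) * omg a c q) * ((r : ℝ) ^ (-1 - 2 * δ) * Nat.gcd (dualForm a c).natAbs r) := by
    intro r hr
    obtain ⟨hrI, hrc⟩ := mem_filter.1 hr
    have hr1 : 1 ≤ r := (mem_Icc.1 hrI).1
    have hr0 : (0 : ℝ) < r := by exact_mod_cast hr1
    rw [Sqa_mul (by omega) (by omega) (smo_coprime hqs hrc), norm_mul]
    have b1 := Sqa_bound (show q ≠ 0 by omega) a c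
    have b2 := Sqa_coprime_bound a c r (by omega) (fun p hp hpr => by
      have hcop := Nat.Coprime.coprime_dvd_left hpr hrc
      refine ⟨?_, fun i hi => ?_⟩
      · rintro rfl
        exact absurd (Nat.Coprime.eq_one_of_dvd hcop (dvd_mul_right 2 _)) (by norm_num)
      · have : p ∣ (∏ i, a i).natAbs := Int.natCast_dvd.1 (hi.trans (dvd_prod_of_mem a (mem_univ i)))
        exact hp.one_lt.ne' (Nat.Coprime.eq_one_of_dvd hcop (this.mul_left 2)))
    have eg : (Int.gcd (dualForm a c) r : ℝ) = Nat.gcd (dualForm a c).natAbs r := by simp [Int.gcd]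
    rw [eg] at b2
    push_cast
    rw [mul_rpow hr0.le hq0.le]
    have er : (r : ℝ) ^ (-1 - 2 * δ) = (r : ℝ) ^ 2 * (r : ℝ) ^ (-3 - 2 * δ) := by
      rw [← rpow_natCast, ← rpow_add hr0]; congr 1; push_cast; ring
    have eq' : (q : ℝ) ^ (-(2 * δ)) = (q : ℝ) ^ 3 * (q : ℝ) ^ (-3 - 2 * δ) := by
      rw [← rpow_natCast, ← rpow_add hq0]; congr 1; push_cast; ring
    rw [er, eq']
    calc _ ≤ ((r : ℝ) ^ 2 * Nat.gcd (dualForm a c).natAbs r) * (4 * q ^ 3 * omg a c q) * ((r : ℝ) ^ (-3 - 2 * δ) * (q : ℝ) ^ (-3 - 2 * δ)) :=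
          mul_le_mul_of_nonneg_right (mul_le_mul b2 b1 (norm_nonneg _) (by positivity)) (by positivity)
      _ = _ := by ring
  refine (sum_le_sum hterm).trans ?_
  rw [← mul_sum]
  calc _ ≤ 4 * ((q : ℝ) ^ (-(2 * δ)) * omg a c q) * (C1 * (C2 * (absProd a ^ (δ / 4) * (∏ i, (1 + (c i : ℝ) ^ 2) ^ (δ / 4))))) :=
        mul_le_mul_of_nonneg_left (hgs.trans (mul_le_mul_of_nonneg_left ht (by linarith))) (by positivity)
    _ = _ := by ring

lemma trm_nondual {δ : ℝ} (hδ : 0 < δ) (hδ1 : δ ≤ 1 / 4) : ∃ C : ℝ, 1 ≤ C ∧ ∀ (a : ℤ⁴), (∀ i, a i ≠ 0) →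
    ∀ (ζ : ℂ⁴), (∀ i, 1 ≤ (ζ i).re) → ∀ B : ℝ, 0 < B → ∀ (X : ℕ) (S : Finset (ℤ⁴)),
    (∀ c ∈ S, dualForm a c ≠ 0) → ∑ c ∈ S, ∑ q ∈ Icc 1 X, ‖trm a B ζ q c‖ ≤
      C * absProd a ^ (1 / 2 + δ) * B ^ (-(1 / 2) + δ) * (∏ i, ‖ζ i‖ ^ (1 / 2 : ℝ)) * ∏ i, ‖ζ i‖ ^ (1 + δ) := by
  obtain ⟨C1, hC1, h1⟩ := JJ_bound hδ hδ1
  obtain ⟨C2, hC2, h2⟩ := Sqa_sum_bound hδ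
  obtain ⟨C3, hC3, h3⟩ := sum_omg_Lc (δ := δ / 2) (by linarith)
  obtain ⟨C4, hC4, h4⟩ := smooth_sum (δ := 2 * δ) (κ := δ / 4) (by linarith) (by linarith)
  refine ⟨1024 * (C1 * C2 * C3 * C4), ?_, fun a ha ζ hζ B hB X S hS => ?_⟩
  · have h5 : 1 ≤ C1 * C2 * C3 * C4 := one_le_mul_of_one_le_of_one_le (one_le_mul_of_one_le_of_one_le (one_le_mul_of_one_le_of_one_le hC1 hC2) hC3) hC4
    linarith
  have hA : (∏ i, a i) ≠ 0 := prod_ne_zero_iff.2 fun i _ => ha i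
  have hM : 2 * (∏ i, a i).natAbs ≠ 0 := by simp [hA, ha, prod_eq_zero_iff]
  set A : ℝ := absProd a with hAd
  have hA1 : 1 ≤ A := by rw [hAd]; exact_mod_cast Int.natAbs_pos.2 hA
  set Z := ∏ i, ‖ζ i‖ ^ (1 / 2 : ℝ) with hZ
  have hZ0 : 0 ≤ Z := prod_nonneg fun i _ => by positivity
  have hk := kap_pos ha hζ
  set T := (Icc 1 X).filter (smo (2 * (∏ i, a i).natAbs)) with hT
  set K := ∏ i, kap a ζ i ^ (δ / 2) with hK
  have hK0 : 0 ≤ K := prod_nonneg fun i _ => by have := hk i; positivity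
  have hBp : 0 < B ^ (-(1 / 2) + δ) := by positivity
  have hpt : ∀ c ∈ S, ∑ q ∈ Icc 1 X, ‖trm a B ζ q c‖ ≤
      (C1 * Z * B ^ (-(1 / 2) + δ)) * (C2 * A ^ (δ / 4)) * (16 * K) * ∑ q ∈ T, (q : ℝ) ^ (-(2 * δ)) * (omg a c q * Lc (δ / 2) a ζ c) := by
    intro c hc
    have hc0 : c ≠ 0 := by
      rintro rfl; exact hS 0 hc (dualForm_zero a)
    have hL := Lc_nonneg δ (a := a) (ζ := ζ) c
    have e1 : ∀ q ∈ Icc 1 X, ‖trm a B ζ q c‖ ≤ (C1 * Z * B ^ (-(1 / 2) + δ) * Lc δ a ζ c) * (‖Sqa a c q‖ * (q : ℝ) ^ (-3 - 2 * δ)) := by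
      intro q hq
      have hq1 : 1 ≤ q := (mem_Icc.1 hq).1
      have hq0 : (0 : ℝ) < q := by exact_mod_cast hq1
      unfold trm
      rw [norm_mul, norm_div, norm_pow, Complex.norm_natCast]
      have hj := h1 a ha ζ hζ c hc0 ((q : ℝ) ^ 2 / (2 * B)) (by positivity)
      have e2 : ((q : ℝ) ^ 2 / (2 * B)) ^ (1 / 2 - δ) = (q : ℝ) ^ (1 - 2 * δ) * (2 * B) ^ (-(1 / 2) + δ) := by
        rw [div_rpow (by positivity) (by positivity), ← rpow_natCast, ← rpow_mul hq0.le, show -(1 / 2) + δ = -(1 / 2 - δ) by ring, rpow_neg (by positivity)]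
        rw [div_eq_mul_inv]; congr 2; push_cast; ring
      have e3 : (q : ℝ) ^ (-3 - 2 * δ) = (q : ℝ) ^ (1 - 2 * δ) / (q : ℝ) ^ 4 := by
        rw [← rpow_natCast, ← rpow_sub hq0]; congr 1; push_cast; ring
      rw [e2] at hj
      have hj2 : ‖JJ (sgv a) ζ (bv a c) ((q : ℝ) ^ 2 / (2 * B))‖ ≤ C1 * Z * ((q : ℝ) ^ (1 - 2 * δ) * B ^ (-(1 / 2) + δ)) * Lc δ a ζ c := by
        refine hj.trans (mul_le_mul_of_nonneg_right (mul_le_mul_of_nonneg_left ?_ (by positivity)) hL)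
        exact mul_le_mul_of_nonneg_left (B_pow_le hB hδ1) (by positivity)
      rw [e3]
      calc _ ≤ ‖Sqa a c q‖ / (q : ℝ) ^ 4 * (C1 * Z * ((q : ℝ) ^ (1 - 2 * δ) * B ^ (-(1 / 2) + δ)) * Lc δ a ζ c) :=
            mul_le_mul_of_nonneg_left hj2 (by positivity)
        _ = _ := by ring
    refine (sum_le_sum e1).trans ?_
    rw [← mul_sum]
    have e4 : Lc δ a ζ c * (∏ i, (1 + (c i : ℝ) ^ 2) ^ (δ / 4)) ≤ 16 * K * Lc (δ / 2) a ζ c := by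
      have : 16 * K * Lc (δ / 2) a ζ c = ∏ i, (2 * kap a ζ i ^ (δ / 2) * L1 (δ / 2) (kap a ζ i) (c i)) := by
        unfold Lc; rw [prod_mul_distrib, prod_mul_distrib]; norm_num [hK]
      rw [this]; unfold Lc; rw [← prod_mul_distrib]
      exact prod_le_prod (fun i _ => mul_nonneg (L1_nonneg _ (by linarith [hk i]) _) (by positivity)) fun i _ => L1_absorb hδ (by linarith) (hk i) (c i)
    have hW0 : 0 ≤ ∑ q ∈ T, (q : ℝ) ^ (-(2 * δ)) * omg a c q := sum_nonneg fun q _ => mul_nonneg (by positivity) (omg_nonneg a c q)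
    calc _ ≤ (C1 * Z * B ^ (-(1 / 2) + δ) * Lc δ a ζ c) * (C2 * A ^ (δ / 4) * (∏ i, (1 + (c i : ℝ) ^ 2) ^ (δ / 4)) * ∑ q ∈ T, (q : ℝ) ^ (-(2 * δ)) * omg a c q) :=
          mul_le_mul_of_nonneg_left (h2 a ha c (hS c hc) X) (by positivity)
      _ = (C1 * Z * B ^ (-(1 / 2) + δ)) * (C2 * A ^ (δ / 4)) * (∑ q ∈ T, (q : ℝ) ^ (-(2 * δ)) * omg a c q) * (Lc δ a ζ c * (∏ i, (1 + (c i : ℝ) ^ 2) ^ (δ / 4))) := by ring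
      _ ≤ (C1 * Z * B ^ (-(1 / 2) + δ)) * (C2 * A ^ (δ / 4)) * (∑ q ∈ T, (q : ℝ) ^ (-(2 * δ)) * omg a c q) * (16 * K * Lc (δ / 2) a ζ c) :=
          mul_le_mul_of_nonneg_left e4 (by positivity)
      _ = (C1 * Z * B ^ (-(1 / 2) + δ)) * (C2 * A ^ (δ / 4)) * (16 * K) * ((∑ q ∈ T, (q : ℝ) ^ (-(2 * δ)) * omg a c q) * Lc (δ / 2) a ζ c) := by ring
      _ = _ := by
        rw [sum_mul]; congr 1
        exact sum_congr rfl fun q _ => by ring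
  refine (sum_le_sum hpt).trans ?_
  rw [← mul_sum, sum_comm]
  have hin : ∑ q ∈ T, ∑ c ∈ S, (q : ℝ) ^ (-(2 * δ)) * (omg a c q * Lc (δ / 2) a ζ c) ≤ (C4 * (2 * A ^ (δ / 4))) * (C3 * ∏ i, kap a ζ i ^ (1 + δ / 2)) := by
    have hp0 : 0 ≤ ∏ i, kap a ζ i ^ (1 + δ / 2) := prod_nonneg fun i _ => by have := hk i; positivity
    calc _ ≤ ∑ q ∈ T, (q : ℝ) ^ (-(2 * δ)) * (C3 * ∏ i, kap a ζ i ^ (1 + δ / 2)) := by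
          refine sum_le_sum fun q _ => ?_
          rw [← mul_sum]
          exact mul_le_mul_of_nonneg_left (h3 a ha ζ hζ q S) (by positivity)
      _ ≤ _ := by
          rw [← sum_mul]
          refine mul_le_mul_of_nonneg_right ((h4 _ hM T fun q hq => (mem_filter.1 hq).2).trans ?_) (by positivity)
          refine mul_le_mul_of_nonneg_left ?_ (by linarith)
          push_cast
          rw [mul_rpow (by norm_num) (by positivity)]
          refine mul_le_mul_of_nonneg_right ?_ (by positivity)
          calc (2 : ℝ) ^ (δ / 4) ≤ 2 ^ (1 : ℝ) := rpow_le_rpow_of_exponent_le (by norm_num) (by linarith)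
            _ = 2 := by norm_num
  have hkk : K * ∏ i, kap a ζ i ^ (1 + δ / 2) ≤ 32 * A ^ ((1 + δ) / 2) * ∏ i, ‖ζ i‖ ^ (1 + δ) := by
    rw [hK, ← prod_mul_distrib]
    have e5 : ∀ i, kap a ζ i ^ (δ / 2) * kap a ζ i ^ (1 + δ / 2) = (2 ^ ((1 + δ) / 2) * nab a i ^ ((1 + δ) / 2)) * ‖ζ i‖ ^ (1 + δ) := by
      intro i
      have := hk i
      have hn := nab_pos ha i
      rw [← rpow_add (by linarith), show δ / 2 + (1 + δ / 2) = 1 + δ by ring]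
      unfold kap
      rw [mul_rpow (by positivity) (by positivity), sqrt_eq_rpow, ← rpow_mul (by linarith), mul_rpow (by norm_num) (by linarith)]
      rw [show 1 / 2 * (1 + δ) = (1 + δ) / 2 by ring]
    simp_rw [e5]
    rw [prod_mul_distrib, prod_mul_distrib, finsetProd_rpow _ (nab a) (fun i _ => by linarith [nab_pos ha i]), prod_nab, ← hAd]
    refine mul_le_mul_of_nonneg_right (mul_le_mul_of_nonneg_right ?_ (by positivity)) (prod_nonneg fun i _ => by positivity)
    rw [prod_const, card_univ, Fintype.card_fin, ← rpow_natCast, ← rpow_mul (by norm_num)]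
    calc (2 : ℝ) ^ ((1 + δ) / 2 * ((4 : ℕ) : ℝ)) ≤ 2 ^ (5 : ℝ) := rpow_le_rpow_of_exponent_le (by norm_num) (by push_cast; linarith)
      _ = 32 := by norm_num
  have eA : A ^ (δ / 4) * A ^ (δ / 4) * A ^ ((1 + δ) / 2) = A ^ (1 / 2 + δ) := by
    rw [← rpow_add (by linarith), ← rpow_add (by linarith)]; congr 1; ring
  calc _ ≤ (C1 * Z * B ^ (-(1 / 2) + δ)) * (C2 * A ^ (δ / 4)) * (16 * K) * ((C4 * (2 * A ^ (δ / 4))) * (C3 * ∏ i, kap a ζ i ^ (1 + δ / 2))) :=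
        mul_le_mul_of_nonneg_left hin (by positivity)
    _ = (32 * (C1 * C2 * C3 * C4) * Z * B ^ (-(1 / 2) + δ) * (A ^ (δ / 4) * A ^ (δ / 4))) * (K * ∏ i, kap a ζ i ^ (1 + δ / 2)) := by ring
    _ ≤ (32 * (C1 * C2 * C3 * C4) * Z * B ^ (-(1 / 2) + δ) * (A ^ (δ / 4) * A ^ (δ / 4))) * (32 * A ^ ((1 + δ) / 2) * ∏ i, ‖ζ i‖ ^ (1 + δ)) :=
        mul_le_mul_of_nonneg_left hkk (by positivity)
    _ = _ := by rw [← eA]; ring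

/-! F7: the core asymptotic formula for the Gaussian weighted count. -/

lemma one_le_prod4 {f : Fin 4 → ℝ} (h : ∀ i, 1 ≤ f i) : 1 ≤ ∏ i, f i := by
  calc (1 : ℝ) = ∏ _i : Fin 4, (1 : ℝ) := by simp
    _ ≤ _ := prod_le_prod (fun _ _ => zero_le_one) fun i _ => h i

lemma Nz_norm : ∃ C : ℝ, 1 ≤ C ∧ ∀ (a : ℤ⁴), (∀ i, a i ≠ 0) → ∀ (ζ : ℂ⁴), (∀ i, 1 ≤ (ζ i).re) → ∀ B : ℝ, 1 ≤ B → ‖Nz a B ζ‖ ≤ C * B ^ 4 := by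
  have hs1 : Summable fun n : ℤ => ‖((1 / (1 + (n : ℝ) ^ 2) : ℝ) : ℂ)‖ := by
    refine ((summable_inv_one_add_mul_sq one_pos)).congr fun n => ?_
    rw [norm_real, norm_eq_abs, abs_of_pos (by positivity), one_mul]
  have hs : Summable fun x : ℤ⁴ => ∏ i, (1 / (1 + (x i : ℝ) ^ 2)) := by
    refine (tsum_pi_prod 4 (fun _ n => ((1 / (1 + (n : ℝ) ^ 2) : ℝ) : ℂ)) (fun _ => hs1)).1.congr fun x => ?_
    rw [norm_prod]
    refine prod_congr rfl fun i _ => ?_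
    rw [norm_real, norm_eq_abs, abs_of_pos (by positivity)]
  have h0 : 0 ≤ ∑' x : ℤ⁴, ∏ i, (1 / (1 + (x i : ℝ) ^ 2)) := tsum_nonneg fun x => prod_nonneg fun i _ => by positivity
  refine ⟨1 + ∑' x : ℤ⁴, ∏ i, (1 / (1 + (x i : ℝ) ^ 2)), by linarith, fun a ha ζ hζ B hB => ?_⟩
  have hB0 : 0 < B := by linarith
  have hb : ∀ x : ℤ⁴, ‖(if Fq a x = 0 then Wx a B ζ x else 0)‖ ≤ (∏ i, (1 / (1 + (x i : ℝ) ^ 2))) * B ^ 4 := by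
    intro x
    have h1 : ‖Wx a B ζ x‖ ≤ (∏ i, (1 / (1 + (x i : ℝ) ^ 2))) * B ^ 4 := by
      refine (Wx_norm_le ha hB0 hζ x).trans ?_
      have : (∏ i, (1 / (1 + (x i : ℝ) ^ 2))) * B ^ 4 = ∏ i, ((1 / (1 + (x i : ℝ) ^ 2)) * B) := by rw [prod_mul_distrib]; simp
      rw [this]
      refine prod_le_prod (fun i _ => (gB_pos _ _).le) fun i _ => ?_
      unfold gB
      refine (exp_neg_le_inv (by positivity)).trans ?_
      have e3 : 1 / (1 + 1 / B * (x i : ℝ) ^ 2) = 1 / (B + (x i : ℝ) ^ 2) * B := by field_simp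
      rw [e3]
      refine mul_le_mul_of_nonneg_right ?_ hB0.le
      exact one_div_le_one_div_of_le (by positivity) (by linarith)
    split_ifs
    · exact h1
    · rw [norm_zero]; exact (norm_nonneg _).trans h1
  unfold Nz
  refine (tsum_of_norm_bounded (hs.mul_right (B ^ 4)).hasSum hb).trans ?_
  rw [tsum_mul_right]
  exact mul_le_mul_of_nonneg_right (by linarith) (by positivity)

lemma box_tendsto : Tendsto (fun X : ℕ => (range (X + 1)) ×ˢ (Fintype.piFinset fun _ : Fin 4 => Icc (-(X : ℤ)) X)) atTop atTop := by
  refine tendsto_atTop_finset_of_monotone ?_ ?_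
  · intro X Y h
    refine product_subset_product (range_mono (by omega)) (Fintype.piFinset_subset _ _ fun _ => Icc_subset_Icc (by omega) (by omega))
  · rintro ⟨q, c⟩
    refine ⟨q + ∑ i, (c i).natAbs, ?_⟩
    simp only [mem_product, mem_range, Fintype.mem_piFinset, mem_Icc]
    refine ⟨by omega, fun i => ?_⟩
    have := single_le_sum (f := fun i => (c i).natAbs) (fun _ _ => Nat.zero_le _) (mem_univ i)
    omega

lemma core_trm {δ : ℝ} (hδ : 0 < δ) (hδ1 : δ ≤ 1 / 4) : ∃ C : ℝ, 1 ≤ C ∧ ∀ (a : ℤ⁴), (∀ i, a i ≠ 0) →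
    ¬ IsSquare (∏ i, a i) → ∀ (ζ : ℂ⁴), (∀ i, 1 ≤ (ζ i).re) → ∀ B : ℝ, 0 < B → ∀ G : ℂ,
    Tendsto (singularPartial a) atTop (nhds G) →
    ‖∑' p : ℕ × (ℤ⁴), trm a B ζ p.1 p.2 - Jinf a ζ * G‖ ≤
      C * (absProd a ^ (2 / 3 + 2 * δ) * (Delta4 a : ℝ) ^ (1 / 2 : ℝ) * B ^ (-(1 / 2) + δ)) * ((∏ i, ‖ζ i‖ ^ 2) * Qz ζ) := by
  obtain ⟨C1, hC1, h1⟩ := trm_zero_freq hδ hδ1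
  obtain ⟨C2, hC2, h2⟩ := trm_dual hδ hδ1
  obtain ⟨C3, hC3, h3⟩ := sum_Lc_dual hδ hδ1
  obtain ⟨C4, hC4, h4⟩ := trm_nondual hδ hδ1
  refine ⟨C1 + C2 * C3 + C4, by nlinarith, fun a ha hsq ζ hζ B hB G hG => ?_⟩
  have hA : (∏ i, a i) ≠ 0 := prod_ne_zero_iff.2 fun i _ => ha i
  have hD1 : (1 : ℝ) ≤ Delta4 a := by exact_mod_cast Delta4_pos a ha
  have hDA : (Delta4 a : ℝ) ≤ absProd a := by exact_mod_cast Delta4_le a ha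
  set A : ℝ := absProd a with hAd
  set D : ℝ := (Delta4 a : ℝ) with hDd
  have hA1 : 1 ≤ A := hD1.trans hDA
  have hz : ∀ i, 1 ≤ ‖ζ i‖ := fun i => one_le_norm_of_re (hζ i)
  have hQ := Qz_ge hζ
  set Z := ∏ i, ‖ζ i‖ ^ (1 / 2 : ℝ) with hZ
  set Z1 := ∏ i, ‖ζ i‖ ^ (1 + δ) with hZ1
  set Z2 := ∏ i, ‖ζ i‖ ^ 2 with hZ2
  have hZ0 : 0 ≤ Z := prod_nonneg fun i _ => by positivity
  have hZ1p : 1 ≤ Z1 := one_le_prod4 fun i => one_le_rpow (hz i) (by linarith)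
  have hZZ : Z * Z1 ≤ Z2 := by
    rw [hZ, hZ1, hZ2, ← prod_mul_distrib]
    refine prod_le_prod (fun i _ => by positivity) fun i _ => ?_
    rw [← rpow_add (by linarith [hz i]), ← rpow_natCast]
    exact rpow_le_rpow_of_exponent_le (hz i) (by push_cast; linarith)
  have hZ12 : Z ≤ Z2 := (le_mul_of_one_le_right hZ0 hZ1p).trans hZZ
  have hZ20 : 0 ≤ Z2 := hZ0.trans hZ12
  have hBp : 0 < B ^ (-(1 / 2) + δ) := by positivity
  have hDh : 1 ≤ D ^ (1 / 2 : ℝ) := one_le_rpow hD1 (by norm_num)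
  have hAle : ∀ s : ℝ, s ≤ 2 / 3 + 2 * δ → A ^ s ≤ A ^ (2 / 3 + 2 * δ) := fun s hs => rpow_le_rpow_of_exponent_le hA1 hs
  have hDA2 : A ^ (2 / 3 + δ) * D ^ ((1 + δ) / 2) ≤ A ^ (2 / 3 + 2 * δ) * D ^ (1 / 2 : ℝ) := by
    rw [show (1 + δ) / 2 = δ / 2 + 1 / 2 by ring, rpow_add (show 0 < D by linarith) (δ / 2), ← mul_assoc]
    refine mul_le_mul_of_nonneg_right ?_ (by positivity)
    calc A ^ (2 / 3 + δ) * D ^ (δ / 2) ≤ A ^ (2 / 3 + δ) * A ^ (δ / 2) :=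
          mul_le_mul_of_nonneg_left (rpow_le_rpow (by linarith) hDA (by linarith)) (by positivity)
      _ = A ^ (2 / 3 + δ + δ / 2) := (rpow_add (by linarith) _ _).symm
      _ ≤ _ := hAle _ (by linarith)
  have hfin : ∀ X : ℕ, 1 ≤ X → ∀ S : Finset (ℤ⁴), (0 : ℤ⁴) ∈ S → ‖∑ c ∈ S, ∑ q ∈ Icc 1 X, trm a B ζ q c - Jinf a ζ * singularPartial a X‖ ≤
        (C1 + C2 * C3 + C4) * (A ^ (2 / 3 + 2 * δ) * D ^ (1 / 2 : ℝ) * B ^ (-(1 / 2) + δ)) * (Z2 * Qz ζ) := by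
    intro X hX S hS
    rw [← add_sum_erase S _ hS, ← sum_filter_add_sum_filter_not (S.erase 0) (fun c => dualForm a c = 0)]
    have k1 := h1 a ha hsq ζ hζ B hB X hX
    have k2 : ‖∑ c ∈ (S.erase 0).filter (fun c => dualForm a c = 0), ∑ q ∈ Icc 1 X, trm a B ζ q c‖ ≤
        C2 * A ^ (2 / 3 + δ) * B ^ (-(1 / 2) + δ) * Z * Qz ζ * (C3 * D ^ ((1 + δ) / 2) * Z1) := by
      refine (norm_sum_le _ _).trans ((sum_le_sum fun c hc => h2 a ha hsq c (ne_of_mem_erase (mem_filter.1 hc).1) (mem_filter.1 hc).2 ζ hζ B hB X hX).trans ?_)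
      rw [← mul_sum]
      exact mul_le_mul_of_nonneg_left (h3 a ha ζ hζ _ fun c hc => (mem_filter.1 hc).2) (by positivity)
    have k3 : ‖∑ c ∈ (S.erase 0).filter (fun c => ¬ dualForm a c = 0), ∑ q ∈ Icc 1 X, trm a B ζ q c‖ ≤
        C4 * A ^ (1 / 2 + δ) * B ^ (-(1 / 2) + δ) * Z * Z1 := by
      refine (norm_sum_le _ _).trans ((sum_le_sum fun c hc => norm_sum_le _ _).trans ?_)
      exact h4 a ha ζ hζ B hB X _ fun c hc => (mem_filter.1 hc).2
    have hW : 1 ≤ A ^ (2 / 3 + 2 * δ) := one_le_rpow hA1 (by linarith)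
    have hZQ : Z2 ≤ Z2 * Qz ζ := le_mul_of_one_le_right hZ20 hQ
    have m1 : C1 * A ^ (2 / 3 + δ) * B ^ (-(1 / 2) + δ) * Z ≤ C1 * (A ^ (2 / 3 + 2 * δ) * D ^ (1 / 2 : ℝ) * B ^ (-(1 / 2) + δ)) * (Z2 * Qz ζ) := by
      rw [mul_assoc C1]
      refine mul_le_mul (mul_le_mul_of_nonneg_left (mul_le_mul_of_nonneg_right ((hAle _ (by linarith)).trans (le_mul_of_one_le_right (by positivity) hDh)) hBp.le) (by linarith)) (hZ12.trans hZQ) hZ0 (by positivity)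
    have m2 : C2 * A ^ (2 / 3 + δ) * B ^ (-(1 / 2) + δ) * Z * Qz ζ * (C3 * D ^ ((1 + δ) / 2) * Z1) ≤ C2 * C3 * (A ^ (2 / 3 + 2 * δ) * D ^ (1 / 2 : ℝ) * B ^ (-(1 / 2) + δ)) * (Z2 * Qz ζ) := by
      calc _ = (C2 * C3) * ((A ^ (2 / 3 + δ) * D ^ ((1 + δ) / 2)) * B ^ (-(1 / 2) + δ)) * ((Z * Z1) * Qz ζ) := by ring
        _ ≤ _ := by
          refine mul_le_mul (mul_le_mul_of_nonneg_left (mul_le_mul_of_nonneg_right hDA2 hBp.le) (by positivity)) (mul_le_mul_of_nonneg_right hZZ (by linarith)) (by positivity) (by positivity)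
    have m3 : C4 * A ^ (1 / 2 + δ) * B ^ (-(1 / 2) + δ) * Z * Z1 ≤ C4 * (A ^ (2 / 3 + 2 * δ) * D ^ (1 / 2 : ℝ) * B ^ (-(1 / 2) + δ)) * (Z2 * Qz ζ) := by
      rw [mul_assoc C4, mul_assoc _ Z]
      refine mul_le_mul (mul_le_mul_of_nonneg_left (mul_le_mul_of_nonneg_right ((hAle _ (by linarith)).trans (le_mul_of_one_le_right (by positivity) hDh)) hBp.le) (by linarith)) (hZZ.trans hZQ) (by positivity) (by positivity)
    have tri : ∀ u v w x : ℂ, ‖u + (v + w) - x‖ ≤ ‖u - x‖ + ‖v‖ + ‖w‖ := by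
      intro u v w x
      rw [show u + (v + w) - x = (u - x) + v + w by ring]
      exact norm_add₃_le
    refine (tri _ _ _ _).trans ?_
    linarith
  have hsum := (trm_summable ha hB hζ).of_norm.hasSum.comp box_tendsto
  have hlim := hsum.sub (hG.const_mul (Jinf a ζ))
  refine le_of_tendsto hlim.norm ?_
  filter_upwards [eventually_ge_atTop 1] with X hX
  refine le_of_eq_of_le ?_ (hfin X hX (Fintype.piFinset fun _ : Fin 4 => Icc (-(X : ℤ)) X) (by simp))
  congr 2
  rw [Function.comp_apply, sum_product_right]
  refine sum_congr rfl fun c _ => ?_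
  refine (sum_subset (fun q hq => ?_) fun q hq hq2 => ?_).symm
  · simp only [mem_Icc] at hq; simp; omega
  · have : q = 0 := by simp at hq hq2; omega
    rw [this, trm_zero]

theorem core {δ : ℝ} (hδ : 0 < δ) (hδ1 : δ ≤ 1 / 4) : ∃ C : ℝ, 1 ≤ C ∧ ∀ (a : ℤ⁴), (∀ i, a i ≠ 0) → ¬ IsSquare (∏ i, a i) → ∀ B : ℝ, 1 ≤ B → ∀ G : ℂ,
    Tendsto (singularPartial a) atTop (nhds G) → ∀ (ζ : ℂ⁴), (∀ i, 1 ≤ (ζ i).re) →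
    ‖Nz a B ζ - ((B / (2 * absProd a ^ (1 / 2 : ℝ)) : ℝ) : ℂ) * (Jinf a ζ * G)‖ ≤ C * (B / absProd a ^ (1 / 2 : ℝ)) *
        (absProd a ^ (2 / 3 + 2 * δ) * (Delta4 a : ℝ) ^ (1 / 2 : ℝ) * B ^ (-(1 / 2) + δ)) * ((∏ i, ‖ζ i‖ ^ 2) * Qz ζ) := by
  obtain ⟨C1, hC1, h1⟩ := core_trm hδ hδ1
  obtain ⟨C2, hC2, h2⟩ := HH_bounds
  obtain ⟨C3, hC3, h3⟩ := Nz_norm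
  refine ⟨C1 + 24 * (C2 * C3), by nlinarith, fun a ha hsq B hB G hG ζ hζ => ?_⟩
  have hA : (∏ i, a i) ≠ 0 := prod_ne_zero_iff.2 fun i _ => ha i
  have hD1 : (1 : ℝ) ≤ Delta4 a := by exact_mod_cast Delta4_pos a ha
  have hDA : (Delta4 a : ℝ) ≤ absProd a := by exact_mod_cast Delta4_le a ha
  have hm := E_main ha (show 0 < B by linarith) hζ
  rw [prod_nab, sqrt_eq_rpow] at hm
  have hB0 : 0 < B := by linarith
  have k1 := h1 a ha hsq ζ hζ B hB0 G hG
  have k3 := h3 a ha ζ hζ B hB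
  have k2 := (h2 (2 * B) (by linarith)).1
  set A : ℝ := absProd a with hAd
  have hA1 : 1 ≤ A := hD1.trans hDA
  have hQ := Qz_ge hζ
  have hZ2 : 1 ≤ ∏ i, ‖ζ i‖ ^ 2 := one_le_prod4 fun i => one_le_pow₀ (one_le_norm_of_re (hζ i))
  set E := A ^ (2 / 3 + 2 * δ) * (Delta4 a : ℝ) ^ (1 / 2 : ℝ) * B ^ (-(1 / 2) + δ) with hE
  set W := (∏ i, ‖ζ i‖ ^ 2) * Qz ζ with hW
  have hW1 : 1 ≤ W := one_le_mul_of_one_le_of_one_le hZ2 hQ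
  set T := ∑' p : ℕ × (ℤ⁴), trm a B ζ p.1 p.2
  set b := B / (2 * A ^ (1 / 2 : ℝ)) with hb
  have hb0 : 0 ≤ b := by positivity
  have hbB : b ≤ B / A ^ (1 / 2 : ℝ) := by rw [hb]; gcongr; linarith [show 0 < A ^ (1 / 2 : ℝ) by positivity]
  have key : Nz a B ζ - ((b : ℝ) : ℂ) * (Jinf a ζ * G) = ((HH (2 * B) : ℝ) : ℂ) * Nz a B ζ + (b : ℂ) * (T - Jinf a ζ * G) := by
    push_cast at hm
    linear_combination hm
  rw [key]
  have hone : 1 ≤ (B / A ^ (1 / 2 : ℝ)) * E := by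
    have e1 : A ^ (2 / 3 + 2 * δ) = A ^ (1 / 2 : ℝ) * A ^ (1 / 6 + 2 * δ) := by rw [← rpow_add (by linarith)]; congr 1; ring
    have e2 : B * B ^ (-(1 / 2) + δ) = B ^ (1 / 2 + δ) := by nth_rw 1 [← rpow_one B]; rw [← rpow_add hB0]; congr 1; ring
    have e3 : (B / A ^ (1 / 2 : ℝ)) * E = A ^ (1 / 6 + 2 * δ) * (Delta4 a : ℝ) ^ (1 / 2 : ℝ) * B ^ (1 / 2 + δ) := by
      rw [hE, e1, ← e2]; field_simp
    rw [e3]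
    exact one_le_mul_of_one_le_of_one_le (one_le_mul_of_one_le_of_one_le (one_le_rpow hA1 (by linarith)) (one_le_rpow hD1 (by norm_num))) (one_le_rpow hB (by linarith))
  have n1 : ‖((HH (2 * B) : ℝ) : ℂ) * Nz a B ζ‖ ≤ 24 * (C2 * C3) := by
    rw [norm_mul, norm_real, norm_eq_abs]
    have p := pow_mul_exp_le 4 hB0.le
    have p2 : exp (-(2 * B)) ≤ exp (-B) := exp_le_exp.2 (by linarith)
    calc _ ≤ (C2 * exp (-(2 * B))) * (C3 * B ^ 4) := mul_le_mul k2 k3 (norm_nonneg _) (by positivity)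
      _ ≤ (C2 * exp (-B)) * (C3 * B ^ 4) := mul_le_mul_of_nonneg_right (mul_le_mul_of_nonneg_left p2 (by linarith)) (by positivity)
      _ = (C2 * C3) * (B ^ 4 * exp (-B)) := by ring
      _ ≤ (C2 * C3) * (Nat.factorial 4 : ℝ) := mul_le_mul_of_nonneg_left p (by positivity)
      _ = _ := by norm_num [Nat.factorial]; ring
  have hE0 : 0 ≤ E := by positivity
  have n2 : ‖(b : ℂ) * (T - Jinf a ζ * G)‖ ≤ (B / A ^ (1 / 2 : ℝ)) * (C1 * E * W) := by
    rw [norm_mul, norm_real, norm_eq_abs, abs_of_nonneg hb0]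
    exact mul_le_mul hbB k1 (norm_nonneg _) (by positivity)
  refine (norm_add_le _ _).trans ((add_le_add n1 n2).trans ?_)
  have : 24 * (C2 * C3) ≤ 24 * (C2 * C3) * ((B / A ^ (1 / 2 : ℝ)) * E * W) := le_mul_of_one_le_right (by positivity) (one_le_mul_of_one_le_of_one_le hone hW1)
  calc _ ≤ 24 * (C2 * C3) * ((B / A ^ (1 / 2 : ℝ)) * E * W) + (B / A ^ (1 / 2 : ℝ)) * (C1 * E * W) := by linarith
    _ = _ := by ring

/-! G1: smooth cut-off functions and their Fourier transforms. -/

def hC (s : ℝ) : ℂ := ((smoothTransition s : ℝ) : ℂ)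
def gC (s : ℝ) : ℂ := ((exp (π * s) * smoothTransition (s + 1) : ℝ) : ℂ)
def Vw (η b s : ℝ) : ℝ := smoothTransition (η⁻¹ * (b - s))
def fC (η b s : ℝ) : ℂ := gC s * hC (η⁻¹ * (b - s))
def phiF (η b : ℝ) : ℝ → ℂ := FourierTransform.fourier (fC η b)

lemma contDiff_hC {n : ℕ∞} : ContDiff ℝ n hC := Complex.ofRealCLM.contDiff.comp smoothTransition.contDiff

lemma contDiff_gC {n : ℕ∞} : ContDiff ℝ n gC := Complex.ofRealCLM.contDiff.comp ((contDiff_exp.comp (contDiff_const.mul contDiff_id)).mul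
    (smoothTransition.contDiff.comp (contDiff_id.add contDiff_const)))

lemma contDiff_hCs (η b : ℝ) {n : ℕ∞} : ContDiff ℝ n (fun s => hC (η⁻¹ * (b - s))) :=
  contDiff_hC.comp (contDiff_const.mul (contDiff_const.sub contDiff_id))

lemma contDiff_fC (η b : ℝ) {n : ℕ∞} : ContDiff ℝ n (fC η b) := contDiff_gC.mul (contDiff_hCs η b)

lemma hC_bd (k : ℕ) : ∃ C : ℝ, 1 ≤ C ∧ ∀ s, ‖iteratedDeriv k hC s‖ ≤ C := by
  have hcont : Continuous (iteratedDeriv k hC) := (contDiff_hC (n := k)).continuous_iteratedDeriv k le_rfl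
  obtain ⟨C, hC'⟩ := (isCompact_Icc (a := (0 : ℝ)) (b := 1)).exists_bound_of_continuousOn hcont.continuousOn
  refine ⟨max C 1, le_max_right _ _, fun s => ?_⟩
  by_cases hs : s ∈ Set.Icc (0 : ℝ) 1
  · exact (hC' s hs).trans (le_max_left _ _)
  · have : ∃ c : ℂ, ‖c‖ ≤ 1 ∧ hC =ᶠ[nhds s] fun _ => c := by
      rcases lt_or_ge s 0 with h | h
      · refine ⟨0, by simp, ?_⟩
        filter_upwards [Iio_mem_nhds h] with x hx
        simp [hC, smoothTransition.zero_of_nonpos (Set.mem_Iio.1 hx).le]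
      · have h1 : 1 < s := by by_contra h2; exact hs ⟨h, not_lt.1 h2⟩
        refine ⟨1, by simp, ?_⟩
        filter_upwards [Ioi_mem_nhds h1] with x hx
        simp [hC, smoothTransition.one_of_one_le (Set.mem_Ioi.1 hx).le]
    obtain ⟨c, hc, he⟩ := this
    rw [he.iteratedDeriv_eq, iteratedDeriv_const]
    refine le_trans ?_ (le_max_right C 1)
    split_ifs
    · exact hc
    · simp

lemma fC_bd (n : ℕ) : ∃ C : ℝ, 1 ≤ C ∧ ∀ η b : ℝ, 0 < η → η ≤ 1 → ∀ s ∈ Set.Icc (-1 : ℝ) 2, ‖iteratedDeriv n (fC η b) s‖ ≤ C * (η⁻¹) ^ n := by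
  have hg : ∀ k : ℕ, ∃ C : ℝ, ∀ s ∈ Set.Icc (-1 : ℝ) 2, ‖iteratedDeriv k gC s‖ ≤ C := fun k =>
    (isCompact_Icc).exists_bound_of_continuousOn ((contDiff_gC (n := k)).continuous_iteratedDeriv k le_rfl).continuousOn
  choose Cg hCg using hg
  choose Ch hCh1 hCh using hC_bd
  refine ⟨1 + ∑ i ∈ range (n + 1), (n.choose i : ℝ) * |Cg i| * Ch (n - i), ?_, fun η b hη hη1 s hs => ?_⟩
  · have : 0 ≤ ∑ i ∈ range (n + 1), (n.choose i : ℝ) * |Cg i| * Ch (n - i) := sum_nonneg fun i _ => by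
      have := hCh1 (n - i); positivity
    linarith
  have hη2 : 1 ≤ η⁻¹ := (one_le_inv₀ hη).2 hη1
  have e1 : ∀ k s, ‖iteratedDeriv k (fun s => hC (η⁻¹ * (b - s))) s‖ ≤ Ch k * (η⁻¹) ^ k := by
    intro k s
    have := congrFun (iteratedDeriv_comp_const_sub (𝕜 := ℝ) (n := k) (f := fun u => hC (η⁻¹ * u)) (s := b)) s
    rw [this, iteratedDeriv_comp_const_smul contDiff_hC, norm_smul, norm_smul, norm_pow, norm_neg, norm_one, one_pow, one_mul, norm_pow,
      norm_eq_abs, abs_of_pos (by positivity), mul_comm]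
    exact mul_le_mul_of_nonneg_right (hCh k _) (by positivity)
  have e2 : iteratedDeriv n (fC η b) s = _ := iteratedDeriv_mul (f := gC) (g := fun s => hC (η⁻¹ * (b - s))) (n := n) (x := s) contDiff_gC.contDiffAt (contDiff_hCs η b).contDiffAt
  rw [e2]
  refine (norm_sum_le _ _).trans ?_
  refine le_trans (sum_le_sum (g := fun i => (n.choose i : ℝ) * |Cg i| * Ch (n - i) * (η⁻¹) ^ n) fun i hi => ?_) ?_
  · rw [norm_mul, norm_mul, Complex.norm_natCast]
    have h3 : (η⁻¹) ^ (n - i) ≤ (η⁻¹) ^ n := pow_le_pow_right₀ hη2 (Nat.sub_le _ _)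
    have h4 := hCh1 (n - i)
    rw [mul_assoc _ (Ch (n - i))]
    refine mul_le_mul (mul_le_mul_of_nonneg_left ((hCg i s hs).trans (le_abs_self _)) (by positivity)) ((e1 _ _).trans (mul_le_mul_of_nonneg_left h3 (by linarith))) (norm_nonneg _) (by positivity)
  · rw [← sum_mul]
    exact mul_le_mul_of_nonneg_right (by linarith) (by positivity)

lemma fC_zero {η b s : ℝ} (hη : 0 < η) (hb : b ≤ 2) (hs : s ∉ Set.Icc (-1 : ℝ) 2) : fC η b s = 0 := by
  unfold fC gC hC
  rcases lt_or_ge s (-1) with h | h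
  · rw [smoothTransition.zero_of_nonpos (show s + 1 ≤ 0 by linarith)]; simp
  · have : 2 < s := by by_contra h2; exact hs ⟨h, not_lt.1 h2⟩
    have h3 : η⁻¹ * (b - s) ≤ 0 := mul_nonpos_of_nonneg_of_nonpos (by positivity) (by linarith)
    rw [smoothTransition.zero_of_nonpos h3]; simp

lemma fC_supp {η b : ℝ} (hη : 0 < η) (hb : b ≤ 2) : HasCompactSupport (fC η b) := HasCompactSupport.intro isCompact_Icc fun _ hs => fC_zero hη hb hs

def fS {η b : ℝ} (hη : 0 < η) (hb : b ≤ 2) : SchwartzMap ℝ ℂ := (fC_supp hη hb).toSchwartzMap (contDiff_fC η b)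

lemma phiF_eq {η b : ℝ} (hη : 0 < η) (hb : b ≤ 2) : phiF η b = (FourierTransform.fourier (fS hη hb) : SchwartzMap ℝ ℂ) := by
  rw [SchwartzMap.fourier_coe]; rfl

lemma phiF_cont {η b : ℝ} (hη : 0 < η) (hb : b ≤ 2) : Continuous (phiF η b) := by
  rw [phiF_eq hη hb]; exact SchwartzMap.continuous _

lemma phiF_int {η b : ℝ} (hη : 0 < η) (hb : b ≤ 2) : Integrable (phiF η b) := by
  rw [phiF_eq hη hb]; exact SchwartzMap.integrable _

lemma fC_repr {η b : ℝ} (hη : 0 < η) (hb : b ≤ 2) (s : ℝ) : fC η b s = ∫ t : ℝ, phiF η b t * cexp (2 * π * I * (t * s)) := by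
  have h1 := congrFun ((contDiff_fC η b (n := 0)).continuous.fourierInv_fourier_eq ((contDiff_fC η b (n := 0)).continuous.integrable_of_hasCompactSupport (fC_supp hη hb)) (phiF_int hη hb)) s
  rw [← h1, fourierInv_eq']
  refine integral_congr_ae (Eventually.of_forall fun t => ?_)
  simp only [smul_eq_mul, phiF]
  rw [mul_comm]
  congr 2
  simp only [RCLike.inner_apply, conj_trivial]
  push_cast; ring

lemma Vw_repr {η b : ℝ} (hη : 0 < η) (hb : b ≤ 2) {s : ℝ} (hs : 0 ≤ s) :
    ((Vw η b s : ℝ) : ℂ) = ∫ t : ℝ, phiF η b t * cexp (-π * ((1 - 2 * I * t) * s)) := by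
  have h1 := fC_repr hη hb s
  have h2 : fC η b s = cexp (π * s) * (Vw η b s : ℝ) := by
    unfold fC gC hC Vw
    rw [smoothTransition.one_of_one_le (show 1 ≤ s + 1 by linarith), mul_one]
    push_cast; rfl
  have h3 : ((Vw η b s : ℝ) : ℂ) = cexp (-(π * s)) * fC η b s := by rw [h2, ← mul_assoc, ← Complex.exp_add]; simp
  rw [h3, h1, ← integral_const_mul]
  refine integral_congr_ae (Eventually.of_forall fun t => ?_)
  simp only
  rw [mul_left_comm, ← Complex.exp_add]
  congr 2; ring

lemma phiF_bd : ∃ C : ℝ, 1 ≤ C ∧ ∀ η b : ℝ, 0 < η → η ≤ 1 → b ≤ 2 → ∀ t, ‖phiF η b t‖ ≤ C ∧ ‖phiF η b t‖ * (η * |t|) ^ 10 ≤ C := by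
  have hgen : ∀ n : ℕ, ∃ C : ℝ, 1 ≤ C ∧ ∀ η b : ℝ, 0 < η → η ≤ 1 → b ≤ 2 → ∀ t, ‖phiF η b t‖ * (η * |t|) ^ n ≤ C := by
    intro n
    obtain ⟨C, hC, h⟩ := fC_bd n
    refine ⟨3 * C, by linarith, fun η b hη hη1 hb t => ?_⟩
    have hz : ∀ m s, s ∉ Set.Icc (-1 : ℝ) 2 → iteratedDeriv m (fC η b) s = 0 := by
      intro m s hs
      have : fC η b =ᶠ[nhds s] fun _ => 0 := by
        filter_upwards [isClosed_Icc.isOpen_compl.mem_nhds hs] with x hx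
        exact fC_zero hη hb hx
      rw [this.iteratedDeriv_eq, iteratedDeriv_const]; simp
    have hInt : ∀ m : ℕ, Integrable (iteratedDeriv m (fC η b)) := fun m =>
      ((contDiff_fC η b (n := m)).continuous_iteratedDeriv m le_rfl).integrable_of_hasCompactSupport (HasCompactSupport.intro isCompact_Icc (hz m))
    have hF := congrFun (fourier_iteratedDeriv (N := (⊤ : ℕ∞)) (n := n) (contDiff_fC η b) (fun m _ => hInt m) le_top) t
    have hn : ‖FourierTransform.fourier (iteratedDeriv n (fC η b)) t‖ ≤ 3 * (C * (η⁻¹) ^ n) := by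
      rw [fourier_real_eq_integral_exp_smul]
      have e : ∀ s, ‖cexp (((-2 * π * s * t : ℝ) : ℂ) * I) • iteratedDeriv n (fC η b) s‖ ≤ (Set.Icc (-1 : ℝ) 2).indicator (fun _ => C * (η⁻¹) ^ n) s := by
        intro s
        rw [norm_smul, Complex.norm_exp_ofReal_mul_I, one_mul]
        by_cases hs : s ∈ Set.Icc (-1 : ℝ) 2
        · rw [Set.indicator_of_mem hs]; exact h η b hη hη1 s hs
        · rw [Set.indicator_of_notMem hs, hz n s hs, norm_zero]
      refine (norm_integral_le_of_norm_le ((integrable_indicator_iff measurableSet_Icc).2 (integrableOn_const (by simp))) (Eventually.of_forall e)).trans ?_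
      rw [integral_indicator measurableSet_Icc, setIntegral_const]
      simp
      norm_num
    rw [hF, norm_smul, norm_pow] at hn
    have e3 : ‖(2 * π * I * t : ℂ)‖ = 2 * π * |t| := by simp [abs_of_pos pi_pos]
    rw [e3] at hn
    have hpi := pi_gt_three
    change _ * ‖phiF η b t‖ ≤ _ at hn
    calc ‖phiF η b t‖ * (η * |t|) ^ n ≤ ‖phiF η b t‖ * (η * (2 * π * |t|)) ^ n := by
          gcongr
          nlinarith [abs_nonneg t]
      _ = η ^ n * ((2 * π * |t|) ^ n * ‖phiF η b t‖) := by rw [mul_pow]; ring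
      _ ≤ η ^ n * (3 * (C * (η⁻¹) ^ n)) := mul_le_mul_of_nonneg_left hn (by positivity)
      _ = 3 * C := by rw [inv_pow]; field_simp
  obtain ⟨C0, hC0, h0⟩ := hgen 0
  obtain ⟨C1, hC1, h1⟩ := hgen 10
  refine ⟨max C0 C1, hC0.trans (le_max_left _ _), fun η b hη hη1 hb t => ⟨?_, (h1 η b hη hη1 hb t).trans (le_max_right _ _)⟩⟩
  have := h0 η b hη hη1 hb t
  rw [pow_zero, mul_one] at this
  exact this.trans (le_max_left _ _)

lemma phiF_moment : ∃ C : ℝ, 1 ≤ C ∧ ∀ η b : ℝ, 0 < η → η ≤ 1 → b ≤ 2 → ∀ k ≤ 6,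
    Integrable (fun t => ‖phiF η b t‖ * (1 + 2 * |t|) ^ k) ∧ ∫ t, ‖phiF η b t‖ * (1 + 2 * |t|) ^ k ≤ C * (η⁻¹) ^ (k + 1) := by
  obtain ⟨C, hC, h⟩ := phiF_bd
  refine ⟨2 ^ 20 * C * π, by nlinarith [pi_gt_three], fun η b hη hη1 hb k hk => ?_⟩
  have hη2 : 1 ≤ η⁻¹ := (one_le_inv₀ hη).2 hη1
  have hpt : ∀ t, ‖phiF η b t‖ * (1 + 2 * |t|) ^ k ≤ (2 ^ 20 * C * (η⁻¹) ^ k) * (1 + (η * t) ^ 2)⁻¹ := by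
    intro t
    obtain ⟨b1, b2⟩ := h η b hη hη1 hb t
    set u := η * |t| with hu
    have hu0 : 0 ≤ u := by positivity
    have e1 : 1 + 2 * |t| ≤ η⁻¹ * (1 + 2 * u) := by
      have : η⁻¹ * (1 + 2 * u) = η⁻¹ + 2 * |t| := by rw [hu]; field_simp
      linarith
    have e2 : (η * t) ^ 2 = u ^ 2 := by rw [hu, mul_pow, mul_pow, sq_abs]
    have e3 : (1 + 2 * u) ^ k * (1 + u ^ 2) ≤ 2 ^ 9 * (1 + 2 ^ 10 * u ^ 10) := by
      calc (1 + 2 * u) ^ k * (1 + u ^ 2) ≤ (1 + 2 * u) ^ 6 * (1 + 2 * u) ^ 4 := by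
            refine mul_le_mul (pow_le_pow_right₀ (by linarith) hk) ?_ (by positivity) (by positivity)
            calc 1 + u ^ 2 ≤ (1 + 2 * u) ^ 2 := by nlinarith
              _ ≤ _ := pow_le_pow_right₀ (by linarith) (by norm_num)
        _ = (1 + 2 * u) ^ 10 := by ring
        _ ≤ 2 ^ 9 * (1 ^ 10 + (2 * u) ^ 10) := add_pow_le zero_le_one (by positivity) 10
        _ = _ := by rw [one_pow, mul_pow]
    rw [e2, ← div_eq_mul_inv, le_div_iff₀ (by positivity)]
    calc ‖phiF η b t‖ * (1 + 2 * |t|) ^ k * (1 + u ^ 2) ≤ ‖phiF η b t‖ * (η⁻¹ * (1 + 2 * u)) ^ k * (1 + u ^ 2) := by gcongr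
      _ = (η⁻¹) ^ k * ‖phiF η b t‖ * ((1 + 2 * u) ^ k * (1 + u ^ 2)) := by rw [mul_pow]; ring
      _ ≤ (η⁻¹) ^ k * ‖phiF η b t‖ * (2 ^ 9 * (1 + 2 ^ 10 * u ^ 10)) := mul_le_mul_of_nonneg_left e3 (by positivity)
      _ = (η⁻¹) ^ k * (2 ^ 9 * ‖phiF η b t‖ + 2 ^ 19 * (‖phiF η b t‖ * u ^ 10)) := by ring
      _ ≤ (η⁻¹) ^ k * (2 ^ 9 * C + 2 ^ 19 * C) := by gcongr
      _ ≤ (η⁻¹) ^ k * (2 ^ 20 * C) := mul_le_mul_of_nonneg_left (by linarith) (by positivity)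
      _ = _ := by ring
  have hi : Integrable fun t : ℝ => (2 ^ 20 * C * (η⁻¹) ^ k) * (1 + (η * t) ^ 2)⁻¹ := (integrable_inv_one_add_sq.comp_mul_left' hη.ne').const_mul _
  have hnn : ∀ t, 0 ≤ ‖phiF η b t‖ * (1 + 2 * |t|) ^ k := fun t => by positivity
  have hcont : Continuous fun t => ‖phiF η b t‖ * (1 + 2 * |t|) ^ k := by
    have := phiF_cont hη hb
    fun_prop
  have hI : Integrable fun t => ‖phiF η b t‖ * (1 + 2 * |t|) ^ k := hi.mono' hcont.aestronglyMeasurable (Eventually.of_forall fun t => by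
      rw [norm_eq_abs, abs_of_nonneg (hnn t)]; exact hpt t)
  refine ⟨hI, (integral_mono hI hi hpt).trans ?_⟩
  rw [integral_const_mul, Measure.integral_comp_mul_left (fun u : ℝ => (1 + u ^ 2)⁻¹) η, integral_univ_inv_one_add_sq, smul_eq_mul, abs_of_pos (by positivity)]
  exact le_of_eq (by ring)

/-! G2: passing from Gaussian weights to smooth cut-off weights. -/

def zt (t : Fin 4 → ℝ) (i : Fin 4) : ℂ := 1 - 2 * I * t i
def Phi (η b : ℝ) (t : Fin 4 → ℝ) : ℂ := ∏ i, phiF η b (t i)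
def KV (η b u : ℝ) : ℂ := ∫ x : ℝ, ((Vw η b (x ^ 2) : ℝ) : ℂ) * cexp (I * (π * u * x ^ 2 : ℝ))

lemma zt_re (t : Fin 4 → ℝ) (i : Fin 4) : 1 ≤ (zt t i).re := by simp [zt]

lemma Phi_moment : ∃ C : ℝ, 1 ≤ C ∧ ∀ η b : ℝ, 0 < η → η ≤ 1 → b ≤ 2 → ∃ M : (Fin 4 → ℝ) → ℝ, Integrable M ∧
    (∀ t, ‖Phi η b t‖ * ((∏ i, ‖zt t i‖ ^ 2) * Qz (zt t)) ≤ M t) ∧ ∫ t, M t ≤ C * (η⁻¹) ^ 16 := by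
  obtain ⟨C, hC, h⟩ := phiF_moment
  refine ⟨4 * C ^ 4, by nlinarith [one_le_pow₀ hC (n := 4)], fun η b hη hη1 hb => ?_⟩
  let k : Fin 4 → Fin 4 → ℕ := fun i j => if j = i then 6 else 2
  have hk : ∀ i j, k i j ≤ 6 := fun i j => by simp only [k]; split_ifs <;> norm_num
  let m : Fin 4 → Fin 4 → ℝ → ℝ := fun i j t => ‖phiF η b t‖ * (1 + 2 * |t|) ^ k i j
  have hm : ∀ i, Integrable (fun t : Fin 4 → ℝ => ∏ j, m i j (t j)) := fun i =>
    Integrable.fintype_prod fun j => (h η b hη hη1 hb _ (hk i j)).1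
  refine ⟨fun t => ∑ i, ∏ j, m i j (t j), integrable_finset_sum _ fun i _ => hm i, fun t => ?_, ?_⟩
  · unfold Phi Qz
    rw [norm_prod, mul_sum, mul_sum]
    refine sum_le_sum fun i _ => ?_
    have hz : ∀ j, ‖zt t j‖ ≤ 1 + 2 * |t j| := fun j => (norm_sub_le _ _).trans (by simp)
    have e : (∏ j, ‖zt t j‖ ^ 2) * ‖zt t i‖ ^ 4 = ∏ j, ‖zt t j‖ ^ k i j := by fin_cases i <;> simp [Fin.prod_univ_four, k] <;> ring
    rw [e, ← prod_mul_distrib]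
    exact prod_le_prod (fun j _ => by positivity) fun j _ =>
      mul_le_mul_of_nonneg_left (pow_le_pow_left₀ (norm_nonneg _) (hz j) _) (norm_nonneg _)
  · rw [integral_finset_sum _ fun i _ => hm i]
    refine (sum_le_card_nsmul _ _ (C ^ 4 * (η⁻¹) ^ 16) fun i _ => ?_).trans (le_of_eq (by simp; ring))
    have e : ∏ j, (C * (η⁻¹) ^ (k i j + 1)) = C ^ 4 * (η⁻¹) ^ 16 := by fin_cases i <;> simp [Fin.prod_univ_four, k] <;> ring
    refine (le_of_eq (integral_fintype_prod_eq_prod (m i))).trans (le_trans ?_ e.le)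
    exact prod_le_prod (fun j _ => integral_nonneg fun t => by simp only [m]; positivity) fun j _ => (h η b hη hη1 hb _ (hk i j)).2

lemma csq_gauss {w : ℂ} (hw : 0 < w.re) : csq w = ∫ x : ℝ, cexp (-π * w * (x : ℂ) ^ 2) := by
  have hp : (π : ℂ) ≠ 0 := by exact_mod_cast pi_ne_zero
  have := integral_gaussian_complex (b := π * w) (by rw [re_ofReal_mul]; exact mul_pos pi_pos hw)
  rw [show (π : ℂ) / (π * w) = w⁻¹ by field_simp, Complex.inv_cpow _ _ fun h => by have := (Complex.arg_eq_pi_iff.1 h).1; linarith] at this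
  simp only [neg_mul] at this ⊢
  rw [this, csq, one_div]

lemma KV_eq {η b : ℝ} (hη : 0 < η) (hb : b ≤ 2) (u : ℝ) : KV η b u = ∫ t : ℝ, phiF η b t * csq (1 - 2 * I * t - I * u) := by
  have hI : Integrable (fun p : ℝ × ℝ => phiF η b p.1 * cexp (-π * (1 - 2 * I * p.1 - I * u) * (p.2 : ℂ) ^ 2)) (volume.prod volume) := by
    refine ((phiF_int hη hb).norm.mul_prod (integrable_exp_neg_mul_sq pi_pos)).mono' ?_ (Eventually.of_forall fun p => ?_)
    · have := phiF_cont hη hb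
      exact Continuous.aestronglyMeasurable (by fun_prop)
    · rw [norm_mul, norm_gauss]; simp
  have h1 := integral_integral_swap (f := fun (t x : ℝ) => phiF η b t * cexp (-π * (1 - 2 * I * t - I * u) * (x : ℂ) ^ 2)) hI
  have h2 : ∀ t : ℝ, ∫ x : ℝ, phiF η b t * cexp (-π * (1 - 2 * I * t - I * u) * (x : ℂ) ^ 2) = phiF η b t * csq (1 - 2 * I * t - I * u) := fun t => by
    rw [integral_const_mul, csq_gauss (by simp)]
  simp only [h2] at h1
  rw [h1]
  refine integral_congr_ae (Eventually.of_forall fun x => ?_)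
  simp only
  rw [Vw_repr hη hb (sq_nonneg x), ← integral_mul_const]
  refine integral_congr_ae (Eventually.of_forall fun t => ?_)
  simp only
  rw [mul_assoc, ← Complex.exp_add]
  congr 2; push_cast; ring

lemma SV_hasSum {a : ℤ⁴} (ha : ∀ i, a i ≠ 0) {B η b : ℝ} (hB : 0 < B) (hη : 0 < η) (hb : b ≤ 2) : Integrable (fun t => Phi η b t * Nz a B (zt t)) ∧
    HasSum (fun x : ℤ⁴ => ((if Fq a x = 0 then ∏ i, Vw η b (nab a i * (x i : ℝ) ^ 2 / B) else 0 : ℝ) : ℂ)) (∫ t, Phi η b t * Nz a B (zt t)) := by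
  let F : (ℤ⁴) → (Fin 4 → ℝ) → ℂ := fun x t => Phi η b t * (if Fq a x = 0 then Wx a B (zt t) x else 0)
  have hP : Integrable (Phi η b) := Integrable.fintype_prod fun i => phiF_int hη hb
  have hW : ∀ x t, ‖(if Fq a x = 0 then Wx a B (zt t) x else 0 : ℂ)‖ ≤ ∏ i, gB B (x i) := fun x t => by
    split_ifs
    · exact Wx_norm_le ha hB (zt_re t) x
    · rw [norm_zero]; exact prod_nonneg fun i _ => (gB_pos _ _).le
  have hc : ∀ x, Continuous fun t : Fin 4 → ℝ => (if Fq a x = 0 then Wx a B (zt t) x else 0 : ℂ) := fun x => by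
    split_ifs
    · unfold Wx zt; fun_prop
    · fun_prop
  have hF : ∀ x, Integrable (F x) := fun x => hP.mul_bdd (hc x).aestronglyMeasurable (Eventually.of_forall (hW x))
  have hS := summable_gB hB
  have hN : ∀ t, ∑' x, F x t = Phi η b t * Nz a B (zt t) := fun t => tsum_mul_left
  refine ⟨hP.mul_bdd (c := ∑' x : ℤ⁴, ∏ i, gB B (x i)) (continuous_tsum hc hS hW).aestronglyMeasurable
    (Eventually.of_forall fun t => tsum_of_norm_bounded hS.hasSum fun x => hW x t), ?_⟩
  have key := hasSum_integral_of_summable_integral_norm hF (by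
    refine Summable.of_nonneg_of_le (fun x => integral_nonneg fun t => norm_nonneg _) (fun x => ?_) (hS.mul_left (∫ t, ‖Phi η b t‖))
    rw [← integral_mul_const]
    refine integral_mono (hF x).norm (hP.norm.mul_const _) fun t => ?_
    simp only [F, norm_mul]
    exact mul_le_mul_of_nonneg_left (hW x t) (norm_nonneg _))
  simp only [hN] at key
  refine (congrArg (fun f => HasSum f _) (funext fun x => ?_)).mpr key
  by_cases h : Fq a x = 0
  · simp only [F, h, if_true]
    rw [Complex.ofReal_prod, prod_congr rfl fun i _ => Vw_repr hη hb (s := nab a i * (x i : ℝ) ^ 2 / B) (by have := nab_pos ha i; positivity)]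
    refine (integral_fintype_prod_eq_prod fun i (t : ℝ) => phiF η b t * cexp (-π * ((1 - 2 * I * t) * ((nab a i * (x i : ℝ) ^ 2 / B : ℝ) : ℂ)))).symm.trans ?_
    refine integral_congr_ae (Eventually.of_forall fun t => ?_)
    simp only [Phi, Wx, prod_mul_distrib, zt]
    congr 1
    refine prod_congr rfl fun i _ => ?_
    congr 1; push_cast; ring
  · simp [F, h]

lemma JV_fubini {a : ℤ⁴} (ha : ∀ i, a i ≠ 0) {η b : ℝ} (hη : 0 < η) (hη1 : η ≤ 1) (hb : b ≤ 2) :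
    Integrable (fun t => Phi η b t * Jinf a (zt t)) ∧ ∫ t, Phi η b t * Jinf a (zt t) = ∫ τ : ℝ, ∏ i, KV η b (sgv a i * τ) := by
  obtain ⟨C, _, h⟩ := Phi_moment
  obtain ⟨M, hM, hM1, _⟩ := h η b hη hη1 hb
  have hI : Integrable (fun p : (Fin 4 → ℝ) × ℝ => Phi η b p.1 * ∏ i, csq (wv (sgv a) (zt p.1) p.2 i)) (volume.prod volume) := by
    refine ((hM.mul_prod integrable_inv_one_add_sq).const_mul 5).mono' ?_ (Eventually.of_forall fun p => ?_)
    · refine Measurable.aestronglyMeasurable ?_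
      have := (phiF_cont hη hb).measurable
      unfold csq wv zt Phi
      fun_prop
    · rw [norm_mul, norm_prod]
      have h1 := prod_csq_bound (fun i => sgv_abs ha i) (zt_re p.1) p.2
      have h2 : ∏ i, ‖zt p.1 i‖ ^ (1 / 2 : ℝ) ≤ (∏ i, ‖zt p.1 i‖ ^ 2) * Qz (zt p.1) := by
        refine le_trans (prod_le_prod (fun i _ => by positivity) fun i _ => ?_) (le_mul_of_one_le_right (prod_nonneg fun i _ => by positivity) (Qz_ge (zt_re p.1)))
        rw [← rpow_natCast]
        exact rpow_le_rpow_of_exponent_le (one_le_norm_of_re (zt_re _ i)) (by norm_num)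
      have hi : 0 ≤ (1 + p.2 ^ 2)⁻¹ := by positivity
      calc _ ≤ ‖Phi η b p.1‖ * (5 * ((∏ i, ‖zt p.1 i‖ ^ 2) * Qz (zt p.1)) * (1 + p.2 ^ 2)⁻¹) :=
            mul_le_mul_of_nonneg_left (h1.trans (mul_le_mul_of_nonneg_right (by linarith) hi)) (norm_nonneg _)
        _ = 5 * ((‖Phi η b p.1‖ * ((∏ i, ‖zt p.1 i‖ ^ 2) * Qz (zt p.1))) * (1 + p.2 ^ 2)⁻¹) := by ring
        _ ≤ _ := mul_le_mul_of_nonneg_left (mul_le_mul_of_nonneg_right (hM1 p.1) hi) (by norm_num)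
  have h1 : ∀ t, ∫ τ : ℝ, Phi η b t * ∏ i, csq (wv (sgv a) (zt t) τ i) = Phi η b t * Jinf a (zt t) := fun t => integral_const_mul _ _
  refine ⟨by simpa only [h1] using hI.integral_prod_left, ?_⟩
  have h2 := integral_integral_swap (f := fun t (τ : ℝ) => Phi η b t * ∏ i, csq (wv (sgv a) (zt t) τ i)) hI
  simp only [h1] at h2
  rw [h2]
  refine integral_congr_ae (Eventually.of_forall fun τ => ?_)
  simp only [KV_eq hη hb, Phi, ← prod_mul_distrib]
  refine Eq.trans ?_ (integral_fintype_prod_eq_prod fun i (t : ℝ) => phiF η b t * csq (1 - 2 * I * t - I * ((sgv a i * τ : ℝ) : ℂ)))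
  simp only [wv, zt]
  rfl

lemma SV_bound {δ : ℝ} (hδ : 0 < δ) (hδ1 : δ ≤ 1 / 4) : ∃ C : ℝ, 1 ≤ C ∧ ∀ (a : ℤ⁴), (∀ i, a i ≠ 0) → ¬ IsSquare (∏ i, a i) →
    ∀ B : ℝ, 1 ≤ B → ∀ G : ℂ, Tendsto (singularPartial a) atTop (nhds G) → ∀ η b : ℝ, 0 < η → η ≤ 1 → b ≤ 2 → ∃ S : ℝ,
    HasSum (fun x : ℤ⁴ => if Fq a x = 0 then ∏ i, Vw η b (nab a i * (x i : ℝ) ^ 2 / B) else 0) S ∧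
    ‖(S : ℂ) - ((B / (2 * absProd a ^ (1 / 2 : ℝ)) : ℝ) : ℂ) * ((∫ τ : ℝ, ∏ i, KV η b (sgv a i * τ)) * G)‖ ≤ C * (B / absProd a ^ (1 / 2 : ℝ)) *
        (absProd a ^ (2 / 3 + 2 * δ) * (Delta4 a : ℝ) ^ (1 / 2 : ℝ) * B ^ (-(1 / 2) + δ)) * (η⁻¹) ^ 16 := by
  obtain ⟨C, hC, h⟩ := core hδ hδ1
  obtain ⟨C1, hC1, h1⟩ := Phi_moment
  refine ⟨C * C1, by nlinarith, fun a ha hsq B hB G hG η b hη hη1 hb => ?_⟩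
  obtain ⟨M, hM, hM1, hM2⟩ := h1 η b hη hη1 hb
  obtain ⟨hN, hS⟩ := SV_hasSum ha (by linarith : 0 < B) hη hb
  obtain ⟨hJ, hJ2⟩ := JV_fubini ha hη hη1 hb
  have hS2 := Complex.hasSum_ofReal.1 (by rw [← hS.tsum_eq, ← Complex.ofReal_tsum] at hS; exact hS)
  refine ⟨_, hS2, ?_⟩
  rw [Complex.ofReal_tsum, hS.tsum_eq, ← hJ2]
  set c : ℂ := ((B / (2 * absProd a ^ (1 / 2 : ℝ)) : ℝ) : ℂ)
  set E : ℝ := C * (B / absProd a ^ (1 / 2 : ℝ)) * (absProd a ^ (2 / 3 + 2 * δ) * (Delta4 a : ℝ) ^ (1 / 2 : ℝ) * B ^ (-(1 / 2) + δ)) with hE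
  have hE0 : 0 ≤ E := by positivity
  have e1 : (∫ t, Phi η b t * Nz a B (zt t)) - c * ((∫ t, Phi η b t * Jinf a (zt t)) * G) =
      ∫ t, Phi η b t * (Nz a B (zt t) - c * (Jinf a (zt t) * G)) := by
    rw [← integral_mul_const, ← integral_const_mul, ← integral_sub hN ((hJ.mul_const _).const_mul _)]
    congr 1; ext t; ring
  rw [e1]
  refine (norm_integral_le_of_norm_le (hM.const_mul E) (Eventually.of_forall fun t => ?_)).trans ?_
  · rw [norm_mul]
    refine (mul_le_mul_of_nonneg_left (h a ha hsq B hB G hG (zt t) (zt_re t)) (norm_nonneg _)).trans ?_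
    refine le_trans (le_of_eq ?_) (mul_le_mul_of_nonneg_left (hM1 t) hE0)
    rw [hE]; ring
  · rw [integral_const_mul]
    refine (mul_le_mul_of_nonneg_left hM2 hE0).trans (le_of_eq ?_)
    rw [hE]; ring


/-! G3: the oscillatory integrals attached to the cut-off weights. -/

def eu (u x : ℝ) : ℂ := cexp (I * (π * u * x ^ 2 : ℝ))
def Kg (v : ℝ → ℝ) (u : ℝ) : ℂ := ∫ x : ℝ, (v x : ℂ) * eu u x
def Wt (u : ℝ) : ℝ := 8 * (1 + u ^ 2) ^ (-(1 / 4) : ℝ)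
def ind1 : ℝ → ℝ := (Set.Icc (-1 : ℝ) 1).indicator 1

lemma norm_eu (u x : ℝ) : ‖eu u x‖ = 1 := Complex.norm_exp_I_mul_ofReal _

lemma eu_cont (u : ℝ) : Continuous (eu u) := by unfold eu; fun_prop

lemma int_le {v : ℝ → ℝ} (hv : ∀ x, |v x| ≤ 1) (u : ℝ) {r : ℝ} (hr : 0 ≤ r) : ‖∫ x in (0 : ℝ)..r, (v x : ℂ) * eu u x‖ ≤ r := by
  have := intervalIntegral.norm_integral_le_of_norm_le_const (a := 0) (b := r) (C := 1) (f := fun x => (v x : ℂ) * eu u x) fun x _ => by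
    rw [norm_mul, norm_eu, mul_one, norm_real]; exact hv x
  simpa [abs_of_nonneg hr] using this

lemma hasDerivAt_int {f : ℝ → ℂ} (hf : Continuous f) (x : ℝ) : HasDerivAt (fun r => ∫ y in (0 : ℝ)..r, f y) (f x) x :=
  intervalIntegral.integral_hasDerivAt_right (hf.intervalIntegrable _ _) (hf.stronglyMeasurableAtFilter _ _) hf.continuousAt

lemma Fr {u ρ r : ℝ} (hρ : 0 < ρ) (h : ρ ^ 2 * |u| = 1) (hr : 0 ≤ r) : ‖∫ x in (0 : ℝ)..r, eu u x‖ ≤ 2 * ρ := by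
  have ht : ∀ r, 0 ≤ r → ‖∫ x in (0 : ℝ)..r, eu u x‖ ≤ r := fun r hr => by simpa using int_le (v := 1) (by simp) u hr
  rcases le_or_gt r ρ with h1 | h1
  · linarith [ht r hr]
  have hu : u ≠ 0 := by rintro rfl; simp at h
  have hu' : 0 < |u| := abs_pos.2 hu
  have huC : (2 * π * I * u : ℂ) ≠ 0 := by simp [hu, pi_ne_zero]
  set k : ℝ := (2 * π * |u|)⁻¹ with hk
  have hkC : ‖(2 * π * I * u : ℂ)⁻¹‖ = k := by simp [hk, abs_of_pos pi_pos]
  have hk1 : k ≤ ρ ^ 2 / 2 := by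
    rw [hk, inv_le_comm₀ (by positivity) (by positivity), inv_div, div_le_iff₀ (by positivity)]
    nlinarith [pi_gt_three]
  have hk0 : 0 < k := by positivity
  have hg : ∀ x : ℝ, 0 < x → ‖eu u x * ((2 * π * I * u)⁻¹ * (x : ℂ)⁻¹)‖ = k * x⁻¹ := fun x hx => by
    rw [norm_mul, norm_eu, norm_mul, hkC, norm_inv, norm_real, norm_eq_abs, abs_of_pos hx, one_mul]
  have hd : ∀ x : ℝ, 0 < x → HasDerivAt (fun x : ℝ => (∫ y in (0 : ℝ)..x, eu u y) - eu u x * ((2 * π * I * u)⁻¹ * (x : ℂ)⁻¹))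
      (eu u x * (2 * π * I * u)⁻¹ * ((x : ℂ) ^ 2)⁻¹) x := by
    intro x hx
    have hxC : (x : ℂ) ≠ 0 := by exact_mod_cast hx.ne'
    have e1 : HasDerivAt (eu u) (eu u x * (I * (π * u * (2 * x) : ℝ))) x := by
      have := ((((hasDerivAt_pow 2 x).const_mul (π * u)).ofReal_comp).const_mul I).cexp
      simpa [eu, Function.comp_def] using this.congr_of_eventuallyEq (f₁ := eu u) (Eventually.of_forall fun y => rfl)
    have e2 := (hasDerivAt_inv hxC).comp_ofReal
    refine ((hasDerivAt_int (eu_cont u) x).sub (e1.mul (e2.const_mul (2 * π * I * u : ℂ)⁻¹))).congr_deriv ?_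
    have huC' : (u : ℂ) ≠ 0 := by exact_mod_cast hu
    push_cast
    field_simp
    ring
  have key := image_norm_le_of_norm_deriv_right_le_deriv_boundary' (a := ρ) (b := r) (B := fun x => ρ + 2 * (k * ρ⁻¹) - k * x⁻¹)
    (B' := fun x => k * (x ^ 2)⁻¹)
    (fun x hx => (hd x (hρ.trans_le hx.1)).continuousAt.continuousWithinAt) (fun x hx => (hd x (hρ.trans_le hx.1)).hasDerivWithinAt)
    (by
      refine (norm_sub_le _ _).trans ?_
      rw [hg ρ hρ]; linarith [ht ρ hρ.le])
    (fun x hx => by have : x ≠ 0 := (hρ.trans_le hx.1).ne'; exact ContinuousAt.continuousWithinAt (by fun_prop (disch := exact this)))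
    (fun x hx => (((hasDerivAt_inv (hρ.trans_le hx.1).ne').const_mul k).const_sub _).hasDerivWithinAt.congr_deriv (by ring))
    (fun x hx => by rw [norm_mul, norm_mul, norm_eu, hkC, norm_inv, norm_pow, norm_real, norm_eq_abs, sq_abs, one_mul])
    (Set.right_mem_Icc.2 h1.le)
  have h3 := norm_add_le ((∫ y in (0 : ℝ)..r, eu u y) - eu u r * ((2 * π * I * u)⁻¹ * (r : ℂ)⁻¹)) (eu u r * ((2 * π * I * u)⁻¹ * (r : ℂ)⁻¹))
  rw [sub_add_cancel, hg r (hρ.trans h1)] at h3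
  have h4 : k * ρ⁻¹ ≤ ρ / 2 := by rw [← div_eq_mul_inv, div_le_iff₀ hρ]; linarith
  linarith

lemma Wt_le {y u : ℝ} (h0 : 0 ≤ y) (h4 : y ≤ 4) (h : ∀ ρ, 0 < ρ → ρ ^ 2 * |u| = 1 → y ≤ 4 * ρ) : y ≤ Wt u := by
  unfold Wt
  rw [rpow_neg (by positivity), ← div_eq_mul_inv, le_div_iff₀ (by positivity)]
  refine le_of_pow_le_pow_left₀ (n := 4) (by norm_num) (by norm_num) ?_
  rw [mul_pow, ← rpow_natCast, ← rpow_natCast ((1 + u ^ 2) ^ (1 / 4 : ℝ)), ← rpow_mul (by positivity)]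
  norm_num
  have h5 : y ^ 4 ≤ 4 ^ 4 := pow_le_pow_left₀ h0 h4 4
  rcases eq_or_ne u 0 with rfl | hu
  · linarith
  have hu' : 0 < |u| := abs_pos.2 hu
  have h6 : (sqrt |u|)⁻¹ ^ 2 * |u| = 1 := by rw [inv_pow, sq_sqrt hu'.le]; field_simp
  have h7 := pow_le_pow_left₀ h0 (h _ (by positivity) h6) 4
  have h8 : (4 * (sqrt |u|)⁻¹) ^ 4 * u ^ 2 = 256 := by
    rw [← sq_abs u]
    calc _ = 256 * ((sqrt |u|)⁻¹ ^ 2 * |u|) ^ 2 := by ring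
      _ = 256 := by rw [h6]; norm_num
  nlinarith [mul_le_mul_of_nonneg_right h7 (sq_nonneg u)]

lemma Kb {v v' : ℝ → ℝ} (hv : ∀ x, HasDerivAt v (v' x) x) (hv' : ∀ x, 0 ≤ x → v' x ≤ 0) (he : ∀ x, v (-x) = v x)
    (h01 : ∀ x, 0 ≤ v x ∧ v x ≤ 1) {R : ℝ} (hR : 0 ≤ R) (hR2 : R ≤ 2) (u : ℝ) :
    ‖∫ x in Set.Icc (-R) R, (v x : ℂ) * eu u x‖ ≤ Wt u := by
  have hvc : Continuous v := continuous_iff_continuousAt.2 fun x => (hv x).continuousAt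
  have hf : Continuous fun x => (v x : ℂ) * eu u x := (Complex.continuous_ofReal.comp hvc).mul (eu_cont u)
  have e1 : ∫ x in Set.Icc (-R) R, (v x : ℂ) * eu u x = 2 * ∫ x in (0 : ℝ)..R, (v x : ℂ) * eu u x := by
    rw [integral_Icc_eq_integral_Ioc, ← intervalIntegral.integral_of_le (by linarith),
      ← intervalIntegral.integral_add_adjacent_intervals (hf.intervalIntegrable (-R) 0) (hf.intervalIntegrable 0 R)]
    have := intervalIntegral.integral_comp_neg (a := 0) (b := R) fun x => (v x : ℂ) * eu u x
    rw [neg_zero] at this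
    rw [← this, two_mul]
    congr 2
    funext x
    rw [he]; simp [eu]
  rw [e1, norm_mul, Complex.norm_ofNat]
  have h1 := int_le (v := v) (fun x => abs_le.2 ⟨by linarith [(h01 x).1], (h01 x).2⟩) u hR
  refine Wt_le (by positivity) (by linarith) fun ρ hρ h => ?_
  have key := image_norm_le_of_norm_deriv_right_le_deriv_boundary (a := 0) (b := R) (B := fun x => 2 * ρ * (v 0 - v x))
    (f := fun r : ℝ => (∫ y in (0 : ℝ)..r, (v y : ℂ) * eu u y) - v r * ∫ y in (0 : ℝ)..r, eu u y)
    (f' := fun x => -((v' x : ℂ) * ∫ y in (0 : ℝ)..x, eu u y)) (B' := fun x => 2 * ρ * -(v' x))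
    (fun x _ => ((hasDerivAt_int hf x).sub ((hv x).ofReal_comp.mul (hasDerivAt_int (eu_cont u) x))).continuousAt.continuousWithinAt)
    (fun x _ => (((hasDerivAt_int hf x).sub ((hv x).ofReal_comp.mul (hasDerivAt_int (eu_cont u) x))).congr_deriv (by ring)).hasDerivWithinAt)
    (by simp) (fun x => ((hv x).const_sub _).const_mul _)
    (fun x hx => by
      rw [norm_neg, norm_mul, norm_real, norm_eq_abs, abs_of_nonpos (hv' x hx.1), mul_comm]
      exact mul_le_mul_of_nonneg_right (Fr hρ h hx.1) (by linarith [hv' x hx.1]))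
    (Set.right_mem_Icc.2 hR)
  have h3 := norm_add_le ((∫ y in (0 : ℝ)..R, (v y : ℂ) * eu u y) - v R * ∫ y in (0 : ℝ)..R, eu u y) (v R * ∫ y in (0 : ℝ)..R, eu u y)
  rw [sub_add_cancel, norm_mul, norm_real, norm_eq_abs, abs_of_nonneg (h01 R).1] at h3
  nlinarith [mul_le_mul_of_nonneg_left (Fr hρ h hR) (h01 R).1, (h01 0).2]

lemma KV_le {η b : ℝ} (hη : 0 < η) (hb : b ≤ 2) (u : ℝ) : ‖Kg (fun x => Vw η b (x ^ 2)) u‖ ≤ Wt u := by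
  have hd : ∀ x : ℝ, HasDerivAt (fun x => Vw η b (x ^ 2)) (deriv smoothTransition (η⁻¹ * (b - x ^ 2)) * (η⁻¹ * -(2 * x))) x := fun x => by
    have h1 := (((hasDerivAt_pow 2 x).const_sub b).const_mul η⁻¹)
    have h2 : DifferentiableAt ℝ smoothTransition (η⁻¹ * (b - x ^ 2)) := (smoothTransition.contDiff (n := 1)).differentiable (by norm_num) _
    exact (h2.hasDerivAt.comp x h1).congr_deriv (by norm_num)
  have hη' : 0 < η⁻¹ := by positivity
  have := Kb hd (fun x hx => mul_nonpos_of_nonneg_of_nonpos smoothTransition.monotone.deriv_nonneg (by nlinarith [mul_nonneg hη'.le hx]))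
    (by simp) (fun x => ⟨smoothTransition.nonneg _, smoothTransition.le_one _⟩) (R := 2) (by norm_num) le_rfl u
  rwa [setIntegral_eq_integral_of_forall_compl_eq_zero] at this
  intro x hx
  have h4 : 4 < x ^ 2 := by
    by_contra h
    exact hx (abs_le.1 (abs_le_of_sq_le_sq (by linarith) (by norm_num)))
  rw [Vw, smoothTransition.zero_of_nonpos (mul_nonpos_of_nonneg_of_nonpos hη'.le (by linarith))]; simp

lemma Kg_ind (u : ℝ) : Kg ind1 u = ∫ x in Set.Icc (-1 : ℝ) 1, eu u x := by
  rw [Kg, ← integral_indicator measurableSet_Icc]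
  congr 1; funext x
  by_cases hx : x ∈ Set.Icc (-1 : ℝ) 1 <;> simp [ind1, hx]

lemma K1_le (u : ℝ) : ‖Kg ind1 u‖ ≤ Wt u := by
  have := Kb (v := 1) (v' := 0) (fun x => hasDerivAt_const x 1) (fun x _ => le_rfl) (by simp) (by simp) (R := 1) (by norm_num) (by norm_num) u
  rw [Kg_ind]; simpa using this

lemma Kdiff {η b : ℝ} (hη : 0 < η) (hη1 : η ≤ 1) (hb : 1 ≤ b) (hb1 : b ≤ 1 + η) (u : ℝ) : ‖Kg (fun x => Vw η b (x ^ 2)) u - Kg ind1 u‖ ≤ 4 * η := by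
  have hi : ∀ c d : ℝ, Integrable ((Set.Icc c d).indicator (1 : ℝ → ℝ)) := fun c d => (integrable_indicator_iff measurableSet_Icc).2 (integrableOn_const (by simp))
  have hbd : ∀ x : ℝ, |Vw η b (x ^ 2) - ind1 x| ≤ (Set.Icc (1 - η) (1 + η)).indicator 1 x + (Set.Icc (-(1 + η)) (-(1 - η))).indicator 1 x := by
    intro x
    have hn : ∀ s : Set ℝ, 0 ≤ s.indicator (1 : ℝ → ℝ) x := fun s => Set.indicator_nonneg (by simp) x
    have hV := smoothTransition.nonneg (η⁻¹ * (b - x ^ 2))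
    have hV1 := smoothTransition.le_one (η⁻¹ * (b - x ^ 2))
    by_cases h : 1 - η ≤ |x| ∧ |x| ≤ 1 + η
    · have h1 : |Vw η b (x ^ 2) - ind1 x| ≤ 1 := by
        have : 0 ≤ ind1 x ∧ ind1 x ≤ 1 := by unfold ind1 Set.indicator; split_ifs <;> simp
        exact abs_le.2 ⟨by unfold Vw; linarith, by unfold Vw; linarith⟩
      rcases abs_cases x with ⟨hx, _⟩ | ⟨hx, _⟩ <;> rw [hx] at h
      · rw [Set.indicator_of_mem (s := Set.Icc (1 - η) (1 + η)) h]
        have := hn (Set.Icc (-(1 + η)) (-(1 - η))); simp only [Pi.one_apply]; linarith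
      · rw [Set.indicator_of_mem (s := Set.Icc (-(1 + η)) (-(1 - η))) ⟨by linarith, by linarith⟩]
        have := hn (Set.Icc (1 - η) (1 + η)); simp only [Pi.one_apply]; linarith
    · refine le_trans (le_of_eq (abs_eq_zero.2 (sub_eq_zero.2 ?_))) (add_nonneg (hn _) (hn _))
      have hx0 := abs_nonneg x
      have hsq := sq_abs x
      rcases lt_or_ge |x| (1 - η) with h1 | h1
      · rw [Vw, smoothTransition.one_of_one_le (by rw [inv_mul_eq_div, le_div_iff₀ hη]; nlinarith), ind1,
          Set.indicator_of_mem (s := Set.Icc (-1 : ℝ) 1) (abs_le.1 (show |x| ≤ 1 by linarith))]; rfl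
      · have h2 : 1 + η < |x| := by by_contra h3; exact h ⟨h1, not_lt.1 h3⟩
        rw [Vw, smoothTransition.zero_of_nonpos (mul_nonpos_of_nonneg_of_nonpos (by positivity) (by nlinarith)), ind1,
          Set.indicator_of_notMem fun h3 => by linarith [abs_le.2 h3]]
  have hm : ∀ (v : ℝ → ℝ), Integrable v → Integrable fun x => (v x : ℂ) * eu u x := fun v hv =>
    hv.ofReal.mul_bdd (c := 1) (eu_cont u).aestronglyMeasurable (Eventually.of_forall fun x => (norm_eu u x).le)
  have hVc : Continuous fun x : ℝ => Vw η b (x ^ 2) := by unfold Vw; have := smoothTransition.continuous; fun_prop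
  have h1 : Integrable ind1 := hi _ _
  have h2 : Integrable fun x : ℝ => Vw η b (x ^ 2) := by
    have : Integrable fun x : ℝ => Vw η b (x ^ 2) - ind1 x := ((hi _ _).add (hi _ _)).mono' (hVc.aestronglyMeasurable.sub h1.1) (Eventually.of_forall hbd)
    exact (this.add h1).congr (Eventually.of_forall fun x => by simp)
  rw [Kg, Kg, ← integral_sub (hm _ h2) (hm _ h1)]
  refine (norm_integral_le_of_norm_le ((hi (1 - η) (1 + η)).add (hi (-(1 + η)) (-(1 - η)))) (Eventually.of_forall fun x => ?_)).trans ?_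
  · rw [← sub_mul, norm_mul, norm_eu, mul_one, ← Complex.ofReal_sub, norm_real]; exact hbd x
  · rw [integral_add' (hi _ _) (hi _ _), integral_indicator_one measurableSet_Icc, integral_indicator_one measurableSet_Icc]
    simp only [measureReal_def, volume_Icc]
    rw [ENNReal.toReal_ofReal (by linarith), ENNReal.toReal_ofReal (by linarith)]; linarith

lemma tele {x y x' y' : ℂ} {d W : ℝ} (hx : ‖x‖ ≤ W) (hy : ‖y'‖ ≤ W) (h1 : ‖x - x'‖ ≤ d) (h2 : ‖y - y'‖ ≤ d) : ‖x * y - x' * y'‖ ≤ 2 * d * W := by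
  rw [show x * y - x' * y' = x * (y - y') + (x - x') * y' by ring]
  refine (norm_add_le _ _).trans ?_
  rw [norm_mul, norm_mul]
  nlinarith [mul_le_mul hx h2 (norm_nonneg _) ((norm_nonneg _).trans hx), mul_le_mul h1 hy (norm_nonneg _) ((norm_nonneg _).trans h1)]

lemma sigma_eq (e : ℤ⁴) : ∫ τ : ℝ, ∏ i, Kg ind1 (e i * τ) = 2 * sigmaInf e := by
  have h := Measure.integral_comp_mul_left (fun τ : ℝ => ∏ i, Kg ind1 (e i * τ)) (-2)
  have h2 : sigmaInf e = ∫ θ : ℝ, ∏ i, Kg ind1 (e i * (-2 * θ)) := by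
    unfold sigmaInf
    congr 1; funext θ
    simp only [Kg_ind]
    rw [volume_pi, Measure.restrict_pi_pi]
    refine Eq.trans ?_ (integral_fintype_prod_eq_prod fun i x => eu (e i * (-2 * θ)) x)
    congr 1; funext x
    unfold eC Gquad eu
    rw [← Complex.exp_sum]
    congr 1
    push_cast
    rw [mul_sum, ← sum_neg_distrib, mul_sum]
    refine sum_congr rfl fun i _ => ?_
    ring
  rw [← h2] at h
  rw [h, Complex.real_smul]
  norm_num
  ring

lemma Wt_int : Integrable fun τ => Wt τ ^ 3 := by
  refine ((integrable_rpow_neg_one_add_norm_sq (E := ℝ) (μ := volume) (r := 3 / 2) (by norm_num)).const_mul 512).congr (Eventually.of_forall fun τ => ?_)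
  simp only [Wt, mul_pow]
  rw [← rpow_natCast _ 3, ← rpow_natCast ((1 + τ ^ 2) ^ (-(1 / 4) : ℝ)), ← rpow_mul (by positivity), norm_eq_abs, sq_abs]
  norm_num

lemma JV_sigma : ∃ C : ℝ, 1 ≤ C ∧ ∀ (a : ℤ⁴), (∀ i, a i ≠ 0) → ∀ η b : ℝ, 0 < η → η ≤ 1 → 1 ≤ b → b ≤ 1 + η →
    ‖(∫ τ : ℝ, ∏ i, KV η b (sgv a i * τ)) - 2 * sigmaInf (sgv a)‖ ≤ C * η := by
  have hW := Wt_int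
  have hW0 : ∀ τ, 0 ≤ Wt τ ∧ Wt τ ≤ 8 := fun τ => by
    unfold Wt
    refine ⟨by positivity, ?_⟩
    linarith [rpow_le_one_of_one_le_of_nonpos (show 1 ≤ 1 + τ ^ 2 by nlinarith) (show (-(1 / 4) : ℝ) ≤ 0 by norm_num)]
  refine ⟨1 + 16 * ∫ τ, Wt τ ^ 3, by linarith [integral_nonneg (μ := volume) (f := fun τ => Wt τ ^ 3) fun τ => pow_nonneg (hW0 τ).1 3], fun a ha η b hη hη1 hb hb1 => ?_⟩
  have hs : ∀ i τ, Wt (sgv a i * τ) = Wt τ := fun i τ => by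
    have : (sgv a i : ℝ) ^ 2 = 1 := by rw [← sq_abs]; exact_mod_cast by rw [sgv_abs ha i]; rfl
    rw [Wt, mul_pow, this, one_mul]; rfl
  have hI : ∀ v : ℝ → ℝ, Measurable v → (∀ u, ‖Kg v u‖ ≤ Wt u) → Integrable fun τ : ℝ => ∏ i, Kg v (sgv a i * τ) := by
    intro v hv hb
    have hm : Measurable (Kg v) := (StronglyMeasurable.integral_prod_right (f := fun u x => (v x : ℂ) * eu u x) (Measurable.stronglyMeasurable (by
      unfold eu Function.uncurry; fun_prop))).measurable
    refine (hW.const_mul 8).mono' (Measurable.aestronglyMeasurable (by fun_prop)) (Eventually.of_forall fun τ => ?_)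
    rw [norm_prod]
    refine (prod_le_prod (fun i _ => norm_nonneg _) fun i _ => (hb _).trans (hs i τ).le).trans ?_
    rw [prod_const, card_univ, Fintype.card_fin, pow_succ, mul_comm]
    exact mul_le_mul_of_nonneg_right (hW0 τ).2 (pow_nonneg (hW0 τ).1 3)
  have hV := KV_le hη (b := b) (by linarith)
  have hVm : Measurable fun x : ℝ => Vw η b (x ^ 2) := by unfold Vw; have := smoothTransition.continuous.measurable; fun_prop
  rw [← sigma_eq]
  change ‖(∫ τ : ℝ, ∏ i, Kg (fun x => Vw η b (x ^ 2)) (sgv a i * τ)) - _‖ ≤ _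
  rw [← integral_sub (hI _ hVm hV) (hI ind1 (measurable_one.indicator measurableSet_Icc) K1_le)]
  refine (norm_integral_le_of_norm_le (hW.const_mul (16 * η)) (Eventually.of_forall fun τ => ?_)).trans ?_
  · have x1 : ∀ i, ‖Kg (fun x => Vw η b (x ^ 2)) (sgv a i * τ)‖ ≤ Wt τ := fun i => (hV _).trans (hs i τ).le
    have x2 : ∀ i, ‖Kg ind1 (sgv a i * τ)‖ ≤ Wt τ := fun i => (K1_le _).trans (hs i τ).le
    have x3 : ∀ i, _ := fun i => Kdiff hη hη1 hb hb1 (sgv a i * τ)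
    rw [Fin.prod_univ_four, Fin.prod_univ_four, mul_assoc, mul_assoc (_ * _)]
    have m : ∀ p q : ℂ, ‖p‖ ≤ Wt τ → ‖q‖ ≤ Wt τ → ‖p * q‖ ≤ Wt τ * Wt τ := fun p q h1 h2 => by
      rw [norm_mul]; exact mul_le_mul h1 h2 (norm_nonneg _) (hW0 τ).1
    refine (tele (m _ _ (x1 0) (x1 1)) (m _ _ (x2 2) (x2 3)) (tele (x1 0) (x2 1) (x3 0) (x3 1)) (tele (x1 2) (x2 3) (x3 2) (x3 3))).trans (le_of_eq ?_)
    ring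
  · rw [integral_const_mul]; nlinarith


/-! G4: terms with a vanishing coordinate, and the sandwich argument. -/

def zi (η : ℝ) (i j : Fin 4) : ℝ := if j = i then (η⁻¹) ^ 2 else 1
def gV (a : ℤ⁴) (B η b : ℝ) (x : ℤ⁴) : ℝ := if Fq a x = 0 then ∏ i, Vw η b (nab a i * (x i : ℝ) ^ 2 / B) else 0
def gR (a : ℤ⁴) (B η : ℝ) (i : Fin 4) (x : ℤ⁴) : ℝ := if Fq a x = 0 then ∏ j, exp (-π * (nab a j / B * zi η i j) * (x j : ℝ) ^ 2) else 0

lemma prod_if4 (i : Fin 4) (x y : ℝ) : ∏ j, (if j = i then x else y) = x * y ^ 3 := by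
  fin_cases i <;> simp [Fin.prod_univ_four] <;> ring

lemma zi_ge {η : ℝ} (hη : 0 < η) (hη1 : η ≤ 1) (i j : Fin 4) : 1 ≤ zi η i j ∧ zi η i j ≤ (η⁻¹) ^ 2 := by
  have : 1 ≤ (η⁻¹) ^ 2 := one_le_pow₀ ((one_le_inv₀ hη).2 hη1)
  unfold zi; split_ifs <;> constructor <;> linarith

lemma Jinf_zi {a : ℤ⁴} (ha : ∀ i, a i ≠ 0) {η : ℝ} (hη : 0 < η) (hη1 : η ≤ 1) (i : Fin 4) :
    ‖Jinf a (fun j => (zi η i j : ℂ))‖ ≤ (∫ τ, Wt τ ^ 3) * η := by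
  unfold Jinf
  rw [mul_comm, ← integral_const_mul]
  refine norm_integral_le_of_norm_le (Wt_int.const_mul η) (Eventually.of_forall fun τ => ?_)
  rw [norm_prod, ← prod_if4 i]
  refine prod_le_prod (fun j _ => norm_nonneg _) fun j _ => ?_
  have hre := wv_re (sgv a) (fun j => (zi η i j : ℂ)) τ j
  rw [csq_norm (wv_ne (fun j => by simpa using (zi_ge hη hη1 i j).1) τ j)]
  split_ifs with h
  · have h1 : (η⁻¹) ^ 2 ≤ ‖wv (sgv a) (fun j => (zi η i j : ℂ)) τ j‖ := by
      refine le_trans ?_ (Complex.re_le_norm _)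
      rw [hre, Complex.ofReal_re, zi, if_pos h]
    refine (rpow_le_rpow_of_nonpos (by positivity) h1 (by norm_num)).trans (le_of_eq ?_)
    rw [← rpow_natCast, ← rpow_mul (by positivity)]
    norm_num [rpow_neg_one]
  · have h1 : ‖wv (sgv a) (fun j => (zi η i j : ℂ)) τ j‖ = (1 + τ ^ 2) ^ (1 / 2 : ℝ) := by
      have : (sgv a j : ℝ) ^ 2 = 1 := by rw [← sq_abs]; exact_mod_cast by rw [sgv_abs ha j]; rfl
      rw [← sqrt_eq_rpow, Complex.norm_def, Complex.normSq_apply, hre]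
      congr 1
      simp [zi, h, wv]
      linear_combination τ ^ 2 * this
    rw [h1, ← rpow_mul (by positivity), Wt]
    norm_num
    linarith [rpow_nonneg (show 0 ≤ 1 + τ ^ 2 by positivity) (-(1 / 4))]

lemma gR_hasSum {a : ℤ⁴} (ha : ∀ i, a i ≠ 0) {B η : ℝ} (hB : 0 < B) (hη : 0 < η) (hη1 : η ≤ 1) (i : Fin 4) :
    ∃ S : ℝ, HasSum (gR a B η i) S ∧ S ≤ ‖Nz a B (fun j => (zi η i j : ℂ))‖ := by
  have h1 : ∀ x, (if Fq a x = 0 then Wx a B (fun j => (zi η i j : ℂ)) x else 0) = ((gR a B η i x : ℝ) : ℂ) := fun x => by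
    unfold gR Wx
    split_ifs <;> push_cast <;> rfl
  have hS : Summable (gR a B η i) := by
    refine Summable.of_norm_bounded (summable_gB hB) fun x => ?_
    rw [← norm_real, ← h1]
    split_ifs
    · exact Wx_norm_le ha hB (fun j => by simpa using (zi_ge hη hη1 i j).1) x
    · rw [norm_zero]; exact prod_nonneg fun j _ => (gB_pos _ _).le
  refine ⟨_, hS.hasSum, ?_⟩
  unfold Nz
  simp only [h1]
  rw [← Complex.ofReal_tsum, norm_real]
  exact le_abs_self _

lemma sandwich {a : ℤ⁴} (ha : ∀ i, a i ≠ 0) {B η : ℝ} (hB : 0 < B) (hη : 0 < η) {S T : ℝ} {R : Fin 4 → ℝ}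
    (hS : HasSum (gV a B η (1 + η)) S) (hT : HasSum (gV a B η 1) T) (hR : ∀ i, HasSum (gR a B η i) (R i)) :
    (Na a B : ℝ) ≤ S ∧ T ≤ Na a B + exp π ^ 4 * ∑ i, R i := by
  set N : Set (ℤ⁴) := {x : ℤ⁴ | (∀ i, x i ≠ 0) ∧ (∑ i, a i * x i ^ 2) = 0 ∧ ∀ i, (((a i * x i ^ 2).natAbs : ℝ)) ≤ B} with hN
  have hs : ∀ (x : ℤ⁴) i, (((a i * x i ^ 2).natAbs : ℝ)) = nab a i * (x i : ℝ) ^ 2 := fun x i => by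
    rw [Int.natAbs_mul, Int.natAbs_pow, nab]; push_cast; rw [Nat.cast_natAbs (x i), Int.cast_abs, sq_abs]
  have hV0 : ∀ b s, 0 ≤ Vw η b s ∧ Vw η b s ≤ 1 := fun b s => ⟨smoothTransition.nonneg _, smoothTransition.le_one _⟩
  have hg0 : ∀ x, 0 ≤ gV a B η (1 + η) x := fun x => by
    unfold gV; split_ifs
    · exact prod_nonneg fun i _ => (hV0 _ _).1
    · exact le_rfl
  have hg1 : ∀ x ∈ N, 1 ≤ gV a B η (1 + η) x := by
    rintro x ⟨_, h2, h3⟩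
    rw [gV, if_pos (show Fq a x = 0 from h2), prod_congr rfl (g := fun _ => (1 : ℝ)) fun i _ => ?_]
    · simp
    · have := h3 i
      rw [hs] at this
      have h4 := (div_le_one hB).2 this
      exact smoothTransition.one_of_one_le (by rw [inv_mul_eq_div, le_div_iff₀ hη]; linarith)
  have hfin : N.Finite := by
    refine Set.Finite.subset (Filter.eventually_cofinite.1 (hS.summable.tendsto_cofinite_zero.eventually_lt_const (zero_lt_one (α := ℝ)))) fun x hx => ?_
    exact not_lt.2 (hg1 x hx)
  have hf : HasSum (N.indicator (1 : (ℤ⁴) → ℝ)) (Na a B) := by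
    have h1 : (Na a B : ℝ) = ∑ x ∈ hfin.toFinset, N.indicator 1 x := by
      rw [Na, ← hN, Set.ncard_eq_toFinset_card _ hfin, sum_congr rfl (g := fun _ => (1 : ℝ)) fun x hx => ?_]
      · simp
      · rw [Set.indicator_of_mem (hfin.mem_toFinset.1 hx)]; rfl
    rw [h1]
    exact hasSum_sum_of_ne_finset_zero fun x hx => Set.indicator_of_notMem (fun h => hx (hfin.mem_toFinset.2 h)) _
  refine ⟨hasSum_le (fun x => ?_) hf hS, hasSum_le (fun x => ?_) hT (hf.add ((hasSum_sum fun i _ => hR i).mul_left (exp π ^ 4)))⟩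
  · by_cases h : x ∈ N
    · rw [Set.indicator_of_mem h]; exact hg1 x h
    · rw [Set.indicator_of_notMem h]; exact hg0 x
  have hR0 : ∀ i, 0 ≤ gR a B η i x := fun i => by unfold gR; split_ifs <;> positivity
  have hE : 0 < exp π ^ 4 := by positivity
  have hr0 : 0 ≤ N.indicator (1 : (ℤ⁴) → ℝ) x := Set.indicator_nonneg (by simp) x
  have hr1 : 0 ≤ exp π ^ 4 * ∑ i, gR a B η i x := mul_nonneg hE.le (sum_nonneg fun i _ => hR0 i)
  by_cases hF : Fq a x = 0
  swap
  · rw [gV, if_neg hF]; linarith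
  have hle : gV a B η 1 x ≤ 1 := by rw [gV, if_pos hF]; exact prod_le_one (fun i _ => (hV0 _ _).1) fun i _ => (hV0 _ _).2
  by_cases hb : ∀ i, nab a i * (x i : ℝ) ^ 2 ≤ B
  swap
  · push Not at hb
    obtain ⟨i, hi⟩ := hb
    have : gV a B η 1 x = 0 := by
      rw [gV, if_pos hF]
      refine prod_eq_zero (mem_univ i) (smoothTransition.zero_of_nonpos (mul_nonpos_of_nonneg_of_nonpos (by positivity) ?_))
      linarith [(one_le_div hB).2 hi.le]
    linarith
  by_cases hx : ∀ i, x i ≠ 0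
  · rw [Set.indicator_of_mem (show x ∈ N from ⟨hx, hF, fun i => by rw [hs]; exact hb i⟩)]
    simp only [Pi.one_apply]; linarith
  push Not at hx
  obtain ⟨i, hi⟩ := hx
  have h1 : 1 ≤ exp π ^ 4 * gR a B η i x := by
    have e : exp π ^ 4 = ∏ _j : Fin 4, exp π := by simp
    rw [gR, if_pos hF, e, ← prod_mul_distrib]
    refine one_le_prod4 fun j => ?_
    rw [← exp_add]
    refine one_le_exp ?_
    by_cases hj : j = i
    · rw [hj, hi]; simp [pi_pos.le]
    · have : nab a j / B * (x j : ℝ) ^ 2 ≤ 1 := by rw [div_mul_eq_mul_div]; exact (div_le_one hB).2 (hb j)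
      simp only [zi, if_neg hj]
      nlinarith [pi_pos]
  have h2 := mul_le_mul_of_nonneg_left (single_le_sum (fun i _ => hR0 i) (mem_univ i)) hE.le
  linarith

lemma numerics {ε δ A B D : ℝ} (hδ : 0 < δ) (hδε : 3 * δ ≤ ε) (hA : 1 ≤ A) (hB : 1 ≤ B) (hD : 1 ≤ D) (hDA : D ≤ A) (hAB : A ≤ B ^ (4 / 7 : ℝ)) :
    A ^ (1 / 24 : ℝ) * B ^ (-(1 / 42) : ℝ) ≤ 1 ∧
    B / A ^ (1 / 2 : ℝ) * ((A ^ (1 / 24 : ℝ) * B ^ (-(1 / 42) : ℝ)) * (A ^ δ * D ^ (1 / 4 : ℝ))) ≤ B ^ (41 / 42 + ε) * D ^ (1 / 3 : ℝ) / A ^ (11 / 24 : ℝ) ∧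
    B / A ^ (1 / 2 : ℝ) * (A ^ (2 / 3 + 2 * δ) * D ^ (1 / 2 : ℝ) * B ^ (-(1 / 2) + δ)) * ((A ^ (1 / 24 : ℝ) * B ^ (-(1 / 42) : ℝ))⁻¹) ^ 16 ≤
      B ^ (41 / 42 + ε) * D ^ (1 / 3 : ℝ) / A ^ (11 / 24 : ℝ) := by
  obtain ⟨α, rfl⟩ : ∃ α, exp α = A := ⟨_, exp_log (by linarith)⟩
  obtain ⟨β, rfl⟩ : ∃ β, exp β = B := ⟨_, exp_log (by linarith)⟩
  obtain ⟨d, rfl⟩ : ∃ d, exp d = D := ⟨_, exp_log (by linarith)⟩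
  simp only [← exp_mul, ← exp_add, ← exp_sub, ← exp_neg, ← exp_nat_mul, exp_le_exp, exp_le_one_iff, one_le_exp_iff] at *
  have h1 : δ * α ≤ δ * β := mul_le_mul_of_nonneg_left (by linarith) hδ.le
  have h2 : 3 * δ * β ≤ ε * β := mul_le_mul_of_nonneg_right hδε (by linarith)
  have h3 : 0 ≤ δ * β := by positivity
  push_cast
  refine ⟨by linarith, by nlinarith, by nlinarith⟩


/-! G5: conclusion. -/

lemma final_bound {ε : ℝ} (hε : 0 < ε) : ∃ C : ℝ, 0 < C ∧ ∀ (a : ℤ⁴) (B : ℝ) (G : ℂ), (∀ i, a i ≠ 0) → ¬ IsSquare (∏ i, a i) →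
    1 ≤ B → absProd a ≤ B ^ ((4 : ℝ) / 7) → Tendsto (singularPartial a) atTop (nhds G) →
    ‖(Na a B : ℂ) - ((B / (2 * absProd a ^ (1 / 2 : ℝ)) : ℝ) : ℂ) * (2 * sigmaInf (sgv a) * G)‖ ≤
      C * (B ^ (41 / 42 + ε) * (Delta4 a : ℝ) ^ (1 / 3 : ℝ) / absProd a ^ (11 / 24 : ℝ)) := by
  have hδ : 0 < min (ε / 3) (1 / 4) := by positivity
  have hδ1 : min (ε / 3) (1 / 4) ≤ 1 / 4 := min_le_right _ _
  have hδε : 3 * min (ε / 3) (1 / 4) ≤ ε := by linarith [min_le_left (ε / 3) (1 / 4)]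
  generalize min (ε / 3) (1 / 4) = δ at *
  obtain ⟨C0, hC0, h0⟩ := core hδ hδ1
  obtain ⟨C1, hC1, h1⟩ := SV_bound hδ hδ1
  obtain ⟨C2, hC2, h2⟩ := JV_sigma
  obtain ⟨C3, hC3, h3⟩ := singular_bound hδ
  have hI : 0 ≤ ∫ τ, Wt τ ^ 3 := integral_nonneg fun τ => pow_nonneg (by unfold Wt; positivity) 3
  set I := ∫ τ, Wt τ ^ 3
  have hE : 0 < exp π ^ 4 := by positivity
  set E := exp π ^ 4
  refine ⟨3 * (C1 + C2 * C3) + E * (4 * (4 * C0 + I * C3)), by positivity, fun a B G ha hsq hB hAB hG => ?_⟩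
  have hA : (∏ i, a i) ≠ 0 := prod_ne_zero_iff.2 fun i _ => ha i
  have hA1 : (1 : ℝ) ≤ absProd a := by exact_mod_cast Int.natAbs_pos.2 hA
  have hD1 : (1 : ℝ) ≤ Delta4 a := by exact_mod_cast Delta4_pos a ha
  have hDA : (Delta4 a : ℝ) ≤ absProd a := by exact_mod_cast Delta4_le a ha
  have hB0 : 0 < B := by linarith
  obtain ⟨hη1, hX, hY⟩ := numerics hδ hδε hA1 hB hD1 hDA hAB
  have g0 := h0 a ha hsq B hB G hG
  have g1 := h1 a ha hsq B hB G hG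
  have g3 := h3 a G ha hsq hG
  have hη : 0 < absProd a ^ (1 / 24 : ℝ) * B ^ (-(1 / 42) : ℝ) := by positivity
  generalize absProd a ^ (1 / 24 : ℝ) * B ^ (-(1 / 42) : ℝ) = η at *
  have hc : B / (2 * absProd a ^ (1 / 2 : ℝ)) = B / absProd a ^ (1 / 2 : ℝ) / 2 := by ring
  simp only [hc] at g0 g1 ⊢
  have hc0 : 0 ≤ B / absProd a ^ (1 / 2 : ℝ) := by positivity
  generalize B / absProd a ^ (1 / 2 : ℝ) = c at *
  have hK : 0 ≤ absProd a ^ (2 / 3 + 2 * δ) * (Delta4 a : ℝ) ^ (1 / 2 : ℝ) * B ^ (-(1 / 2) + δ) := by positivity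
  generalize absProd a ^ (2 / 3 + 2 * δ) * (Delta4 a : ℝ) ^ (1 / 2 : ℝ) * B ^ (-(1 / 2) + δ) = K at *
  rw [mul_assoc C3] at g3
  generalize absProd a ^ δ * (Delta4 a : ℝ) ^ (1 / 4 : ℝ) = g at *
  generalize B ^ (41 / 42 + ε) * (Delta4 a : ℝ) ^ (1 / 3 : ℝ) / absProd a ^ (11 / 24 : ℝ) = X at *
  have hcn : ‖((c / 2 : ℝ) : ℂ)‖ ≤ c := by rw [norm_real, norm_of_nonneg (by positivity)]; linarith
  have hmain : ∀ (m : ℝ) (J : ℂ), 0 ≤ m → ‖J‖ ≤ m * η → ‖((c / 2 : ℝ) : ℂ) * (J * G)‖ ≤ m * C3 * X := fun m J hm hJ => by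
    rw [norm_mul, norm_mul]
    calc _ ≤ c * ((m * η) * (C3 * g)) := mul_le_mul hcn (mul_le_mul hJ g3 (norm_nonneg _) (by positivity)) (by positivity) hc0
      _ = m * C3 * (c * (η * g)) := by ring
      _ ≤ _ := mul_le_mul_of_nonneg_left hX (by positivity)
  have hV : ∀ b, 1 ≤ b → b ≤ 1 + η → ∃ S : ℝ, HasSum (gV a B η b) S ∧
      ‖(S : ℂ) - ((c / 2 : ℝ) : ℂ) * (2 * sigmaInf (sgv a) * G)‖ ≤ (C1 + C2 * C3) * X := fun b hb hb1 => by
    obtain ⟨S, hS, hS1⟩ := g1 η b hη hη1 (by linarith)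
    refine ⟨S, hS, ?_⟩
    have k1 := hmain C2 _ (by linarith) (h2 a ha η b hη hη1 hb hb1)
    have k2 := mul_le_mul_of_nonneg_left hY (show 0 ≤ C1 by linarith)
    calc _ = ‖((S : ℂ) - ((c / 2 : ℝ) : ℂ) * ((∫ τ : ℝ, ∏ i, KV η b (sgv a i * τ)) * G)) +
          ((c / 2 : ℝ) : ℂ) * (((∫ τ : ℝ, ∏ i, KV η b (sgv a i * τ)) - 2 * sigmaInf (sgv a)) * G)‖ := by congr 1; ring
      _ ≤ _ := (norm_add_le _ _).trans (by linarith)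
  have hZ : ∀ i, ∃ R : ℝ, HasSum (gR a B η i) R ∧ R ≤ (4 * C0 + I * C3) * X := fun i => by
    obtain ⟨R, hR, hR1⟩ := gR_hasSum ha hB0 hη hη1 i
    refine ⟨R, hR, hR1.trans ?_⟩
    have hz := zi_ge hη hη1 i
    have hn : ∀ j, ‖((zi η i j : ℝ) : ℂ)‖ = zi η i j := fun j => by rw [norm_real, norm_of_nonneg (by linarith [(hz j).1])]
    have k0 := g0 (fun j => (zi η i j : ℂ)) fun j => by simpa using (hz j).1
    have k1 := hmain I _ hI (Jinf_zi ha hη hη1 i)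
    have hi1 : 1 ≤ η⁻¹ := (one_le_inv₀ hη).2 hη1
    have p1 : ∏ j, ‖((zi η i j : ℝ) : ℂ)‖ ^ 2 = (η⁻¹) ^ 4 := by
      simp only [hn]
      rw [prod_pow]
      unfold zi
      rw [prod_if4]; ring
    have p2 : Qz (fun j => (zi η i j : ℂ)) ≤ 4 * (η⁻¹) ^ 8 := by
      unfold Qz
      simp only [hn]
      have : ∀ j, zi η i j ^ 4 ≤ (η⁻¹) ^ 8 := fun j =>
        (pow_le_pow_left₀ (by linarith [(hz j).1]) (hz j).2 4).trans (le_of_eq (by ring))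
      calc _ ≤ ∑ _j : Fin 4, (η⁻¹) ^ 8 := sum_le_sum fun j _ => this j
        _ = _ := by simp
    have p3 : (∏ j, ‖((zi η i j : ℝ) : ℂ)‖ ^ 2) * Qz (fun j => (zi η i j : ℂ)) ≤ 4 * (η⁻¹) ^ 16 := by
      rw [p1]
      calc _ ≤ (η⁻¹) ^ 4 * (4 * (η⁻¹) ^ 8) := mul_le_mul_of_nonneg_left p2 (by positivity)
        _ = 4 * (η⁻¹) ^ 12 := by ring
        _ ≤ _ := mul_le_mul_of_nonneg_left (pow_le_pow_right₀ hi1 (by norm_num)) (by norm_num)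
    have k2 := mul_le_mul_of_nonneg_left p3 (show 0 ≤ C0 * c * K by positivity)
    have k3 := mul_le_mul_of_nonneg_left hY (show 0 ≤ 4 * C0 by linarith)
    have k4 := norm_le_norm_add_norm_sub' (Nz a B fun j => (zi η i j : ℂ)) (((c / 2 : ℝ) : ℂ) * (Jinf a (fun j => (zi η i j : ℂ)) * G))
    linarith
  obtain ⟨S, hS, hS1⟩ := hV (1 + η) (by linarith) le_rfl
  obtain ⟨T, hT, hT1⟩ := hV 1 le_rfl (by linarith)
  choose R hR hR1 using hZ
  obtain ⟨s1, s2⟩ := sandwich ha hB0 hη hS hT hR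
  generalize ((c / 2 : ℝ) : ℂ) * (2 * sigmaInf (sgv a) * G) = M at *
  have hsum : E * ∑ i, R i ≤ E * (4 * ((4 * C0 + I * C3) * X)) := by
    refine mul_le_mul_of_nonneg_left ?_ hE.le
    calc _ ≤ ∑ _j : Fin 4, (4 * C0 + I * C3) * X := sum_le_sum fun j _ => hR1 j
      _ = _ := by simp
  have q1 : ‖((S - T : ℝ) : ℂ)‖ ≤ (C1 + C2 * C3) * X + (C1 + C2 * C3) * X := by
    rw [show ((S - T : ℝ) : ℂ) = ((S : ℂ) - M) - ((T : ℂ) - M) by push_cast; ring]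
    exact (norm_sub_le _ _).trans (add_le_add hS1 hT1)
  rw [norm_real] at q1
  have q2 := (le_abs_self _).trans q1
  have q3 : ‖((Na a B : ℝ) : ℂ) - (S : ℂ)‖ = S - Na a B := by
    rw [← Complex.ofReal_sub, norm_real, norm_eq_abs, abs_sub_comm, abs_of_nonneg (by linarith)]
  calc _ = ‖(((Na a B : ℝ) : ℂ) - (S : ℂ)) + ((S : ℂ) - M)‖ := by congr 1; push_cast; ring
    _ ≤ _ := (norm_add_le _ _).trans (by rw [q3]; linarith)

end

/-- Theorem 1.4: the circle method estimate for `N_a(B)`. -/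
theorem statement_1 (ε : ℝ) (hε : 0 < ε) :
    ∃ C : ℝ, 0 < C ∧ ∀ (a : Fin 4 → ℤ) (B : ℝ) (G : ℂ),
      (∀ i, a i ≠ 0) → ¬ IsSquare (∏ i, a i) → 1 ≤ B →
      (((∏ i, a i).natAbs : ℝ)) ≤ B ^ ((4 : ℝ) / 7) →
      Filter.Tendsto (singularPartial a) Filter.atTop (nhds G) →
      ‖(Na a B : ℂ) - G * sigmaInf (fun i => Int.sign (a i)) * (B : ℂ) /
          ((((∏ i, a i).natAbs : ℝ) ^ ((1 : ℝ) / 2) : ℝ) : ℂ)‖ ≤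
        C * B ^ ((41 : ℝ) / 42 + ε) * (Delta4 a : ℝ) ^ ((1 : ℝ) / 3) /
          (((∏ i, a i).natAbs : ℝ) ^ ((11 : ℝ) / 24)) := by
  obtain ⟨C, hC, h⟩ := final_bound hε
  refine ⟨C, hC, fun a B G ha hsq hB hAB hG => ?_⟩
  have hA : (∏ i, a i) ≠ 0 := Finset.prod_ne_zero_iff.2 fun i _ => ha i
  have hA1 : (0 : ℝ) < ((∏ i, a i).natAbs : ℝ) := by exact_mod_cast Int.natAbs_pos.2 hA
  have hs : (((((∏ i, a i).natAbs : ℝ) ^ ((1 : ℝ) / 2) : ℝ)) : ℂ) ≠ 0 := by exact_mod_cast (Real.rpow_pos_of_pos hA1 _).ne'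
  have key := h a B G ha hsq hB hAB hG
  calc _ = _ := by
        congr 2
        change G * sigmaInf (sgv a) * (B : ℂ) / _ = _
        rw [Complex.ofReal_div, Complex.ofReal_mul]
        field_simp
        push_cast
        ring
    _ ≤ _ := key
    _ = _ := by ring
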